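/- Let k be a field, X and Y proper varieties over k equipped with k-rational points x ∈ X(k) and y ∈ Y(k), Z a geometrically connected scheme of finite type over k, and L a line bundle on X × Y × Z. If the pull-backs of L to {x} × Y × Z and to X × {y} × Z are both trivial, then L is isomorphic to the pull-back of some line bundle M on X × Y along the projection X × Y × Z → X × Y. -/

import Mathlib

open AlgebraicGeometry CategoryTheory CategoryTheory.Limits Opposite

universe u

noncomputable section

/-- The spectrum of the field `k`, the base of all schemes considered. -/
abbrev Spk (k : Type u) [Field k] : Scheme.{u} := Spec (CommRingCat.of k)

/-- A scheme over the field `k`: a scheme together with a structure morphism to `Spec k`. -/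
structure SchemeOver (k : Type u) [Field k] : Type (u + 1) where
  carrier : Scheme.{u}
  str : carrier ⟶ Spk k

variable (k : Type u) [Field k]

/-- A group scheme over `k`, presented via its functor of points: for every scheme `T`
and every pair of `T`-points lying over the same `T`-point of `Spec k`, a product point,
together with unit and inverse, satisfying the group axioms functorially. -/
structure GroupSchemeOver extends SchemeOver k where
  mul : ∀ {T : Scheme.{u}} (a b : T ⟶ carrier), a ≫ str = b ≫ str → (T ⟶ carrier)
  one : Spk k ⟶ carrier
  inv : ∀ {T : Scheme.{u}}, (T ⟶ carrier) → (T ⟶ carrier)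
  mul_str : ∀ {T : Scheme.{u}} (a b : T ⟶ carrier) (h), mul a b h ≫ str = a ≫ str
  one_str : one ≫ str = 𝟙 (Spk k)
  inv_str : ∀ {T : Scheme.{u}} (a : T ⟶ carrier), inv a ≫ str = a ≫ str
  mul_natural : ∀ {T' T : Scheme.{u}} (g : T' ⟶ T) (a b : T ⟶ carrier) (h h'),
    g ≫ mul a b h = mul (g ≫ a) (g ≫ b) h'
  inv_natural : ∀ {T' T : Scheme.{u}} (g : T' ⟶ T) (a : T ⟶ carrier),
    g ≫ inv a = inv (g ≫ a)
  mul_assoc : ∀ {T : Scheme.{u}} (a b c : T ⟶ carrier) (h₁ h₂ h₃ h₄),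
    mul (mul a b h₁) c h₂ = mul a (mul b c h₃) h₄
  one_mul : ∀ {T : Scheme.{u}} (a : T ⟶ carrier) (h), mul (a ≫ str ≫ one) a h = a
  mul_one : ∀ {T : Scheme.{u}} (a : T ⟶ carrier) (h), mul a (a ≫ str ≫ one) h = a
  inv_mul : ∀ {T : Scheme.{u}} (a : T ⟶ carrier) (h), mul (inv a) a h = a ≫ str ≫ one

variable {k}

theorem GroupSchemeOver.mul_congr (G : GroupSchemeOver k) {T : Scheme.{u}}
    {a a' b b' : T ⟶ G.carrier} (ha : a = a') (hb : b = b') (h h') :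
    G.mul a b h = G.mul a' b' h' := by subst ha; subst hb; rfl

/-- A homomorphism of group schemes over `k`. -/
structure GroupHom (G H : GroupSchemeOver k) where
  hom : G.carrier ⟶ H.carrier
  hom_str : hom ≫ H.str = G.str
  hom_one : G.one ≫ hom = H.one
  hom_mul : ∀ {T : Scheme.{u}} (a b : T ⟶ G.carrier) (h h'),
    G.mul a b h ≫ hom = H.mul (a ≫ hom) (b ≫ hom) h'

/-- An action of a group scheme `G` over `k` on a scheme `X` over `k`, presented via
its functor of points. -/
structure ActionOver (G : GroupSchemeOver k) (X : SchemeOver k) where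
  act : ∀ {T : Scheme.{u}} (g : T ⟶ G.carrier) (x : T ⟶ X.carrier),
    g ≫ G.str = x ≫ X.str → (T ⟶ X.carrier)
  act_str : ∀ {T : Scheme.{u}} (g : T ⟶ G.carrier) (x : T ⟶ X.carrier) (h),
    act g x h ≫ X.str = x ≫ X.str
  act_natural : ∀ {T' T : Scheme.{u}} (f : T' ⟶ T) (g : T ⟶ G.carrier)
    (x : T ⟶ X.carrier) (h h'), f ≫ act g x h = act (f ≫ g) (f ≫ x) h'
  one_act : ∀ {T : Scheme.{u}} (x : T ⟶ X.carrier) (h), act (x ≫ X.str ≫ G.one) x h = x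
  mul_act : ∀ {T : Scheme.{u}} (g g' : T ⟶ G.carrier) (x : T ⟶ X.carrier) (h₁ h₂ h₃ h₄),
    act (G.mul g g' h₁) x h₂ = act g (act g' x h₃) h₄

theorem ActionOver.act_congr {G : GroupSchemeOver k} {X : SchemeOver k}
    (α : ActionOver G X) {T : Scheme.{u}} {g g' : T ⟶ G.carrier} {x x' : T ⟶ X.carrier}
    (hg : g = g') (hx : x = x') (h h') : α.act g x h = α.act g' x' h' := by
  subst hg; subst hx; rfl

/-- The action of a group scheme on itself by left translations. -/
def GroupSchemeOver.selfAction (G : GroupSchemeOver k) : ActionOver G G.toSchemeOver where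
  act g x h := G.mul g x h
  act_str g x h := (G.mul_str g x h).trans h
  act_natural f g x h h' := G.mul_natural f g x h h'
  one_act x h := G.one_mul x h
  mul_act g g' x h₁ h₂ h₃ h₄ := G.mul_assoc g g' x h₁ h₂ h₃ h₄

/-- Restriction of an action along a homomorphism of group schemes. -/
def ActionOver.res {G H : GroupSchemeOver k} {X : SchemeOver k} (φ : GroupHom H G)
    (α : ActionOver G X) : ActionOver H X where
  act g x h := α.act (g ≫ φ.hom) x (by rw [Category.assoc, φ.hom_str, h])
  act_str g x h := α.act_str _ _ _
  act_natural f g x h h' := by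
    refine (α.act_natural f (g ≫ φ.hom) x _ ?_).trans (α.act_congr ?_ rfl _ _)
    · simp only [Category.assoc, φ.hom_str, ← h']
    · simp only [Category.assoc]
  one_act x h := by
    refine (α.act_congr ?_ rfl _ ?_).trans (α.one_act x ?_)
    · simp only [Category.assoc, φ.hom_one]
    · simp only [Category.assoc, G.one_str, Category.comp_id]
    · simp only [Category.assoc, G.one_str, Category.comp_id]
  mul_act g g' x h₁ h₂ h₃ h₄ := by
    have hg : g ≫ H.str = x ≫ X.str := (H.mul_str g g' h₁).symm.trans h₂
    have hg' : g' ≫ H.str = x ≫ X.str := h₁.symm.trans hg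
    have p1 : (g ≫ φ.hom) ≫ G.str = (g' ≫ φ.hom) ≫ G.str := by
      simp only [Category.assoc, φ.hom_str]; exact h₁
    have p3 : (g' ≫ φ.hom) ≫ G.str = x ≫ X.str := by
      simp only [Category.assoc, φ.hom_str]; exact hg'
    refine (α.act_congr (φ.hom_mul g g' h₁ p1) rfl _ ?_).trans
      (α.mul_act (g ≫ φ.hom) (g' ≫ φ.hom) x p1 ?_ p3 ?_)
    · rw [G.mul_str]
      simp only [Category.assoc, φ.hom_str]; exact hg
    · rw [G.mul_str]
      simp only [Category.assoc, φ.hom_str]; exact hg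
    · rw [α.act_str]
      simp only [Category.assoc, φ.hom_str]; exact hg
/-! ### Vector bundles and line bundles, geometrically -/

/-- The data underlying a (geometric) vector bundle on a scheme `X`: a total space `π : tot ⟶ X`
together with a fiberwise `Γ(T, ⊤)`-module structure on the `T`-points of `tot` over a fixed
`T`-point of `X`, functorially in `T`. -/
structure VecBundleData (X : Scheme.{u}) : Type (u + 1) where
  tot : Scheme.{u}
  π : tot ⟶ X
  zero : X ⟶ tot
  zero_π : zero ≫ π = 𝟙 X
  add : ∀ {T : Scheme.{u}} (a b : T ⟶ tot), a ≫ π = b ≫ π → (T ⟶ tot)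
  smul : ∀ {T : Scheme.{u}} (f : Γ(T, ⊤)) (a : T ⟶ tot), T ⟶ tot
  add_π : ∀ {T : Scheme.{u}} (a b : T ⟶ tot) (h), add a b h ≫ π = a ≫ π
  smul_π : ∀ {T : Scheme.{u}} (f : Γ(T, ⊤)) (a : T ⟶ tot), smul f a ≫ π = a ≫ π
  add_natural : ∀ {T' T : Scheme.{u}} (g : T' ⟶ T) (a b : T ⟶ tot) (h h'),
    g ≫ add a b h = add (g ≫ a) (g ≫ b) h'
  smul_natural : ∀ {T' T : Scheme.{u}} (g : T' ⟶ T) (f : Γ(T, ⊤)) (a : T ⟶ tot),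
    g ≫ smul f a = smul (g.appTop f) (g ≫ a)
  add_comm : ∀ {T : Scheme.{u}} (a b : T ⟶ tot) (h h'), add a b h = add b a h'
  add_assoc : ∀ {T : Scheme.{u}} (a b c : T ⟶ tot) (h₁ h₂ h₃ h₄),
    add (add a b h₁) c h₂ = add a (add b c h₃) h₄
  zero_add : ∀ {T : Scheme.{u}} (a : T ⟶ tot) (h), add ((a ≫ π) ≫ zero) a h = a
  one_smul : ∀ {T : Scheme.{u}} (a : T ⟶ tot), smul 1 a = a
  mul_smul : ∀ {T : Scheme.{u}} (f g : Γ(T, ⊤)) (a : T ⟶ tot), smul (f * g) a = smul f (smul g a)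
  smul_add : ∀ {T : Scheme.{u}} (f : Γ(T, ⊤)) (a b : T ⟶ tot) (h h'),
    smul f (add a b h) = add (smul f a) (smul f b) h'
  add_smul : ∀ {T : Scheme.{u}} (f g : Γ(T, ⊤)) (a : T ⟶ tot) (h),
    smul (f + g) a = add (smul f a) (smul g a) h
  zero_smul : ∀ {T : Scheme.{u}} (a : T ⟶ tot), smul 0 a = (a ≫ π) ≫ zero
  smul_zero : ∀ {T : Scheme.{u}} (f : Γ(T, ⊤)) (x : T ⟶ X), smul f (x ≫ zero) = x ≫ zero

namespace VecBundleData

variable {X : Scheme.{u}} (E : VecBundleData X)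

theorem add_congr {T : Scheme.{u}} {a a' b b' : T ⟶ E.tot} (ha : a = a') (hb : b = b')
    (h h') : E.add a b h = E.add a' b' h' := by subst ha; subst hb; rfl

/-- The fiber of a vector bundle over a `T`-point of the base. -/
abbrev Fiber {T : Scheme.{u}} (x : T ⟶ X) : Type u := { a : T ⟶ E.tot // a ≫ E.π = x }

instance fiberZero {T : Scheme.{u}} (x : T ⟶ X) : Zero (E.Fiber x) :=
  ⟨⟨x ≫ E.zero, by rw [Category.assoc, E.zero_π, Category.comp_id]⟩⟩

instance fiberAdd {T : Scheme.{u}} (x : T ⟶ X) : Add (E.Fiber x) :=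
  ⟨fun a b => ⟨E.add a.1 b.1 (a.2.trans b.2.symm), (E.add_π _ _ _).trans a.2⟩⟩

instance fiberSMul {T : Scheme.{u}} (x : T ⟶ X) : SMul Γ(T, ⊤) (E.Fiber x) :=
  ⟨fun f a => ⟨E.smul f a.1, (E.smul_π _ _).trans a.2⟩⟩

@[simp] theorem coe_fiber_zero {T : Scheme.{u}} (x : T ⟶ X) :
    ((0 : E.Fiber x) : T ⟶ E.tot) = x ≫ E.zero := rfl

@[simp] theorem coe_fiber_add {T : Scheme.{u}} (x : T ⟶ X) (a b : E.Fiber x) :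
    ((a + b : E.Fiber x) : T ⟶ E.tot) = E.add a.1 b.1 (a.2.trans b.2.symm) := rfl

@[simp] theorem coe_fiber_smul {T : Scheme.{u}} (x : T ⟶ X) (f : Γ(T, ⊤)) (a : E.Fiber x) :
    ((f • a : E.Fiber x) : T ⟶ E.tot) = E.smul f a.1 := rfl

instance {T : Scheme.{u}} (x : T ⟶ X) : AddCommMonoid (E.Fiber x) where
  add_assoc a b c := Subtype.ext (E.add_assoc _ _ _ _ _ _ _)
  add_comm a b := Subtype.ext (E.add_comm _ _ _ _)
  zero_add a := Subtype.ext (by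
    have hz : ((a.1 ≫ E.π) ≫ E.zero) ≫ E.π = a.1 ≫ E.π := by
      rw [Category.assoc, E.zero_π, Category.comp_id]
    show E.add (x ≫ E.zero) a.1 _ = a.1
    exact (E.add_congr (by rw [a.2]) rfl _ hz).trans (E.zero_add a.1 hz))
  add_zero a := Subtype.ext (by
    have hz : ((a.1 ≫ E.π) ≫ E.zero) ≫ E.π = a.1 ≫ E.π := by
      rw [Category.assoc, E.zero_π, Category.comp_id]
    have hz' : (x ≫ E.zero) ≫ E.π = a.1 ≫ E.π := by
      rw [Category.assoc, E.zero_π, Category.comp_id, a.2]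
    show E.add a.1 (x ≫ E.zero) _ = a.1
    exact (E.add_comm _ _ _ hz').trans
      ((E.add_congr (by rw [a.2]) rfl _ hz).trans (E.zero_add a.1 hz)))
  nsmul := nsmulRec
  nsmul_zero _ := rfl
  nsmul_succ _ _ := rfl

instance {T : Scheme.{u}} (x : T ⟶ X) : Module Γ(T, ⊤) (E.Fiber x) where
  one_smul a := Subtype.ext (E.one_smul a.1)
  mul_smul f g a := Subtype.ext (E.mul_smul f g a.1)
  smul_zero f := Subtype.ext (E.smul_zero f x)
  smul_add f a b := Subtype.ext (E.smul_add f a.1 b.1 _ _)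
  add_smul f g a := Subtype.ext (E.add_smul f g a.1 _)
  zero_smul a := Subtype.ext ((E.zero_smul a.1).trans (by rw [a.2]; rfl))

/-- A family of `n` local sections of `E` over an open subset `U` is a frame if every point
of the total space over `U` is, in a unique way, a linear combination of these sections. -/
def IsFrame {n : ℕ} (U : X.Opens) (s : Fin n → (U.toScheme ⟶ E.tot)) : Prop :=
  ∃ hs : ∀ i, s i ≫ E.π = U.ι,
    ∀ {T : Scheme.{u}} (x : T ⟶ U.toScheme),
      Function.Bijective (fun f : Fin n → Γ(T, ⊤) =>
        (∑ i, f i • (⟨x ≫ s i, by rw [Category.assoc, hs i]⟩ : E.Fiber (x ≫ U.ι))))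

/-- A family of `n` global sections of `E` is a global frame if every point of the total
space is, in a unique way, a linear combination of these sections. -/
def IsGlobalFrame {n : ℕ} (s : Fin n → (X ⟶ E.tot)) : Prop :=
  ∃ hs : ∀ i, s i ≫ E.π = 𝟙 X,
    ∀ {T : Scheme.{u}} (x : T ⟶ X),
      Function.Bijective (fun f : Fin n → Γ(T, ⊤) =>
        (∑ i, f i • (⟨x ≫ s i, by rw [Category.assoc, hs i, Category.comp_id]⟩ : E.Fiber x)))

end VecBundleData

/-- A (geometric) vector bundle of rank `n` on `X`: bundle data which is locally trivial,
i.e. admits local frames around every point of `X`. -/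
structure VecBundle (n : ℕ) (X : Scheme.{u}) extends VecBundleData X where
  locTriv : ∀ x : X, ∃ (U : X.Opens) (s : Fin n → (U.toScheme ⟶ tot)),
    x ∈ U ∧ toVecBundleData.IsFrame U s

/-- A (geometric) line bundle on a scheme. -/
abbrev LineBundle (X : Scheme.{u}) := VecBundle 1 X

/-- A morphism of total spaces of vector bundles over `X` is linear if it commutes with the
projections, the fiberwise additions and the fiberwise scalar multiplications. -/
def IsLinearHom {X : Scheme.{u}} (E F : VecBundleData X) (φ : E.tot ⟶ F.tot) : Prop :=
  (φ ≫ F.π = E.π) ∧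
  (∀ {T : Scheme.{u}} (a b : T ⟶ E.tot) (h h'), E.add a b h ≫ φ = F.add (a ≫ φ) (b ≫ φ) h') ∧
  (∀ {T : Scheme.{u}} (f : Γ(T, ⊤)) (a : T ⟶ E.tot), E.smul f a ≫ φ = F.smul f (a ≫ φ))

/-- Two vector bundles on `X` are isomorphic if there is a linear isomorphism between them. -/
def VBIso {X : Scheme.{u}} {n m : ℕ} (E : VecBundle n X) (F : VecBundle m X) : Prop :=
  ∃ φ : E.tot ⟶ F.tot, IsLinearHom E.toVecBundleData F.toVecBundleData φ ∧ IsIso φ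

/-- `F` is a pullback of the vector bundle `E` along `g : Y ⟶ X`. -/
def IsPullbackBundle {Y X : Scheme.{u}} (g : Y ⟶ X) {n : ℕ} (E : VecBundle n X)
    (F : VecBundle n Y) : Prop :=
  ∃ τ : F.tot ⟶ E.tot,
    (τ ≫ E.π = F.π ≫ g) ∧
    (∀ {T : Scheme.{u}} (a b : T ⟶ F.tot) (h h'), F.add a b h ≫ τ = E.add (a ≫ τ) (b ≫ τ) h') ∧
    (∀ {T : Scheme.{u}} (f : Γ(T, ⊤)) (a : T ⟶ F.tot), F.smul f a ≫ τ = E.smul f (a ≫ τ)) ∧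
    (∀ {T : Scheme.{u}} (y : T ⟶ Y) (a : T ⟶ E.tot), a ≫ E.π = y ≫ g →
      ∃! b : T ⟶ F.tot, b ≫ F.π = y ∧ b ≫ τ = a)

/-- A vector bundle is trivial if it admits a global frame. -/
def IsTrivialBundle {X : Scheme.{u}} {n : ℕ} (E : VecBundle n X) : Prop :=
  ∃ s : Fin n → (X ⟶ E.tot), E.toVecBundleData.IsGlobalFrame s

/-- `N` is a tensor product of the line bundles `L` and `M`: witnessed by a fiberwise
bilinear pairing taking local frames to local frames. -/
def IsTensor {X : Scheme.{u}} (L M N : LineBundle X) : Prop :=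
  ∃ β : ∀ {T : Scheme.{u}} (a : T ⟶ L.tot) (b : T ⟶ M.tot), a ≫ L.π = b ≫ M.π → (T ⟶ N.tot),
    (∀ {T : Scheme.{u}} (a : T ⟶ L.tot) (b : T ⟶ M.tot) (h), β a b h ≫ N.π = a ≫ L.π) ∧
    (∀ {T' T : Scheme.{u}} (g : T' ⟶ T) (a : T ⟶ L.tot) (b : T ⟶ M.tot) (h h'),
      g ≫ β a b h = β (g ≫ a) (g ≫ b) h') ∧
    (∀ {T : Scheme.{u}} (a a' : T ⟶ L.tot) (b : T ⟶ M.tot) (h₁ h₂ h₃ h₄ h₅),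
      β (L.add a a' h₁) b h₂ = N.add (β a b h₃) (β a' b h₄) h₅) ∧
    (∀ {T : Scheme.{u}} (a : T ⟶ L.tot) (b b' : T ⟶ M.tot) (h₁ h₂ h₃ h₄ h₅),
      β a (M.add b b' h₁) h₂ = N.add (β a b h₃) (β a b' h₄) h₅) ∧
    (∀ {T : Scheme.{u}} (f : Γ(T, ⊤)) (a : T ⟶ L.tot) (b : T ⟶ M.tot) (h₁ h₂),
      β (L.smul f a) b h₁ = N.smul f (β a b h₂)) ∧
    (∀ {T : Scheme.{u}} (f : Γ(T, ⊤)) (a : T ⟶ L.tot) (b : T ⟶ M.tot) (h₁ h₂),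
      β a (M.smul f b) h₁ = N.smul f (β a b h₂)) ∧
    (∀ (U : X.Opens) (sL : Fin 1 → (U.toScheme ⟶ L.tot)) (sM : Fin 1 → (U.toScheme ⟶ M.tot)),
      L.toVecBundleData.IsFrame U sL → M.toVecBundleData.IsFrame U sM →
      ∀ (h : sL 0 ≫ L.π = sM 0 ≫ M.π),
        N.toVecBundleData.IsFrame (n := 1) U (fun _ => β (sL 0) (sM 0) h))

/-- `N` is an `m`-th tensor power of the line bundle `L`. -/
def IsTensorPow {X : Scheme.{u}} (L : LineBundle X) : ℕ → LineBundle X → Prop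
  | 0, N => IsTrivialBundle N
  | m + 1, N => ∃ M : LineBundle X, IsTensorPow L m M ∧ IsTensor M L N

/-- A line bundle is ample if the base is quasi-compact and quasi-separated and the
non-vanishing loci of global sections of positive tensor powers give an affine open cover. -/
def IsAmple {X : Scheme.{u}} (L : LineBundle X) : Prop :=
  CompactSpace X ∧ QuasiSeparatedSpace X ∧
  ∀ x : X, ∃ (m : ℕ), 0 < m ∧ ∃ (N : LineBundle X), IsTensorPow L m N ∧
    ∃ (s : X ⟶ N.tot), s ≫ N.π = 𝟙 X ∧
      ∃ U : X.Opens, IsAffineOpen U ∧ x ∈ U ∧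
        (U : Set X) = {y : X | s.base y ≠ N.zero.base y}
/-! ### Properties of schemes and group schemes over `k` -/

/-- An algebraic group over `k` is a group scheme of finite type over `k`. -/
def GroupSchemeOver.IsAlgebraic {k : Type u} [Field k] (G : GroupSchemeOver k) : Prop :=
  LocallyOfFiniteType G.str ∧ QuasiCompact G.str

/-- A scheme of finite type over `k`. -/
def SchemeOver.IsFiniteType {k : Type u} [Field k] (X : SchemeOver k) : Prop :=
  LocallyOfFiniteType X.str ∧ QuasiCompact X.str

/-- A variety over `k`: an integral separated scheme of finite type over `k`. -/
def SchemeOver.IsVariety {k : Type u} [Field k] (X : SchemeOver k) : Prop :=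
  IsIntegral X.carrier ∧ AlgebraicGeometry.IsSeparated X.str ∧ X.IsFiniteType

/-- A scheme is normal if all its local rings are integrally closed domains. -/
def IsNormalScheme (X : Scheme.{u}) : Prop :=
  ∀ x : X, IsDomain (X.presheaf.stalk x) ∧ IsIntegrallyClosed (X.presheaf.stalk x)

/-- The base change of a scheme over `k` to the algebraic closure of `k`. -/
def SchemeOver.geomFiber {k : Type u} [Field k] (X : SchemeOver k) : Scheme.{u} :=
  pullback X.str (Spec.map (CommRingCat.ofHom (algebraMap k (AlgebraicClosure k))))

/-- A scheme over `k` is geometrically integral if its base change to an algebraic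
closure of `k` is integral. -/
def SchemeOver.IsGeomIntegral {k : Type u} [Field k] (X : SchemeOver k) : Prop :=
  IsIntegral X.geomFiber

/-- A scheme over `k` is geometrically connected if its base change to an algebraic
closure of `k` is connected. -/
def SchemeOver.IsGeomConnected {k : Type u} [Field k] (X : SchemeOver k) : Prop :=
  ConnectedSpace X.geomFiber

/-- A scheme over `k` is geometrically irreducible if its base change to an algebraic
closure of `k` is irreducible. -/
def SchemeOver.IsGeomIrreducible {k : Type u} [Field k] (X : SchemeOver k) : Prop :=
  IrreducibleSpace X.geomFiber

/-- An open subscheme of a scheme over `k`, as a scheme over `k`. -/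
def SchemeOver.ofOpens {k : Type u} [Field k] (X : SchemeOver k) (U : X.carrier.Opens) :
    SchemeOver k :=
  ⟨U.toScheme, U.ι ≫ X.str⟩

/-- A scheme over `k` is quasi-projective if it is separated, of finite type, and carries
an ample line bundle. -/
def SchemeOver.IsQuasiProjective {k : Type u} [Field k] (X : SchemeOver k) : Prop :=
  AlgebraicGeometry.IsSeparated X.str ∧ X.IsFiniteType ∧
    ∃ L : LineBundle X.carrier, IsAmple L

/-- An open subset of `X` is stable under an action of `G` if the action preserves its
`T`-points, for all `T`. -/
def ActionOver.Stable {k : Type u} [Field k] {G : GroupSchemeOver k} {X : SchemeOver k}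
    (α : ActionOver G X) (U : X.carrier.Opens) : Prop :=
  ∀ {T : Scheme.{u}} (g : T ⟶ G.carrier) (x : T ⟶ X.carrier) (h),
    Set.range x.base ⊆ (U : Set X.carrier) →
      Set.range (α.act g x h).base ⊆ (U : Set X.carrier)

/-- A `G`-linearization of a vector bundle `E` on a `G`-scheme `X`: an action of `G` on the
total space of `E`, lifting the action on `X` and acting linearly on the fibers (equivalently,
an action of `G × 𝔾ₘ` on `E` for which the projection is equivariant and `𝔾ₘ` acts by
multiplication on the fibers). -/
structure LinearizationData {k : Type u} [Field k] {G : GroupSchemeOver k} {X : SchemeOver k}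
    (α : ActionOver G X) {n : ℕ} (E : VecBundle n X.carrier) where
  lact : ∀ {T : Scheme.{u}} (g : T ⟶ G.carrier) (e : T ⟶ E.tot),
    g ≫ G.str = (e ≫ E.π) ≫ X.str → (T ⟶ E.tot)
  lact_π : ∀ {T : Scheme.{u}} (g : T ⟶ G.carrier) (e : T ⟶ E.tot) (h h'),
    lact g e h ≫ E.π = α.act g (e ≫ E.π) h'
  lact_natural : ∀ {T' T : Scheme.{u}} (f : T' ⟶ T) (g : T ⟶ G.carrier) (e : T ⟶ E.tot) (h h'),
    f ≫ lact g e h = lact (f ≫ g) (f ≫ e) h'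
  one_lact : ∀ {T : Scheme.{u}} (e : T ⟶ E.tot) (h), lact (((e ≫ E.π) ≫ X.str) ≫ G.one) e h = e
  mul_lact : ∀ {T : Scheme.{u}} (g g' : T ⟶ G.carrier) (e : T ⟶ E.tot) (h₁ h₂ h₃ h₄),
    lact (G.mul g g' h₁) e h₂ = lact g (lact g' e h₃) h₄
  lact_add : ∀ {T : Scheme.{u}} (g : T ⟶ G.carrier) (a b : T ⟶ E.tot) (h₁ h₂ h₃ h₄ h₅),
    lact g (E.add a b h₁) h₂ = E.add (lact g a h₃) (lact g b h₄) h₅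
  lact_smul : ∀ {T : Scheme.{u}} (g : T ⟶ G.carrier) (f : Γ(T, ⊤)) (a : T ⟶ E.tot) (h₁ h₂),
    lact g (E.smul f a) h₁ = E.smul f (lact g a h₂)

/-- A vector bundle is `G`-linearized (linearizable) if it admits a linearization. -/
def ActionOver.IsLinearized {k : Type u} [Field k] {G : GroupSchemeOver k} {X : SchemeOver k}
    (α : ActionOver G X) {n : ℕ} (E : VecBundle n X.carrier) : Prop :=
  Nonempty (LinearizationData α E)

/-- Equivariance of a morphism relative to a homomorphism of group schemes. -/
def IsEquivariantRel {k : Type u} [Field k] {G H : GroupSchemeOver k} {X Y : SchemeOver k}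
    (φ : GroupHom G H) (α : ActionOver G X) (β : ActionOver H Y)
    (f : X.carrier ⟶ Y.carrier) : Prop :=
  f ≫ Y.str = X.str ∧
  ∀ {T : Scheme.{u}} (g : T ⟶ G.carrier) (x : T ⟶ X.carrier) (h h'),
    α.act g x h ≫ f = β.act (g ≫ φ.hom) (x ≫ f) h'

/-- Equivariance of a morphism of `G`-schemes. -/
def IsEquivariant {k : Type u} [Field k] {G : GroupSchemeOver k} {X Y : SchemeOver k}
    (α : ActionOver G X) (β : ActionOver G Y) (f : X.carrier ⟶ Y.carrier) : Prop :=
  f ≫ Y.str = X.str ∧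
  ∀ {T : Scheme.{u}} (g : T ⟶ G.carrier) (x : T ⟶ X.carrier) (h h'),
    α.act g x h ≫ f = β.act g (x ≫ f) h'

/-- A `T`-point of `G` acts trivially if it acts trivially on all points of `X` over `T`. -/
def ActionOver.ActsTrivially {k : Type u} [Field k] {G : GroupSchemeOver k}
    {X : SchemeOver k} (α : ActionOver G X) {T : Scheme.{u}} (g : T ⟶ G.carrier) : Prop :=
  ∀ {T' : Scheme.{u}} (t : T' ⟶ T) (x : T' ⟶ X.carrier) (h), α.act (t ≫ g) x h = x

/-- An action is almost faithful if its kernel is finite, i.e. all trivially acting points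
factor through a fixed closed subscheme of `G` which is finite over `k`. -/
def ActionOver.IsAlmostFaithful {k : Type u} [Field k] {G : GroupSchemeOver k}
    {X : SchemeOver k} (α : ActionOver G X) : Prop :=
  ∃ (K : Scheme.{u}) (ι : K ⟶ G.carrier), IsClosedImmersion ι ∧ IsFinite (ι ≫ G.str) ∧
    ∀ {T : Scheme.{u}} (g : T ⟶ G.carrier), α.ActsTrivially g → ∃ g' : T ⟶ K, g' ≫ ι = g

/-- An abelian variety over `k` is a smooth connected proper algebraic group over `k`. -/
def GroupSchemeOver.IsAbelianVariety {k : Type u} [Field k] (G : GroupSchemeOver k) : Prop :=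
  G.IsAlgebraic ∧ IsSmooth G.str ∧ ConnectedSpace G.carrier ∧ IsProper G.str

section Cube

variable {k : Type u} [Field k]

/-- The product `Y ×ₖ Z`. -/
def prodYZ (Y Z : SchemeOver k) : Scheme.{u} := pullback Y.str Z.str

/-- The structure morphism of `Y ×ₖ Z`. -/
def prodYZstr (Y Z : SchemeOver k) : prodYZ Y Z ⟶ Spk k := pullback.snd Y.str Z.str ≫ Z.str

/-- The triple product `X ×ₖ Y ×ₖ Z`. -/
def prodXYZ (X Y Z : SchemeOver k) : Scheme.{u} := pullback X.str (prodYZstr Y Z)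

namespace Cub
open Category
open Finset (sum_congr)

section
section Basic
variable {T T' T'' : Scheme.{u}}

lemma le_pre_inf {f : T' ⟶ T} {O : T'.Opens} {U V : T.Opens} (h : O ≤ f ⁻¹ᵁ U) (h' : O ≤ f ⁻¹ᵁ V) :
    O ≤ f ⁻¹ᵁ (U ⊓ V) := le_inf h h'

lemma le_pre_comp {f : T' ⟶ T} {g : T'' ⟶ T'} {f' : T'' ⟶ T} (e : g ≫ f = f') {O : T''.Opens}
    {U : T.Opens} (h : O ≤ f' ⁻¹ᵁ U) : O ≤ g ⁻¹ᵁ (f ⁻¹ᵁ U) := by subst e; exact h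

lemma le_pre_mono {f : T' ⟶ T} {O : T'.Opens} {U V : T.Opens} (h : O ≤ f ⁻¹ᵁ U) (h' : U ≤ V) :
    O ≤ f ⁻¹ᵁ V := fun _ hx => h' (h hx)

lemma le_pre_pre {f : T' ⟶ T} {g : T'' ⟶ T'} {U : T.Opens} {V : T'.Opens} {W : T''.Opens}
    (h : V ≤ f ⁻¹ᵁ U) (h' : W ≤ g ⁻¹ᵁ V) : W ≤ (g ≫ f) ⁻¹ᵁ U := fun _ hx => h (h' hx)

lemma le_pre_of_comp {f : T' ⟶ T} {g : T'' ⟶ T'} {f' : T'' ⟶ T} (e : g ≫ f = f') {U : T.Opens}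
    {V : T'.Opens} {W : T''.Opens}
    (h : V ≤ f ⁻¹ᵁ U) (h' : W ≤ g ⁻¹ᵁ V) : W ≤ f' ⁻¹ᵁ U := by subst e; exact le_pre_pre h h'

lemma le_of_pre_id {O U : T.Opens} (h : O ≤ (𝟙 T) ⁻¹ᵁ U) : O ≤ U := h

/-- pullback of functions -/
def pl (f : T' ⟶ T) {U : T.Opens} {V : T'.Opens} (h : V ≤ f ⁻¹ᵁ U) : Γ(T, U) →+* Γ(T', V) :=
  (f.appLE U V h).hom

/-- restriction of functions -/
def rs {U V : T.Opens} (h : V ≤ U) : Γ(T, U) →+* Γ(T, V) := (T.presheaf.map (homOfLE h).op).hom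

@[simp] lemma rs_self {U : T.Opens} (h : U ≤ U) (a : Γ(T, U)) : rs h a = a := by
  simp [rs]

@[simp] lemma rs_rs {U V W : T.Opens} (h : V ≤ U) (h' : W ≤ V) (a : Γ(T, U)) :
    rs h' (rs h a) = rs (h'.trans h) a := by
  simp only [rs, ← CommRingCat.comp_apply, ← Functor.map_comp]; rfl

@[simp] lemma rs_pl (f : T' ⟶ T) {U : T.Opens} {V W : T'.Opens} (h : V ≤ f ⁻¹ᵁ U) (h' : W ≤ V)
    (a : Γ(T, U)) : rs h' (pl f h a) = pl f (h'.trans h) a := by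
  simp only [rs, pl, ← CommRingCat.comp_apply, Scheme.Hom.appLE_map]

@[simp] lemma pl_rs (f : T' ⟶ T) {U W : T.Opens} {V : T'.Opens} (h' : W ≤ U) (h : V ≤ f ⁻¹ᵁ W)
    (a : Γ(T, U)) : pl f h (rs h' a) = pl f (le_pre_mono h h') a := by
  simp only [rs, pl, ← CommRingCat.comp_apply, Scheme.Hom.map_appLE]

lemma pl_pl (f : T' ⟶ T) (g : T'' ⟶ T') {U : T.Opens} {V : T'.Opens} {W : T''.Opens}
    (h : V ≤ f ⁻¹ᵁ U) (h' : W ≤ g ⁻¹ᵁ V) (a : Γ(T, U)) :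
    pl g h' (pl f h a) = pl (g ≫ f) (le_pre_pre h h') a := by
  simp only [pl, ← CommRingCat.comp_apply, Scheme.Hom.appLE_comp_appLE]

lemma pl_comp {f : T' ⟶ T} {g : T'' ⟶ T'} {f' : T'' ⟶ T} (e : g ≫ f = f')
    {U : T.Opens} {V : T'.Opens} {W : T''.Opens}
    (h : V ≤ f ⁻¹ᵁ U) (h' : W ≤ g ⁻¹ᵁ V) (h'' : W ≤ f' ⁻¹ᵁ U) (a : Γ(T, U)) :
    pl g h' (pl f h a) = pl f' h'' a := by subst e; exact pl_pl ..

@[simp] lemma pl_id {U V : T.Opens} (h : V ≤ 𝟙 T ⁻¹ᵁ U) (a : Γ(T, U)) : pl (𝟙 T) h a = rs (le_of_pre_id h) a := by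
  simp only [pl, rs, Scheme.Hom.appLE, Scheme.Hom.id_app]
  rfl

lemma rs_ext {κ : Type*} {V : T.Opens} (O : κ → T.Opens) (hO : ∀ c, O c ≤ V)
    (hc : ∀ x ∈ V, ∃ c, x ∈ O c) {a b : Γ(T, V)} (h : ∀ c, rs (hO c) a = rs (hO c) b) : a = b := by
  apply T.IsSheaf.section_ext
  intro x hx
  obtain ⟨c, hc⟩ := hc x hx
  exact ⟨O c, hO c, hc, h c⟩

lemma rs_glue {κ : Type*} {V : T.Opens} (O : κ → T.Opens) (hO : ∀ c, O c ≤ V)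
    (hc : ∀ x ∈ V, ∃ c, x ∈ O c) (a : ∀ c, Γ(T, O c))
    (h : ∀ c d, rs (inf_le_left : O c ⊓ O d ≤ O c) (a c) = rs (inf_le_right : O c ⊓ O d ≤ O d) (a d)) :
    ∃ s : Γ(T, V), ∀ c, rs (hO c) s = a c := by
  -- reduce to an index in universe u via points
  choose p hp using fun x : V => hc x.1 x.2
  obtain ⟨s, hs, -⟩ := TopCat.Sheaf.existsUnique_gluing' T.sheaf (fun x : V => O (p x)) V
    (fun x => homOfLE (hO _)) (fun x hx => by
      exact TopologicalSpace.Opens.mem_iSup.mpr ⟨⟨x, hx⟩, hp ⟨x, hx⟩⟩)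
    (fun x => a (p x)) (fun x y => h (p x) (p y))
  change Γ(T, V) at s
  refine ⟨s, fun c => ?_⟩
  refine rs_ext (fun x : O c => O c ⊓ O (p ⟨x.1, hO c x.2⟩)) (fun _ => inf_le_left)
    (fun x hx => ⟨⟨x, hx⟩, hx, hp ⟨x, _⟩⟩) (fun x => ?_)
  rw [h c (p ⟨x.1, hO c x.2⟩)]
  have := hs ⟨x.1, hO c x.2⟩
  rw [← show rs (hO _) s = a _ from this, rs_rs, rs_rs]

lemma isUnit_of_local {κ : Type*} {V : T.Opens} (O : κ → T.Opens) (hO : ∀ c, O c ≤ V)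
    (hc : ∀ x ∈ V, ∃ c, x ∈ O c) {a : Γ(T, V)} (h : ∀ c, IsUnit (rs (hO c) a)) : IsUnit a := by
  choose b hb using fun c => (h c).exists_right_inv
  obtain ⟨s, hs⟩ := rs_glue O hO hc b (fun c d => by
    have e1 := congrArg (rs (inf_le_left : O c ⊓ O d ≤ O c)) (hb c)
    have e2 := congrArg (rs (inf_le_right : O c ⊓ O d ≤ O d)) (hb d)
    simp only [map_mul, map_one, rs_rs] at e1 e2
    exact left_inv_eq_right_inv (by rw [mul_comm]; exact e1) e2)
  refine IsUnit.of_mul_eq_one s (rs_ext O hO hc fun c => ?_)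
  rw [map_mul, hs, hb, map_one]

end Basic

/-- A line bundle given by a cocycle. -/
structure LB (S : Scheme.{u}) where
  ι : Type u
  U : ι → S.Opens
  cov : ∀ s, ∃ i, s ∈ U i
  g : ∀ i j, Γ(S, U i ⊓ U j)
  g_self : ∀ i, g i i = 1
  coc : ∀ i j l, rs (le_inf (inf_le_left.trans inf_le_left) (inf_le_left.trans inf_le_right)) (g i j) *
    rs (le_inf (inf_le_left.trans inf_le_right) inf_le_right) (g j l) =
    rs (le_inf (inf_le_left.trans inf_le_left) inf_le_right : U i ⊓ U j ⊓ U l ≤ _) (g i l)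

variable {S T T' : Scheme.{u}} (N : LB S) (f : T ⟶ S)

/-- transition functions pulled back to an open subset. -/
def LB.tr (i j : N.ι) {O : T.Opens} (hi : O ≤ f ⁻¹ᵁ N.U i) (hj : O ≤ f ⁻¹ᵁ N.U j) : Γ(T, O) :=
  pl f (le_pre_inf hi hj) (N.g i j)

@[simp] lemma LB.tr_self (i : N.ι) {O : T.Opens} (hi : O ≤ f ⁻¹ᵁ N.U i) : N.tr f i i hi hi = 1 := by
  simp [LB.tr, N.g_self]

@[simp] lemma LB.tr_mul (i j l : N.ι) {O : T.Opens} (hi : O ≤ f ⁻¹ᵁ N.U i) (hj : O ≤ f ⁻¹ᵁ N.U j)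
    (hl : O ≤ f ⁻¹ᵁ N.U l) : N.tr f i j hi hj * N.tr f j l hj hl = N.tr f i l hi hl := by
  have := congrArg (pl f (le_pre_inf (le_pre_inf hi hj) hl))
    (N.coc i j l)
  simpa only [map_mul, pl_rs, LB.tr] using this

lemma LB.tr_symm (i j : N.ι) {O : T.Opens} (hi : O ≤ f ⁻¹ᵁ N.U i) (hj : O ≤ f ⁻¹ᵁ N.U j) :
    N.tr f i j hi hj * N.tr f j i hj hi = 1 := by simp

lemma LB.tr_isUnit (i j : N.ι) {O : T.Opens} (hi : O ≤ f ⁻¹ᵁ N.U i) (hj : O ≤ f ⁻¹ᵁ N.U j) :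
    IsUnit (N.tr f i j hi hj) := IsUnit.of_mul_eq_one _ (N.tr_symm f i j hi hj)

@[simp] lemma LB.rs_tr (i j : N.ι) {O O' : T.Opens} (h : O' ≤ O) (hi : O ≤ f ⁻¹ᵁ N.U i)
    (hj : O ≤ f ⁻¹ᵁ N.U j) : rs h (N.tr f i j hi hj) = N.tr f i j (h.trans hi) (h.trans hj) := by
  simp [LB.tr]

lemma LB.pl_tr {f' : T' ⟶ S} (h : T' ⟶ T) (e : h ≫ f = f') (i j : N.ι) {O : T.Opens} {O' : T'.Opens}
    (hO : O' ≤ h ⁻¹ᵁ O)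
    (hi : O ≤ f ⁻¹ᵁ N.U i) (hj : O ≤ f ⁻¹ᵁ N.U j) (hi' : O' ≤ f' ⁻¹ᵁ N.U i) (hj' : O' ≤ f' ⁻¹ᵁ N.U j) :
    pl h hO (N.tr f i j hi hj) = N.tr f' i j hi' hj' := by
  subst e
  simp only [LB.tr, pl_pl]

/-- the inverse line bundle -/
def LB.inv : LB S where
  ι := N.ι
  U := N.U
  cov := N.cov
  g i j := rs (le_inf inf_le_right inf_le_left) (N.g j i)
  g_self i := by simp [N.g_self]
  coc i j l := by
    have := N.tr_mul (𝟙 S) l j i (O := N.U i ⊓ N.U j ⊓ N.U l) (fun _ h => h.2)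
      (fun _ h => h.1.2) (fun _ h => h.1.1)
    simp only [rs_rs]
    simp only [LB.tr, pl_id] at this
    rw [mul_comm]; exact this

/-- Sections of `N` over `f : T ⟶ S` on the open subset `V`. -/
structure Sec (V : T.Opens) : Type u where
  v : ∀ i : N.ι, Γ(T, f ⁻¹ᵁ N.U i ⊓ V)
  prop : ∀ i j, rs (le_inf (inf_le_left.trans inf_le_left) inf_le_right :
        f ⁻¹ᵁ N.U i ⊓ f ⁻¹ᵁ N.U j ⊓ V ≤ _) (v i) =
      N.tr f i j (inf_le_left.trans inf_le_left) (inf_le_left.trans inf_le_right) *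
      rs (le_inf (inf_le_left.trans inf_le_right) inf_le_right) (v j)

variable {N f} {V : T.Opens}

lemma Sec.ext' {σ τ : Sec N f V} (h : σ.1 = τ.1) : σ = τ := by
  cases σ; cases τ; cases h; rfl

/-- The coordinate of a section on an open subset of a chart. -/
def Sec.at (σ : Sec N f V) (i : N.ι) {O : T.Opens} (hi : O ≤ f ⁻¹ᵁ N.U i) (hV : O ≤ V) : Γ(T, O) :=
  rs (le_inf hi hV) (σ.1 i)

@[simp] lemma Sec.rs_at (σ : Sec N f V) (i : N.ι) {O O' : T.Opens} (h : O' ≤ O)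
    (hi : O ≤ f ⁻¹ᵁ N.U i) (hV : O ≤ V) : rs h (σ.at i hi hV) = σ.at i (h.trans hi) (h.trans hV) := by
  simp [Sec.at]

lemma Sec.at_tr (σ : Sec N f V) (i j : N.ι) {O : T.Opens}
    (hi : O ≤ f ⁻¹ᵁ N.U i) (hj : O ≤ f ⁻¹ᵁ N.U j) (hV : O ≤ V) :
    σ.at i hi hV = N.tr f i j hi hj * σ.at j hj hV := by
  have := congrArg (rs (le_inf (le_inf hi hj) hV)) (σ.2 i j)
  simpa [Sec.at] using this

lemma Sec.ext_at {κ : Type*} (O : κ → T.Opens) (i : κ → N.ι) (hi : ∀ c, O c ≤ f ⁻¹ᵁ N.U (i c))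
    (hO : ∀ c, O c ≤ V) (hc : ∀ x ∈ V, ∃ c, x ∈ O c) {σ τ : Sec N f V}
    (h : ∀ c, σ.at (i c) (hi c) (hO c) = τ.at (i c) (hi c) (hO c)) : σ = τ := by
  apply Sec.ext'; funext j
  refine rs_ext (fun c => f ⁻¹ᵁ N.U j ⊓ O c) (fun c => inf_le_inf_left _ (hO c))
    (fun x hx => (hc x hx.2).imp fun c h => ⟨hx.1, h⟩) (fun c => ?_)
  have key : ∀ ρ : Sec N f V, rs (inf_le_inf_left _ (hO c)) (ρ.1 j) =
     N.tr f j (i c) inf_le_left (inf_le_right.trans (hi c)) *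
      rs inf_le_right (ρ.at (i c) (hi c) (hO c)) := fun ρ => by
    rw [Sec.rs_at, ← Sec.at_tr]; rfl
  rw [key, key, h]

lemma Sec.ext {σ τ : Sec N f V} (h : ∀ i (O : T.Opens) (hi : O ≤ f ⁻¹ᵁ N.U i) (hV : O ≤ V),
    σ.at i hi hV = τ.at i hi hV) : σ = τ := by
  apply Sec.ext'; funext j
  have := h j _ inf_le_left inf_le_right
  simpa only [Sec.at, rs_self] using this

lemma LB.cov' (N : LB S) (f : T ⟶ S) (x : T) : ∃ i, x ∈ f ⁻¹ᵁ N.U i := N.cov (f x)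

/-- Gluing of sections from coordinates. -/
lemma Sec.glue {κ : Type*} (O : κ → T.Opens) (i : κ → N.ι) (hi : ∀ c, O c ≤ f ⁻¹ᵁ N.U (i c))
    (hO : ∀ c, O c ≤ V) (hc : ∀ x ∈ V, ∃ c, x ∈ O c) (a : ∀ c, Γ(T, O c))
    (h : ∀ c d, rs (inf_le_left : O c ⊓ O d ≤ O c) (a c) =
      N.tr f (i c) (i d) (inf_le_left.trans (hi c)) (inf_le_right.trans (hi d)) *
        rs (inf_le_right : O c ⊓ O d ≤ O d) (a d)) :
    ∃ σ : Sec N f V, ∀ c, σ.at (i c) (hi c) (hO c) = a c := by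
  have H : ∀ j : N.ι, ∃ s : Γ(T, f ⁻¹ᵁ N.U j ⊓ V), ∀ c, rs (inf_le_inf_left _ (hO c)) s =
      N.tr f j (i c) inf_le_left (inf_le_right.trans (hi c)) *
        rs (inf_le_right : f ⁻¹ᵁ N.U j ⊓ O c ≤ _) (a c) := fun j => by
    refine rs_glue (fun c => f ⁻¹ᵁ N.U j ⊓ O c) (fun c => inf_le_inf_left _ (hO c))
      (fun x hx => (hc x hx.2).imp fun c h => ⟨hx.1, h⟩) _ (fun c d => ?_)
    have := congrArg (rs (show f ⁻¹ᵁ N.U j ⊓ O c ⊓ (f ⁻¹ᵁ N.U j ⊓ O d) ≤ O c ⊓ O d from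
      fun _ h => ⟨h.1.2, h.2.2⟩)) (h c d)
    simp only [map_mul, rs_rs, LB.rs_tr] at this ⊢
    rw [this, ← mul_assoc, LB.tr_mul]
  choose s hs using H
  refine ⟨⟨s, fun j l => ?_⟩, fun c => ?_⟩
  · refine rs_ext (fun c => f ⁻¹ᵁ N.U j ⊓ f ⁻¹ᵁ N.U l ⊓ O c) (fun c => inf_le_inf_left _ (hO c))
      (fun x hx => (hc x hx.2).imp fun c h => ⟨hx.1, h⟩) (fun c => ?_)
    have e1 := congrArg (rs (show f ⁻¹ᵁ N.U j ⊓ f ⁻¹ᵁ N.U l ⊓ O c ≤ f ⁻¹ᵁ N.U j ⊓ O c from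
      fun _ h => ⟨h.1.1, h.2⟩)) (hs j c)
    have e2 := congrArg (rs (show f ⁻¹ᵁ N.U j ⊓ f ⁻¹ᵁ N.U l ⊓ O c ≤ f ⁻¹ᵁ N.U l ⊓ O c from
      fun _ h => ⟨h.1.2, h.2⟩)) (hs l c)
    simp only [map_mul, rs_rs, LB.rs_tr] at e1 e2 ⊢
    rw [e1, e2, ← mul_assoc, LB.tr_mul]
  · have e1 := congrArg (rs (le_inf (hi c) le_rfl)) (hs (i c) c)
    simpa [Sec.at] using e1

/-- restriction of sections to a smaller open. -/
def Sec.res {V' : T.Opens} (h : V' ≤ V) (σ : Sec N f V) : Sec N f V' :=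
  ⟨fun i => σ.at i inf_le_left (inf_le_right.trans h), fun i j => by
    rw [Sec.rs_at, Sec.rs_at, ← Sec.at_tr]⟩

@[simp] lemma Sec.res_at {V' : T.Opens} (h : V' ≤ V) (σ : Sec N f V) (i : N.ι) {O : T.Opens}
    (hi : O ≤ f ⁻¹ᵁ N.U i) (hV : O ≤ V') : (σ.res h).at i hi hV = σ.at i hi (hV.trans h) := by
  simp [Sec.res, Sec.at]

@[simp] lemma Sec.res_res {V' V'' : T.Opens} (h : V' ≤ V) (h' : V'' ≤ V') (σ : Sec N f V) :
    (σ.res h).res h' = σ.res (h'.trans h) := Sec.ext fun i O hi hV => by simp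

@[simp] lemma Sec.res_self (h : V ≤ V) (σ : Sec N f V) : σ.res h = σ :=
  Sec.ext fun i O hi hV => by simp

/-- pullback of sections -/
def Sec.pull {f' : T' ⟶ S} (h : T' ⟶ T) (e : h ≫ f = f') (σ : Sec N f V) {V' : T'.Opens}
    (hV : V' ≤ h ⁻¹ᵁ V) : Sec N f' V' :=
  ⟨fun i => pl h (le_pre_inf (le_pre_comp e inf_le_left) (inf_le_right.trans hV)) (σ.1 i), fun i j => by
    subst e
    have := congrArg (pl h (le_pre_inf (le_pre_inf (le_pre_comp rfl (inf_le_left.trans inf_le_left))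
      (le_pre_comp rfl (inf_le_left.trans inf_le_right))) (inf_le_right.trans hV) :
      (h ≫ f) ⁻¹ᵁ N.U i ⊓ (h ≫ f) ⁻¹ᵁ N.U j ⊓ V' ≤ _)) (σ.2 i j)
    rw [map_mul, N.pl_tr f h rfl i j _ _ _ (inf_le_left.trans inf_le_left)
      (inf_le_left.trans inf_le_right)] at this
    rw [rs_pl, rs_pl]
    rw [pl_rs, pl_rs] at this
    exact this⟩

lemma Sec.pull_at {f' : T' ⟶ S} (h : T' ⟶ T) (e : h ≫ f = f') (σ : Sec N f V) {V' : T'.Opens}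
    (hV : V' ≤ h ⁻¹ᵁ V) (i : N.ι) {O : T.Opens} {O' : T'.Opens} (hO : O' ≤ h ⁻¹ᵁ O)
    (hi' : O' ≤ f' ⁻¹ᵁ N.U i) (hV' : O' ≤ V') (hi : O ≤ f ⁻¹ᵁ N.U i) (hV0 : O ≤ V) :
    (σ.pull h e hV).at i hi' hV' = pl h hO (σ.at i hi hV0) := by
  simp [Sec.pull, Sec.at]

/-- A canonical evaluation of `pull_at`. -/
lemma Sec.pull_at' {f' : T' ⟶ S} (h : T' ⟶ T) (e : h ≫ f = f') (σ : Sec N f V) {V' : T'.Opens}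
    (hV : V' ≤ h ⁻¹ᵁ V) (i : N.ι) {O' : T'.Opens}
    (hi' : O' ≤ f' ⁻¹ᵁ N.U i) (hV' : O' ≤ V') :
    (σ.pull h e hV).at i hi' hV' = pl h (le_pre_inf (le_pre_comp e hi') (hV'.trans hV)) (σ.1 i) := by
  simp [Sec.pull, Sec.at]

/-- sections as a subgroup of a product -/
def Sec.sub (N : LB S) (f : T ⟶ S) (V : T.Opens) : AddSubgroup (∀ i : N.ι, Γ(T, f ⁻¹ᵁ N.U i ⊓ V)) where
  carrier := { a | ∀ i j, rs (le_inf (inf_le_left.trans inf_le_left) inf_le_right :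
        f ⁻¹ᵁ N.U i ⊓ f ⁻¹ᵁ N.U j ⊓ V ≤ _) (a i) =
      N.tr f i j (inf_le_left.trans inf_le_left) (inf_le_left.trans inf_le_right) *
      rs (le_inf (inf_le_left.trans inf_le_right) inf_le_right) (a j) }
  add_mem' {a b} ha hb i j := by simp [ha i j, hb i j, mul_add]
  zero_mem' i j := by simp
  neg_mem' {a} ha i j := by simp [ha i j]

/-- sections as a subgroup of a product -/
def Sec.equiv (N : LB S) (f : T ⟶ S) (V : T.Opens) : Sec N f V ≃ Sec.sub N f V :=
  ⟨fun σ => ⟨σ.1, σ.2⟩, fun a => ⟨a.1, a.2⟩, fun _ => rfl, fun _ => rfl⟩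

instance : AddCommGroup (Sec N f V) := (Sec.equiv N f V).addCommGroup

lemma Sec.at_add (σ τ : Sec N f V) (i : N.ι) {O : T.Opens} (hi : O ≤ f ⁻¹ᵁ N.U i) (hV : O ≤ V) :
    (σ + τ).at i hi hV = σ.at i hi hV + τ.at i hi hV := map_add (rs _) _ _

lemma Sec.at_zero (i : N.ι) {O : T.Opens} (hi : O ≤ f ⁻¹ᵁ N.U i) (hV : O ≤ V) :
    (0 : Sec N f V).at i hi hV = 0 := map_zero (rs _)

instance : SMul Γ(T, V) (Sec N f V) :=
  ⟨fun c σ => ⟨fun i => rs inf_le_right c * σ.1 i, fun i j => by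
    simp only [map_mul, rs_rs, σ.2 i j]; ring⟩⟩

lemma Sec.at_smul (c : Γ(T, V)) (σ : Sec N f V) (i : N.ι) {O : T.Opens} (hi : O ≤ f ⁻¹ᵁ N.U i)
    (hV : O ≤ V) : (c • σ).at i hi hV = rs hV c * σ.at i hi hV := by
  have : (c • σ).at i hi hV = rs (le_inf hi hV) (rs inf_le_right c * σ.1 i) := rfl
  rw [this, map_mul, rs_rs]; rfl

instance : Module Γ(T, V) (Sec N f V) where
  one_smul σ := Sec.ext fun i O hi hV => by simp [Sec.at_smul]
  mul_smul c d σ := Sec.ext fun i O hi hV => by simp [Sec.at_smul, mul_assoc]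
  smul_zero c := Sec.ext fun i O hi hV => by simp [Sec.at_smul, Sec.at_zero]
  smul_add c σ τ := Sec.ext fun i O hi hV => by simp [Sec.at_smul, Sec.at_add, mul_add]
  add_smul c d σ := Sec.ext fun i O hi hV => by simp [Sec.at_smul, Sec.at_add, add_mul]
  zero_smul σ := Sec.ext fun i O hi hV => by simp [Sec.at_smul, Sec.at_zero]
end

section
variable {S T T' T'' : Scheme.{u}} {N : LB S} {f : T ⟶ S} {V : T.Opens}

lemma Sec.at_sum {κ : Type*} (s : Finset κ) (σ : κ → Sec N f V) (i : N.ι) {O : T.Opens}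
    (hi : O ≤ f ⁻¹ᵁ N.U i) (hV : O ≤ V) :
    (∑ a ∈ s, σ a).at i hi hV = ∑ a ∈ s, (σ a).at i hi hV := by
  classical
  induction s using Finset.induction_on with
  | empty => simp [Sec.at_zero]
  | insert a s ha ih => rw [Finset.sum_insert ha, Finset.sum_insert ha, Sec.at_add, ih]

/-- Uniqueness of sections: they may be compared on small opens inside charts. -/
lemma Sec.ext_loc {σ τ : Sec N f V} (h : ∀ x ∈ V, ∃ (O : T.Opens) (i : N.ι) (hi : O ≤ f ⁻¹ᵁ N.U i)
    (hO : O ≤ V), x ∈ O ∧ σ.at i hi hO = τ.at i hi hO) : σ = τ := by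
  choose O i hi hO hx he using fun x : V => h x.1 x.2
  exact Sec.ext_at O i hi hO (fun x hxV => ⟨⟨x, hxV⟩, hx ⟨x, hxV⟩⟩) he

lemma Sec.ext_res {κ : Type*} (O : κ → T.Opens) (hO : ∀ c, O c ≤ V)
    (hc : ∀ x ∈ V, ∃ c, x ∈ O c) {σ τ : Sec N f V} (h : ∀ c, σ.res (hO c) = τ.res (hO c)) : σ = τ := by
  refine Sec.ext_loc fun x hx => ?_
  obtain ⟨c, hc⟩ := hc x hx
  obtain ⟨i, hi⟩ := N.cov' f x
  refine ⟨f ⁻¹ᵁ N.U i ⊓ O c, i, inf_le_left, inf_le_right.trans (hO c), ⟨hi, hc⟩, ?_⟩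
  have := congrArg (fun ρ : Sec N f (O c) => ρ.at i (O := f ⁻¹ᵁ N.U i ⊓ O c) inf_le_left inf_le_right) (h c)
  simpa using this

lemma Sec.glue_res {κ : Type*} (O : κ → T.Opens) (hO : ∀ c, O c ≤ V)
    (hc : ∀ x ∈ V, ∃ c, x ∈ O c) (a : ∀ c, Sec N f (O c))
    (h : ∀ c d, (a c).res (inf_le_left : O c ⊓ O d ≤ O c) = (a d).res inf_le_right) :
    ∃ σ : Sec N f V, ∀ c, σ.res (hO c) = a c := by
  obtain ⟨σ, hσ⟩ := Sec.glue (N := N) (f := f) (V := V) (κ := κ × N.ι)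
    (fun c => f ⁻¹ᵁ N.U c.2 ⊓ O c.1) (fun c => c.2) (fun c => inf_le_left)
    (fun c => inf_le_right.trans (hO c.1))
    (fun x hx => by
      obtain ⟨c, hc⟩ := hc x hx
      obtain ⟨i, hi⟩ := N.cov' f x
      exact ⟨(c, i), hi, hc⟩)
    (fun c => (a c.1).at c.2 inf_le_left inf_le_right)
    (fun c d => by
      rw [Sec.rs_at, Sec.rs_at, (a c.1).at_tr c.2 d.2 _ (inf_le_right.trans inf_le_left)]
      congr 1
      have := congrArg (fun ρ : Sec N f (O c.1 ⊓ O d.1) =>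
        ρ.at d.2 (O := f ⁻¹ᵁ N.U c.2 ⊓ O c.1 ⊓ (f ⁻¹ᵁ N.U d.2 ⊓ O d.1)) (inf_le_right.trans inf_le_left)
        (le_inf (inf_le_left.trans inf_le_right) (inf_le_right.trans inf_le_right))) (h c.1 d.1)
      simpa using this)
  refine ⟨σ, fun c => Sec.ext_at (κ := N.ι) (fun i => f ⁻¹ᵁ N.U i ⊓ O c) (fun i => i)
    (fun _ => inf_le_left) (fun _ => inf_le_right) (fun x hx => ?_) (fun i => ?_)⟩
  · obtain ⟨i, hi⟩ := N.cov' f x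
    exact ⟨i, hi, hx⟩
  · rw [Sec.res_at]; exact hσ (c, i)

lemma Sec.res_add {V' : T.Opens} (h : V' ≤ V) (σ τ : Sec N f V) :
    (σ + τ).res h = σ.res h + τ.res h := Sec.ext fun i O hi hV => by simp [Sec.at_add]
lemma Sec.res_smul {V' : T.Opens} (h : V' ≤ V) (c : Γ(T, V)) (σ : Sec N f V) :
    (c • σ).res h = rs h c • σ.res h := Sec.ext fun i O hi hV => by simp [Sec.at_smul]
lemma Sec.res_sum {κ : Type*} (s : Finset κ) (σ : κ → Sec N f V) {V' : T.Opens} (h : V' ≤ V) :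
    (∑ a ∈ s, σ a).res h = ∑ a ∈ s, (σ a).res h :=
  Sec.ext fun i O hi hV => by simp [Sec.at_sum]

section pull
variable {f' : T' ⟶ S} (h : T' ⟶ T) (e : h ≫ f = f') {V' : T'.Opens} (hV : V' ≤ h ⁻¹ᵁ V)

lemma Sec.pull_add (σ τ : Sec N f V) : (σ + τ).pull h e hV = σ.pull h e hV + τ.pull h e hV :=
  Sec.ext fun i O hi hO => by
    rw [Sec.at_add, Sec.pull_at', Sec.pull_at', Sec.pull_at', ← map_add]; rfl
@[simp] lemma Sec.pull_zero : (0 : Sec N f V).pull h e hV = 0 :=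
  Sec.ext fun i O hi hO => by
    rw [Sec.at_zero, Sec.pull_at']; exact map_zero _
lemma Sec.pull_smul (c : Γ(T, V)) (σ : Sec N f V) :
    (c • σ).pull h e hV = pl h hV c • σ.pull h e hV :=
  Sec.ext fun i O hi hO => by
    rw [Sec.at_smul, Sec.pull_at', Sec.pull_at']
    have : (c • σ).1 i = rs inf_le_right c * σ.1 i := rfl
    rw [this, map_mul, pl_rs, rs_pl]
lemma Sec.pull_sum {κ : Type*} (s : Finset κ) (σ : κ → Sec N f V) :
    (∑ a ∈ s, σ a).pull h e hV = ∑ a ∈ s, (σ a).pull h e hV := by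
  classical
  induction s using Finset.induction_on with
  | empty => simp
  | insert a s ha ih => rw [Finset.sum_insert ha, Finset.sum_insert ha, Sec.pull_add, ih]

lemma Sec.pull_res {V₁ : T.Opens} (hV₁ : V₁ ≤ V) (hV : V' ≤ h ⁻¹ᵁ V₁) (σ : Sec N f V) :
    (σ.res hV₁).pull h e hV = σ.pull h e (le_pre_mono hV hV₁) :=
  Sec.ext fun i O hi hO => by
    rw [Sec.pull_at' h e σ, Sec.pull_at']
    have : (σ.res hV₁).1 i = rs (le_inf inf_le_left (inf_le_right.trans hV₁)) (σ.1 i) := rfl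
    rw [this, pl_rs]

lemma Sec.res_pull {V₁' : T'.Opens} (hV₁' : V₁' ≤ V') (σ : Sec N f V) :
    (σ.pull h e hV).res hV₁' = σ.pull h e (hV₁'.trans hV) :=
  Sec.ext fun i O hi hO => by
    rw [Sec.res_at, Sec.pull_at', Sec.pull_at']

lemma Sec.pull_pull {f'' : T'' ⟶ S} (h' : T'' ⟶ T') (e' : h' ≫ f' = f'') {V'' : T''.Opens}
    (hV' : V'' ≤ h' ⁻¹ᵁ V') (h'' : T'' ⟶ T) (e'' : h' ≫ h = h'') (e3 : h'' ≫ f = f'')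
    (hV'' : V'' ≤ h'' ⁻¹ᵁ V) (σ : Sec N f V) :
    (σ.pull h e hV).pull h' e' hV' = σ.pull h'' e3 hV'' := by
  subst e''
  refine Sec.ext fun i O hi hO => ?_
  rw [Sec.pull_at', Sec.pull_at']
  have : (σ.pull h e hV).1 i = pl h (le_pre_inf (le_pre_comp e inf_le_left) (inf_le_right.trans hV)) (σ.1 i) := rfl
  rw [this, pl_pl]

lemma Sec.pull_congr {h h₁ : T' ⟶ T} (hh : h = h₁) (e : h ≫ f = f') (e₁ : h₁ ≫ f = f')
    (hV : V' ≤ h ⁻¹ᵁ V) (hV₁ : V' ≤ h₁ ⁻¹ᵁ V) (σ : Sec N f V) :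
    σ.pull h e hV = σ.pull h₁ e₁ hV₁ := by subst hh; rfl

end pull

@[simp] lemma Sec.pull_id (e : 𝟙 T ≫ f = f) (σ : Sec N f V) {V' : T.Opens} (hV : V' ≤ 𝟙 T ⁻¹ᵁ V) :
    σ.pull (𝟙 T) e hV = σ.res (le_of_pre_id hV) := Sec.ext fun i O hi hO => by
  rw [Sec.res_at, Sec.pull_at' , pl_id]; rfl

/-! ### generators -/

/-- A section is a generator if all its coordinates are units. -/
def Sec.IsGen (σ : Sec N f V) : Prop :=
  ∀ (i : N.ι) (O : T.Opens) (hi : O ≤ f ⁻¹ᵁ N.U i) (hV : O ≤ V), IsUnit (σ.at i hi hV)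

lemma Sec.isGen_loc {σ : Sec N f V} (h : ∀ x ∈ V, ∃ (O : T.Opens) (i : N.ι) (hi : O ≤ f ⁻¹ᵁ N.U i)
    (hO : O ≤ V), x ∈ O ∧ IsUnit (σ.at i hi hO)) : σ.IsGen := by
  intro j O' hj hV
  choose O i hi hO hx he using fun x : V => h x.1 x.2
  refine isUnit_of_local (κ := V) (fun x => O' ⊓ O x) (fun _ => inf_le_left)
    (fun x hx' => ⟨⟨x, hV hx'⟩, hx', hx ⟨x, hV hx'⟩⟩) fun x => ?_
  rw [Sec.rs_at, σ.at_tr j (i x) _ (inf_le_right.trans (hi x))]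
  refine (N.tr_isUnit ..).mul ?_
  have := (he x).map (rs (inf_le_right : O' ⊓ O x ≤ O x))
  simpa using this

lemma Sec.IsGen.res {σ : Sec N f V} (h : σ.IsGen) {V' : T.Opens} (hV : V' ≤ V) :
    (σ.res hV).IsGen := fun i O hi hO => by
  rw [Sec.res_at]; exact h ..

lemma Sec.IsGen.pull {σ : Sec N f V} (hσ : σ.IsGen) {f' : T' ⟶ S} (h : T' ⟶ T) (e : h ≫ f = f')
    {V' : T'.Opens} (hV : V' ≤ h ⁻¹ᵁ V) : (σ.pull h e hV).IsGen := fun i O hi hO => by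
  have := (hσ i _ inf_le_left inf_le_right).map
    (pl h (le_pre_inf (le_pre_comp e hi) (hO.trans hV)))
  rw [Sec.pull_at']
  simpa [Sec.at] using this

lemma Sec.IsGen.smul {σ : Sec N f V} (h : σ.IsGen) {c : Γ(T, V)} (hc : IsUnit c) :
    (c • σ).IsGen := fun i O hi hO => by
  rw [Sec.at_smul]; exact (hc.map _).mul (h ..)

lemma Sec.isGen_cover {κ : Type*} (O : κ → T.Opens) (hO : ∀ c, O c ≤ V)
    (hc : ∀ x ∈ V, ∃ c, x ∈ O c) {σ : Sec N f V} (h : ∀ c, (σ.res (hO c)).IsGen) : σ.IsGen := by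
  refine Sec.isGen_loc fun x hx => ?_
  obtain ⟨c, hc⟩ := hc x hx
  obtain ⟨i, hi⟩ := N.cov' f x
  refine ⟨f ⁻¹ᵁ N.U i ⊓ O c, i, inf_le_left, inf_le_right.trans (hO c), ⟨hi, hc⟩, ?_⟩
  have := h c i (f ⁻¹ᵁ N.U i ⊓ O c) inf_le_left inf_le_right
  simpa using this

/-- division by a generator -/
lemma Sec.IsGen.exists_smul {σ : Sec N f V} (h : σ.IsGen) (τ : Sec N f V) :
    ∃ c : Γ(T, V), τ = c • σ := by
  choose b hb using fun i => (h i _ inf_le_left inf_le_right).exists_right_inv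
  have hu : ∀ (i : N.ι) (O : T.Opens) (hi : O ≤ f ⁻¹ᵁ N.U i) (hV : O ≤ V),
     σ.at i hi hV * rs (le_inf hi hV) (b i) = 1 := fun i O hi hV => by
    have := congrArg (rs (le_inf hi hV)) (hb i)
    simpa using this
  obtain ⟨c, hc⟩ := rs_glue (T := T) (V := V) (fun i : N.ι => f ⁻¹ᵁ N.U i ⊓ V) (fun _ => inf_le_right)
    (fun x hx => (N.cov' f x).imp fun i hi => ⟨hi, hx⟩)
    (fun i => τ.at i inf_le_left inf_le_right * b i) (fun i j => by
      have h1 : f ⁻¹ᵁ N.U i ⊓ V ⊓ (f ⁻¹ᵁ N.U j ⊓ V) ≤ f ⁻¹ᵁ N.U i := inf_le_left.trans inf_le_left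
      have h2 : f ⁻¹ᵁ N.U i ⊓ V ⊓ (f ⁻¹ᵁ N.U j ⊓ V) ≤ f ⁻¹ᵁ N.U j := inf_le_right.trans inf_le_left
      have h3 : f ⁻¹ᵁ N.U i ⊓ V ⊓ (f ⁻¹ᵁ N.U j ⊓ V) ≤ V := inf_le_right.trans inf_le_right
      have e1 := hu i _ h1 h3
      have e2 := hu j _ h2 h3
      rw [σ.at_tr i j h1 h2] at e1
      simp only [map_mul, Sec.rs_at]
      rw [τ.at_tr i j h1 h2]
      have := N.tr_symm f i j h1 h2
      linear_combination (-(τ.at j h2 h3) * N.tr f i j h1 h2 * rs (le_inf h1 h3) (b i)) * e2 +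
        (τ.at j h2 h3) * rs (le_inf h2 h3) (b j) * e1)
  refine ⟨c, Sec.ext fun i O hi hV => ?_⟩
  have e := congrArg (rs (le_inf hi hV)) (hc i)
  simp only [rs_rs, map_mul, Sec.rs_at] at e
  rw [Sec.at_smul, e]
  linear_combination (-τ.at i hi hV) * hu i O hi hV

lemma Sec.IsGen.smul_inj {σ : Sec N f V} (h : σ.IsGen) {c d : Γ(T, V)} (e : c • σ = d • σ) : c = d := by
  refine rs_ext (fun i : N.ι => f ⁻¹ᵁ N.U i ⊓ V) (fun _ => inf_le_right)
    (fun x hx => (N.cov' f x).imp fun i hi => ⟨hi, hx⟩) fun i => ?_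
  have := congrArg (fun ρ : Sec N f V => ρ.at i inf_le_left inf_le_right) e
  simp only [Sec.at_smul] at this
  exact (h ..).mul_right_cancel this

lemma Sec.IsGen.isUnit {σ : Sec N f V} (h : σ.IsGen) {c : Γ(T, V)} (h' : (c • σ).IsGen) : IsUnit c := by
  obtain ⟨d, hd⟩ := h'.exists_smul σ
  refine IsUnit.of_mul_eq_one d (h.smul_inj ?_)
  rw [one_smul, mul_comm, mul_smul, ← hd]

/-- the tautological generator over a chart -/
def LB.chart (N : LB S) (f : T ⟶ S) (i : N.ι) : Sec N f (f ⁻¹ᵁ N.U i) :=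
  ⟨fun j => N.tr f j i inf_le_left inf_le_right, fun j l => by simp⟩

@[simp] lemma LB.chart_at (N : LB S) (f : T ⟶ S) (i j : N.ι) {O : T.Opens} (hj : O ≤ f ⁻¹ᵁ N.U j)
    (hi : O ≤ f ⁻¹ᵁ N.U i) : (N.chart f i).at j hj hi = N.tr f j i hj hi := by
  simp [LB.chart, Sec.at]

lemma LB.chart_isGen (N : LB S) (f : T ⟶ S) (i : N.ι) : (N.chart f i).IsGen := fun j O hj hi => by
  rw [LB.chart_at]; exact N.tr_isUnit ..

/-! ### pairing with the inverse -/

lemma LB.inv_tr (i j : N.ι) {O : T.Opens} (hi : O ≤ f ⁻¹ᵁ N.U i) (hj : O ≤ f ⁻¹ᵁ N.U j) :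
    N.inv.tr f i j hi hj = N.tr f j i hj hi := by
  have : N.inv.g i j = rs (le_inf inf_le_right inf_le_left) (N.g j i) := rfl
  unfold LB.tr
  rw [this]
  exact pl_rs ..

/-- coordinates of a section of the inverse -/
def Sec.iat (τ : Sec N.inv f V) (i : N.ι) {O : T.Opens} (hi : O ≤ f ⁻¹ᵁ N.U i) (hV : O ≤ V) : Γ(T, O) :=
  Sec.at (N := N.inv) τ i hi hV

@[simp] lemma Sec.rs_iat (σ : Sec N.inv f V) (i : N.ι) {O O' : T.Opens} (h : O' ≤ O)
    (hi : O ≤ f ⁻¹ᵁ N.U i) (hV : O ≤ V) : rs h (σ.iat i hi hV) = σ.iat i (h.trans hi) (h.trans hV) :=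
  Sec.rs_at (N := N.inv) σ i h hi hV

lemma Sec.iat_tr (σ : Sec N.inv f V) (i j : N.ι) {O : T.Opens}
    (hi : O ≤ f ⁻¹ᵁ N.U i) (hj : O ≤ f ⁻¹ᵁ N.U j) (hV : O ≤ V) :
    σ.iat i hi hV = N.tr f j i hj hi * σ.iat j hj hV := by
  rw [← LB.inv_tr]
  exact Sec.at_tr (N := N.inv) σ i j hi hj hV

@[simp] lemma Sec.res_iat {V' : T.Opens} (h : V' ≤ V) (σ : Sec N.inv f V) (i : N.ι) {O : T.Opens}
    (hi : O ≤ f ⁻¹ᵁ N.U i) (hV : O ≤ V') : (σ.res h).iat i hi hV = σ.iat i hi (hV.trans h) :=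
  Sec.res_at (N := N.inv) h σ i hi hV

lemma Sec.pull_iat {f' : T' ⟶ S} (h : T' ⟶ T) (e : h ≫ f = f') (σ : Sec N.inv f V) {V' : T'.Opens}
    (hV : V' ≤ h ⁻¹ᵁ V) (i : N.ι) {O : T.Opens} {O' : T'.Opens} (hO : O' ≤ h ⁻¹ᵁ O)
    (hi' : O' ≤ f' ⁻¹ᵁ N.U i) (hV' : O' ≤ V') (hi : O ≤ f ⁻¹ᵁ N.U i) (hV0 : O ≤ V) :
    (σ.pull h e hV).iat i hi' hV' = pl h hO (σ.iat i hi hV0) :=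
  Sec.pull_at (N := N.inv) h e σ hV i hO hi' hV' hi hV0

lemma exists_pair (σ : Sec N f V) (τ : Sec N.inv f V) : ∃ c : Γ(T, V),
    ∀ (i : N.ι) (O : T.Opens) (hi : O ≤ f ⁻¹ᵁ N.U i) (hV : O ≤ V),
      rs hV c = σ.at i hi hV * τ.iat i hi hV := by
  obtain ⟨c, hc⟩ := rs_glue (T := T) (V := V) (fun i : N.ι => f ⁻¹ᵁ N.U i ⊓ V) (fun _ => inf_le_right)
    (fun x hx => (N.cov' f x).imp fun i hi => ⟨hi, hx⟩)
    (fun i => σ.at i inf_le_left inf_le_right * τ.iat i inf_le_left inf_le_right) (fun i j => by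
      have h1 : f ⁻¹ᵁ N.U i ⊓ V ⊓ (f ⁻¹ᵁ N.U j ⊓ V) ≤ f ⁻¹ᵁ N.U i := inf_le_left.trans inf_le_left
      have h2 : f ⁻¹ᵁ N.U i ⊓ V ⊓ (f ⁻¹ᵁ N.U j ⊓ V) ≤ f ⁻¹ᵁ N.U j := inf_le_right.trans inf_le_left
      have h3 : f ⁻¹ᵁ N.U i ⊓ V ⊓ (f ⁻¹ᵁ N.U j ⊓ V) ≤ V := inf_le_right.trans inf_le_right
      have e1 := σ.at_tr i j h1 h2 h3
      have e2 := τ.iat_tr i j h1 h2 h3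
      simp only [map_mul, Sec.rs_at, Sec.rs_iat]
      have := N.tr_symm f i j h1 h2
      rw [e1, e2]
      linear_combination (σ.at j h2 h3 * τ.iat j h2 h3) * this)
  refine ⟨c, fun i O hi hV => ?_⟩
  have e := congrArg (rs (le_inf hi hV)) (hc i)
  simpa only [rs_rs, map_mul, Sec.rs_at, Sec.rs_iat] using e

/-- The pairing of sections of `N` with sections of the inverse. -/
def pair (σ : Sec N f V) (τ : Sec N.inv f V) : Γ(T, V) := (exists_pair σ τ).choose

lemma rs_pair (σ : Sec N f V) (τ : Sec N.inv f V)
    (i : N.ι) {O : T.Opens} (hi : O ≤ f ⁻¹ᵁ N.U i) (hV : O ≤ V) :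
      rs hV (pair σ τ) = σ.at i hi hV * τ.iat i hi hV := (exists_pair σ τ).choose_spec i O hi hV

lemma eq_pair {σ : Sec N f V} {τ : Sec N.inv f V} {c : Γ(T, V)}
    (h : ∀ (i : N.ι), rs (inf_le_right : f ⁻¹ᵁ N.U i ⊓ V ≤ V) c =
      σ.at i inf_le_left inf_le_right * τ.iat i inf_le_left inf_le_right) : c = pair σ τ :=
  rs_ext (fun i : N.ι => f ⁻¹ᵁ N.U i ⊓ V) (fun _ => inf_le_right)
    (fun x hx => (N.cov' f x).imp fun i hi => ⟨hi, hx⟩) fun i => by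
      rw [h, rs_pair _ _ i]

lemma pair_add (σ σ' : Sec N f V) (τ : Sec N.inv f V) : pair (σ + σ') τ = pair σ τ + pair σ' τ :=
  (eq_pair fun i => by
    rw [map_add, rs_pair _ _ i inf_le_left, rs_pair _ _ i inf_le_left, Sec.at_add, add_mul]).symm

lemma pair_smul (c : Γ(T, V)) (σ : Sec N f V) (τ : Sec N.inv f V) : pair (c • σ) τ = c * pair σ τ :=
  (eq_pair fun i => by rw [map_mul, rs_pair _ _ i inf_le_left, Sec.at_smul, mul_assoc]).symm

lemma pair_sum {κ : Type*} (s : Finset κ) (σ : κ → Sec N f V) (τ : Sec N.inv f V) :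
    pair (∑ a ∈ s, σ a) τ = ∑ a ∈ s, pair (σ a) τ :=
  (eq_pair fun i => by
    rw [Sec.at_sum, map_sum, Finset.sum_mul]
    exact sum_congr rfl fun a _ => by rw [rs_pair _ _ i inf_le_left]).symm

lemma pair_res {V' : T.Opens} (h : V' ≤ V) (σ : Sec N f V) (τ : Sec N.inv f V) :
    pair (σ.res h) (τ.res h) = rs h (pair σ τ) :=
  (eq_pair fun i => by
    rw [rs_rs, rs_pair σ τ i inf_le_left, Sec.res_at, Sec.res_iat]).symm

lemma pair_pull {f' : T' ⟶ S} (h : T' ⟶ T) (e : h ≫ f = f') {V' : T'.Opens}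
    (hV : V' ≤ h ⁻¹ᵁ V) (σ : Sec N f V) (τ : Sec N.inv f V) :
    pair (σ.pull h e hV) (τ.pull h e hV) = pl h hV (pair σ τ) :=
  (eq_pair fun i => by
    have hO : f' ⁻¹ᵁ N.U i ⊓ V' ≤ h ⁻¹ᵁ (f ⁻¹ᵁ N.U i ⊓ V) :=
      le_pre_inf (le_pre_comp e inf_le_left) (inf_le_right.trans hV)
    have e1 := congrArg (pl h hO) (rs_pair σ τ i inf_le_left inf_le_right)
    rw [pl_rs, map_mul] at e1
    rw [rs_pl, e1, Sec.pull_at h e σ hV i hO _ _ inf_le_left inf_le_right,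
      Sec.pull_iat h e τ hV i hO _ _ inf_le_left inf_le_right]).symm

lemma sum_pair_smul {κ : Type*} (s : Finset κ) (a : κ → Sec N f V) (b : κ → Sec N.inv f V)
    (h : ∑ c ∈ s, pair (a c) (b c) = 1) (σ : Sec N f V) : σ = ∑ c ∈ s, pair σ (b c) • a c := by
  refine Sec.ext_at (κ := N.ι) (fun i => f ⁻¹ᵁ N.U i ⊓ V) (fun i => i) (fun _ => inf_le_left)
    (fun _ => inf_le_right) (fun x hx => (N.cov' f x).imp fun i hi => ⟨hi, hx⟩) (fun i => ?_)
  rw [Sec.at_sum]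
  simp only [Sec.at_smul, rs_pair _ _ i inf_le_left inf_le_right]
  have := congrArg (rs (inf_le_right : f ⁻¹ᵁ N.U i ⊓ V ≤ V)) h
  rw [map_sum, map_one] at this
  simp only [rs_pair _ _ i inf_le_left inf_le_right] at this
  calc σ.at i inf_le_left inf_le_right = σ.at i inf_le_left inf_le_right * 1 := (mul_one _).symm
    _ = _ := by
      rw [← this, Finset.mul_sum]
      exact sum_congr rfl fun c _ => by ring
end

section
variable {S T T' T'' : Scheme.{u}} {N : LB S} {f : T ⟶ S} {V : T.Opens}

lemma basicOpen_rs {U W : T.Opens} (h : W ≤ U) (a : Γ(T, U)) :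
    T.basicOpen (rs h a) = W ⊓ T.basicOpen a := Scheme.basicOpen_res _ _ _

lemma basicOpen_pl (h : T' ⟶ T) {U : T.Opens} {W : T'.Opens} (hW : W ≤ h ⁻¹ᵁ U) (a : Γ(T, U)) :
    T'.basicOpen (pl h hW a) = W ⊓ h ⁻¹ᵁ T.basicOpen a := by
  have : pl h hW a = rs hW (h.app U a) := rfl
  rw [this, basicOpen_rs, Scheme.preimage_basicOpen]

lemma isUnit_rs_of_le_basicOpen {U W : T.Opens} (a : Γ(T, U)) (h : W ≤ T.basicOpen a) :
    IsUnit (rs (h.trans (T.basicOpen_le a)) a) := by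
  have := (RingedSpace.isUnit_res_basicOpen T.toRingedSpace a).map (rs h)
  convert this using 1
  exact (rs_rs (T.basicOpen_le a) h a).symm

/-- The locus where a section does not vanish. -/
def Sec.nv (σ : Sec N f V) : T.Opens := ⨆ i, T.basicOpen (σ.v i)

lemma Sec.nv_le (σ : Sec N f V) : σ.nv ≤ V :=
  iSup_le fun i => (T.basicOpen_le _).trans inf_le_right

lemma Sec.isGen_of_le_nv (σ : Sec N f V) {O : T.Opens} (h : O ≤ σ.nv) (hV : O ≤ V) :
    (σ.res hV).IsGen := by
  refine Sec.isGen_loc fun x hx => ?_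
  obtain ⟨i, hi⟩ := TopologicalSpace.Opens.mem_iSup.mp (h hx)
  have hb : O ⊓ T.basicOpen (σ.v i) ≤ f ⁻¹ᵁ N.U i ⊓ V := inf_le_right.trans (T.basicOpen_le _)
  refine ⟨O ⊓ T.basicOpen (σ.v i), i, hb.trans inf_le_left, inf_le_left, ⟨hx, hi⟩, ?_⟩
  rw [Sec.res_at]
  exact isUnit_rs_of_le_basicOpen (σ.v i) inf_le_right

lemma Sec.le_nv_of_isGen_pull (σ : Sec N f V) {f' : T' ⟶ S} (h : T' ⟶ T) (e : h ≫ f = f')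
    {V' : T'.Opens} (hV : V' ≤ h ⁻¹ᵁ V) (hg : (σ.pull h e hV).IsGen) : V' ≤ h ⁻¹ᵁ σ.nv := by
  intro x hx
  obtain ⟨i, hi⟩ := N.cov' f' x
  have := hg i (f' ⁻¹ᵁ N.U i ⊓ V') inf_le_left inf_le_right
  rw [Sec.pull_at'] at this
  have h2 := Scheme.basicOpen_of_isUnit _ this
  rw [basicOpen_pl] at h2
  have h3 : x ∈ f' ⁻¹ᵁ N.U i ⊓ V' := ⟨hi, hx⟩
  rw [← h2] at h3
  exact TopologicalSpace.Opens.mem_iSup.mpr ⟨i, h3.2⟩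

/-! ### affine opens -/

lemma rs_tor {U O : T.Opens} (hU : IsCompact U.1) (a x : Γ(T, U)) (hO : O ≤ U)
    (hO' : U ⊓ T.basicOpen a ≤ O) (h : rs hO x = 0) : ∃ n : ℕ, ∀ m ≥ n, a ^ m * x = 0 := by
  obtain ⟨n, hn⟩ := exists_pow_mul_eq_zero_of_res_basicOpen_eq_zero_of_isCompact T hU x a (by
    have h1 := congrArg (rs (le_inf (T.basicOpen_le a) le_rfl |>.trans hO')) h
    rw [rs_rs, map_zero] at h1
    exact h1)
  exact ⟨n, fun m hm => by rw [← Nat.sub_add_cancel hm, pow_add, mul_assoc, hn, mul_zero]⟩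

lemma rs_extend {U O : T.Opens} (hU : IsAffineOpen U) (a : Γ(T, U)) (hO : O ≤ U)
    (hO' : O = U ⊓ T.basicOpen a) (x : Γ(T, O)) : ∃ n : ℕ, ∀ m ≥ n, ∃ y : Γ(T, U),
      rs hO y = rs hO a ^ m * x := by
  obtain rfl : O = T.basicOpen a := by rw [hO']; exact inf_eq_right.mpr (T.basicOpen_le a)
  obtain ⟨n, y, hy⟩ := exists_eq_pow_mul_of_isAffineOpen T U hU a x
  refine ⟨n, fun m hm => ⟨a ^ (m - n) * y, ?_⟩⟩
  have hy' : rs hO y = rs hO a ^ n * x := hy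
  conv_rhs => rw [← Nat.sub_add_cancel hm, pow_add, mul_assoc, ← hy']
  rw [map_mul, map_pow]

lemma fin_unif {κ : Type*} [Finite κ] {P : κ → ℕ → Prop} (h : ∀ c, ∃ n, ∀ m ≥ n, P c m) :
    ∃ n, ∀ m ≥ n, ∀ c, P c m := by
  cases nonempty_fintype κ
  choose n hn using h
  exact ⟨∑ c, n c, fun m hm c => hn c m ((Finset.single_le_sum (f := n) (fun _ _ => Nat.zero_le _)
    (Finset.mem_univ c)).trans hm)⟩

/-- affine opens have finite covers by basic opens contained in charts -/
lemma exists_chart_cover (N : LB S) (f : T ⟶ S) (hV : IsAffineOpen V) : ∃ s : Finset Γ(T, V),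
    Ideal.span (s : Set Γ(T, V)) = ⊤ ∧ ∀ g ∈ s, ∃ i, T.basicOpen g ≤ f ⁻¹ᵁ N.U i := by
  have : Ideal.span { g : Γ(T, V) | ∃ i, T.basicOpen g ≤ f ⁻¹ᵁ N.U i } = ⊤ := by
    rw [← hV.self_le_iSup_basicOpen_iff]
    intro x hx
    obtain ⟨i, hi⟩ := N.cov' f x
    obtain ⟨g, hg, hxg⟩ := hV.exists_basicOpen_le (V := f ⁻¹ᵁ N.U i) ⟨x, hi⟩ hx
    exact TopologicalSpace.Opens.mem_iSup.mpr ⟨⟨g, i, hg⟩, hxg⟩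
  obtain ⟨s, hs, hs'⟩ := (Ideal.span_eq_top_iff_finite _).mp this
  exact ⟨s, hs', fun g hg => hs hg⟩

lemma mem_basicOpen_of_span (hV : IsAffineOpen V) {s : Finset Γ(T, V)}
    (hs : Ideal.span (s : Set Γ(T, V)) = ⊤) {x : T} (hx : x ∈ V) :
    ∃ g : s, x ∈ T.basicOpen g.1 := by
  have := hV.self_le_iSup_basicOpen_iff.mpr hs hx
  exact TopologicalSpace.Opens.mem_iSup.mp this

lemma Sec.extend (hV : IsAffineOpen V) (a : Γ(T, V)) {O : T.Opens} (hO : O ≤ V)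
    (hO' : O = V ⊓ T.basicOpen a) (σ : Sec N f O) : ∃ n : ℕ, ∀ m ≥ n, ∃ τ : Sec N f V,
      τ.res hO = rs hO a ^ m • σ := by
  obtain ⟨s, hs, hi⟩ := exists_chart_cover N f hV
  choose i hi using fun g : s => hi g.1 g.2
  have hle : ∀ g : s, T.basicOpen g.1 ≤ V := fun g => T.basicOpen_le _
  have h1 : ∃ n, ∀ m ≥ n, ∀ g : s, ∃ y : Γ(T, T.basicOpen g.1),
      rs inf_le_left y = rs (inf_le_left.trans (hle g) : T.basicOpen g.1 ⊓ O ≤ V) a ^ m *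
        σ.at (i g) (inf_le_left.trans (hi g)) inf_le_right := by
    refine fin_unif fun g => ?_
    obtain ⟨n, hn⟩ := rs_extend (hV.basicOpen g.1) (rs (hle g) a)
      (O := T.basicOpen g.1 ⊓ O) inf_le_left (by
        rw [basicOpen_rs, hO', ← inf_assoc, ← inf_assoc, inf_idem, inf_eq_left.mpr (hle g)])
      (σ.at (i g) (inf_le_left.trans (hi g)) inf_le_right)
    refine ⟨n, fun m hm => ?_⟩
    obtain ⟨y, hy⟩ := hn m hm
    exact ⟨y, by rw [hy, rs_rs]⟩
  obtain ⟨n, hn⟩ := h1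
  choose y hy using hn n le_rfl
  have h2 : ∃ n', ∀ m ≥ n', ∀ g : s × s,
      rs (inf_le_left.trans (hle g.1) : T.basicOpen g.1.1 ⊓ T.basicOpen g.2.1 ≤ V) a ^ m *
      (rs inf_le_left (y g.1) -
      N.tr f (i g.1) (i g.2) (inf_le_left.trans (hi g.1)) (inf_le_right.trans (hi g.2)) *
        rs (inf_le_right : T.basicOpen g.1.1 ⊓ T.basicOpen g.2.1 ≤ T.basicOpen g.2.1) (y g.2)) = 0 := by
    refine fin_unif fun g => ?_
    refine rs_tor (O := T.basicOpen g.1.1 ⊓ T.basicOpen g.2.1 ⊓ O) ?_ _ _ inf_le_left ?_ ?_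
    · rw [← Scheme.basicOpen_mul]
      exact (hV.basicOpen _).isCompact
    · rw [basicOpen_rs, hO', inf_comm V, inf_eq_left.mpr (T.basicOpen_le a)]
      exact le_inf inf_le_left (inf_le_right.trans inf_le_right)
    · have e1 := congrArg (rs (show T.basicOpen g.1.1 ⊓ T.basicOpen g.2.1 ⊓ O ≤ T.basicOpen g.1.1 ⊓ O from
        inf_le_inf_right _ inf_le_left)) (hy g.1)
      have e2 := congrArg (rs (show T.basicOpen g.1.1 ⊓ T.basicOpen g.2.1 ⊓ O ≤ T.basicOpen g.2.1 ⊓ O from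
        inf_le_inf_right _ inf_le_right)) (hy g.2)
      simp only [rs_rs, map_mul, map_pow, Sec.rs_at] at e1 e2
      simp only [map_sub, map_mul, rs_rs, LB.rs_tr]
      rw [e1, e2, σ.at_tr (i g.1) (i g.2) _ (inf_le_left.trans (inf_le_right.trans (hi g.2)))]
      ring
  obtain ⟨n', hn'⟩ := h2
  refine ⟨n + n', fun m hm => ?_⟩
  obtain ⟨τ, hτ⟩ := Sec.glue (N := N) (f := f) (V := V) (fun g : s => T.basicOpen g.1) i hi hle
    (fun x hx => mem_basicOpen_of_span hV hs hx) (fun g => rs (hle g) a ^ (m - n) * y g) (fun g g' => by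
      have := hn' (m - n) (by omega) (g, g')
      simp only [map_mul, map_pow, rs_rs] at this ⊢
      linear_combination this)
  refine ⟨τ, Sec.ext_at (fun g : s => T.basicOpen g.1 ⊓ O) i (fun g => inf_le_left.trans (hi g))
    (fun _ => inf_le_right) (fun x hx => (mem_basicOpen_of_span hV hs (hO hx)).imp fun g hg => ⟨hg, hx⟩)
    fun g => ?_⟩
  have := congrArg (rs (inf_le_left : T.basicOpen g.1 ⊓ O ≤ _)) (hτ g)
  simp only [Sec.rs_at, map_mul, map_pow, rs_rs, hy] at this
  rw [Sec.res_at, Sec.at_smul, map_pow, rs_rs, this, ← mul_assoc, ← pow_add]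
  congr 2; omega

/-- chart of the inverse -/
def LB.ichart (N : LB S) (f : T ⟶ S) (i : N.ι) : Sec N.inv f (f ⁻¹ᵁ N.U i) := N.inv.chart f i

lemma LB.ichart_iat (N : LB S) (f : T ⟶ S) (i j : N.ι) {O : T.Opens} (hj : O ≤ f ⁻¹ᵁ N.U j)
    (hi : O ≤ f ⁻¹ᵁ N.U i) : (N.ichart f i).iat j hj hi = N.tr f i j hi hj := by
  rw [← N.inv_tr j i hj hi]
  exact N.inv.chart_at f i j hj hi

lemma Sec.iat_smul (c : Γ(T, V)) (σ : Sec N.inv f V) (i : N.ι) {O : T.Opens} (hi : O ≤ f ⁻¹ᵁ N.U i)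
    (hV : O ≤ V) : (c • σ).iat i hi hV = rs hV c * σ.iat i hi hV :=
  Sec.at_smul (N := N.inv) c σ i hi hV

/-- On an affine open a line bundle is a direct summand of a finite free module. -/
lemma exists_dual_basis (N : LB S) (f : T ⟶ S) (hV : IsAffineOpen V) :
    ∃ (n : ℕ) (s : Fin n → Sec N f V) (t : Fin n → Sec N.inv f V), ∑ a, pair (s a) (t a) = 1 := by
  obtain ⟨s, hs, hi⟩ := exists_chart_cover N f hV
  choose i hi using fun g : s => hi g.1 g.2
  have hle : ∀ g : s, T.basicOpen g.1 ≤ V := fun g => T.basicOpen_le _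
  have key : ∀ g : s, ∃ (n : ℕ) (σ : Sec N f V) (τ : Sec N.inv f V), pair σ τ = g.1 ^ n := fun g => by
    have hb : T.basicOpen g.1 = V ⊓ T.basicOpen g.1 := (inf_eq_right.mpr (hle g)).symm
    obtain ⟨n, hn⟩ := Sec.extend hV g.1 (hle g) hb ((N.chart f (i g)).res (hi g))
    obtain ⟨σ, hσ⟩ := hn n le_rfl
    obtain ⟨n', hn'⟩ := Sec.extend hV g.1 (hle g) hb ((N.ichart f (i g)).res (hi g))
    obtain ⟨τ, hτ⟩ := hn' n' le_rfl
    have hp : rs (hle g) (pair σ τ) = rs (hle g) g.1 ^ (n + n') := by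
      rw [rs_pair σ τ (i g) (hi g)]
      have e1 := congrArg (fun ρ : Sec N f (T.basicOpen g.1) => ρ.at (i g) (hi g) le_rfl) hσ
      have e2 := congrArg (fun ρ : Sec N.inv f (T.basicOpen g.1) => ρ.iat (i g) (hi g) le_rfl) hτ
      simp only [Sec.res_at, Sec.at_smul, LB.chart_at, LB.tr_self, rs_self, mul_one, Sec.res_iat, Sec.iat_smul, LB.ichart_iat] at e1 e2
      rw [e1, e2, pow_add]
    obtain ⟨r, hr⟩ := rs_tor hV.isCompact g.1 (pair σ τ - g.1 ^ (n + n')) (hle g) inf_le_right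
      (by rw [map_sub, hp, map_pow, sub_self])
    refine ⟨r + (n + n'), g.1 ^ r • σ, τ, ?_⟩
    have := hr r le_rfl
    rw [pair_smul, pow_add]
    linear_combination this
  choose n σ τ hp using key
  have h1 := Ideal.span_range_pow_eq_top (s : Set Γ(T, V)) hs n
  rw [Ideal.eq_top_iff_one, Ideal.mem_span_range_iff_exists_fun] at h1
  obtain ⟨c, hc⟩ := h1
  let e := (Finite.equivFin s)
  refine ⟨_, fun a => c (e.symm a) • σ (e.symm a), fun a => τ (e.symm a), ?_⟩
  rw [← hc]
  simp only [pair_smul, hp]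
  exact e.symm.sum_comp (fun g : s => c g * g.1 ^ n g)
end

section
/-- valuation at infinity on polynomials -/
def degVal (k : Type*) [Field k] (d : ℕ) : Valuation (MvPolynomial (Fin d) k) (WithZero (Multiplicative ℤ)) where
  toFun p := open Classical in if p = 0 then 0 else WithZero.exp (p.totalDegree : ℤ)
  map_zero' := by simp
  map_one' := by simp
  map_mul' p q := by
    by_cases hp : p = 0
    · simp [hp]
    by_cases hq : q = 0
    · simp [hq]
    simp [hp, hq, MvPolynomial.totalDegree_mul_of_isDomain hp hq, WithZero.exp_add]
  map_add_le_max' p q := by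
    by_cases hp : p = 0
    · subst hp; rw [zero_add]; exact le_max_right _ _
    by_cases hq : q = 0
    · subst hq; rw [add_zero]; exact le_max_left _ _
    by_cases hpq : p + q = 0
    · simp [hpq]
    have := MvPolynomial.totalDegree_add p q
    simp only [hp, hq, hpq, if_false]
    rcases le_max_iff.mp this with h | h
    · exact le_max_of_le_left (by simpa using h)
    · exact le_max_of_le_right (by simpa using h)

lemma degVal_apply (k : Type*) [Field k] (d : ℕ) {p : MvPolynomial (Fin d) k} (hp : p ≠ 0) :
    degVal k d p = WithZero.exp (p.totalDegree : ℤ) := by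
  simp [degVal, hp]

lemma degVal_le (k : Type*) [Field k] (d : ℕ) {p : MvPolynomial (Fin d) k} {n : ℕ} :
    degVal k d p ≤ WithZero.exp (n : ℤ) ↔ p.totalDegree ≤ n := by
  by_cases hp : p = 0
  · simp [hp]
  · rw [degVal_apply _ _ hp]; simp

/-- The degree bound on constant coefficients of minimal polynomials. -/
lemma coeff_bound {k : Type*} [Field k] {d : ℕ} {F K : Type*} [Field F] [Field K]
    [Algebra (MvPolynomial (Fin d) k) F] [IsFractionRing (MvPolynomial (Fin d) k) F]
    [Algebra F K] [Algebra (MvPolynomial (Fin d) k) K] [IsScalarTower (MvPolynomial (Fin d) k) F K]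
    (v : Valuation F (WithZero (Multiplicative ℤ)))
    (hv : ∀ p, v (algebraMap (MvPolynomial (Fin d) k) F p) = degVal k d p) (i0 : Fin d)
    (f : K) (hf : IsIntegral (MvPolynomial (Fin d) k) f) (β : ℕ)
    (hfβ : IsIntegral v.valuationSubring (f / algebraMap (MvPolynomial (Fin d) k) K (MvPolynomial.X i0) ^ β)) :
    ((minpoly (MvPolynomial (Fin d) k) f).coeff 0).totalDegree ≤ β * (minpoly F f).natDegree := by
  set P := MvPolynomial (Fin d) k
  have hfF : IsIntegral F f := hf.tower_top
  set z : F := algebraMap P F (MvPolynomial.X i0) with hz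
  let E := IntermediateField.adjoin F {f}
  have : FiniteDimensional F E := IntermediateField.adjoin.finiteDimensional hfF
  let g : E := IntermediateField.AdjoinSimple.gen F f
  let y : E := g * algebraMap F E (z ^ β)⁻¹
  have hy : IsIntegral v.valuationSubring y := by
    have : algebraMap E K y = f / algebraMap P K (MvPolynomial.X i0) ^ β := by
      rw [IsScalarTower.algebraMap_apply P F K, ← hz]
      simp only [y, map_mul, ← IsScalarTower.algebraMap_apply F E K, map_inv₀, map_pow]
      rw [div_eq_mul_inv]; rfl
    rw [← this] at hfβ
    exact (isIntegral_algebraMap_iff (algebraMap E K).injective).mp hfβ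
  have hN := Algebra.isIntegral_norm F hy
  obtain ⟨r, hr⟩ := IsIntegrallyClosed.isIntegral_iff.mp hN
  have hle : v (Algebra.norm F y) ≤ 1 := by rw [← hr]; exact r.2
  have hg : Algebra.norm F g = (-1) ^ (minpoly F f).natDegree * algebraMap P F ((minpoly P f).coeff 0) := by
    have := Algebra.PowerBasis.norm_gen_eq_coeff_zero_minpoly (IntermediateField.adjoin.powerBasis hfF)
    rw [IntermediateField.adjoin.powerBasis_gen, IntermediateField.adjoin.powerBasis_dim,
      IntermediateField.minpoly_gen] at this
    rw [this, minpoly.isIntegrallyClosed_eq_field_fractions' F hf]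
    simp only [Polynomial.coeff_map]; rfl
  have hfin : Module.finrank F E = (minpoly F f).natDegree := IntermediateField.adjoin.finrank hfF
  rw [map_mul, Algebra.norm_algebraMap, hg, hfin] at hle
  have hvz : v z = WithZero.exp 1 := by
    rw [hz, hv, degVal_apply _ _ (MvPolynomial.X_ne_zero _)]; simp
  rw [← degVal_le, ← hv]
  simp only [map_mul, map_pow, map_inv₀, Valuation.map_neg, map_one, one_pow, one_mul, hvz] at hle
  rw [inv_pow, ← div_eq_mul_inv, div_le_one₀ (by simp [WithZero.exp_pos]), ← pow_mul, ← WithZero.exp_nsmul] at hle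
  simpa using hle

lemma exists_beta {k : Type*} [Field k] {d : ℕ} {F K : Type*} [Field F] [Field K]
    [Algebra (MvPolynomial (Fin d) k) F] [IsFractionRing (MvPolynomial (Fin d) k) F]
    [Algebra F K] [Algebra (MvPolynomial (Fin d) k) K] [IsScalarTower (MvPolynomial (Fin d) k) F K]
    (v : Valuation F (WithZero (Multiplicative ℤ)))
    (hv : ∀ p, v (algebraMap (MvPolynomial (Fin d) k) F p) = degVal k d p) (i0 : Fin d)
    (f : K) (hf : IsIntegral (MvPolynomial (Fin d) k) f) :
    ∃ β : ℕ, ∀ β' ≥ β,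
      IsIntegral v.valuationSubring (f / algebraMap (MvPolynomial (Fin d) k) K (MvPolynomial.X i0) ^ β') := by
  set P := MvPolynomial (Fin d) k
  obtain ⟨p, hp, hp0⟩ := hf
  set z : F := algebraMap P F (MvPolynomial.X i0) with hz
  have hvz : v z = WithZero.exp 1 := by
    rw [hz, hv, degVal_apply _ _ (MvPolynomial.X_ne_zero _)]; simp
  refine ⟨∑ i ∈ p.support, (p.coeff i).totalDegree, fun β hβ => ?_⟩
  let q : Polynomial F := (p.map (algebraMap P F)).scaleRoots ((z ^ β)⁻¹)
  have hq : q.Monic := (Polynomial.monic_scaleRoots_iff _).mpr (hp.map _)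
  have hcoef : ∀ n, q.coeff n ∈ v.valuationSubring := fun n => by
    rw [Valuation.mem_valuationSubring_iff]
    by_cases hn : p.natDegree ≤ n
    · rcases hn.eq_or_lt with rfl | hn
      · have : q.coeff p.natDegree = 1 := by
          have := hq.coeff_natDegree
          rwa [Polynomial.natDegree_scaleRoots, hp.natDegree_map] at this
        rw [this]; simp
      · have : q.coeff n = 0 := Polynomial.coeff_eq_zero_of_natDegree_lt (by
          rwa [Polynomial.natDegree_scaleRoots, hp.natDegree_map])
        rw [this]; simp
    · push Not at hn
      simp only [q, Polynomial.coeff_scaleRoots, Polynomial.coeff_map, hp.natDegree_map, map_mul, map_pow,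
        map_inv₀, hvz]
      have h1 : degVal k d (p.coeff n) ≤ WithZero.exp (β : ℤ) := by
        rw [degVal_le]
        by_cases hs : n ∈ p.support
        · exact (Finset.single_le_sum (f := fun i => (p.coeff i).totalDegree) (fun _ _ => Nat.zero_le _) hs).trans hβ
        · rw [Polynomial.notMem_support_iff.mp hs]; simp
      rw [inv_pow, ← div_eq_mul_inv, div_le_one₀ (by simp [WithZero.exp_pos]), ← pow_mul, ← WithZero.exp_nsmul]
      refine le_trans (hv (p.coeff n)).le (h1.trans ?_)
      rw [WithZero.exp_le_exp]
      simp only [smul_eq_mul, nsmul_eq_mul, mul_one]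
      exact_mod_cast Nat.le_mul_of_pos_right β (by omega)
  obtain ⟨q', hq'⟩ := (Polynomial.lifts_iff_coeff_lifts (f := algebraMap v.valuationSubring F) q).mpr
    (fun n => ⟨⟨_, hcoef n⟩, rfl⟩)
  have hq'' : q'.map (algebraMap v.valuationSubring F) = q := hq'
  refine ⟨q', ?_, ?_⟩
  · exact Polynomial.monic_of_injective (FaithfulSMul.algebraMap_injective v.valuationSubring F) (by rw [hq'']; exact hq)
  · rw [← Polynomial.aeval_def, ← Polynomial.aeval_map_algebraMap F, hq'']
    have h3 : f / algebraMap P K (MvPolynomial.X i0) ^ β = algebraMap F K (z ^ β)⁻¹ * f := by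
      rw [IsScalarTower.algebraMap_apply P F K, ← hz, map_inv₀, map_pow, div_eq_inv_mul]
    rw [h3]
    exact Polynomial.scaleRoots_aeval_eq_zero (by
      rw [Polynomial.aeval_map_algebraMap]; exact hp0)

lemma finF {k K : Type*} [Field k] [Field K] [Algebra k K] {κ : Type*} [Finite κ]
    (R : κ → Subalgebra k K) (hfg : ∀ j, (R j).FG)
    (hval : ∀ V : ValuationSubring K, (∀ c, algebraMap k K c ∈ V) → ∃ j, ∀ x ∈ R j, x ∈ V)
    (W : Submodule k K) (hW : ∀ j, ∃ G : Finset K, ∀ f ∈ W, f ∈ Submodule.span (R j) (G : Set K)) :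
    FiniteDimensional k W := by
  classical
  cases nonempty_fintype κ
  obtain ⟨j0, -⟩ := hval ⊤ (fun _ => trivial)
  choose G hG using hW
  let A : Finset K := Finset.univ.biUnion G
  obtain ⟨t, ht⟩ := hfg j0
  let B : Subalgebra k K := Algebra.adjoin k (↑(t ∪ A) : Set K)
  have hAB : ∀ a ∈ A, a ∈ B := fun a ha => Algebra.subset_adjoin (by simp [ha])
  have hRB : R j0 ≤ B := by
    rw [← ht]; exact Algebra.adjoin_mono (by simp)
  have hWB : ∀ f ∈ W, f ∈ B := fun f hf => by
    refine Submodule.span_induction (p := fun x _ => x ∈ B) ?_ B.zero_mem (fun _ _ _ _ => B.add_mem)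
      (fun r x _ hx => ?_) (hG j0 f hf)
    · intro a ha; exact hAB a (Finset.mem_biUnion.mpr ⟨j0, Finset.mem_univ _, ha⟩)
    · exact B.mul_mem (hRB r.2) hx
  have hBfg : B.FG := ⟨t ∪ A, rfl⟩
  have hBft : Algebra.FiniteType k B := (Subalgebra.fg_iff_finiteType B).mp hBfg
  obtain ⟨d, g, hg, hgf⟩ := exists_finite_inj_algHom_of_fg k B
  -- it is enough to embed W in a finite dimensional quotient of B
  let ι : W →ₗ[k] B := LinearMap.codRestrict (Subalgebra.toSubmodule B) W.subtype (fun x => hWB _ x.2)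
  suffices h : ∃ I : Ideal B, Module.Finite k (B ⧸ I) ∧ ∀ f (hf : f ∈ W), (⟨f, hWB f hf⟩ : B) ∈ I → f = 0 by
    obtain ⟨I, hI, h⟩ := h
    let φ : W →ₗ[k] (B ⧸ I) := (Ideal.Quotient.mkₐ k I).toLinearMap ∘ₗ ι
    refine FiniteDimensional.of_injective φ ((injective_iff_map_eq_zero φ).mpr fun a ha => ?_)
    exact Subtype.ext (h a.1 a.2 (Ideal.Quotient.eq_zero_iff_mem.mp ha))
  have hNB : IsNoetherianRing B := Algebra.FiniteType.isNoetherianRing k B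
  let P := MvPolynomial (Fin d) k
  letI algPB : Algebra P B := g.toRingHom.toAlgebra
  have hPBfin : Module.Finite P B := hgf
  have : IsScalarTower k P B := IsScalarTower.of_algebraMap_eq fun c => (g.commutes c).symm
  rcases Nat.eq_zero_or_pos d with rfl | hd
  · refine ⟨⊥, ?_, fun f hf h => ?_⟩
    · have h1 : Module.Finite k P := Module.Finite.equiv (MvPolynomial.isEmptyAlgEquiv k (Fin 0)).toLinearEquiv.symm
      have h2 : Module.Finite k B := Module.Finite.trans P B
      exact Module.Finite.of_surjective (Ideal.Quotient.mkₐ k (⊥ : Ideal B)).toLinearMap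
        (Ideal.Quotient.mkₐ_surjective k _)
    · exact congrArg Subtype.val (Ideal.mem_bot.mp h)
  letI algPK : Algebra P K := ((algebraMap B K).comp (algebraMap P B)).toAlgebra
  have : IsScalarTower P B K := IsScalarTower.of_algebraMap_eq fun c => rfl
  have : FaithfulSMul P K := (faithfulSMul_iff_algebraMap_injective P K).mpr
    (Subtype.val_injective.comp hg)
  let F := FractionRing P
  letI algFK : Algebra F K := FractionRing.liftAlgebra P K
  have : IsScalarTower P F K := FractionRing.isScalarTower_liftAlgebra P K
  let v : Valuation F (WithZero (Multiplicative ℤ)) := (degVal k d).extendToLocalization (S := nonZeroDivisors P)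
    (fun p hp => by
      have h0 : (p : P) ≠ 0 := nonZeroDivisors.ne_zero hp
      change ¬ (degVal k d p = 0)
      rw [degVal_apply _ _ h0]; exact WithZero.exp_ne_zero) F
  have hv : ∀ p, v (algebraMap P F p) = degVal k d p := fun p => Valuation.extendToLocalization_apply_map_apply ..
  let i0 : Fin d := ⟨0, hd⟩
  have h_int : ∀ b ∈ B, IsIntegral P b := fun b hb =>
    (Algebra.IsIntegral.isIntegral (R := P) (⟨b, hb⟩ : B)).map (IsScalarTower.toAlgHom P B K)
  choose! β hβ using fun a (ha : a ∈ A) => exists_beta v hv i0 a (h_int a (hAB a ha))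
  let b := ∑ a ∈ A, β a
  have hb : ∀ a ∈ A, IsIntegral v.valuationSubring (a / algebraMap P K (MvPolynomial.X i0) ^ b) := fun a ha =>
    hβ a ha b (Finset.single_le_sum (f := β) (fun _ _ => Nat.zero_le _) ha)
  let s : Set K := Set.range (algebraMap v.valuationSubring K)
  have hk : ∀ c : k, algebraMap k K c ∈ s := fun c => by
    refine ⟨⟨algebraMap P F (MvPolynomial.C c), ?_⟩, ?_⟩
    · rw [Valuation.mem_valuationSubring_iff, hv]
      have := (degVal_le k d (p := MvPolynomial.C c) (n := 0)).mpr (by simp)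
      simpa using this
    · change algebraMap F K (algebraMap P F (MvPolynomial.C c)) = _
      rw [← IsScalarTower.algebraMap_apply, IsScalarTower.algebraMap_apply P B K]
      change algebraMap B K (algebraMap P B (algebraMap k P c)) = _
      rw [← IsScalarTower.algebraMap_apply k P B]; rfl
  have hfb : ∀ f ∈ W, IsIntegral v.valuationSubring (f / algebraMap P K (MvPolynomial.X i0) ^ b) := fun f hf => by
    have hmem : f / algebraMap P K (MvPolynomial.X i0) ^ b ∈
        (⨅ V : {V : ValuationSubring K // s ⊆ V.toSubring}, V.1.toSubring) := by
      rw [Subring.mem_iInf]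
      rintro ⟨V, hV⟩
      obtain ⟨j, hj⟩ := hval V (fun c => hV (hk c))
      refine Submodule.span_induction
        (p := fun x _ => x / algebraMap P K (MvPolynomial.X i0) ^ b ∈ V.toSubring) ?_ ?_ ?_ ?_ (hG j f hf)
      · intro a ha
        have ha' : a ∈ A := Finset.mem_biUnion.mpr ⟨j, Finset.mem_univ _, ha⟩
        obtain ⟨p, hp, hp0⟩ := hb a ha'
        have hsV : ∀ x, algebraMap v.valuationSubring K x ∈ V := fun x => hV ⟨x, rfl⟩
        let θ : v.valuationSubring →+* V := (algebraMap v.valuationSubring K).codRestrict V.toSubring hsV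
        have : IsIntegral V (a / algebraMap P K (MvPolynomial.X i0) ^ b) := by
          refine ⟨p.map θ, hp.map _, ?_⟩
          rw [Polynomial.eval₂_map]; exact hp0
        obtain ⟨y, hy⟩ := IsIntegrallyClosed.isIntegral_iff.mp this
        rw [← hy]; exact y.2
      · simp
      · intro x y _ _ hx hy
        rw [add_div]; exact add_mem hx hy
      · intro r x _ hx
        rw [Algebra.smul_def, mul_div_assoc]
        exact mul_mem (hj _ r.2) hx
    rw [iInf_valuationSubring_superset] at hmem
    have hcl : Subring.closure s = (algebraMap v.valuationSubring K).range := by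
      apply le_antisymm
      · rw [Subring.closure_le]; rintro _ ⟨x, rfl⟩; exact ⟨x, rfl⟩
      · rintro _ ⟨x, rfl⟩; exact Subring.subset_closure ⟨x, rfl⟩
    obtain ⟨p, hp, hp0⟩ := hmem
    choose γ hγ using fun x : Subring.closure s => (show (x : K) ∈ (algebraMap v.valuationSubring K).range from
      hcl ▸ x.2)
    have hinj : Function.Injective (algebraMap v.valuationSubring K) :=
      (algebraMap F K).injective.comp Subtype.val_injective
    let θ : Subring.closure s →+* v.valuationSubring :=
      { toFun := γ
        map_one' := hinj (by rw [hγ]; simp)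
        map_mul' := fun x y => hinj (by rw [map_mul, hγ, hγ, hγ]; rfl)
        map_zero' := hinj (by rw [hγ]; simp)
        map_add' := fun x y => hinj (by rw [map_add, hγ, hγ, hγ]; rfl) }
    refine ⟨p.map θ, hp.map _, ?_⟩
    rw [Polynomial.eval₂_map]
    convert hp0 using 2
    ext x; exact hγ x
  -- uniform degree bound
  let E : Submodule F K := Submodule.span F (B : Set K)
  have hE : Module.Finite F E := by
    obtain ⟨S, hS⟩ := (Module.finite_def.mp hPBfin)
    refine Module.Finite.of_fg ⟨S.image (algebraMap B K), le_antisymm ?_ ?_⟩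
    · rw [Submodule.span_le]
      intro x hx
      obtain ⟨y, -, rfl⟩ := Finset.mem_image.mp hx
      exact Submodule.subset_span y.2
    · rw [Submodule.span_le]
      intro x hx
      have : (⟨x, hx⟩ : B) ∈ Submodule.span P (S : Set B) := by rw [hS]; trivial
      refine Submodule.span_induction (p := fun (y : B) _ => (y : K) ∈
        Submodule.span F (S.image (algebraMap B K) : Set K)) ?_ ?_ ?_ ?_ this
      · intro y hy; exact Submodule.subset_span (Finset.mem_image_of_mem _ hy)
      · exact Submodule.zero_mem _
      · intro y z _ _ hy hz; exact Submodule.add_mem _ hy hz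
      · intro c y _ hy
        have : ((c • y : B) : K) = algebraMap P F c • (y : K) := by
          rw [Algebra.smul_def, Algebra.smul_def, ← IsScalarTower.algebraMap_apply]
          rfl
        rw [this]; exact Submodule.smul_mem _ _ hy
  have hdeg : ∀ f ∈ B, (minpoly F f).natDegree ≤ Module.finrank F E := fun f hf => by
    have hfF : IsIntegral F f := (h_int f hf).tower_top
    rw [← IntermediateField.adjoin.finrank hfF]
    have hle : Subalgebra.toSubmodule (Algebra.adjoin F {f}) ≤ E := by
      intro x hx
      change x ∈ Algebra.adjoin F {f} at hx
      rw [Algebra.adjoin_singleton_eq_range_aeval] at hx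
      obtain ⟨p, rfl⟩ := hx
      change Polynomial.aeval f p ∈ E
      rw [Polynomial.aeval_eq_sum_range]
      exact Submodule.sum_mem _ fun i _ => Submodule.smul_mem _ _ (Submodule.subset_span (pow_mem hf i))
    have := Submodule.finrank_mono hle
    rw [← IntermediateField.adjoin_simple_toSubalgebra_of_isAlgebraic hfF.isAlgebraic] at this
    exact this
  let D : Submodule k B := (MvPolynomial.restrictTotalDegree (Fin d) k (b * Module.finrank F E)).map
    g.toLinearMap
  have hD : Module.Finite k D := Module.Finite.map _ _
  have hcD : ∀ f (hf : f ∈ W), ∃ c ∈ D, c ∈ Ideal.span {(⟨f, hWB f hf⟩ : B)} ∧ (c = 0 → f = 0) := fun f hf => by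
    have hfi := h_int f (hWB f hf)
    have h1 := coeff_bound v hv i0 f hfi b (hfb f hf)
    refine ⟨g ((minpoly P f).coeff 0), Submodule.mem_map_of_mem
      ((MvPolynomial.mem_restrictTotalDegree _ _ _).mpr (h1.trans (Nat.mul_le_mul_left _ (hdeg f (hWB f hf))))),
      ?_, ?_⟩
    · have h2 : Polynomial.aeval (⟨f, hWB f hf⟩ : B) (minpoly P f) = 0 := by
        apply Subtype.val_injective
        have := Polynomial.aeval_algebraMap_apply K (⟨f, hWB f hf⟩ : B) (minpoly P f)
        have h3 := minpoly.aeval P f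
        change Polynomial.aeval (algebraMap B K ⟨f, hWB f hf⟩) (minpoly P f) = 0 at h3
        rw [h3] at this
        exact this.symm
      rw [← Polynomial.divX_mul_X_add (minpoly P f), map_add, map_mul, Polynomial.aeval_X, Polynomial.aeval_C] at h2
      rw [Ideal.mem_span_singleton]
      refine ⟨-Polynomial.aeval (⟨f, hWB f hf⟩ : B) (minpoly P f).divX, ?_⟩
      have : algebraMap P B ((minpoly P f).coeff 0) = g ((minpoly P f).coeff 0) := rfl
      rw [← this]
      linear_combination h2
    · intro h0
      have h4 : (minpoly P f).coeff 0 = 0 := hg (h0.trans (map_zero g).symm)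
      have h5 : (minpoly F f).coeff 0 = 0 := by
        rw [minpoly.isIntegrallyClosed_eq_field_fractions' F hfi, Polynomial.coeff_map]
        exact (congrArg _ h4).trans (map_zero _)
      exact (minpoly.coeff_zero_eq_zero hfi.tower_top).mp h5
  obtain ⟨m, hm⟩ := Ideal.exists_maximal B
  have hKr : ⨅ n, m ^ n = ⊥ := Ideal.iInf_pow_eq_bot_of_isDomain m hm.ne_top
  -- stabilisation
  let Dn : ℕ → Submodule k D := fun n => ((m ^ n).restrictScalars k).comap D.subtype
  have hanti : Antitone Dn := fun a c h x hx => Ideal.pow_le_pow_right h hx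
  obtain ⟨n, hn⟩ := IsArtinian.monotone_stabilizes (R := k) (M := D)
    ⟨fun n => OrderDual.toDual (Dn n), fun a c h => hanti h⟩
  have hDn : ∀ x ∈ D, x ∈ m ^ n → x = 0 := fun x hx hxn => by
    have : x ∈ (⨅ n, m ^ n : Ideal B) := by
      rw [Ideal.mem_iInf]
      intro r
      rcases le_total n r with h | h
      · have h1 : Dn n = Dn r := hn r h
        have h2 : (⟨x, hx⟩ : D) ∈ Dn n := hxn
        rw [h1] at h2; exact h2
      · exact Ideal.pow_le_pow_right h hxn
    rw [hKr] at this; exact this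
  refine ⟨m ^ n, ?_, fun f hf hfm => ?_⟩
  · have : Algebra.FiniteType k (B ⧸ m ^ n) := inferInstance
    rw [Module.finite_iff_isArtinianRing, isArtinianRing_iff_isNoetherianRing_krullDimLE_zero]
    refine ⟨inferInstance, ?_⟩
    refine Ring.krullDimLE_zero_iff.mpr fun I hI => ?_
    have h1 : m ^ n ≤ I.comap (Ideal.Quotient.mk (m ^ n)) := fun x hx => by
      rw [Ideal.mem_comap, Ideal.Quotient.eq_zero_iff_mem.mpr hx]; exact I.zero_mem
    have h2 : m ≤ I.comap (Ideal.Quotient.mk (m ^ n)) := by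
      rcases Nat.eq_zero_or_pos n with rfl | hn0
      · exact absurd (top_le_iff.mp (by simpa using h1)) (Ideal.IsPrime.ne_top inferInstance)
      · exact Ideal.IsPrime.le_of_pow_le h1
    have h3 : m = I.comap (Ideal.Quotient.mk (m ^ n)) :=
      hm.eq_of_le (Ideal.IsPrime.ne_top inferInstance) h2
    have h4 := hm
    rw [h3] at h4
    have h5 := Ideal.map_eq_top_or_isMaximal_of_surjective (Ideal.Quotient.mk (m ^ n))
      Ideal.Quotient.mk_surjective h4
    rw [Ideal.map_comap_of_surjective _ Ideal.Quotient.mk_surjective] at h5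
    exact h5.resolve_left hI.ne_top
  · obtain ⟨c, hcD, hc, h0⟩ := hcD f hf
    refine h0 (hDn c hcD ?_)
    exact (Ideal.span_singleton_le_iff_mem _).mpr hfm hc
end

section
open TensorProduct

lemma le_pre_top {X Y : Scheme.{u}} {f : Y ⟶ X} {U : Y.Opens} : U ≤ f ⁻¹ᵁ ⊤ := fun _ _ => trivial

section Sct
variable {k : Type u} [Field k]

/-- structure map on sections -/
def kal {X : Scheme.{u}} (s : X ⟶ Spk k) (U : X.Opens) : k →+* Γ(X, U) :=
  (pl s (U := ⊤) (V := U) le_pre_top).comp (Scheme.ΓSpecIso (CommRingCat.of k)).inv.hom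

lemma rs_kal {X : Scheme.{u}} (s : X ⟶ Spk k) {U V : X.Opens} (h : V ≤ U) (c : k) :
    rs h (kal s U c) = kal s V c := by
  simp only [kal, RingHom.comp_apply]
  rw [rs_pl]

lemma pl_kal {X Y : Scheme.{u}} {s : X ⟶ Spk k} {s' : Y ⟶ Spk k}
    {f : Y ⟶ X} (e : f ≫ s = s') {U : X.Opens} {V : Y.Opens} (h : V ≤ f ⁻¹ᵁ U) (c : k) :
    pl f h (kal s U c) = kal s' V c := by
  simp only [kal, RingHom.comp_apply]
  rw [pl_comp e]

/-- Sections as `k`-algebra. -/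
def Sct {X : Scheme.{u}} (_s : X ⟶ Spk k) (U : X.Opens) : Type u := Γ(X, U)

variable {X T Q : Scheme.{u}}

instance (s : X ⟶ Spk k) (U : X.Opens) : CommRing (Sct s U) :=
  inferInstanceAs (CommRing Γ(X, U))

def toS (s : X ⟶ Spk k) (U : X.Opens) : Γ(X, U) ≃+* Sct s U := RingEquiv.refl Γ(X, U)

instance (s : X ⟶ Spk k) (U : X.Opens) : Algebra k (Sct s U) :=
  RingHom.toAlgebra (S := Sct s U) ((toS s U).toRingHom.comp (kal s U))

variable {sX : X ⟶ Spk k} {sT : T ⟶ Spk k}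

lemma algebraMap_Sct {U : X.Opens} (c : k) : algebraMap k (Sct sX U) c = toS sX U (kal sX U c) :=
  rfl

lemma smul_toS {U : X.Opens} (c : k) (a : Γ(X, U)) : c • toS sX U a = toS sX U (kal sX U c * a) := by
  rw [Algebra.smul_def, algebraMap_Sct, map_mul]

lemma symm_smul_toS {U : X.Opens} (c : k) (a : Sct sX U) :
    (toS sX U).symm (c • a) = kal sX U c * (toS sX U).symm a := by
  rw [Algebra.smul_def, algebraMap_Sct, map_mul, RingEquiv.symm_apply_apply]

/-- linear restriction -/
def rsL (sX : X ⟶ Spk k) {U V : X.Opens} (h : V ≤ U) : Sct sX U →ₐ[k] Sct sX V where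
  __ := (toS sX V).toRingHom.comp ((rs h).comp (toS sX U).symm.toRingHom)
  commutes' c := congrArg (toS sX V) (rs_kal sX h c)

@[simp] lemma symm_rsL {U V : X.Opens} (h : V ≤ U) (a : Sct sX U) :
    (toS sX V).symm (rsL sX h a) = rs h ((toS sX U).symm a) := rfl

/-- linear pullback -/
def plL {f : T ⟶ X} (e : f ≫ sX = sT) {U : X.Opens} {V : T.Opens} (h : V ≤ f ⁻¹ᵁ U) : Sct sX U →ₐ[k] Sct sT V where
  __ := (toS sT V).toRingHom.comp ((pl f h).comp (toS sX U).symm.toRingHom)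
  commutes' c := congrArg (toS sT V) (pl_kal e h c)

/-- quasi-compact and quasi-separated opens -/
def QQ (U : X.Opens) : Prop := IsCompact (U : Set X) ∧ IsQuasiSeparated (U : Set X)

lemma QQ.affine {U : X.Opens} (h : IsAffineOpen U) : QQ U := ⟨h.isCompact, h.isQuasiSeparated⟩

variable {p : Q ⟶ X} {q : Q ⟶ T} (H : IsPullback p q sX sT)

lemma hWl {U : X.Opens} {O : T.Opens} {W : Q.Opens} (hW : W = p ⁻¹ᵁ U ⊓ q ⁻¹ᵁ O) : W ≤ p ⁻¹ᵁ U :=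
  hW.le.trans inf_le_left
lemma hWr {U : X.Opens} {O : T.Opens} {W : Q.Opens} (hW : W = p ⁻¹ᵁ U ⊓ q ⁻¹ᵁ O) : W ≤ q ⁻¹ᵁ O :=
  hW.le.trans inf_le_right

include H

lemma pushout_sct {U : X.Opens} {O : T.Opens} {W : Q.Opens} (hU : QQ U) (hO : IsAffineOpen O)
    (hW : W = p ⁻¹ᵁ U ⊓ q ⁻¹ᵁ O) :
    IsPushout (CommRingCat.ofHom (algebraMap k (Sct sX U))) (CommRingCat.ofHom (algebraMap k (Sct sT O)))
      (CommRingCat.ofHom ((pl p (hWl hW)).comp (toS sX U).symm.toRingHom))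
      (CommRingCat.ofHom ((pl q (hWr hW)).comp (toS sT O).symm.toRingHom)) := by
  have hflat : Flat sT := inferInstance
  have h1 := (isIso_pushoutSection_iff H (US := ⊤) (UT := O) (UX := U) le_pre_top le_pre_top hW).mp
    (isIso_pushoutSection_of_isQuasiSeparated_of_flat_right H le_pre_top le_pre_top hW (isAffineOpen_top _) hO hU.1 hU.2)
  refine h1.of_iso (Scheme.ΓSpecIso (CommRingCat.of k)) (toS sX U).toCommRingCatIso (toS sT O).toCommRingCatIso (Iso.refl _)
    ?_ ?_ ?_ ?_
  · ext a
    change toS sX U _ = toS sX U (pl _ _ _)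
    refine congrArg _ ?_
    change _ = pl sX le_pre_top ((Scheme.ΓSpecIso (CommRingCat.of k)).inv.hom ((Scheme.ΓSpecIso (CommRingCat.of k)).hom.hom a))
    rw [← CommRingCat.comp_apply, Iso.hom_inv_id]; rfl
  · ext a
    change toS sT O _ = toS sT O (pl _ _ _)
    refine congrArg _ ?_
    change _ = pl sT le_pre_top ((Scheme.ΓSpecIso (CommRingCat.of k)).inv.hom ((Scheme.ΓSpecIso (CommRingCat.of k)).hom.hom a))
    rw [← CommRingCat.comp_apply, Iso.hom_inv_id]; rfl
  · ext a; rfl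
  · ext a; rfl

lemma exists_gam {U : X.Opens} {O : T.Opens} {W : Q.Opens} (hU : QQ U) (hO : IsAffineOpen O)
    (hW : W = p ⁻¹ᵁ U ⊓ q ⁻¹ᵁ O) : ∃ e : Sct sX U ⊗[k] Sct sT O ≃+* Γ(Q, W),
      ∀ a c, e (toS sX U a ⊗ₜ toS sT O c) = pl p (hWl hW) a * pl q (hWr hW) c := by
  have h2 := CommRingCat.isPushout_tensorProduct k (Sct sX U) (Sct sT O)
  have h1 := pushout_sct H hU hO hW
  let i := h2.isoIsPushout _ _ h1
  refine ⟨i.commRingCatIsoToRingEquiv, fun a c => ?_⟩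
  have e : toS sX U a ⊗ₜ[k] toS sT O c = (toS sX U a ⊗ₜ[k] 1) * (1 ⊗ₜ toS sT O c) := by simp
  rw [e, map_mul]
  congr 1
  · have := IsPushout.inl_isoIsPushout_hom _ _ h2 h1
    exact congrArg (fun f => f.hom (toS sX U a)) this
  · have := IsPushout.inr_isoIsPushout_hom _ _ h2 h1
    exact congrArg (fun f => f.hom (toS sT O c)) this

/-- The Künneth isomorphism. -/
def gam {U : X.Opens} {O : T.Opens} {W : Q.Opens} (hU : QQ U) (hO : IsAffineOpen O)
    (hW : W = p ⁻¹ᵁ U ⊓ q ⁻¹ᵁ O) : Sct sX U ⊗[k] Sct sT O ≃+* Γ(Q, W) := (exists_gam H hU hO hW).choose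

lemma gam_tmul {U : X.Opens} {O : T.Opens} {W : Q.Opens} (hU : QQ U) (hO : IsAffineOpen O)
    (hW : W = p ⁻¹ᵁ U ⊓ q ⁻¹ᵁ O) (a : Γ(X, U)) (c : Γ(T, O)) :
    gam H hU hO hW (toS sX U a ⊗ₜ toS sT O c) = pl p (hWl hW) a * pl q (hWr hW) c :=
  (exists_gam H hU hO hW).choose_spec a c

lemma bx_induction {U : X.Opens} {O : T.Opens} {W : Q.Opens} (hU : QQ U) (hO : IsAffineOpen O)
    (hW : W = p ⁻¹ᵁ U ⊓ q ⁻¹ᵁ O) {P : Γ(Q, W) → Prop} (hadd : ∀ u v, P u → P v → P (u + v))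
    (hm : ∀ a c, P (pl p (hWl hW) a * pl q (hWr hW) c)) (u : Γ(Q, W)) : P u := by
  obtain ⟨t, rfl⟩ := (gam H hU hO hW).surjective u
  induction t with
  | zero =>
    have := hm 0 0
    rwa [map_zero, zero_mul, ← map_zero (gam H hU hO hW)] at this
  | tmul a c => rw [← (toS sX U).apply_symm_apply a, ← (toS sT O).apply_symm_apply c, gam_tmul]; exact hm _ _
  | add x y hx hy => rw [map_add]; exact hadd _ _ hx hy

lemma bx_expand {U : X.Opens} {O : T.Opens} {W : Q.Opens} (hU : QQ U) (hO : IsAffineOpen O)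
    (hW : W = p ⁻¹ᵁ U ⊓ q ⁻¹ᵁ O) (u : Γ(Q, W)) : ∃ (n : ℕ) (a : Fin n → Γ(X, U)) (c : Fin n → Γ(T, O)),
      u = ∑ i, pl p (hWl hW) (a i) * pl q (hWr hW) (c i) := by
  refine bx_induction H hU hO hW (P := fun u => ∃ (n : ℕ) (a : Fin n → Γ(X, U)) (c : Fin n → Γ(T, O)),
      u = ∑ i, pl p (hWl hW) (a i) * pl q (hWr hW) (c i)) ?_ (fun a c => ⟨1, fun _ => a, fun _ => c, by simp⟩) u
  rintro _ _ ⟨n, a, c, rfl⟩ ⟨n', a', c', rfl⟩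
  exact ⟨n + n', Fin.append a a', Fin.append c c', by simp [Fin.sum_univ_add]⟩

/-- slices -/
def slice {U : X.Opens} {O : T.Opens} {W : Q.Opens} (hU : QQ U) (hO : IsAffineOpen O)
    (hW : W = p ⁻¹ᵁ U ⊓ q ⁻¹ᵁ O) (l : Sct sX U →ₗ[k] k) : Γ(Q, W) →+ Γ(T, O) :=
  ((toS sT O).symm.toRingHom.toAddMonoidHom.comp
    ((TensorProduct.lid k _).toLinearMap ∘ₗ l.rTensor (Sct sT O)).toAddMonoidHom).comp
    (gam H hU hO hW).symm.toRingHom.toAddMonoidHom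

section
variable {U : X.Opens} {O : T.Opens} {W : Q.Opens} (hU : QQ U) (hO : IsAffineOpen O)
    (hW : W = p ⁻¹ᵁ U ⊓ q ⁻¹ᵁ O)

lemma slice_mk (l : Sct sX U →ₗ[k] k) (a : Γ(X, U)) (c : Γ(T, O)) :
    slice H hU hO hW l (pl p (hWl hW) a * pl q (hWr hW) c) = kal sT O (l (toS sX U a)) * c := by
  rw [← gam_tmul H hU hO hW]
  change (toS sT O).symm (TensorProduct.lid k _ (l.rTensor _ ((gam H hU hO hW).symm (gam H hU hO hW _)))) = _
  rw [RingEquiv.symm_apply_apply, LinearMap.rTensor_tmul, TensorProduct.lid_tmul, symm_smul_toS,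
    RingEquiv.symm_apply_apply]

lemma slice_mul (l : Sct sX U →ₗ[k] k) (c : Γ(T, O)) (u : Γ(Q, W)) :
    slice H hU hO hW l (pl q (hWr hW) c * u) = c * slice H hU hO hW l u := by
  refine bx_induction H hU hO hW (P := fun u => slice H hU hO hW l (pl q (hWr hW) c * u) = c * slice H hU hO hW l u)
    (fun u v hu hv => by rw [mul_add, map_add, map_add, mul_add, hu, hv]) (fun a d => ?_) u
  rw [mul_left_comm, ← map_mul, slice_mk, slice_mk]; ring

lemma rs_slice {U' : X.Opens} {O' : T.Opens} {W' : Q.Opens} (hU' : QQ U') (hO' : IsAffineOpen O')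
    (hW' : W' = p ⁻¹ᵁ U' ⊓ q ⁻¹ᵁ O') (hUU : U' ≤ U) (hOO : O' ≤ O) (hWW : W' ≤ W)
    (l : Sct sX U' →ₗ[k] k) (u : Γ(Q, W)) :
    rs hOO (slice H hU hO hW (l ∘ₗ (rsL sX hUU).toLinearMap) u) = slice H hU' hO' hW' l (rs hWW u) := by
  refine bx_induction H hU hO hW (P := fun u => rs hOO (slice H hU hO hW (l ∘ₗ (rsL sX hUU).toLinearMap) u) =
      slice H hU' hO' hW' l (rs hWW u)) (fun u v hu hv => ?_) (fun a c => ?_) u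
  · simp only [map_add, hu, hv]
  · rw [slice_mk, map_mul, map_mul, rs_kal, rs_pl, rs_pl, ← pl_rs p hUU (hWl hW'), ← pl_rs q hOO (hWr hW'), slice_mk]
    rfl

lemma slice_rs {U' : X.Opens} {W' : Q.Opens} (hU' : QQ U')
    (hW' : W' = p ⁻¹ᵁ U' ⊓ q ⁻¹ᵁ O) (hUU : U' ≤ U) (hWW : W' ≤ W)
    (l : Sct sX U' →ₗ[k] k) (u : Γ(Q, W)) :
    slice H hU' hO hW' l (rs hWW u) = slice H hU hO hW (l ∘ₗ (rsL sX hUU).toLinearMap) u := by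
  rw [← rs_slice H hU hO hW hU' hO hW' hUU le_rfl hWW, rs_self]

lemma pl_slice {T' Q' : Scheme.{u}} {sT' : T' ⟶ Spk k} {p' : Q' ⟶ X} {q' : Q' ⟶ T'}
    (H' : IsPullback p' q' sX sT') {h : T' ⟶ T} {h' : Q' ⟶ Q} (eh : h ≫ sT = sT') (e1 : h' ≫ p = p')
    (e2 : h' ≫ q = q' ≫ h)
    {O' : T'.Opens} {W' : Q'.Opens} (hO' : IsAffineOpen O')
    (hW' : W' = p' ⁻¹ᵁ U ⊓ q' ⁻¹ᵁ O') (hOO : O' ≤ h ⁻¹ᵁ O) (hWW : W' ≤ h' ⁻¹ᵁ W)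
    (l : Sct sX U →ₗ[k] k) (u : Γ(Q, W)) :
    pl h hOO (slice H hU hO hW l u) = slice H' hU hO' hW' l (pl h' hWW u) := by
  refine bx_induction H hU hO hW (P := fun u => pl h hOO (slice H hU hO hW l u) =
      slice H' hU hO' hW' l (pl h' hWW u)) (fun u v hu hv => ?_) (fun a c => ?_) u
  · simp only [map_add, hu, hv]
  · rw [slice_mk, map_mul, map_mul, pl_kal eh, pl_comp e1 _ _ (hWl hW'), pl_comp e2 _ _ (le_pre_pre hOO (hWr hW')),
      ← pl_pl h q' hOO (hWr hW'), slice_mk]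

end

/-- the fundamental linear algebra lemma for slices -/
lemma slice_mem {κ : Type*} [Fintype κ] {U : κ → X.Opens} {O : T.Opens} {W : κ → Q.Opens} (hU : ∀ i, QQ (U i))
    (hO : IsAffineOpen O) (hW : ∀ i, W i = p ⁻¹ᵁ (U i) ⊓ q ⁻¹ᵁ O)
    (D : Submodule k (∀ i, Sct sX (U i))) (u : ∀ i, Γ(Q, W i))
    (h : ∀ l : ∀ i, Sct sX (U i) →ₗ[k] k, (∀ d ∈ D, ∑ i, l i (d i) = 0) →
      ∑ i, slice H (hU i) hO (hW i) (l i) (u i) = 0) :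
    ∃ (n : ℕ) (d : Fin n → D) (c : Fin n → Γ(T, O)), ∀ i,
      u i = ∑ m, pl p (hWl (hW i)) ((toS sX (U i)).symm ((d m).1 i)) * pl q (hWr (hW i)) (c m) := by
  classical
  let B := Module.Free.chooseBasis k (Sct sT O)
  let co : ∀ i, _ →₀ Sct sX (U i) := fun i => TensorProduct.equivFinsuppOfBasisRight B ((gam H (hU i) hO (hW i)).symm (u i))
  have hco : ∀ i, u i = (co i).sum fun m r => pl p (hWl (hW i)) ((toS sX (U i)).symm r) * pl q (hWr (hW i)) ((toS sT O).symm (B m)) := fun i => by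
    apply (gam H (hU i) hO (hW i)).symm.injective
    have h1 := (TensorProduct.equivFinsuppOfBasisRight (M := Sct sX (U i)) B).symm_apply_apply ((gam H (hU i) hO (hW i)).symm (u i))
    rw [← h1, TensorProduct.equivFinsuppOfBasisRight_symm_apply]
    apply (gam H (hU i) hO (hW i)).injective
    rw [RingEquiv.apply_symm_apply, Finsupp.sum, map_sum]
    refine sum_congr rfl fun m _ => ?_
    change _ = pl p _ _ * pl q _ _
    rw [← gam_tmul H (hU i) hO (hW i), RingEquiv.apply_symm_apply, RingEquiv.apply_symm_apply]
  let S := Finset.univ.biUnion fun i => (co i).support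
  have hco' : ∀ i, u i = ∑ m ∈ S, pl p (hWl (hW i)) ((toS sX (U i)).symm (co i m)) * pl q (hWr (hW i)) ((toS sT O).symm (B m)) := fun i => by
    rw [hco i]
    exact Finsupp.sum_of_support_subset _ (Finset.subset_biUnion_of_mem (fun i => (co i).support) (Finset.mem_univ i)) _ (by simp)
  have hD : ∀ m, (fun i => co i m) ∈ D := fun m => by
    by_contra hm
    obtain ⟨f, hf, hf'⟩ := Submodule.exists_le_ker_of_notMem hm
    let l : ∀ i, Sct sX (U i) →ₗ[k] k := fun i => f ∘ₗ LinearMap.single k (fun i => Sct sX (U i)) i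
    have hl : ∀ d : ∀ i, Sct sX (U i), ∑ i, l i (d i) = f d := fun d => by
      change ∑ i, f (LinearMap.single k (fun i => Sct sX (U i)) i (d i)) = _
      rw [← map_sum]
      congr 1
      ext i
      simp [Finset.sum_apply]
    have h1 := h l (fun d hd => by rw [hl]; exact hf' hd)
    have h2 : ∑ m ∈ S, (f fun i => co i m) • B m = 0 := by
      apply (toS sT O).symm.injective
      rw [map_zero, ← h1, map_sum]
      simp_rw [hco' , map_sum, slice_mk, RingEquiv.apply_symm_apply]
      rw [Finset.sum_comm]
      refine sum_congr rfl fun m _ => ?_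
      rw [← Finset.sum_mul, ← map_sum, hl, symm_smul_toS]
    have h3 := linearIndependent_iff'.mp B.linearIndependent S _ h2
    by_cases hmS : m ∈ S
    · exact hf (h3 m hmS)
    · apply hm
      have : (fun i => co i m) = 0 := by
        ext i
        by_contra h0
        exact hmS (Finset.mem_biUnion.mpr ⟨i, Finset.mem_univ _, Finsupp.mem_support_iff.mpr h0⟩)
      rw [this]; exact D.zero_mem
  refine ⟨S.card, fun m => ⟨_, hD (S.equivFin.symm m)⟩, fun m => (toS sT O).symm (B (S.equivFin.symm m)), fun i => ?_⟩
  rw [hco' i, ← Finset.sum_coe_sort]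
  exact (S.equivFin.symm.sum_comp _).symm

end Sct
end

section
/-- functions on `Q` come from the base `T` -/
structure IsRig {Q T : Scheme.{u}} (q : Q ⟶ T) (σ : T ⟶ Q) : Prop where
  sec : σ ≫ q = 𝟙 T
  eq : ∀ (O : T.Opens) (h : O ≤ σ ⁻¹ᵁ (q ⁻¹ᵁ O)) (u : Γ(Q, q ⁻¹ᵁ O)), u = pl q le_rfl (pl σ h u)

lemma le_sec {Q T : Scheme.{u}} {q : Q ⟶ T} {σ : T ⟶ Q} (e : σ ≫ q = 𝟙 T) (O : T.Opens) :
    O ≤ σ ⁻¹ᵁ (q ⁻¹ᵁ O) := by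
  intro x hx
  change (σ ≫ q) x ∈ O
  rw [e]; exact hx

lemma IsRig.comp {Q T T' : Scheme.{u}} {q : Q ⟶ T} {σ : T ⟶ Q} {q' : T ⟶ T'} {σ' : T' ⟶ T}
    (R : IsRig q σ) (R' : IsRig q' σ') : IsRig (q ≫ q') (σ' ≫ σ) := by
  refine ⟨by rw [assoc, ← assoc σ, R.sec, id_comp, R'.sec], fun O h u => ?_⟩
  change Γ(Q, q ⁻¹ᵁ (q' ⁻¹ᵁ O)) at u
  have h1 := R.eq (q' ⁻¹ᵁ O) (le_sec R.sec _) u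
  have h2 := R'.eq O (le_sec R'.sec _) (pl σ (le_sec R.sec _) u)
  have h3 : pl σ' (le_sec R'.sec _) (pl σ (le_sec R.sec _) u) = pl (σ' ≫ σ) h u := pl_pl ..
  have h4 : ∀ w, pl q (le_rfl : q ⁻¹ᵁ (q' ⁻¹ᵁ O) ≤ _) (pl q' (le_rfl : q' ⁻¹ᵁ O ≤ _) w) =
    pl (q ≫ q') (le_rfl : (q ≫ q') ⁻¹ᵁ O ≤ _) w := fun w => pl_pl ..
  have h5 := (h1.trans (congrArg (pl q le_rfl) h2)).trans (h4 _)
  exact h5.trans (congrArg (pl (q ≫ q') le_rfl) h3)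

section proper
variable {k : Type u} [Field k] {X T Q : Scheme.{u}}
  {sX : X ⟶ Spk k} {sT : T ⟶ Spk k}

lemma kal_surj [IsIntegral X] [IsProper sX] (x : Spk k ⟶ X)
    (hx : x ≫ sX = 𝟙 _) (a : Γ(X, ⊤)) : ∃ c, a = kal sX ⊤ c := by
  have hf : IsField Γ(X, ⊤) := isField_of_universallyClosed (K := k) sX
  let _ : Field Γ(X, ⊤) := hf.toField
  let v : Γ(X, ⊤) →+* k := (Scheme.ΓSpecIso (CommRingCat.of k)).hom.hom.comp (pl x (le_pre_top (U := ⊤)))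
  refine ⟨v a, v.injective ?_⟩
  change _ = (Scheme.ΓSpecIso (CommRingCat.of k)).hom.hom (pl x _ (kal sX ⊤ (v a)))
  rw [pl_kal hx]
  change _ = (Scheme.ΓSpecIso (CommRingCat.of k)).hom.hom (pl (𝟙 _) _ ((Scheme.ΓSpecIso (CommRingCat.of k)).inv.hom (v a)))
  rw [pl_id, rs_self, ← CommRingCat.comp_apply, Iso.inv_hom_id]; rfl

lemma QQ.top [CompactSpace X] [QuasiSeparatedSpace X] : QQ (⊤ : X.Opens) :=
  ⟨isCompact_univ, isQuasiSeparated_univ_iff.mpr inferInstance⟩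

lemma isRig_of_proper [IsIntegral X] [IsProper sX] (x : Spk k ⟶ X)
    (hx : x ≫ sX = 𝟙 _) {p : Q ⟶ X} {q : Q ⟶ T} (H : IsPullback p q sX sT) {σ : T ⟶ Q}
    (hσ : σ ≫ q = 𝟙 T) : IsRig q σ := by
  have : CompactSpace X := QuasiCompact.compactSpace_of_compactSpace sX
  have : QuasiSeparatedSpace X := quasiSeparatedSpace_of_quasiSeparated sX
  refine ⟨hσ, fun O h u => ?_⟩
  refine rs_ext (fun V : {V : T.Opens // IsAffineOpen V ∧ V ≤ O} => q ⁻¹ᵁ V.1)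
    (fun V => le_pre_mono le_rfl V.2.2) (fun y hy => ?_) (fun V => ?_)
  · obtain ⟨V, hV, hyV, hVO⟩ := exists_isAffineOpen_mem_and_subset (U := O) (x := q y) hy
    exact ⟨⟨V, hV, hVO⟩, hyV⟩
  · rw [rs_pl]
    have key : ∀ w : Γ(Q, q ⁻¹ᵁ V.1), ∃ c : Γ(T, V.1), w = pl q le_rfl c := by
      refine bx_induction H QQ.top V.2.1 (W := q ⁻¹ᵁ V.1) (by simp) ?_ ?_
      · rintro _ _ ⟨a, rfl⟩ ⟨b, rfl⟩
        exact ⟨a + b, (map_add _ _ _).symm⟩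
      · intro a c
        obtain ⟨a, rfl⟩ := kal_surj x hx a
        refine ⟨kal sT V.1 a * c, ?_⟩
        rw [map_mul, pl_kal rfl, pl_kal rfl, H.w]
    obtain ⟨c, hc⟩ := key (rs (le_pre_mono le_rfl V.2.2) u)
    have h3 : pl σ (le_sec hσ V.1) (rs (le_pre_mono le_rfl V.2.2) u) = c := by
      rw [hc, pl_comp hσ _ _ (show V.1 ≤ (𝟙 T) ⁻¹ᵁ V.1 from le_rfl), pl_id, rs_self]
    rw [hc, ← h3, pl_rs, ← pl_rs q V.2.2 le_rfl, rs_pl]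

end proper

section triv
variable {S T Q : Scheme.{u}} (N : LB S) (f : Q ⟶ S) (q : Q ⟶ T)

/-- triviality over an open of the base -/
def TrivOver (O : T.Opens) : Prop := ∃ h : Sec N f (q ⁻¹ᵁ O), h.IsGen

variable {N f q}

lemma TrivOver.mono {O O' : T.Opens} (h : TrivOver N f q O) (hO : O' ≤ O) : TrivOver N f q O' :=
  h.imp' (fun σ => σ.res (le_pre_mono le_rfl hO)) (fun _ hσ => hσ.res _)

variable {σ : T ⟶ Q} (R : IsRig q σ) {r : Sec N (σ ≫ f) ⊤} (hr : r.IsGen)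
include R

lemma norm_unique {O : T.Opens} {h h' : Sec N f (q ⁻¹ᵁ O)} (hg : h'.IsGen)
    (e : h.pull σ rfl (le_sec R.sec O) = h'.pull σ rfl (le_sec R.sec O)) : h = h' := by
  obtain ⟨c, rfl⟩ := hg.exists_smul h
  rw [Sec.pull_smul] at e
  have e1 := (hg.pull σ rfl (le_sec R.sec O)).smul_inj (e.trans (one_smul _ _).symm)
  rw [R.eq O (le_sec R.sec O) c, e1, map_one, one_smul]

include hr
lemma norm_exists {O : T.Opens} (h : TrivOver N f q O) : ∃ h : Sec N f (q ⁻¹ᵁ O), h.IsGen ∧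
    h.pull σ rfl (le_sec R.sec O) = r.res le_top := by
  obtain ⟨h, hg⟩ := h
  obtain ⟨c, hc⟩ := (hg.pull σ rfl (le_sec R.sec O)).exists_smul (r.res le_top)
  have hu : IsUnit c := (hg.pull σ rfl (le_sec R.sec O)).isUnit (hc ▸ hr.res le_top)
  refine ⟨pl q le_rfl c • h, hg.smul (hu.map _), ?_⟩
  rw [Sec.pull_smul, hc, pl_comp R.sec _ _ (show O ≤ (𝟙 T) ⁻¹ᵁ O from le_rfl), pl_id, rs_self]

lemma triv_local {V : T.Opens} {κ : Type*} (O : κ → T.Opens) (hO : ∀ c, O c ≤ V)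
    (hc : ∀ x ∈ V, ∃ c, x ∈ O c) (h : ∀ c, TrivOver N f q (O c)) : TrivOver N f q V := by
  choose h hg hn using fun c => norm_exists R hr (h c)
  obtain ⟨s, hs⟩ := Sec.glue_res (fun c => q ⁻¹ᵁ (O c)) (fun c => le_pre_mono le_rfl (hO c))
    (fun x hx => hc (q x) hx) h (fun c d => by
      suffices key : (h c).res (le_pre_mono le_rfl inf_le_left : q ⁻¹ᵁ (O c ⊓ O d) ≤ q ⁻¹ᵁ (O c)) =
          (h d).res (le_pre_mono le_rfl inf_le_right) from key
      refine norm_unique R (O := O c ⊓ O d) ((hg d).res _) ?_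
      have e1 := congrArg (Sec.res (inf_le_left : O c ⊓ O d ≤ O c)) (hn c)
      have e2 := congrArg (Sec.res (inf_le_right : O c ⊓ O d ≤ O d)) (hn d)
      rw [Sec.res_pull, Sec.res_res] at e1 e2
      rw [Sec.pull_res, Sec.pull_res, e1, e2])
  exact ⟨s, Sec.isGen_cover (fun c => q ⁻¹ᵁ (O c)) (fun c => le_pre_mono le_rfl (hO c))
    (fun x hx => hc (q x) hx) (fun c => by rw [hs]; exact hg c)⟩

end triv
end

section
section geoF
variable {k : Type u} [Field k]

/-- sections over the whole spectrum -/
def sp {A : Type u} [CommRing A] : A ≃+* Γ(Spec (CommRingCat.of A), ⊤) :=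
  (Scheme.ΓSpecIso (CommRingCat.of A)).symm.commRingCatIsoToRingEquiv

lemma pl_sp {A B : Type u} [CommRing A] [CommRing B] (φ : A →+* B)
    (h : ⊤ ≤ (Spec.map (CommRingCat.ofHom φ)) ⁻¹ᵁ ⊤) (a : A) :
    pl (Spec.map (CommRingCat.ofHom φ)) h (sp a) = sp (φ a) := by
  have := Scheme.ΓSpecIso_inv_naturality (CommRingCat.ofHom φ)
  have h2 := congrArg (fun f => f.hom a) this
  refine Eq.trans ?_ h2.symm
  change ((Spec.map (CommRingCat.ofHom φ)).appLE ⊤ ⊤ h).hom _ = ((Spec.map (CommRingCat.ofHom φ)).appTop).hom _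
  rw [Scheme.Hom.appTop, ← Scheme.Hom.appLE_eq_app]
  rfl

lemma kal_sp {X : Scheme.{u}} (s : X ⟶ Spk k) (U : X.Opens) (c : k) :
    kal s U c = pl s le_pre_top (sp c) := rfl

lemma finiteType_Sct {X : Scheme.{u}} (sX : X ⟶ Spk k) [LocallyOfFiniteType sX] {U : X.Opens}
    (hU : IsAffineOpen U) : Algebra.FiniteType k (Sct sX U) := by
  have h1 : ((sX.appLE ⊤ U le_pre_top).hom).FiniteType :=
    LocallyOfFiniteType.finiteType_appLE sX (isAffineOpen_top _) hU le_pre_top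
  have h2 : ((pl sX (le_pre_top (U := U))).comp (sp (A := k)).toRingHom).FiniteType :=
    h1.comp (RingHom.FiniteType.of_surjective _ (sp (A := k)).surjective)
  exact h2

lemma pre_top_of_closedPoint {V : Type u} [CommRing V] [IsLocalRing V] {X : Scheme.{u}}
    (l : Spec (CommRingCat.of V) ⟶ X) {U : X.Opens} (h : l (IsLocalRing.closedPoint V) ∈ U) :
    (⊤ : (Spec (CommRingCat.of V)).Opens) ≤ l ⁻¹ᵁ U := by
  have : l ⁻¹ᵁ U = ⊤ := (IsLocalRing.closedPoint_mem_iff (R := V) (l ⁻¹ᵁ U)).mp h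
  rw [this]

lemma geoF_aux {X : Scheme.{u}} {sX : X ⟶ Spk k} [IsProper sX]
    {K : Type u} [Field K] (η : Spk K ⟶ X)
    (hη : ∀ {U : X.Opens}, (U : Set X).Nonempty → (⊤ : (Spec (CommRingCat.of K)).Opens) ≤ η ⁻¹ᵁ U)
    (hinj : ∀ {U : X.Opens} (h : (U : Set X).Nonempty), Function.Injective (pl η (hη h)))
    {κ : Type*} [Finite κ] (U : κ → X.Opens) (hU : ∀ j, IsAffineOpen (U j)) (hne : ∀ j, (U j : Set X).Nonempty)
    (hc : ∀ x, ∃ j, x ∈ U j) (j0 : κ) (W : Submodule k (Sct sX (U j0)))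
    (hW : ∀ j, ∃ (n : ℕ) (g : Fin n → Γ(X, U j0 ⊓ U j)), ∀ w : Γ(X, U j0), toS sX _ w ∈ W → ∃ c : Fin n → Γ(X, U j),
      rs inf_le_left w = ∑ m, rs inf_le_right (c m) * g m) : FiniteDimensional k W := by
  obtain ⟨φ, hφ⟩ : ∃ φ : k →+* K, Spec.map (CommRingCat.ofHom φ) = η ≫ sX :=
    ⟨(Spec.preimage (η ≫ sX)).hom, Spec.map_preimage _⟩
  let _ : Algebra k K := φ.toAlgebra
  let ev : ∀ {U : X.Opens} (h : (U : Set X).Nonempty), Sct sX U →ₐ[k] K := fun {U} h =>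
    { (sp (A := K)).symm.toRingHom.comp ((pl η (hη h)).comp (toS sX U).symm.toRingHom) with
      commutes' := fun c => by
        change (sp (A := K)).symm (pl η (hη h) (kal sX U c)) = φ c
        rw [RingEquiv.symm_apply_eq, kal_sp, pl_comp hφ.symm _ _ le_pre_top, pl_sp] }
  have hev : ∀ {U : X.Opens} (h : (U : Set X).Nonempty) (a : Γ(X, U)), ev h (toS sX U a) = (sp (A := K)).symm (pl η (hη h) a) :=
    fun _ _ => rfl
  have hevi : ∀ {U : X.Opens} (h : (U : Set X).Nonempty), Function.Injective (ev h) := fun {U} h a b hab =>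
    (toS sX U).symm.injective (hinj h ((sp (A := K)).symm.injective hab))
  let R : κ → Subalgebra k K := fun j => (ev (hne j)).range
  have hfg : ∀ j, (R j).FG := fun j => by
    have := finiteType_Sct sX (hU j)
    have h2 : Algebra.FiniteType k (ev (hne j)).range :=
      Algebra.FiniteType.of_surjective (ev (hne j)).rangeRestrict (ev (hne j)).rangeRestrict_surjective
    exact (Subalgebra.fg_iff_finiteType _).mpr h2
  have hval : ∀ V : ValuationSubring K, (∀ c, algebraMap k K c ∈ V) → ∃ j, ∀ x ∈ R j, x ∈ V := fun V hV => by
    let ψ : k →+* V := φ.codRestrict V.toSubring hV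
    have hex : ValuativeCriterion.Existence sX := by
      have h : UniversallyClosed sX := inferInstance
      rw [UniversallyClosed.eq_valuativeCriterion] at h
      exact h.1
    let Sq : ValuativeCommSq sX :=
      { R := V
        K := K
        i₁ := η
        i₂ := Spec.map (CommRingCat.ofHom ψ)
        commSq := ⟨by rw [← hφ, ← Spec.map_comp]; rfl⟩ }
    obtain ⟨⟨⟨l, hl1, hl2⟩⟩⟩ := hex Sq
    change Spec (CommRingCat.of V) ⟶ X at l
    change Spec.map (CommRingCat.ofHom (algebraMap V K)) ≫ l = η at hl1
    obtain ⟨j, hj⟩ := hc (l (IsLocalRing.closedPoint V))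
    refine ⟨j, ?_⟩
    rintro _ ⟨a, rfl⟩
    have h1 := pre_top_of_closedPoint l hj
    have : (ev (hne j)) a = algebraMap V K ((sp (A := V)).symm (pl l h1 ((toS sX (U j)).symm a))) := by
      change (sp (A := K)).symm (pl η _ _) = _
      rw [RingEquiv.symm_apply_eq, ← pl_sp (algebraMap V K) le_pre_top, RingEquiv.apply_symm_apply, pl_comp hl1 _ _ (hη (hne j))]; rfl
    change (ev (hne j)) a ∈ V
    rw [this]
    exact Subtype.prop _
  have hfin : FiniteDimensional k (W.map (ev (hne j0)).toLinearMap) := by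
    refine finF R hfg hval _ fun j => ?_
    classical
    obtain ⟨n, g, hg⟩ := hW j
    have hne2 : ((U j0 ⊓ U j : X.Opens) : Set X).Nonempty := ⟨η (IsLocalRing.closedPoint K), hη (hne j0) trivial, hη (hne j) trivial⟩
    refine ⟨Finset.univ.image fun m => ev hne2 (toS sX _ (g m)), ?_⟩
    rintro _ ⟨w, hw, rfl⟩
    obtain ⟨c, hc'⟩ := hg ((toS sX _).symm w) hw
    have e1 := congrArg (fun a => ev hne2 (toS sX _ a)) hc'
    have e2 : ∀ {V V' : X.Opens} (h : (V : Set X).Nonempty) (h' : (V' : Set X).Nonempty) (hv : V ≤ V') (a : Γ(X, V')),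
      ev h (toS sX _ (rs hv a)) = ev h' (toS sX _ a) := fun {V V'} h h' hv a => by
      rw [hev h, hev h', pl_rs]
    simp only [map_sum, map_mul] at e1
    rw [e2 hne2 (hne j0)] at e1
    change ev (hne j0) w ∈ _
    have e3 : ev (hne j0) w = _ := e1
    rw [e3]
    refine Submodule.sum_mem _ fun m _ => ?_
    rw [e2 hne2 (hne j)]
    exact Submodule.smul_mem _ (⟨ev (hne j) (toS sX _ (c m)), ⟨_, rfl⟩⟩ : R j)
      (Submodule.subset_span (by simp))
  exact LinearEquiv.finiteDimensional (Submodule.equivMapOfInjective (ev (hne j0)).toLinearMap (hevi (hne j0)) W).symm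

lemma geoF {X : Scheme.{u}} {sX : X ⟶ Spk k} [IsIntegral X] [IsProper sX]
    {κ : Type*} [Finite κ] (U : κ → X.Opens) (hU : ∀ j, IsAffineOpen (U j)) (hne : ∀ j, (U j : Set X).Nonempty)
    (hc : ∀ x, ∃ j, x ∈ U j) (j0 : κ) (W : Submodule k (Sct sX (U j0)))
    (hW : ∀ j, ∃ (n : ℕ) (g : Fin n → Γ(X, U j0 ⊓ U j)), ∀ w : Γ(X, U j0), toS sX _ w ∈ W → ∃ c : Fin n → Γ(X, U j),
      rs inf_le_left w = ∑ m, rs inf_le_right (c m) * g m) : FiniteDimensional k W := by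
  have hgen : ∀ {U : X.Opens}, (U : Set X).Nonempty → genericPoint X ∈ U := fun {U} h =>
    ((genericPoint_spec X).mem_open_set_iff U.isOpen).mpr (by simpa using h)
  have hη : ∀ {U : X.Opens}, (U : Set X).Nonempty →
      (⊤ : (Spec X.functionField).Opens) ≤ (X.fromSpecStalk (genericPoint X)) ⁻¹ᵁ U := fun {U} h =>

    @pre_top_of_closedPoint X.functionField X.functionField.commRing (inferInstanceAs (IsLocalRing (X.presheaf.stalk (genericPoint X)))) _ (X.fromSpecStalk (genericPoint X)) U (by
      have : (X.fromSpecStalk (genericPoint X)) (IsLocalRing.closedPoint X.functionField) = genericPoint X :=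
        Scheme.fromSpecStalk_closedPoint
      exact Set.mem_of_eq_of_mem this (hgen h))
  refine geoF_aux (K := X.functionField) (X.fromSpecStalk (genericPoint X)) hη (fun {U} h a b hab => ?_) U hU hne hc j0 W hW
  refine germ_injective_of_isIntegral X (genericPoint X) (hgen h) ?_
  have e := Scheme.fromSpecStalk_app (hgen h)
  have e2 : ∀ a, pl (X.fromSpecStalk (genericPoint X)) (hη h) a = rs (hη h)
    (((X.fromSpecStalk (genericPoint X)).app U).hom a) := fun a => rfl
  have e3 : ∀ a, pl (X.fromSpecStalk (genericPoint X)) (hη h) a =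
      (Scheme.ΓSpecIso (X.functionField)).inv.hom ((X.presheaf.germ U _ (hgen h)).hom a) := fun a => by
    rw [e2, e]
    change rs _ (rs le_top ((Scheme.ΓSpecIso (X.functionField)).inv.hom ((X.presheaf.germ U _ (hgen h)).hom a))) = _
    rw [rs_rs, rs_self]
  have h4 := (e3 a).symm.trans (hab.trans (e3 b))
  exact (Scheme.ΓSpecIso (X.functionField)).symm.commRingCatIsoToRingEquiv.injective h4

end geoF
end

section
lemma LA {C : Type*} [CommRing C] [IsNoetherianRing C] (I : Ideal C) {m : Type*} [Finite m] {κ : Type*}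
    (l : κ → (m → C) →ₗ[C] C) (w1 : m → C) (w : ℕ → m → C) (hl : ∀ n i, l i (w n) ∈ I ^ n)
    (hw : ∀ n a, w n a - w1 a ∈ I) : ∃ v : m → C, (∀ i, l i v = 0) ∧ ∀ a, v a - w1 a ∈ I := by
  classical
  cases nonempty_fintype m
  let P := Submodule.span C (Set.range l)
  have hfg : P.FG := IsNoetherian.noetherian P
  obtain ⟨s, hs⟩ := hfg
  have hP : ∀ x ∈ P, ∀ n, x (w n) ∈ I ^ n := fun x hx n => by
    refine Submodule.span_induction (p := fun x _ => x (w n) ∈ I ^ n) ?_ ?_ ?_ ?_ hx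
    · rintro _ ⟨i, rfl⟩; exact hl n i
    · simp
    · intro x y _ _ h1 h2; exact add_mem h1 h2
    · intro c x _ h; exact Ideal.mul_mem_left _ _ h
  let L : (m → C) →ₗ[C] (s → C) := LinearMap.pi fun i => i.1
  obtain ⟨c, hc⟩ := Ideal.exists_pow_inf_eq_pow_smul I (LinearMap.range L)
  have hpi : ∀ {β : Type _} [Fintype β] (J : Ideal C) (v : β → C), (∀ b, v b ∈ J) → v ∈ J • (⊤ : Submodule C (β → C)) := by
    intro β _ J v hv
    rw [pi_eq_sum_univ' v]
    exact Submodule.sum_mem _ fun i _ => Submodule.smul_mem_smul (hv i) trivial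
  have hpi' : ∀ {β : Type _} [Fintype β] (J : Ideal C) (v : β → C), v ∈ J • (⊤ : Submodule C (β → C)) → ∀ b, v b ∈ J := by
    intro β _ J v hv b
    refine Submodule.smul_induction_on (p := fun v : β → C => v b ∈ J) hv ?_ ?_
    · intro r hr n _; exact Ideal.mul_mem_right _ _ hr
    · intro x y hx hy; exact add_mem hx hy
  have h1 : L (w (c + 1)) ∈ I ^ (c + 1) • (⊤ : Submodule C (s → C)) ⊓ LinearMap.range L :=
    ⟨hpi _ _ fun b => hP _ (hs ▸ Submodule.subset_span b.2) _, ⟨_, rfl⟩⟩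
  rw [hc (c + 1) (by omega)] at h1
  have h2 : L (w (c + 1)) ∈ Submodule.map L (I • (⊤ : Submodule C (m → C))) := by
    rw [Submodule.map_smul'', Submodule.map_top]
    rw [Nat.add_sub_cancel_left, pow_one] at h1
    exact Submodule.smul_mono le_rfl inf_le_right h1
  obtain ⟨d, hd, hd'⟩ := h2
  refine ⟨w (c + 1) - d, fun i => ?_, fun a => ?_⟩
  · have hz : L (w (c + 1) - d) = 0 := by rw [map_sub, hd', sub_self]
    have : l i ∈ P := Submodule.subset_span ⟨i, rfl⟩
    have hall : ∀ x ∈ P, x (w (c + 1) - d) = 0 := fun x hx => by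
      rw [← hs] at hx
      refine Submodule.span_induction (p := fun x _ => x (w (c+1) - d) = 0) ?_ ?_ ?_ ?_ hx
      · intro x hx; exact congrFun hz ⟨x, hx⟩
      · simp
      · intro x y _ _ h1 h2; rw [LinearMap.add_apply, h1, h2, add_zero]
      · intro c x _ h; rw [LinearMap.smul_apply, h, smul_zero]
    exact hall _ this
  · have := sub_mem (hw (c + 1) a) (hpi' _ _ hd a)
    convert this using 1
    simp only [Pi.sub_apply]; ring

lemma fd_dual {k V : Type*} [Field k] [AddCommGroup V] [Module k V] (D : Submodule k V) [FiniteDimensional k D] :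
    ∃ (n : ℕ) (e : Fin n → V) (φ : Fin n → V →ₗ[k] k), ∀ w ∈ D, w = ∑ l, φ l w • e l := by
  obtain ⟨g, hg⟩ := D.subtype.exists_leftInverse_of_injective D.ker_subtype
  let b := Module.finBasis k D
  refine ⟨_, fun l => (b l : V), fun l => b.coord l ∘ₗ g, fun w hw => ?_⟩
  have h1 : g w = ⟨w, hw⟩ := LinearMap.congr_fun hg ⟨w, hw⟩
  have h2 := b.sum_repr ⟨w, hw⟩
  have h3 := congrArg D.subtype h2
  rw [map_sum] at h3
  simp only [map_smul] at h3
  refine h3.symm.trans (sum_congr rfl fun l _ => ?_)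
  simp [h1]

lemma box_inf {X T Q : Scheme.{u}} {p : Q ⟶ X} {q : Q ⟶ T} {U U' : X.Opens} {O : T.Opens} {W W' : Q.Opens} (hW : W = p ⁻¹ᵁ U ⊓ q ⁻¹ᵁ O)
    (hW' : W' = p ⁻¹ᵁ U' ⊓ q ⁻¹ᵁ O) : W ⊓ W' = p ⁻¹ᵁ (U ⊓ U') ⊓ q ⁻¹ᵁ O := by
  subst hW hW'
  ext x
  exact ⟨fun h => ⟨⟨h.1.1, h.2.1⟩, h.1.2⟩, fun h => ⟨⟨h.1.1, h.2⟩, ⟨h.1.2, h.2⟩⟩⟩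

section box
variable {k : Type u} [Field k] {X T Q : Scheme.{u}}
  {sX : X ⟶ Spk k} {sT : T ⟶ Spk k}
  {p : Q ⟶ X} {q : Q ⟶ T} (H : IsPullback p q sX sT)
include H

lemma box_affine {U : X.Opens} {O : T.Opens} {W : Q.Opens} (hU : IsAffineOpen U) (hO : IsAffineOpen O)
    (hW : W = p ⁻¹ᵁ U ⊓ q ⁻¹ᵁ O) : IsAffineOpen W := by
  have : IsAffine U.toScheme := hU
  have : IsAffine O.toScheme := hO
  let j : pullback (U.ι ≫ sX) (O.ι ≫ sT) ⟶ pullback sX sT :=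
    pullback.map _ _ _ _ U.ι O.ι (𝟙 _) (by simp) (by simp)
  have h1 := isAffineOpen_opensRange (j ≫ H.isoPullback.inv)
  convert h1
  rw [hW]
  ext x
  have hr : Set.range j = (pullback.fst sX sT ⁻¹' (Set.range U.ι)) ∩ (pullback.snd sX sT ⁻¹' (Set.range O.ι)) := by
    simp only [j]
    rw [Scheme.Pullback.range_map]
  have h2 : x ∈ (j ≫ H.isoPullback.inv).opensRange ↔ H.isoPullback.hom x ∈ Set.range j := by
    constructor
    · rintro ⟨y, rfl⟩
      refine ⟨y, ?_⟩
      rw [← Scheme.Hom.comp_apply, assoc, Iso.inv_hom_id, comp_id]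
    · rintro ⟨y, hy⟩
      refine ⟨y, ?_⟩
      rw [Scheme.Hom.comp_apply, hy, ← Scheme.Hom.comp_apply, Iso.hom_inv_id]; rfl
  refine Iff.trans ?_ h2.symm
  rw [hr, Set.mem_inter_iff, Set.mem_preimage, Set.mem_preimage, ← Scheme.Hom.comp_apply, ← Scheme.Hom.comp_apply,
    H.isoPullback_hom_fst, H.isoPullback_hom_snd]
  simp

lemma slice_flip {U : X.Opens} {O : T.Opens} {W : Q.Opens} (hU : IsAffineOpen U) (hO : IsAffineOpen O)
    (hW : W = p ⁻¹ᵁ U ⊓ q ⁻¹ᵁ O) (hW' : W = q ⁻¹ᵁ O ⊓ p ⁻¹ᵁ U) (l : Sct sX U →ₗ[k] k) (m : Sct sT O →ₗ[k] k) (u : Γ(Q, W)) :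
    m (toS sT O (slice H (QQ.affine hU) hO hW l u)) = l (toS sX U (slice H.flip (QQ.affine hO) hU hW' m u)) := by
  refine bx_induction H (QQ.affine hU) hO hW (P := fun u =>
    m (toS sT O (slice H (QQ.affine hU) hO hW l u)) = l (toS sX U (slice H.flip (QQ.affine hO) hU hW' m u)))
    (fun u v hu hv => ?_) (fun a c => ?_) u
  · simp only [map_add, hu, hv]
  · rw [slice_mk, mul_comm (pl p _ a), slice_mk, ← smul_toS, ← smul_toS, map_smul, map_smul, smul_eq_mul, smul_eq_mul, mul_comm]

lemma slice_zero {U : X.Opens} {O : T.Opens} {W : Q.Opens} (hU : QQ U) (hO : IsAffineOpen O)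
    (hW : W = p ⁻¹ᵁ U ⊓ q ⁻¹ᵁ O) (u : Γ(Q, W)) (h : ∀ l, slice H hU hO hW l u = 0) : u = 0 := by
  obtain ⟨n, d, c, hd⟩ := slice_mem H (κ := Unit) (U := fun _ => U) (W := fun _ => W) (fun _ => hU) hO (fun _ => hW) ⊥
    (fun _ => u) (fun l _ => by simp [h])
  rw [hd ()]
  refine Finset.sum_eq_zero fun m _ => ?_
  have : (d m).1 = 0 := (Submodule.mem_bot k).mp (d m).2
  rw [this]; simp

lemma slice_mem_range {U U' : X.Opens} {O : T.Opens} {W W' : Q.Opens} (hU' : QQ U') (hO : IsAffineOpen O)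
    (hW : W = p ⁻¹ᵁ U ⊓ q ⁻¹ᵁ O) (hW' : W' = p ⁻¹ᵁ U' ⊓ q ⁻¹ᵁ O) (hUU : U' ≤ U) (hWW : W' ≤ W) (u : Γ(Q, W'))
    (h : ∀ l : Sct sX U' →ₗ[k] k, l ∘ₗ (rsL sX hUU).toLinearMap = 0 → slice H hU' hO hW' l u = 0) :
    ∃ v : Γ(Q, W), rs hWW v = u := by
  obtain ⟨n, d, c, hd⟩ := slice_mem H (κ := Unit) (U := fun _ => U') (W := fun _ => W') (fun _ => hU') hO (fun _ => hW')
    (LinearMap.range (LinearMap.pi (fun _ : Unit => (rsL sX hUU).toLinearMap)))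
    (fun _ => u) (fun l hl => by
      simp only [Finset.univ_unique, Finset.sum_singleton]
      refine h _ (LinearMap.ext fun a => ?_)
      have := hl _ ⟨a, rfl⟩
      simpa using this)
  choose e he using fun m => (d m).2
  refine ⟨∑ m, pl p (hWl hW) ((toS sX U).symm (e m)) * pl q (hWr hW) (c m), ?_⟩
  rw [hd (), map_sum]
  refine sum_congr rfl fun m _ => ?_
  rw [map_mul, rs_pl, rs_pl, ← he, ← pl_rs p hUU (hWl hW')]
  rfl

lemma box_inj [IsIntegral X] {U U' : X.Opens} {O : T.Opens} {W W' : Q.Opens} (hU : QQ U) (hU' : QQ U') (hO : IsAffineOpen O)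
    (hW : W = p ⁻¹ᵁ U ⊓ q ⁻¹ᵁ O) (hW' : W' = p ⁻¹ᵁ U' ⊓ q ⁻¹ᵁ O) (hUU : U' ≤ U) (hne : (U' : Set X).Nonempty)
    (hWW : W' ≤ W) (u : Γ(Q, W)) (h : rs hWW u = 0) : u = 0 := by
  have hinj : Function.Injective (rsL sX hUU).toLinearMap := by
    have : Nonempty U' := hne.to_subtype
    exact (injective_iff_map_eq_zero (rs hUU)).mp (AlgebraicGeometry.map_injective_of_isIntegral X (homOfLE hUU)) |> fun h =>
      (injective_iff_map_eq_zero (rsL sX hUU).toLinearMap).mpr h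
  obtain ⟨g, hg⟩ := (rsL sX hUU).toLinearMap.exists_leftInverse_of_injective (LinearMap.ker_eq_bot.mpr hinj)
  refine slice_zero H hU hO hW u fun l => ?_
  have e : l = (l ∘ₗ g) ∘ₗ (rsL sX hUU).toLinearMap := by rw [LinearMap.comp_assoc, hg]; rfl
  rw [e, ← slice_rs H hU hO hW hU' hW' hUU hWW, h, map_zero]

lemma sec_inj [IsIntegral X] {S : Scheme.{u}} {N : LB S} {f : Q ⟶ S}
    {U U' : X.Opens} {O : T.Opens} {W W' : Q.Opens} (hU : IsAffineOpen U) (hU' : QQ U') (hO : IsAffineOpen O)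
    (hW : W = p ⁻¹ᵁ U ⊓ q ⁻¹ᵁ O) (hW' : W' = p ⁻¹ᵁ U' ⊓ q ⁻¹ᵁ O) (hUU : U' ≤ U) (hne : (U' : Set X).Nonempty)
    (hWW : W' ≤ W) (σ τ : Sec N f W) (h : σ.res hWW = τ.res hWW) : σ = τ := by
  obtain ⟨n, s, t, hst⟩ := exists_dual_basis N f (box_affine H hU hO hW)
  rw [sum_pair_smul Finset.univ s t hst σ, sum_pair_smul Finset.univ s t hst τ]
  refine sum_congr rfl fun a _ => ?_
  congr 1
  rw [← sub_eq_zero]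
  refine box_inj H (QQ.affine hU) hU' hO hW hW' hUU hne hWW _ ?_
  rw [map_sub, ← pair_res, ← pair_res, h, sub_self]

end box
end

section
section bx
variable {X T Q : Scheme.{u}}
/-- boxes -/
def Bx (p : Q ⟶ X) (q : Q ⟶ T) (U : X.Opens) (O : T.Opens) : Q.Opens := p ⁻¹ᵁ U ⊓ q ⁻¹ᵁ O

variable {p : Q ⟶ X} {q : Q ⟶ T} {U U' : X.Opens} {O O' : T.Opens}
lemma Bx.l : Bx p q U O ≤ p ⁻¹ᵁ U := inf_le_left
lemma Bx.r : Bx p q U O ≤ q ⁻¹ᵁ O := inf_le_right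
lemma Bx.mono (h : U' ≤ U) (h' : O' ≤ O) : Bx p q U' O' ≤ Bx p q U O := inf_le_inf (fun _ hx => h hx) (fun _ hx => h' hx)
lemma Bx.le {T' Q' : Scheme.{u}} {p' : Q' ⟶ X} {q' : Q' ⟶ T'} {a : T' ⟶ T} {j : Q' ⟶ Q} {O' : T'.Opens}
    (e1 : j ≫ p = p') (e2 : j ≫ q = q' ≫ a) (hO : O' ≤ a ⁻¹ᵁ O) : Bx p' q' U O' ≤ j ⁻¹ᵁ Bx p q U O := by
  intro x hx
  refine ⟨?_, ?_⟩
  · have := hx.1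
    rw [← e1] at this
    exact this
  · have h1 : (q' ≫ a) x ∈ O := hO hx.2
    rw [← e2] at h1
    exact h1
lemma Bx.eq : Bx p q U O = p ⁻¹ᵁ U ⊓ q ⁻¹ᵁ O := rfl
lemma Bx.swap : Bx p q U O = q ⁻¹ᵁ O ⊓ p ⁻¹ᵁ U := inf_comm _ _
lemma Bx.inf : Bx p q U O ⊓ Bx p q U' O = Bx p q (U ⊓ U') O := box_inf rfl rfl
end bx

lemma pair_dual {S T : Scheme.{u}} {N : LB S} {f : T ⟶ S} {V : T.Opens} {κ : Type*} [Fintype κ] (s : κ → Sec N f V)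
    (t : κ → Sec N.inv f V) (h : ∑ c, pair (s c) (t c) = 1) (σ : Sec N f V) (τ : Sec N.inv f V) :
    pair σ τ = ∑ b, pair σ (t b) * pair (s b) τ := by
  conv_lhs => rw [sum_pair_smul Finset.univ s t h σ, pair_sum]
  exact sum_congr rfl fun b _ => by rw [pair_smul]

section fd
variable {k : Type u} [Field k] {X T Q : Scheme.{u}}
  {sX : X ⟶ Spk k} {sT : T ⟶ Spk k}
  {p : Q ⟶ X} {q : Q ⟶ T} (H : IsPullback p q sX sT) {S : Scheme.{u}} {N : LB S} {f : Q ⟶ S}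
include H

lemma rs_slice' {U : X.Opens} {O O' : T.Opens} {W W' : Q.Opens} (hU : QQ U) (hO : IsAffineOpen O) (hO' : IsAffineOpen O')
    (hW : W = p ⁻¹ᵁ U ⊓ q ⁻¹ᵁ O) (hW' : W' = p ⁻¹ᵁ U ⊓ q ⁻¹ᵁ O') (hOO : O' ≤ O) (hWW : W' ≤ W)
    (l : Sct sX U →ₗ[k] k) (u : Γ(Q, W)) :
    rs hOO (slice H hU hO hW l u) = slice H hU hO' hW' l (rs hWW u) := by
  have e : l ∘ₗ (rsL sX (le_refl U)).toLinearMap = l :=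
    LinearMap.ext fun a => congrArg l (rs_self (le_refl U) a)
  rw [← rs_slice H hU hO hW hU hO' hW' le_rfl hOO hWW, e]

omit H in
lemma slice_key {U₀ U₁ V : X.Opens}
    (h0 : V ≤ U₀) (h1 : V ≤ U₁) {O : T.Opens}
    (t0 : Sec N.inv f (Bx p q U₀ O)) {r : ℕ} (s : Fin r → Sec N f (Bx p q U₁ O)) (t : Fin r → Sec N.inv f (Bx p q U₁ O))
    (hst : ∑ c, pair (s c) (t c) = 1) (n : Fin r → ℕ) (g : ∀ b, Fin (n b) → Γ(X, V)) (c : ∀ b, Fin (n b) → Γ(T, O))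
    (hg : ∀ b, pair ((s b).res (Bx.mono h1 le_rfl : Bx p q V O ≤ _)) (t0.res (Bx.mono h0 le_rfl)) = ∑ i, pl p Bx.l (g b i) * pl q Bx.r (c b i))
    {T' Q' : Scheme.{u}} {p' : Q' ⟶ X} {q' : Q' ⟶ T'} {a : T' ⟶ T} {j : Q' ⟶ Q} (e1 : j ≫ p = p') (e2 : j ≫ q = q' ≫ a)
    (ha : ⊤ ≤ a ⁻¹ᵁ O) (h : Sec N (j ≫ f) ⊤) :
    rs (Bx.mono h0 le_rfl : Bx p' q' V ⊤ ≤ _) (pair (h.res (le_top : Bx p' q' U₀ ⊤ ≤ ⊤)) (t0.pull j rfl (Bx.le e1 e2 ha)))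
      = ∑ b, ∑ i, pl p' Bx.l (g b i) * rs (Bx.mono h1 le_rfl : Bx p' q' V ⊤ ≤ _) (pl q' Bx.r (pl a ha (c b i)) *
          pair (h.res (le_top : Bx p' q' U₁ ⊤ ≤ ⊤)) ((t b).pull j rfl (Bx.le e1 e2 ha))) := by
  rw [← pair_res, Sec.res_res, Sec.res_pull,
    pair_dual (fun b => (s b).pull j rfl ((Bx.le e1 e2 ha).trans' (Bx.mono h1 le_rfl)))
      (fun b => (t b).pull j rfl ((Bx.le e1 e2 ha).trans' (Bx.mono h1 le_rfl))) (by
      simp_rw [pair_pull]; rw [← map_sum, hst, map_one])]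
  refine sum_congr rfl fun b _ => ?_
  have e3 : pair ((s b).pull j (f' := j ≫ f) rfl ((Bx.le e1 e2 ha).trans' (Bx.mono h1 le_rfl) : Bx p' q' V ⊤ ≤ _)) (t0.pull j rfl ((Bx.mono h0 le_rfl).trans (Bx.le e1 e2 ha))) =
      pl j (Bx.le e1 e2 ha) (pair ((s b).res (Bx.mono h1 le_rfl : Bx p q V O ≤ _)) (t0.res (Bx.mono h0 le_rfl))) := by
    rw [← pair_pull j rfl, Sec.pull_res, Sec.pull_res]
  rw [e3, hg, map_sum, Finset.mul_sum]
  refine sum_congr rfl fun i _ => ?_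
  rw [map_mul, map_mul, pl_comp e1 _ _ Bx.l, pl_comp e2 _ _ (le_pre_pre ha Bx.r), ← pl_pl a q' ha Bx.r, rs_pl,
    ← pair_res, Sec.res_res, Sec.res_pull, mul_left_comm, mul_comm (pair _ _)]

lemma slice_form {U₀ U₁ V : X.Opens} (hU₀ : IsAffineOpen U₀) (hU₁ : IsAffineOpen U₁) (hV : IsAffineOpen V)
    (h0 : V ≤ U₀) (h1 : V ≤ U₁) {O : T.Opens} (hO : IsAffineOpen O)
    (t0 : Sec N.inv f (Bx p q U₀ O)) {r : ℕ} (s : Fin r → Sec N f (Bx p q U₁ O)) (t : Fin r → Sec N.inv f (Bx p q U₁ O))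
    (hst : ∑ c, pair (s c) (t c) = 1) :
    ∃ (n : ℕ) (g : Fin n → Γ(X, V)), ∀ {T' Q' : Scheme.{u}} {sT' : T' ⟶ Spk k} {p' : Q' ⟶ X} {q' : Q' ⟶ T'}
      (H' : IsPullback p' q' sX sT') {a : T' ⟶ T} {j : Q' ⟶ Q} (e1 : j ≫ p = p') (e2 : j ≫ q = q' ≫ a)
      (hT' : IsAffineOpen (⊤ : T'.Opens)) (ha : ⊤ ≤ a ⁻¹ᵁ O) (h : Sec N (j ≫ f) ⊤) (l : Sct sT' ⊤ →ₗ[k] k),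
      ∃ c : Fin n → Γ(X, U₁), rs h0 (slice H'.flip (QQ.affine hT') hU₀ Bx.swap l
        (pair (h.res (le_top : Bx p' q' U₀ ⊤ ≤ ⊤)) (t0.pull j rfl (Bx.le e1 e2 ha)))) = ∑ m, rs h1 (c m) * g m := by
  classical
  choose n g c hg using fun b => bx_expand H (QQ.affine hV) hO (W := Bx p q V O) Bx.eq (pair ((s b).res (Bx.mono h1 le_rfl)) (t0.res (Bx.mono h0 le_rfl)))
  let e := Fintype.equivFin (Σ b, Fin (n b))
  refine ⟨_, fun m => g (e.symm m).1 (e.symm m).2, fun {T' Q' sT' p' q'} H' {a j} e1 e2 hT' ha h l => ?_⟩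
  refine ⟨fun m => slice H'.flip (QQ.affine hT') hU₁ Bx.swap l (pl q' Bx.r (pl a ha (c (e.symm m).1 (e.symm m).2)) *
    pair (h.res (le_top : Bx p' q' U₁ ⊤ ≤ ⊤)) ((t (e.symm m).1).pull j rfl (Bx.le e1 e2 ha))), ?_⟩
  refine Eq.trans ?_ (e.symm.sum_comp (fun y => rs h1 (slice H'.flip (QQ.affine hT') hU₁ Bx.swap l (pl q' Bx.r (pl a ha (c y.1 y.2)) *
    pair (h.res (le_top : Bx p' q' U₁ ⊤ ≤ ⊤)) ((t y.1).pull j rfl (Bx.le e1 e2 ha)))) * g y.1 y.2)).symm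
  rw [Fintype.sum_sigma, rs_slice' H'.flip (QQ.affine hT') hU₀ hV Bx.swap Bx.swap h0 (Bx.mono h0 le_rfl),
    slice_key h0 h1 t0 s t hst n g c hg e1 e2 ha h, map_sum]
  refine sum_congr rfl fun b _ => ?_
  rw [map_sum]
  refine sum_congr rfl fun i _ => ?_
  rw [rs_slice' H'.flip (QQ.affine hT') hU₁ hV Bx.swap Bx.swap h1 (Bx.mono h1 le_rfl), mul_comm (slice _ _ _ _ _ _)]
  exact slice_mul H'.flip (QQ.affine hT') hV Bx.swap l _ _

omit H in
lemma inf_affine [IsSeparated sX] {U V : X.Opens} (hU : IsAffineOpen U) (hV : IsAffineOpen V) : IsAffineOpen (U ⊓ V) := by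
  have : X.IsSeparated := by
    rw [Scheme.isSeparated_iff, ← terminal.comp_from sX]
    infer_instance
  exact hU.inf hV

lemma fd_slices [IsIntegral X] [IsProper sX] {κ : Type*} [Finite κ] (U : κ → X.Opens) (hU : ∀ j, IsAffineOpen (U j))
    (hne : ∀ j, (U j : Set X).Nonempty) (hc : ∀ x, ∃ j, x ∈ U j) (j0 : κ) {O : T.Opens} (hO : IsAffineOpen O)
    {r : κ → ℕ} (s : ∀ j, Fin (r j) → Sec N f (Bx p q (U j) O)) (t : ∀ j, Fin (r j) → Sec N.inv f (Bx p q (U j) O))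
    (hst : ∀ j, ∑ c, pair (s j c) (t j c) = 1)
    {T' Q' : ℕ → Scheme.{u}} {sT' : ∀ n, T' n ⟶ Spk k} {p' : ∀ n, Q' n ⟶ X} {q' : ∀ n, Q' n ⟶ T' n}
    (H' : ∀ n, IsPullback (p' n) (q' n) sX (sT' n)) {a : ∀ n, T' n ⟶ T} {j : ∀ n, Q' n ⟶ Q}
    (e1 : ∀ n, j n ≫ p = p' n) (e2 : ∀ n, j n ≫ q = q' n ≫ a n)
    (hT' : ∀ n, IsAffineOpen (⊤ : (T' n).Opens)) (ha : ∀ n, ⊤ ≤ a n ⁻¹ᵁ O) (h : ∀ n, Sec N (j n ≫ f) ⊤) (b : Fin (r j0)) :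
    FiniteDimensional k (Submodule.span k {w : Sct sX (U j0) | ∃ n l, w = toS sX (U j0)
      (slice (H' n).flip (QQ.affine (hT' n)) (hU j0) Bx.swap l
        (pair ((h n).res (le_top : Bx (p' n) (q' n) (U j0) ⊤ ≤ ⊤)) ((t j0 b).pull (j n) rfl (Bx.le (e1 n) (e2 n) (ha n)))))}) := by
  refine geoF U hU hne hc j0 _ fun i => ?_
  obtain ⟨m, g, hg⟩ := slice_form H (hU j0) (hU i) (inf_affine (sX := sX) (hU j0) (hU i)) inf_le_left inf_le_right hO (t j0 b) (s i) (t i) (hst i)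
  refine ⟨m, g, fun w hw => ?_⟩
  refine Submodule.span_induction (p := fun w _ => ∃ c : Fin m → Γ(X, U i), rs (inf_le_left : U j0 ⊓ U i ≤ _) ((toS sX (U j0)).symm w)
    = ∑ m, rs (inf_le_right : U j0 ⊓ U i ≤ _) (c m) * g m) ?_ ?_ ?_ ?_ hw
  · rintro _ ⟨n, l, rfl⟩
    exact hg (H' n) (e1 n) (e2 n) (hT' n) (ha n) (h n) l
  · exact ⟨0, by simp⟩
  · rintro w w' _ _ ⟨c, hc⟩ ⟨c', hc'⟩
    refine ⟨c + c', ?_⟩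
    rw [map_add, map_add, hc, hc', ← Finset.sum_add_distrib]
    exact sum_congr rfl fun m _ => by rw [Pi.add_apply, map_add, add_mul]
  · rintro x w _ ⟨c, hc⟩
    refine ⟨fun m => kal sX _ x * c m, ?_⟩
    rw [symm_smul_toS, map_mul, hc, Finset.mul_sum, rs_kal]
    exact sum_congr rfl fun m _ => by rw [map_mul, rs_kal, mul_assoc]

end fd
end

section
section core
variable {k : Type u} [Field k] {X T Q : Scheme.{u}}
  {sX : X ⟶ Spk k} {sT : T ⟶ Spk k}
  {p : Q ⟶ X} {q : Q ⟶ T} {S : Scheme.{u}} {N : LB S} {f : Q ⟶ S}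

lemma bx_expand_dual (H : IsPullback p q sX sT) {U : X.Opens} {O : T.Opens} (hU : IsAffineOpen U) (hO : IsAffineOpen O)
    {m : ℕ} (e : Fin m → Sct sX U) (φ : Fin m → Sct sX U →ₗ[k] k) (v : Γ(Q, Bx p q U O))
    (hv : ∀ l, toS sX U (slice H.flip (QQ.affine hO) hU Bx.swap l v) =
      ∑ i, φ i (toS sX U (slice H.flip (QQ.affine hO) hU Bx.swap l v)) • e i) :
    v = ∑ i, pl p Bx.l ((toS sX U).symm (e i)) * pl q Bx.r (slice H (QQ.affine hU) hO Bx.eq (φ i) v) := by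
  rw [← sub_eq_zero]
  refine slice_zero H.flip (QQ.affine hO) hU Bx.swap _ fun l => ?_
  rw [map_sub, map_sum, sub_eq_zero]
  apply (toS sX U).injective
  rw [hv, map_sum]
  refine sum_congr rfl fun i _ => ?_
  rw [← slice_flip H hU hO Bx.eq Bx.swap, mul_comm (pl p _ _), slice_mk, ← smul_toS, RingEquiv.apply_symm_apply]

/-- sections with coefficients -/
def sg {U : X.Opens} {O : T.Opens} {m r : ℕ} (e : Fin m → Γ(X, U)) (s : Fin r → Sec N f (Bx p q U O))
    (w : Fin m × Fin r → Γ(T, O)) : Sec N f (Bx p q U O) :=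
  ∑ b, (∑ l, pl p Bx.l (e l) * pl q Bx.r (w (l, b))) • s b

lemma sg_add {U : X.Opens} {O : T.Opens} {m r : ℕ} (e : Fin m → Γ(X, U)) (s : Fin r → Sec N f (Bx p q U O))
    (w w' : Fin m × Fin r → Γ(T, O)) : sg e s (w + w') = sg e s w + sg e s w' := by
  simp only [sg]
  rw [← Finset.sum_add_distrib]
  refine sum_congr rfl fun b _ => ?_
  rw [← add_smul, ← Finset.sum_add_distrib]
  congr 1
  exact sum_congr rfl fun l _ => by rw [Pi.add_apply, map_add, mul_add]

lemma sg_smul {U : X.Opens} {O : T.Opens} {m r : ℕ} (e : Fin m → Γ(X, U)) (s : Fin r → Sec N f (Bx p q U O))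
    (c : Γ(T, O)) (w : Fin m × Fin r → Γ(T, O)) : sg e s (c • w) = pl q (Bx.r (p := p) (U := U)) c • sg e s w := by
  simp only [sg]
  rw [Finset.smul_sum]
  refine sum_congr rfl fun b _ => ?_
  rw [← mul_smul, Finset.mul_sum]
  congr 1
  exact sum_congr rfl fun l _ => by rw [Pi.smul_apply, smul_eq_mul, map_mul, mul_left_comm]

lemma pull_sg {U : X.Opens} {O : T.Opens} {m r : ℕ} (e : Fin m → Γ(X, U)) (s : Fin r → Sec N f (Bx p q U O))
    (w : Fin m × Fin r → Γ(T, O))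
    {T' Q' : Scheme.{u}} {p' : Q' ⟶ X} {q' : Q' ⟶ T'} {a : T' ⟶ T} {j : Q' ⟶ Q} {O' : T'.Opens}
    (e1 : j ≫ p = p') (e2 : j ≫ q = q' ≫ a) (hO : O' ≤ a ⁻¹ᵁ O) :
    (sg e s w).pull j rfl (Bx.le e1 e2 hO) =
      sg (p := p') (q := q') e (fun b => (s b).pull j rfl (Bx.le e1 e2 hO)) (fun x => pl a hO (w x)) := by
  simp only [sg]
  rw [Sec.pull_sum]
  refine sum_congr rfl fun b _ => ?_
  rw [Sec.pull_smul, map_sum]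
  congr 1
  refine sum_congr rfl fun l _ => ?_
  rw [map_mul, pl_comp e1 _ _ Bx.l, pl_comp e2 _ _ (le_pre_pre hO Bx.r), ← pl_pl a q' hO Bx.r]

/-- slice forms -/
def sform (H : IsPullback p q sX sT) {U V : X.Opens} {O : T.Opens} (hV : IsAffineOpen V) (hO : IsAffineOpen O) (hVU : V ≤ U)
    {m r : ℕ} (e : Fin m → Γ(X, U)) (s : Fin r → Sec N f (Bx p q U O)) (t : Sec N.inv f (Bx p q V O)) (μ : Sct sX V →ₗ[k] k) :
    (Fin m × Fin r → Γ(T, O)) →ₗ[Γ(T, O)] Γ(T, O) where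
  toFun w := slice H (QQ.affine hV) hO Bx.eq μ (pair ((sg e s w).res (Bx.mono hVU le_rfl)) t)
  map_add' w w' := by rw [sg_add, Sec.res_add, pair_add, map_add]
  map_smul' c w := by
    rw [sg_smul, Sec.res_smul, pair_smul, rs_pl, slice_mul]; rfl

lemma sform_apply (H : IsPullback p q sX sT) {U V : X.Opens} {O : T.Opens} (hV : IsAffineOpen V) (hO : IsAffineOpen O) (hVU : V ≤ U)
    {m r : ℕ} (e : Fin m → Γ(X, U)) (s : Fin r → Sec N f (Bx p q U O)) (t : Sec N.inv f (Bx p q V O)) (μ : Sct sX V →ₗ[k] k)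
    (w : Fin m × Fin r → Γ(T, O)) : sform H hV hO hVU e s t μ w =
      slice H (QQ.affine hV) hO Bx.eq μ (pair ((sg e s w).res (Bx.mono hVU le_rfl)) t) := rfl

lemma slice_zero_fun (H : IsPullback p q sX sT) {U : X.Opens} {O : T.Opens} {W : Q.Opens} (hU : QQ U) (hO : IsAffineOpen O)
    (hW : W = p ⁻¹ᵁ U ⊓ q ⁻¹ᵁ O) (u : Γ(Q, W)) : slice H hU hO hW 0 u = 0 := by
  refine bx_induction H hU hO hW (P := fun u => slice H hU hO hW 0 u = 0) (fun u v hu hv => ?_) (fun a c => ?_) u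
  · rw [map_add, hu, hv, add_zero]
  · rw [slice_mk, LinearMap.zero_apply, map_zero, zero_mul]

lemma form_vanish (H : IsPullback p q sX sT) {U₀ U₁ V : X.Opens} {O : T.Opens} (hU₁ : IsAffineOpen U₁) (hV : IsAffineOpen V)
    (hO : IsAffineOpen O) (h0 : V ≤ U₀) (h1 : V ≤ U₁)
    {m r : ℕ} (e : Fin m → Γ(X, U₀)) (s : Fin r → Sec N f (Bx p q U₀ O)) (t : Sec N.inv f (Bx p q U₁ O)) (μ : Sct sX V →ₗ[k] k)
    (hμ : μ ∘ₗ (rsL sX h1).toLinearMap = 0) (w : Fin m × Fin r → Γ(T, O))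
    {T' Q' : Scheme.{u}} {sT' : T' ⟶ Spk k} {p' : Q' ⟶ X} {q' : Q' ⟶ T'}
    (H' : IsPullback p' q' sX sT') {a : T' ⟶ T} {j : Q' ⟶ Q} (ea : a ≫ sT = sT')
    (e1 : j ≫ p = p') (e2 : j ≫ q = q' ≫ a) (hT' : IsAffineOpen (⊤ : T'.Opens)) (ha : ⊤ ≤ a ⁻¹ᵁ O) (h : Sec N (j ≫ f) ⊤)
    (hh : (sg e s w).pull j rfl (Bx.le e1 e2 ha) = h.res (le_top : Bx p' q' U₀ ⊤ ≤ ⊤)) :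
    pl a ha (sform H hV hO h0 e s (t.res (Bx.mono h1 le_rfl)) μ w) = 0 := by
  rw [sform_apply, pl_slice H (QQ.affine hV) hO Bx.eq H' ea e1 e2 hT' Bx.eq ha (Bx.le e1 e2 ha), ← pair_pull j rfl,
    Sec.pull_res, Sec.pull_res]
  have e3 := congrArg (Sec.res (Bx.mono h0 le_rfl : Bx p' q' V ⊤ ≤ _)) hh
  rw [Sec.res_pull, Sec.res_res] at e3
  have e4 : h.res (le_top : Bx p' q' V ⊤ ≤ ⊤) = (h.res (le_top : Bx p' q' U₁ ⊤ ≤ ⊤)).res (Bx.mono h1 le_rfl) := by rw [Sec.res_res]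
  have e5 := Sec.res_pull j rfl (Bx.le e1 e2 ha) (Bx.mono h1 le_rfl : Bx p' q' V ⊤ ≤ _) t
  have e6 : pair ((sg e s w).pull j rfl (le_pre_mono (Bx.le e1 e2 ha) (Bx.mono h0 le_rfl)) : Sec N (j ≫ f) (Bx p' q' V ⊤))
       (t.pull j rfl (le_pre_mono (Bx.le e1 e2 ha) (Bx.mono h1 le_rfl))) =
      rs (Bx.mono h1 le_rfl) (pair (h.res (le_top : Bx p' q' U₁ ⊤ ≤ ⊤)) (t.pull j rfl (Bx.le e1 e2 ha))) := by
    rw [← pair_res, ← e4, e5]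
    exact congrArg (fun z => pair z _) e3
  rw [e6, slice_rs H' (QQ.affine hU₁) hT' Bx.eq (QQ.affine hV) Bx.eq h1, hμ, slice_zero_fun]

lemma pull_sg_dual {U : X.Opens} {O : T.Opens} {m r : ℕ} (e : Fin m → Γ(X, U)) (s : Fin r → Sec N f (Bx p q U O))
    (t : Fin r → Sec N.inv f (Bx p q U O)) (hst : ∑ c, pair (s c) (t c) = 1)
    (w : Fin m × Fin r → Γ(T, O))
    {T' Q' : Scheme.{u}} {p' : Q' ⟶ X} {q' : Q' ⟶ T'} {a : T' ⟶ T} {j : Q' ⟶ Q}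
    (e1 : j ≫ p = p') (e2 : j ≫ q = q' ≫ a) (ha : ⊤ ≤ a ⁻¹ᵁ O) (h : Sec N (j ≫ f) ⊤)
    (hw : ∀ b, pair (h.res (le_top : Bx p' q' U ⊤ ≤ ⊤)) ((t b).pull j rfl (Bx.le e1 e2 ha)) =
      ∑ l, pl p' Bx.l (e l) * pl q' Bx.r (pl a ha (w (l, b)))) :
    (sg e s w).pull j rfl (Bx.le e1 e2 ha) = h.res (le_top : Bx p' q' U ⊤ ≤ ⊤) := by
  rw [pull_sg e s w e1 e2 ha]
  refine Eq.trans ?_ (sum_pair_smul Finset.univ (fun b => (s b).pull j rfl (Bx.le e1 e2 ha)) (fun b => (t b).pull j rfl (Bx.le e1 e2 ha)) (by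
      simp_rw [pair_pull]; rw [← map_sum, hst, map_one]) (h.res le_top)).symm
  simp only [sg, hw]

end core
end

section
section core
variable {k : Type u} [Field k] {X T Q : Scheme.{u}}
  {sX : X ⟶ Spk k} {sT : T ⟶ Spk k}
  {p : Q ⟶ X} {q : Q ⟶ T} {S : Scheme.{u}} {N : LB S} {f : Q ⟶ S}

/-- gluing sections agreeing on a dense chart -/
lemma chart_glue (H : IsPullback p q sX sT) [IsIntegral X] [IsSeparated sX] {κ : Type*} (U : κ → X.Opens) (hU : ∀ j, IsAffineOpen (U j))
    (hne : ∀ j, (U j : Set X).Nonempty) (hc : ∀ x, ∃ j, x ∈ U j) (j0 : κ) {O : T.Opens} (hO : IsAffineOpen O)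
    (τ : Sec N f (Bx p q (U j0) O)) (σ : ∀ i, Sec N f (Bx p q (U i) O))
    (h : ∀ i, (σ i).res (Bx.mono inf_le_right le_rfl : Bx p q (U j0 ⊓ U i) O ≤ _) = τ.res (Bx.mono inf_le_left le_rfl)) :
    ∃ g : Sec N f (q ⁻¹ᵁ O), ∀ i, g.res (Bx.r (p := p) (U := U j0 ⊓ U i)) = τ.res (Bx.mono inf_le_left le_rfl) := by
  obtain ⟨g, hg⟩ := Sec.glue_res (fun i => Bx p q (U i) O) (fun i => Bx.r) (fun x hx => (hc (p x)).imp fun i hi => ⟨hi, hx⟩) σ (fun i l => by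
    have hne3 : ((U j0 ⊓ (U i ⊓ U l) : X.Opens) : Set X).Nonempty := by
      have h1 : ((U i : Set X) ∩ U l).Nonempty := nonempty_preirreducible_inter (U i).2 (U l).2 (hne i) (hne l)
      exact nonempty_preirreducible_inter (U j0).2 (U i ⊓ U l).2 (hne j0) h1
    have ha : IsAffineOpen (U i ⊓ U l) := inf_affine (sX := sX) (hU i) (hU l)
    have hle : Bx p q (U j0 ⊓ (U i ⊓ U l)) O ≤ Bx p q (U i) O ⊓ Bx p q (U l) O :=
      le_inf (Bx.mono (inf_le_right.trans inf_le_left) le_rfl) (Bx.mono (inf_le_right.trans inf_le_right) le_rfl)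
    refine sec_inj H (U := U i ⊓ U l) (U' := U j0 ⊓ (U i ⊓ U l)) ha (QQ.affine (inf_affine (sX := sX) (hU j0) ha)) hO (W := Bx p q (U i) O ⊓ Bx p q (U l) O) Bx.inf Bx.eq inf_le_right hne3 hle _ _ ?_
    rw [Sec.res_res, Sec.res_res]
    have h1 := congrArg (Sec.res (Bx.mono (inf_le_inf_left _ inf_le_left) le_rfl : Bx p q (U j0 ⊓ (U i ⊓ U l)) O ≤ _)) (h i)
    have h2 := congrArg (Sec.res (Bx.mono (inf_le_inf_left _ inf_le_right) le_rfl : Bx p q (U j0 ⊓ (U i ⊓ U l)) O ≤ _)) (h l)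
    rw [Sec.res_res, Sec.res_res] at h1 h2
    rw [h1, h2])
  refine ⟨g, fun i => ?_⟩
  rw [← h i, ← hg i, Sec.res_res]

/-- extending a section from a chart overlap -/
lemma chart_ext (H : IsPullback p q sX sT) {U₁ V : X.Opens} {O : T.Opens} (hV : IsAffineOpen V)
    (hO : IsAffineOpen O) (h1 : V ≤ U₁) {r : ℕ} (s : Fin r → Sec N f (Bx p q U₁ O)) (t : Fin r → Sec N.inv f (Bx p q U₁ O))
    (hst : ∑ c, pair (s c) (t c) = 1) (τ : Sec N f (Bx p q V O))
    (h : ∀ b (μ : Sct sX V →ₗ[k] k), μ ∘ₗ (rsL sX h1).toLinearMap = 0 →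
      slice H (QQ.affine hV) hO Bx.eq μ (pair τ ((t b).res (Bx.mono h1 le_rfl))) = 0) :
    ∃ σ : Sec N f (Bx p q U₁ O), σ.res (Bx.mono h1 le_rfl) = τ := by
  choose u hu using fun b => slice_mem_range H (QQ.affine hV) hO Bx.eq Bx.eq h1 (Bx.mono h1 le_rfl) _ (h b)
  refine ⟨∑ b, u b • s b, ?_⟩
  rw [Sec.res_sum, sum_pair_smul Finset.univ (fun b => (s b).res (Bx.mono h1 le_rfl)) (fun b => (t b).res (Bx.mono h1 le_rfl)) (by
      simp_rw [pair_res]; rw [← map_sum, hst, map_one]) τ]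
  exact sum_congr rfl fun b _ => by rw [Sec.res_smul, hu]

/-- coefficients -/
lemma coeff_one {U : X.Opens} (hU : IsAffineOpen U) {O : T.Opens} {r : ℕ} (s : Fin r → Sec N f (Bx p q U O))
    (t : Fin r → Sec N.inv f (Bx p q U O)) (hst : ∑ c, pair (s c) (t c) = 1) {m : ℕ} (e : Fin m → Sct sX U) (φ : Fin m → Sct sX U →ₗ[k] k)
    (w : Fin m × Fin r → Γ(T, O))
    {T' Q' : Scheme.{u}} {sT' : T' ⟶ Spk k} {p' : Q' ⟶ X} {q' : Q' ⟶ T'}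
    (H' : IsPullback p' q' sX sT') {a : T' ⟶ T} {j : Q' ⟶ Q}
    (e1 : j ≫ p = p') (e2 : j ≫ q = q' ≫ a) (hT' : IsAffineOpen (⊤ : T'.Opens)) (ha : ⊤ ≤ a ⁻¹ᵁ O) (h : Sec N (j ≫ f) ⊤)
    (hv : ∀ b l, toS sX U (slice H'.flip (QQ.affine hT') hU Bx.swap l (pair (h.res (le_top : Bx p' q' U ⊤ ≤ ⊤)) ((t b).pull j rfl (Bx.le e1 e2 ha)))) =
      ∑ i, φ i (toS sX U (slice H'.flip (QQ.affine hT') hU Bx.swap l (pair (h.res (le_top : Bx p' q' U ⊤ ≤ ⊤)) ((t b).pull j rfl (Bx.le e1 e2 ha))))) • e i)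
    (hw : ∀ l b, pl a ha (w (l, b)) = slice H' (QQ.affine hU) hT' Bx.eq (φ l) (pair (h.res (le_top : Bx p' q' U ⊤ ≤ ⊤)) ((t b).pull j rfl (Bx.le e1 e2 ha)))) :
    (sg (fun i => (toS sX U).symm (e i)) s w).pull j rfl (Bx.le e1 e2 ha) = h.res (le_top : Bx p' q' U ⊤ ≤ ⊤) := by
  refine pull_sg_dual _ s t hst w e1 e2 ha h fun b => ?_
  simp only [hw]
  exact bx_expand_dual H' hU hT' e φ _ (hv b)

lemma coeff_compat {U : X.Opens} (hU : IsAffineOpen U) {O : T.Opens} (t : Sec N.inv f (Bx p q U O)) (φ : Sct sX U →ₗ[k] k)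
    {T' Q' : Scheme.{u}} {sT' : T' ⟶ Spk k} {p' : Q' ⟶ X} {q' : Q' ⟶ T'}
    (H' : IsPullback p' q' sX sT') {a : T' ⟶ T} {j : Q' ⟶ Q} (ea : a ≫ sT = sT')
    (e1 : j ≫ p = p') (e2 : j ≫ q = q' ≫ a) (hT' : IsAffineOpen (⊤ : T'.Opens)) (ha : ⊤ ≤ a ⁻¹ᵁ O) (h : Sec N (j ≫ f) ⊤)
    {T₀ Q₀ : Scheme.{u}} {sT₀ : T₀ ⟶ Spk k} {p₀ : Q₀ ⟶ X} {q₀ : Q₀ ⟶ T₀}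
    (H₀ : IsPullback p₀ q₀ sX sT₀) {a₀ : T₀ ⟶ T} {j₀ : Q₀ ⟶ Q} (ea₀ : a₀ ≫ sT = sT₀)
    (e1₀ : j₀ ≫ p = p₀) (e2₀ : j₀ ≫ q = q₀ ≫ a₀) (hT₀ : IsAffineOpen (⊤ : T₀.Opens)) (ha₀ : ⊤ ≤ a₀ ⁻¹ᵁ O) (h₀ : Sec N (j₀ ≫ f) ⊤)
    {β : T₀ ⟶ T'} {B : Q₀ ⟶ Q'} (eβ : β ≫ a = a₀) (eB : B ≫ j = j₀) (eq' : B ≫ q' = q₀ ≫ β) (eB' : B ≫ j ≫ f = j₀ ≫ f)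
    (hh : h.pull B eB' le_pre_top = h₀) :
    pl β le_pre_top (slice H' (QQ.affine hU) hT' Bx.eq φ (pair (h.res (le_top : Bx p' q' U ⊤ ≤ ⊤)) (t.pull j rfl (Bx.le e1 e2 ha)))) =
      slice H₀ (QQ.affine hU) hT₀ Bx.eq φ (pair (h₀.res (le_top : Bx p₀ q₀ U ⊤ ≤ ⊤)) (t.pull j₀ rfl (Bx.le e1₀ e2₀ ha₀))) := by
  have ep : B ≫ p' = p₀ := by rw [← e1, ← e1₀, ← eB, assoc]
  rw [pl_slice H' (QQ.affine hU) hT' Bx.eq H₀ (by rw [← ea, ← ea₀, ← eβ, assoc]) ep eq' hT₀ Bx.eq le_pre_top (Bx.le ep eq' le_pre_top),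
    ← pair_pull B eB', Sec.pull_pull j rfl _ B eB' _ j₀ eB rfl (Bx.le e1₀ e2₀ ha₀), Sec.pull_res, ← hh, Sec.res_pull]

/-- T4 core -/
theorem T4core [IsIntegral X] [IsProper sX] (H : IsPullback p q sX sT) {κ : Type*} [Finite κ] (U : κ → X.Opens) (hU : ∀ j, IsAffineOpen (U j))
    (hne : ∀ j, (U j : Set X).Nonempty) (hc : ∀ x, ∃ j, x ∈ U j) (j0 : κ) {O : T.Opens} (hO : IsAffineOpen O)
    [IsNoetherianRing Γ(T, O)] (I : Ideal Γ(T, O))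
    {T' Q' : ℕ → Scheme.{u}} {sT' : ∀ n, T' n ⟶ Spk k} {p' : ∀ n, Q' n ⟶ X} {q' : ∀ n, Q' n ⟶ T' n}
    (H' : ∀ n, IsPullback (p' n) (q' n) sX (sT' n)) {a : ∀ n, T' n ⟶ T} {j : ∀ n, Q' n ⟶ Q} (ea : ∀ n, a n ≫ sT = sT' n)
    (e1 : ∀ n, j n ≫ p = p' n) (e2 : ∀ n, j n ≫ q = q' n ≫ a n)
    (hT' : ∀ n, IsAffineOpen (⊤ : (T' n).Opens)) (ha : ∀ n, ⊤ ≤ a n ⁻¹ᵁ O) (h : ∀ n, Sec N (j n ≫ f) ⊤)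
    {β : ∀ n, T' 0 ⟶ T' n} {B : ∀ n, Q' 0 ⟶ Q' n} (eβ : ∀ n, β n ≫ a n = a 0) (eB : ∀ n, B n ≫ j n = j 0)
    (eq' : ∀ n, B n ≫ q' n = q' 0 ≫ β n) (eB' : ∀ n, B n ≫ j n ≫ f = j 0 ≫ f)
    (hh : ∀ n, (h n).pull (B n) (eB' n) le_pre_top = h 0)
    (hs : ∀ n, Function.Surjective (pl (a n) (ha n)))
    (hk : ∀ n c, pl (a n) (ha n) c = 0 ↔ c ∈ I ^ (n + 1)) :
    ∃ g : Sec N f (q ⁻¹ᵁ O), g.pull (j 0) rfl (le_pre_comp (e2 0) (le_pre_of_comp rfl (ha 0) le_pre_top)) = h 0 := by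
  choose r s t hst using fun i => exists_dual_basis N f (box_affine H (hU i) hO (Bx.eq (p := p) (q := q) (U := U i) (O := O)))
  have hfd := fd_slices H U hU hne hc j0 hO s t hst H' e1 e2 hT' ha h
  obtain ⟨m, e, φ, hφ⟩ := fd_dual (⨆ b, Submodule.span k {w : Sct sX (U j0) | ∃ n l, w = toS sX (U j0)
      (slice (H' n).flip (QQ.affine (hT' n)) (hU j0) Bx.swap l
        (pair ((h n).res (le_top : Bx (p' n) (q' n) (U j0) ⊤ ≤ ⊤)) ((t j0 b).pull (j n) rfl (Bx.le (e1 n) (e2 n) (ha n)))))})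
  choose w hw using fun n (x : Fin m × Fin (r j0)) => hs n (slice (H' n) (QQ.affine (hU j0)) (hT' n) Bx.eq (φ x.1)
    (pair ((h n).res (le_top : Bx (p' n) (q' n) (U j0) ⊤ ≤ ⊤)) ((t j0 x.2).pull (j n) rfl (Bx.le (e1 n) (e2 n) (ha n)))))
  have hsg : ∀ n, (sg (fun i => (toS sX (U j0)).symm (e i)) (s j0) (w n)).pull (j n) rfl (Bx.le (e1 n) (e2 n) (ha n)) =
      (h n).res (le_top : Bx (p' n) (q' n) (U j0) ⊤ ≤ ⊤) := fun n =>
    coeff_one (hU j0) (s j0) (t j0) (hst j0) e φ (w n) (H' n) (e1 n) (e2 n) (hT' n) (ha n) (h n)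
      (fun b l => hφ _ (Submodule.mem_iSup_of_mem b (Submodule.subset_span ⟨n, l, rfl⟩))) (fun l b => hw n (l, b))
  have hw0 : ∀ n x, w n x - w 0 x ∈ I := fun n x => by
    have h1 : pl (a 0) (ha 0) (w n x) = pl (a 0) (ha 0) (w 0 x) := by
      rw [hw 0, ← coeff_compat (hU j0) (t j0 x.2) (φ x.1) (H' n) (ea n) (e1 n) (e2 n) (hT' n) (ha n) (h n) (H' 0) (ea 0) (e1 0) (e2 0)
        (hT' 0) (ha 0) (h 0) (eβ n) (eB n) (eq' n) (eB' n) (hh n), ← hw n, pl_comp (eβ n)]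
    have h2 := (hk 0 (w n x - w 0 x)).mp (by rw [map_sub, h1, sub_self])
    simpa using h2
  have hV : ∀ i, IsAffineOpen (U j0 ⊓ U i) := fun i => inf_affine (sX := sX) (hU j0) (hU i)
  obtain ⟨v, hv, hvw⟩ := LA I (κ := Σ i : κ, Fin (r i) × {μ : Sct sX (U j0 ⊓ U i) →ₗ[k] k // μ ∘ₗ (rsL sX (inf_le_right : U j0 ⊓ U i ≤ _)).toLinearMap = 0})
    (fun z => sform H (hV z.1) hO inf_le_left (fun i => (toS sX (U j0)).symm (e i)) (s j0) ((t z.1 z.2.1).res (Bx.mono inf_le_right le_rfl)) z.2.2.1)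
    (w 0) w (fun n z => by
      have h1 := form_vanish H (hU z.1) (hV z.1) hO inf_le_left inf_le_right (fun i => (toS sX (U j0)).symm (e i)) (s j0) (t z.1 z.2.1) z.2.2.1 z.2.2.2
        (w n) (H' n) (ea n) (e1 n) (e2 n) (hT' n) (ha n) (h n) (hsg n)
      exact Ideal.pow_le_pow_right (Nat.le_succ n) ((hk n _).mp h1)) hw0
  choose σ hσ using fun i => chart_ext H (hV i) hO (inf_le_right : U j0 ⊓ U i ≤ U i) (s i) (t i) (hst i)
    ((sg (fun i => (toS sX (U j0)).symm (e i)) (s j0) v).res (Bx.mono inf_le_left le_rfl)) (fun b μ hμ => hv ⟨i, b, μ, hμ⟩)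
  obtain ⟨g, hg⟩ := chart_glue H U hU hne hc j0 hO _ σ hσ
  have hv0 : (fun x => pl (a 0) (ha 0) (v x)) = (fun x => pl (a 0) (ha 0) (w 0 x)) := funext fun x => by
    rw [← sub_eq_zero, ← map_sub, hk 0]; simpa using hvw x
  have hsv := (pull_sg (fun i => (toS sX (U j0)).symm (e i)) (s j0) v (e1 0) (e2 0) (ha 0)).trans
    ((congrArg _ hv0).trans (pull_sg (fun i => (toS sX (U j0)).symm (e i)) (s j0) (w 0) (e1 0) (e2 0) (ha 0)).symm)
  rw [hsg 0] at hsv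
  refine ⟨g, Sec.ext_res (fun i => Bx (p' 0) (q' 0) (U i) ⊤) (fun _ => le_top) (fun x _ => (hc (p' 0 x)).imp fun i hi => ⟨hi, trivial⟩) fun i => ?_⟩
  refine sec_inj (H' 0) (hU i) (QQ.affine (hV i)) (hT' 0) Bx.eq Bx.eq inf_le_right (nonempty_preirreducible_inter (U j0).2 (U i).2 (hne j0) (hne i))
    (Bx.mono inf_le_right le_rfl) _ _ ?_
  have h1 := congrArg (fun z => Sec.pull (j 0) rfl z (Bx.le (e1 0) (e2 0) (ha 0))) (hg i)
  have h2 := congrArg (Sec.res (Bx.mono inf_le_left le_rfl : Bx (p' 0) (q' 0) (U j0 ⊓ U i) ⊤ ≤ _)) hsv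
  rw [Sec.pull_res, Sec.pull_res] at h1
  rw [Sec.res_pull, Sec.res_res] at h2
  rw [Sec.res_pull, Sec.res_pull, Sec.res_res, ← h2, h1]

end core
end

section
section top
variable {S T Q : Scheme.{u}} {N : LB S} {f : Q ⟶ S} {q : Q ⟶ T} {σ : T ⟶ Q} (R : IsRig q σ)
include R

lemma norm_unique_top {h h' : Sec N f ⊤} (hg : h'.IsGen)
    (e : h.pull σ (f' := σ ≫ f) rfl (le_pre_top : ⊤ ≤ _) = h'.pull σ rfl (le_pre_top : ⊤ ≤ _)) : h = h' := by
  have h1 := norm_unique (O := ⊤) R (h := h.res le_top) (h' := h'.res le_top) (hg.res _) (by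
    rw [Sec.pull_res, Sec.pull_res]; exact e)
  have h2 := congrArg (Sec.res (le_pre_top : (⊤ : Q.Opens) ≤ q ⁻¹ᵁ ⊤)) h1
  rwa [Sec.res_res, Sec.res_res, Sec.res_self, Sec.res_self] at h2

lemma norm_exists_top {r : Sec N (σ ≫ f) ⊤} (hr : r.IsGen) {h : Sec N f ⊤} (hg : h.IsGen) : ∃ h : Sec N f ⊤, h.IsGen ∧
    h.pull σ rfl (le_pre_top : ⊤ ≤ _) = r := by
  obtain ⟨h', hg', e⟩ := norm_exists R hr (O := ⊤) ⟨h.res le_top, hg.res _⟩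
  refine ⟨h'.res le_pre_top, hg'.res _, ?_⟩
  rw [Sec.pull_res, e, Sec.res_self]
end top

section TA
variable {S T Q T' : Scheme.{u}}

/-- triviality after base change along `a` -/
def TA (q : Q ⟶ T) (N : LB S) (f : Q ⟶ S) (a : T' ⟶ T) : Prop := ∃ σ : Sec N (pullback.fst q a ≫ f) ⊤, σ.IsGen

variable {q : Q ⟶ T} {N : LB S} {f : Q ⟶ S} {a : T' ⟶ T}

lemma TA.use (h : TA q N f a) {Q' : Scheme.{u}} {j : Q' ⟶ Q} {q' : Q' ⟶ T'} (e : j ≫ q = q' ≫ a) {f' : Q' ⟶ S} (e' : j ≫ f = f') :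
    ∃ σ : Sec N f' ⊤, σ.IsGen := by
  obtain ⟨σ, hσ⟩ := h
  refine ⟨σ.pull (pullback.lift j q' e) (by rw [pullback.lift_fst_assoc, e']) le_pre_top, hσ.pull _ _ _⟩

lemma TA.of {Q' : Scheme.{u}} {j : Q' ⟶ Q} {q' : Q' ⟶ T'} (H : IsPullback j q' q a) {f' : Q' ⟶ S} (e' : j ≫ f = f')
    {σ : Sec N f' ⊤} (h : σ.IsGen) : TA q N f a :=
  ⟨σ.pull (H.lift _ _ pullback.condition) (by rw [← e', H.lift_fst_assoc]) le_pre_top, h.pull _ _ _⟩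

lemma TA.comp (h : TA q N f a) {T'' : Scheme.{u}} (b : T'' ⟶ T') {c : T'' ⟶ T} (e : b ≫ a = c) : TA q N f c :=
  h.use (q' := pullback.snd q c ≫ b) (by rw [pullback.condition, assoc, e]) rfl

end TA

lemma pl_fromSpec {T : Scheme.{u}} {O : T.Opens} (hO : IsAffineOpen O) (h : ⊤ ≤ hO.fromSpec ⁻¹ᵁ O) (c : Γ(T, O)) :
    pl hO.fromSpec h c = sp (A := Γ(T, O)) c := by
  have h1 : hO.fromSpec.appLE O ⊤ h = (Scheme.ΓSpecIso Γ(T, O)).inv := by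
    rw [Scheme.Hom.appLE, hO.fromSpec_app_self, assoc, ← Functor.map_comp]
    have : (eqToHom hO.fromSpec_preimage_self).op ≫ (homOfLE h).op = 𝟙 _ := rfl
    rw [this, CategoryTheory.Functor.map_id, comp_id]
  exact congrArg (fun z => z.hom c) h1

lemma le_fromSpec {T : Scheme.{u}} {O : T.Opens} (hO : IsAffineOpen O) : ⊤ ≤ hO.fromSpec ⁻¹ᵁ O := by
  rw [hO.fromSpec_preimage_self]

/-- infinitesimal neighbourhoods -/
def nb {T : Scheme.{u}} {O : T.Opens} (hO : IsAffineOpen O) (I : Ideal Γ(T, O)) : Spec (CommRingCat.of (Γ(T, O) ⧸ I)) ⟶ T :=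
  Spec.map (CommRingCat.ofHom (Ideal.Quotient.mk I)) ≫ hO.fromSpec

lemma le_nb {T : Scheme.{u}} {O : T.Opens} (hO : IsAffineOpen O) (I : Ideal Γ(T, O)) : ⊤ ≤ nb hO I ⁻¹ᵁ O :=
  le_pre_of_comp rfl (le_fromSpec hO) le_pre_top

lemma pl_nb {T : Scheme.{u}} {O : T.Opens} (hO : IsAffineOpen O) (I : Ideal Γ(T, O)) (c : Γ(T, O)) :
    pl (nb hO I) (le_nb hO I) c = sp (Ideal.Quotient.mk I c) := by
  rw [← pl_sp _ le_pre_top, ← pl_fromSpec hO (le_fromSpec hO), pl_comp rfl _ _ (le_nb hO I)]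
  rfl

lemma nb_factor {T : Scheme.{u}} {O : T.Opens} (hO : IsAffineOpen O) {I J : Ideal Γ(T, O)} (h : J ≤ I) :
    Spec.map (CommRingCat.ofHom (Ideal.Quotient.factor h)) ≫ nb hO J = nb hO I := by
  rw [nb, nb, ← Spec.map_comp_assoc]
  rfl

lemma exists_affine_cover (X : Scheme.{u}) [CompactSpace X] : ∃ (n : ℕ) (U : Fin n → X.Opens), (∀ j, IsAffineOpen (U j)) ∧
    (∀ j, (U j : Set X).Nonempty) ∧ ∀ x, ∃ j, x ∈ U j := by
  choose V hV hx _ using fun x : X => exists_isAffineOpen_mem_and_subset (U := ⊤) (x := x) trivial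
  obtain ⟨s, hs⟩ := isCompact_univ.elim_finite_subcover (fun x => (V x : Set X)) (fun x => (V x).2) (fun x _ => Set.mem_iUnion.mpr ⟨x, hx x⟩)
  refine ⟨s.card, fun i => V (s.equivFin.symm i).1, fun i => hV _, fun i => ⟨_, hx _⟩, fun x => ?_⟩
  obtain ⟨y, hy, hxy⟩ := Set.mem_iUnion₂.mp (hs (Set.mem_univ x))
  exact ⟨s.equivFin ⟨y, hy⟩, by simpa using hxy⟩

section T4
variable {k : Type u} [Field k] {X T Q : Scheme.{u}}
  {sX : X ⟶ Spk k} {sT : T ⟶ Spk k}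
  {p : Q ⟶ X} {q : Q ⟶ T} {S : Scheme.{u}} {N : LB S} {f : Q ⟶ S}

/-- the section over a base change -/
def bsec (σ : T ⟶ Q) (hσ : σ ≫ q = 𝟙 T) {T' : Scheme.{u}} (a : T' ⟶ T) : T' ⟶ pullback q a :=
  pullback.lift (a ≫ σ) (𝟙 _) (by rw [assoc, hσ, comp_id, id_comp])

lemma bsec_fst (σ : T ⟶ Q) (hσ : σ ≫ q = 𝟙 T) {T' : Scheme.{u}} (a : T' ⟶ T) : bsec σ hσ a ≫ pullback.fst q a = a ≫ σ :=
  pullback.lift_fst _ _ _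
lemma bsec_snd (σ : T ⟶ Q) (hσ : σ ≫ q = 𝟙 T) {T' : Scheme.{u}} (a : T' ⟶ T) : bsec σ hσ a ≫ pullback.snd q a = 𝟙 _ :=
  pullback.lift_snd _ _ _

lemma bsec_map (σ : T ⟶ Q) (hσ : σ ≫ q = 𝟙 T) {T' T₀ : Scheme.{u}} {a : T' ⟶ T} {a₀ : T₀ ⟶ T} {β : T₀ ⟶ T'} (e : β ≫ a = a₀)
    (h : pullback.fst q a₀ ≫ q = (pullback.snd q a₀ ≫ β) ≫ a) :
    bsec σ hσ a₀ ≫ pullback.lift (pullback.fst q a₀) (pullback.snd q a₀ ≫ β) h = β ≫ bsec σ hσ a := by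
  apply pullback.hom_ext
  · rw [assoc, assoc, pullback.lift_fst, bsec_fst, bsec_fst, reassoc_of% e]
  · rw [assoc, assoc, pullback.lift_snd, ← assoc, bsec_snd, bsec_snd, id_comp, comp_id]

lemma TA.norm [IsIntegral X] [IsProper sX] (x : Spk k ⟶ X)
    (hx : x ≫ sX = 𝟙 _) (H : IsPullback p q sX sT) {σ : T ⟶ Q} (hσ : σ ≫ q = 𝟙 T) {r : Sec N (σ ≫ f) ⊤} (hr : r.IsGen)
    {T' : Scheme.{u}} {a : T' ⟶ T} (e : a ≫ σ ≫ f = bsec σ hσ a ≫ pullback.fst q a ≫ f) (h : TA q N f a) :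
    ∃ h : Sec N (pullback.fst q a ≫ f) ⊤, h.IsGen ∧ h.pull (bsec σ hσ a) rfl (le_pre_top : ⊤ ≤ _) = r.pull a e le_pre_top := by
  have R : IsRig (pullback.snd q a) (bsec σ hσ a) := isRig_of_proper x hx (((IsPullback.of_hasPullback q a).flip.paste_vert H.flip).flip)
    (pullback.lift_snd _ _ _)
  obtain ⟨h, hg⟩ := h
  exact norm_exists_top R (hr.pull _ _ _) hg

lemma norm_compat [IsIntegral X] [IsProper sX] (x : Spk k ⟶ X)
    (hx : x ≫ sX = 𝟙 _) (H : IsPullback p q sX sT) {σ : T ⟶ Q} (hσ : σ ≫ q = 𝟙 T) (r : Sec N (σ ≫ f) ⊤)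
    {T' T₀ : Scheme.{u}} {a : T' ⟶ T} {a₀ : T₀ ⟶ T}
    (e : a ≫ σ ≫ f = bsec σ hσ a ≫ pullback.fst q a ≫ f) (e₀ : a₀ ≫ σ ≫ f = bsec σ hσ a₀ ≫ pullback.fst q a₀ ≫ f)
    {h : Sec N (pullback.fst q a ≫ f) ⊤} {h₀ : Sec N (pullback.fst q a₀ ≫ f) ⊤} (hg : h₀.IsGen)
    (hn : h.pull (bsec σ hσ a) rfl (le_pre_top : ⊤ ≤ _) = r.pull a e le_pre_top)
    (hn₀ : h₀.pull (bsec σ hσ a₀) rfl (le_pre_top : ⊤ ≤ _) = r.pull a₀ e₀ le_pre_top)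
    {β : T₀ ⟶ T'} (eβ : β ≫ a = a₀) (eβ' : pullback.fst q a₀ ≫ q = (pullback.snd q a₀ ≫ β) ≫ a)
    (eB : pullback.lift (pullback.fst q a₀) (pullback.snd q a₀ ≫ β) eβ' ≫ pullback.fst q a ≫ f = pullback.fst q a₀ ≫ f) :
    h.pull (pullback.lift (pullback.fst q a₀) (pullback.snd q a₀ ≫ β) eβ') eB le_pre_top = h₀ := by
  have R : IsRig (pullback.snd q a₀) (bsec σ hσ a₀) := isRig_of_proper x hx (((IsPullback.of_hasPullback q a₀).flip.paste_vert H.flip).flip)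
    (pullback.lift_snd _ _ _)
  refine norm_unique_top R hg ?_
  have e1 : β ≫ bsec σ hσ a ≫ pullback.fst q a ≫ f = bsec σ hσ a₀ ≫ pullback.fst q a₀ ≫ f := by
    rw [← e, ← e₀, ← eβ, assoc]
  have e2 : (β ≫ bsec σ hσ a) ≫ pullback.fst q a ≫ f = bsec σ hσ a₀ ≫ pullback.fst q a₀ ≫ f := by
    rw [assoc, e1]
  rw [hn₀, Sec.pull_pull _ _ _ _ rfl _ (β ≫ bsec σ hσ a) (bsec_map σ hσ eβ _) e2 le_pre_top,
    ← Sec.pull_pull (bsec σ hσ a) rfl (le_pre_top : ⊤ ≤ _) β e1 le_pre_top _ rfl, hn, Sec.pull_pull _ _ _ _ _ _ _ eβ]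

lemma nb_surj {O : T.Opens} (hO : IsAffineOpen O) (I : Ideal Γ(T, O)) : Function.Surjective (pl (nb hO I) (le_nb hO I)) := fun y => by
  obtain ⟨c, hc⟩ := Ideal.Quotient.mk_surjective ((sp (A := Γ(T, O) ⧸ I)).symm y)
  exact ⟨c, by rw [pl_nb, hc, RingEquiv.apply_symm_apply]⟩

lemma nb_ker {O : T.Opens} (hO : IsAffineOpen O) (I : Ideal Γ(T, O)) (c) : pl (nb hO I) (le_nb hO I) c = 0 ↔ c ∈ I := by
  rw [pl_nb, EmbeddingLike.map_eq_zero_iff, Ideal.Quotient.eq_zero_iff_mem]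

theorem T4 [IsIntegral X] [IsProper sX] (x : Spk k ⟶ X)
    (hx : x ≫ sX = 𝟙 _) (H : IsPullback p q sX sT) {σ : T ⟶ Q} (hσ : σ ≫ q = 𝟙 T) {r : Sec N (σ ≫ f) ⊤} (hr : r.IsGen)
    {O : T.Opens} (hO : IsAffineOpen O) [IsNoetherianRing Γ(T, O)] (I : Ideal Γ(T, O))
    (h : ∀ n, TA q N f (nb hO (I ^ (n + 1)))) :
    ∃ g : Sec N f (q ⁻¹ᵁ O), (g.pull (pullback.fst q (nb hO (I ^ (0 + 1)))) rfl
      (le_pre_comp pullback.condition (le_pre_of_comp rfl (le_nb hO _) le_pre_top)) : Sec N _ ⊤).IsGen := by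
  have : CompactSpace X := QuasiCompact.compactSpace_of_compactSpace sX
  obtain ⟨m, U, hU, hne, hc⟩ := exists_affine_cover X
  obtain ⟨j0, -⟩ := hc (genericPoint X)
  have e : ∀ n, nb hO (I ^ (n + 1)) ≫ σ ≫ f = bsec σ hσ (nb hO (I ^ (n + 1))) ≫ pullback.fst q _ ≫ f := fun n => by
    rw [bsec, pullback.lift_fst_assoc, assoc]
  choose h hg hn using fun n => (h n).norm x hx H hσ hr (e n)
  have hle : ∀ n, I ^ (n + 1) ≤ I ^ (0 + 1) := fun n => Ideal.pow_le_pow_right (by omega)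
  have eβ : ∀ n, Spec.map (CommRingCat.ofHom (Ideal.Quotient.factor (hle n))) ≫ nb hO _ = nb hO _ := fun n => nb_factor hO (hle n)
  have eB' : ∀ n, pullback.lift (pullback.fst q (nb hO (I ^ (0 + 1)))) (pullback.snd q (nb hO (I ^ (0 + 1))) ≫ Spec.map (CommRingCat.ofHom (Ideal.Quotient.factor (hle n))))
      (by rw [assoc, eβ n, pullback.condition]) ≫ pullback.fst q (nb hO (I ^ (n + 1))) ≫ f = pullback.fst q (nb hO (I ^ (0 + 1))) ≫ f :=
    fun n => by rw [pullback.lift_fst_assoc]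
  have H' : ∀ n, IsPullback (pullback.fst q (nb hO (I ^ (n + 1))) ≫ p) (pullback.snd q _) sX (nb hO (I ^ (n + 1)) ≫ sT) := fun n =>
    ((IsPullback.of_hasPullback q _).flip.paste_vert H.flip).flip
  have key := T4core H U hU hne hc j0 hO I (N := N) (f := f) (T' := fun n => Spec (CommRingCat.of (Γ(T, O) ⧸ I ^ (n + 1))))
    (Q' := fun n => pullback q (nb hO (I ^ (n + 1)))) (sT' := fun n => nb hO (I ^ (n + 1)) ≫ sT)
    (p' := fun n => pullback.fst q (nb hO (I ^ (n + 1))) ≫ p) (q' := fun n => pullback.snd q _) H'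
    (a := fun n => nb hO (I ^ (n + 1))) (j := fun n => pullback.fst q _) (fun n => rfl) (fun n => rfl) (fun n => pullback.condition)
    (fun n => isAffineOpen_top _) (fun n => le_nb hO _) h eβ (fun n => pullback.lift_fst _ _ _) (fun n => pullback.lift_snd _ _ _) eB'
  refine Exists.imp (fun g hg' => by rw [hg']; exact hg 0) (key (fun n => ?_) (fun n y => ?_) (fun n c => ?_))
  · exact norm_compat x hx H hσ _ (e n) (e 0) (hg 0) (hn n) (hn 0) (eβ n) _ (eB' n)
  · exact nb_surj hO _ y
  · exact nb_ker hO _ c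

lemma closure_triv {O : T.Opens} (hq : IsClosedMap q) (g : Sec N f (q ⁻¹ᵁ O)) {T' : Scheme.{u}} (a : T' ⟶ T)
    {h : ⊤ ≤ pullback.fst q a ⁻¹ᵁ (q ⁻¹ᵁ O)} (hg : (g.pull (pullback.fst q a) rfl h : Sec N _ ⊤).IsGen) :
    ∃ O' ≤ O, (∀ t ∈ O, t ∈ Set.range a → t ∈ O') ∧ TrivOver N f q O' := by
  have h1 := Sec.le_nv_of_isGen_pull g _ _ _ hg
  let F : T.Opens := ⟨(q '' (g.nv : Set Q)ᶜ)ᶜ, (hq _ g.nv.2.isClosed_compl).isOpen_compl⟩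
  refine ⟨O ⊓ F, inf_le_left, fun t ht htr => ⟨ht, ?_⟩, g.res (le_pre_mono le_rfl inf_le_left), ?_⟩
  · rintro ⟨y, hy, rfl⟩
    obtain ⟨s, hs⟩ := htr
    obtain ⟨z, hz, -⟩ := Scheme.Pullback.exists_preimage_pullback (f := q) (g := a) y s hs.symm
    refine hy ?_
    rw [← hz]
    exact h1 (show z ∈ ⊤ from trivial)
  · refine Sec.isGen_of_le_nv g ?_ _
    intro y hy
    by_contra hn
    exact hy.2 ⟨y, hn, rfl⟩

theorem T4' [IsIntegral X] [IsProper sX] (x : Spk k ⟶ X)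
    (hx : x ≫ sX = 𝟙 _) (H : IsPullback p q sX sT) {σ : T ⟶ Q} (hσ : σ ≫ q = 𝟙 T) {r : Sec N (σ ≫ f) ⊤} (hr : r.IsGen)
    {O : T.Opens} (hO : IsAffineOpen O) [IsNoetherianRing Γ(T, O)] (I : Ideal Γ(T, O))
    (h : ∀ n, TA q N f (nb hO (I ^ (n + 1)))) :
    ∃ O' ≤ O, (∀ t ∈ O, t ∈ Set.range (nb hO (I ^ (0 + 1))) → t ∈ O') ∧ TrivOver N f q O' := by
  obtain ⟨g, hg⟩ := T4 x hx H hσ hr hO I h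
  have : IsProper q := MorphismProperty.of_isPullback H inferInstance
  exact closure_triv q.isClosedMap g _ hg

end T4
end

section
section sq
variable {k : Type u} [Field k] {X T Q : Scheme.{u}}
  {sX : X ⟶ Spk k} {sT : T ⟶ Spk k}
  {p : Q ⟶ X} {q : Q ⟶ T} (H : IsPullback p q sX sT)
include H

omit H in
lemma exists_proj {k V : Type*} [Field k] [AddCommGroup V] [Module k V] (J : Submodule k V) :
    ∃ ρ : V →ₗ[k] V, (∀ v, ρ v ∈ J) ∧ ∀ v ∈ J, ρ v = v := by
  obtain ⟨g, hg⟩ := J.subtype.exists_leftInverse_of_injective J.ker_subtype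
  exact ⟨J.subtype ∘ₗ g, fun v => (g v).2, fun v hv => congrArg Subtype.val (LinearMap.congr_fun hg ⟨v, hv⟩)⟩

lemma slice_mem_J {κ : Type*} [Fintype κ] {U : κ → X.Opens} {O : T.Opens} {W : κ → Q.Opens} (hU : ∀ i, QQ (U i))
    (hO : IsAffineOpen O) (hW : ∀ i, W i = p ⁻¹ᵁ (U i) ⊓ q ⁻¹ᵁ O)
    (D : Submodule k (∀ i, Sct sX (U i))) (u : ∀ i, Γ(Q, W i))
    (h : ∀ l : ∀ i, Sct sX (U i) →ₗ[k] k, (∀ d ∈ D, ∑ i, l i (d i) = 0) →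
      ∑ i, slice H (hU i) hO (hW i) (l i) (u i) = 0)
    (J : Submodule k (Sct sT O)) (hJ : ∀ i l, toS sT O (slice H (hU i) hO (hW i) l (u i)) ∈ J) :
    ∃ (n : ℕ) (d : Fin n → D) (c : Fin n → Γ(T, O)), (∀ m, toS sT O (c m) ∈ J) ∧ ∀ i,
      u i = ∑ m, pl p (hWl (hW i)) ((toS sX (U i)).symm ((d m).1 i)) * pl q (hWr (hW i)) (c m) := by
  obtain ⟨n, d, c, hc⟩ := slice_mem H hU hO hW D u h
  obtain ⟨ρ, hρ, hρ'⟩ := exists_proj J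
  refine ⟨n, d, fun m => (toS sT O).symm (ρ (toS sT O (c m))), fun m => by rw [RingEquiv.apply_symm_apply]; exact hρ _, fun i => ?_⟩
  rw [← sub_eq_zero]
  refine slice_zero H (hU i) hO (hW i) _ fun l => ?_
  rw [map_sub, sub_eq_zero]
  have h1 := hρ' _ (hJ i l)
  rw [map_sum]
  simp_rw [slice_mk]
  apply (toS sT O).injective
  rw [← h1, hc i, map_sum]
  simp_rw [slice_mk]
  rw [map_sum, map_sum, map_sum]
  refine sum_congr rfl fun m _ => ?_
  rw [← smul_toS, map_smul, ← smul_toS, RingEquiv.apply_symm_apply, RingEquiv.apply_symm_apply]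

lemma slice_add_fun {κ : Type*} [Fintype κ] {U : X.Opens} {O : T.Opens} {W : Q.Opens} (hU : QQ U) (hO : IsAffineOpen O)
    (hW : W = p ⁻¹ᵁ U ⊓ q ⁻¹ᵁ O) (l l' : κ → Sct sX U →ₗ[k] k) (h : ∀ d, ∑ i, l i d = ∑ i, l' i d) (u : Γ(Q, W)) :
    ∑ i, slice H hU hO hW (l i) u = ∑ i, slice H hU hO hW (l' i) u := by
  refine bx_induction H hU hO hW (P := fun u => ∑ i, slice H hU hO hW (l i) u = ∑ i, slice H hU hO hW (l' i) u)
    (fun u v hu hv => ?_) (fun a c => ?_) u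
  · simp only [map_add, Finset.sum_add_distrib, hu, hv]
  · simp only [slice_mk]
    rw [← Finset.sum_mul, ← Finset.sum_mul, ← map_sum, ← map_sum, h]

omit H in
/-- square zero thickenings on an affine open -/
structure SqZ {T' T : Scheme.{u}} (j : T' ⟶ T) (O : T.Opens) (O' : T'.Opens) (h : O' ≤ j ⁻¹ᵁ O) : Prop where
  aff : IsAffineOpen O
  aff' : IsAffineOpen O'
  surj : Function.Surjective (pl j h)
  sq : ∀ a b, pl j h a = 0 → pl j h b = 0 → a * b = 0

variable {T' Q' : Scheme.{u}} {sT' : T' ⟶ Spk k} {p' : Q' ⟶ X} {q' : Q' ⟶ T'}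
    (H' : IsPullback p' q' sX sT') {j : T' ⟶ T} {J : Q' ⟶ Q} (eh : j ≫ sT = sT') (e1 : J ≫ p = p')
    (e2 : J ≫ q = q' ≫ j) {O : T.Opens} {O' : T'.Opens} {hO : O' ≤ j ⁻¹ᵁ O} (Z : SqZ j O O' hO)
include H' eh Z

omit H eh in
lemma SqZ.bx_surj {U : X.Opens} (hU : QQ U) : Function.Surjective (pl J (Bx.le e1 e2 hO : Bx p' q' U O' ≤ _)) := by
  intro u
  refine bx_induction H' hU Z.aff' Bx.eq (P := fun u => ∃ a, pl J (Bx.le e1 e2 hO : Bx p' q' U O' ≤ _) a = u) ?_ (fun a c => ?_) u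
  · rintro _ _ ⟨a, rfl⟩ ⟨b, rfl⟩
    exact ⟨a + b, map_add _ _ _⟩
  · obtain ⟨c, rfl⟩ := Z.surj c
    refine ⟨pl p Bx.l a * pl q Bx.r c, ?_⟩
    rw [map_mul, pl_comp e1 _ _ Bx.l, pl_comp e2 _ _ (le_pre_pre hO Bx.r), pl_pl]

lemma SqZ.slice_ker {U : X.Opens} (hU : QQ U) (u : Γ(Q, Bx p q U O)) (hu : pl J (Bx.le e1 e2 hO : Bx p' q' U O' ≤ _) u = 0) (l) :
    pl j hO (slice H hU Z.aff Bx.eq l u) = 0 := by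
  rw [pl_slice H hU Z.aff Bx.eq H' eh e1 e2 Z.aff' Bx.eq hO (Bx.le e1 e2 hO), hu, map_zero]

/-- the kernel as a subspace -/
def SqZ.ker (_Z : SqZ j O O' hO) (eh : j ≫ sT = sT') : Submodule k (Sct sT O) := LinearMap.ker (plL eh hO).toLinearMap

lemma SqZ.ker_expand {U : X.Opens} (hU : QQ U) (u : Γ(Q, Bx p q U O)) (hu : pl J (Bx.le e1 e2 hO : Bx p' q' U O' ≤ _) u = 0) :
    ∃ (n : ℕ) (a : Fin n → Γ(X, U)) (c : Fin n → Γ(T, O)), (∀ i, pl j hO (c i) = 0) ∧ u = ∑ i, pl p Bx.l (a i) * pl q Bx.r (c i) := by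
  obtain ⟨n, d, c, hc, h⟩ := slice_mem_J H (κ := Unit) (U := fun _ => U) (W := fun _ => Bx p q U O) (fun _ => hU) Z.aff (fun _ => Bx.eq) ⊤
    (fun _ => u) (fun l hl => by
      have : ∀ i, l i = 0 := fun i => LinearMap.ext fun a => by simpa using hl (fun _ => a) trivial
      refine Finset.sum_eq_zero fun i _ => ?_
      rw [this, slice_zero_fun]) (Z.ker eh) (fun i l => Z.slice_ker H H' eh e1 e2 hU u hu l)
  exact ⟨n, fun m => (toS sX U).symm ((d m).1 ()), c, hc, h ()⟩

lemma SqZ.bx_sq {U : X.Opens} (hU : QQ U) (u v : Γ(Q, Bx p q U O)) (hu : pl J (Bx.le e1 e2 hO : Bx p' q' U O' ≤ _) u = 0)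
    (hv : pl J (Bx.le e1 e2 hO : Bx p' q' U O' ≤ _) v = 0) : u * v = 0 := by
  obtain ⟨n, a, c, hc, rfl⟩ := Z.ker_expand H H' eh e1 e2 hU u hu
  obtain ⟨n', a', c', hc', rfl⟩ := Z.ker_expand H H' eh e1 e2 hU v hv
  rw [Finset.sum_mul_sum]
  refine Finset.sum_eq_zero fun i _ => Finset.sum_eq_zero fun i' _ => ?_
  rw [mul_mul_mul_comm, ← map_mul, ← map_mul, Z.sq _ _ (hc i) (hc' i'), map_zero, mul_zero]

lemma SqZ.bx {U : X.Opens} (hU : IsAffineOpen U) : SqZ J (Bx p q U O) (Bx p' q' U O') (Bx.le e1 e2 hO) :=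
  ⟨box_affine H hU Z.aff Bx.eq, box_affine H' hU Z.aff' Bx.eq, Z.bx_surj H' e1 e2 (QQ.affine hU),
    Z.bx_sq H H' eh e1 e2 (QQ.affine hU)⟩
end sq

section lift
variable {S T T' : Scheme.{u}} {N : LB S} {f : T ⟶ S} {f' : T' ⟶ S} {j : T' ⟶ T} (e : j ≫ f = f') {O : T.Opens} {O' : T'.Opens} {hO : O' ≤ j ⁻¹ᵁ O} (Z : SqZ j O O' hO)
include Z

lemma SqZ.lift (s : Sec N f' O') : ∃ σ : Sec N f O, σ.pull j e hO = s := by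
  obtain ⟨n, σ, τ, hst⟩ := exists_dual_basis N f Z.aff
  choose c hc using fun a => Z.surj (pair s ((τ a).pull j e hO))
  refine ⟨∑ a, c a • σ a, ?_⟩
  rw [Sec.pull_sum, sum_pair_smul Finset.univ (fun a => (σ a).pull j e hO) (fun a => (τ a).pull j e hO) (by
    simp_rw [pair_pull]; rw [← map_sum, hst, map_one]) s]
  exact sum_congr rfl fun a _ => by rw [Sec.pull_smul, hc]

lemma SqZ.lift_gen [Surjective j] (hO' : j ⁻¹ᵁ O ≤ O') {s : Sec N f' O'} (hs : s.IsGen) : ∃ σ : Sec N f O, σ.IsGen ∧ σ.pull j e hO = s := by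
  obtain ⟨σ, rfl⟩ := Z.lift e s
  refine ⟨σ, ?_, rfl⟩
  have h1 := σ.le_nv_of_isGen_pull j e hO hs
  have h2 : O ≤ σ.nv := fun t ht => by
    obtain ⟨t', rfl⟩ := j.surjective t
    exact h1 (hO' ht)
  have h3 := σ.isGen_of_le_nv h2 le_rfl
  rwa [Sec.res_self] at h3

omit Z in
lemma pl_eq_one {σ τ : Sec N f O} {u : Γ(T, O)} (h : τ = u • σ) {s : Sec N f' O'} (hs : s.IsGen) (h1 : σ.pull j e hO = s) (h2 : τ.pull j e hO = s) :
    pl j hO u = 1 := by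
  rw [h, Sec.pull_smul, h1] at h2
  exact hs.smul_inj (h2.trans (one_smul _ _).symm)
end lift
end

section
section OB
variable {k : Type u} [Field k] {X T Q : Scheme.{u}}
  {sX : X ⟶ Spk k} {sT : T ⟶ Spk k}
  {p : Q ⟶ X} {q : Q ⟶ T} (H : IsPullback p q sX sT)
  {T' Q' : Scheme.{u}} {sT' : T' ⟶ Spk k} {p' : Q' ⟶ X} {q' : Q' ⟶ T'}
    (H' : IsPullback p' q' sX sT') {j : T' ⟶ T} {J : Q' ⟶ Q} (eh : j ≫ sT = sT') (e1 : J ≫ p = p')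
    (e2 : J ≫ q = q' ≫ j) {n : ℕ} {U : Fin n → X.Opens} (hU : ∀ a b, QQ (U a ⊓ U b))
  {S : Scheme.{u}} {N : LB S} {f : Q ⟶ S} {f' : Q' ⟶ S} (ef : J ≫ f = f') (s : Sec N f' ⊤)
  {O : T.Opens} {O' : T'.Opens} (hO : O' ≤ j ⁻¹ᵁ O) (aff : IsAffineOpen O)

omit [Field k] in
/-- transition data -/
structure TD (U : Fin n → X.Opens) (e : ∀ a, Sec N f (Bx p q (U a) O)) (u : ∀ a b, Γ(Q, Bx p q (U a ⊓ U b) O)) : Prop where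
  gen : ∀ a, (e a).IsGen
  pb : ∀ a, (e a).pull J ef (Bx.le e1 e2 hO) = s.res le_top
  tr : ∀ a b, (e a).res (Bx.mono inf_le_left le_rfl) = u a b • (e b).res (Bx.mono inf_le_right le_rfl)

/-- obstruction relation -/
def OB (l : ∀ a b, Sct sX (U a ⊓ U b) →ₗ[k] k) (ω : Γ(T, O)) : Prop :=
  ∃ e u, TD e1 e2 ef s hO U e u ∧ ω = ∑ a, ∑ b, slice H (hU a b) aff Bx.eq (l a b) (u a b - 1)

variable {e1 e2 ef s hO aff}

lemma TD.pl_one {e : ∀ a, Sec N f (Bx p q (U a) O)} {u : ∀ a b, Γ(Q, Bx p q (U a ⊓ U b) O)} (D : TD e1 e2 ef s hO U e u)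
    (hs : s.IsGen) (a b) : pl J (Bx.le e1 e2 hO) (u a b) = 1 := by
  refine pl_eq_one (N := N) ef (D.tr a b) (hs.res (le_top : Bx p' q' (U a ⊓ U b) O' ≤ _)) ?_ ?_
  · have := congrArg (Sec.res (Bx.mono inf_le_right le_rfl : Bx p' q' (U a ⊓ U b) O' ≤ Bx p' q' (U b) O')) (D.pb b)
    rw [Sec.res_pull, Sec.res_res] at this
    rw [Sec.pull_res, this]
  · have := congrArg (Sec.res (Bx.mono inf_le_left le_rfl : Bx p' q' (U a ⊓ U b) O' ≤ Bx p' q' (U a) O')) (D.pb a)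
    rw [Sec.res_pull, Sec.res_res] at this
    rw [Sec.pull_res, this]

omit [Field k] in
lemma alg_diff {R : Type*} [CommRing R] {u u' a b : R} (h : u' * b = a * u) (h1 : (u' - 1) * (b - 1) = 0) (h2 : (a - 1) * (u - 1) = 0) :
    u' - u = (a - 1) - (b - 1) := by
  linear_combination h - h1 + h2

include H H' eh hU in
lemma TD.diff (Z : SqZ j O O' hO) {e e₁ : ∀ a, Sec N f (Bx p q (U a) O)} {u u₁ : ∀ a b, Γ(Q, Bx p q (U a ⊓ U b) O)} (D : TD e1 e2 ef s hO U e u)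
    (D₁ : TD e1 e2 ef s hO U e₁ u₁) (hs : s.IsGen) : ∃ c : ∀ a, Γ(Q, Bx p q (U a) O), ∀ a b,
    u₁ a b - u a b = rs (Bx.mono inf_le_left le_rfl) (c a) - rs (Bx.mono inf_le_right le_rfl) (c b) := by
  choose v hv using fun a => (D.gen a).exists_smul (e₁ a)
  have hv1 : ∀ a, pl J (Bx.le e1 e2 hO) (v a) = 1 := fun a =>
    pl_eq_one (N := N) ef (hv a) (hs.res (le_top : Bx p' q' (U a) O' ≤ _)) (D.pb a) (D₁.pb a)
  refine ⟨fun a => v a - 1, fun a b => ?_⟩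
  have hle : Bx p' q' (U a ⊓ U b) O' ≤ J ⁻¹ᵁ (Bx p q (U a ⊓ U b) O) := Bx.le e1 e2 hO
  have hva : pl J hle (rs (Bx.mono inf_le_left le_rfl) (v a)) = 1 := by
    have := congrArg (rs (Bx.mono inf_le_left le_rfl : Bx p' q' (U a ⊓ U b) O' ≤ Bx p' q' (U a) O')) (hv1 a)
    rw [rs_pl, map_one] at this
    rw [pl_rs, this]
  have hvb : pl J hle (rs (Bx.mono inf_le_right le_rfl) (v b)) = 1 := by
    have := congrArg (rs (Bx.mono inf_le_right le_rfl : Bx p' q' (U a ⊓ U b) O' ≤ Bx p' q' (U b) O')) (hv1 b)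
    rw [rs_pl, map_one] at this
    rw [pl_rs, this]
  rw [map_sub, map_sub, map_one, map_one]
  refine alg_diff ?_ (Z.bx_sq H H' eh e1 e2 (hU a b) _ _ ?_ ?_) (Z.bx_sq H H' eh e1 e2 (hU a b) _ _ ?_ ?_)
  · have h1 := D₁.tr a b
    rw [hv a, hv b, Sec.res_smul, Sec.res_smul, D.tr a b, smul_smul, smul_smul] at h1
    exact (((D.gen b).res _).smul_inj h1).symm
  · rw [map_sub, map_one, D₁.pl_one hs, sub_self]
  · rw [map_sub, map_one, hvb, sub_self]
  · rw [map_sub, map_one, hva, sub_self]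
  · rw [map_sub, map_one, D.pl_one hs, sub_self]

lemma slice_cob (hV : ∀ a, IsAffineOpen (U a)) {l : ∀ a b, Sct sX (U a ⊓ U b) →ₗ[k] k}
    (hl : ∀ a d, ∑ b, l a b (rsL sX inf_le_left d) = ∑ b, l b a (rsL sX inf_le_right d)) (c : ∀ a, Γ(Q, Bx p q (U a) O)) :
    ∑ a, ∑ b, slice H (hU a b) aff Bx.eq (l a b) (rs (Bx.mono inf_le_left le_rfl) (c a) - rs (Bx.mono inf_le_right le_rfl) (c b)) = 0 := by
  simp only [map_sub, Finset.sum_sub_distrib]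
  rw [sub_eq_zero, Finset.sum_comm (f := fun a b => slice H (hU a b) aff Bx.eq (l a b) (rs (Bx.mono inf_le_right le_rfl) (c b)))]
  refine sum_congr rfl fun a _ => ?_
  have h1 := slice_add_fun H (QQ.affine (hV a)) aff Bx.eq (fun b => l a b ∘ₗ (rsL sX inf_le_left).toLinearMap)
    (fun b => l b a ∘ₗ (rsL sX inf_le_right).toLinearMap) (fun d => hl a d) (c a)
  refine ((sum_congr rfl fun b _ => ?_).trans h1).trans (sum_congr rfl fun b _ => ?_)
  · rw [slice_rs H (QQ.affine (hV a)) aff Bx.eq (hU a b) Bx.eq inf_le_left (Bx.mono inf_le_left le_rfl)]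
  · rw [slice_rs H (QQ.affine (hV a)) aff Bx.eq (hU b a) Bx.eq inf_le_right (Bx.mono inf_le_right le_rfl)]

include H' eh in
lemma OB.unique (hV : ∀ a, IsAffineOpen (U a)) (Z : SqZ j O O' hO) {l : ∀ a b, Sct sX (U a ⊓ U b) →ₗ[k] k}
    (hl : ∀ a d, ∑ b, l a b (rsL sX inf_le_left d) = ∑ b, l b a (rsL sX inf_le_right d)) (hs : s.IsGen) {ω ω₁ : Γ(T, O)}
    (h : OB H e1 e2 hU ef s hO aff l ω) (h₁ : OB H e1 e2 hU ef s hO aff l ω₁) : ω₁ = ω := by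
  obtain ⟨e, u, D, rfl⟩ := h
  obtain ⟨e', u', D', rfl⟩ := h₁
  obtain ⟨c, hc⟩ := D.diff H H' eh hU Z D' hs
  have h1 := slice_cob H hU (aff := aff) hV hl c
  simp only [← hc] at h1
  rw [← sub_eq_zero, ← Finset.sum_sub_distrib]
  refine Eq.trans (sum_congr rfl fun a _ => ?_) h1
  rw [← Finset.sum_sub_distrib]
  refine sum_congr rfl fun b _ => ?_
  rw [← map_sub, sub_sub_sub_cancel_right]

include H H' eh in
lemma TD.exists (hV : ∀ a, IsAffineOpen (U a)) [Surjective J] (hO' : j ⁻¹ᵁ O ≤ O') (Z : SqZ j O O' hO) (hs : s.IsGen) :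
    ∃ e u, TD e1 e2 ef s hO U e u := by
  choose e he he' using fun a => (Z.bx H H' eh e1 e2 (hV a)).lift_gen ef (fun t ht => by
    refine ⟨?_, hO' ?_⟩
    · have := ht.1
      rw [← e1]; exact this
    · have h1 : (J ≫ q) t ∈ O := ht.2
      rw [e2] at h1
      exact h1) (hs.res (le_top : Bx p' q' (U a) O' ≤ _))
  choose u hu using fun a b => ((he b).res (Bx.mono inf_le_right le_rfl : Bx p q (U a ⊓ U b) O ≤ _)).exists_smul ((e a).res (Bx.mono inf_le_left le_rfl))
  exact ⟨e, u, he, he', hu⟩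

section pull
variable {T₂ Q₂ T₂' Q₂' : Scheme.{u}} {sT₂ : T₂ ⟶ Spk k} {p₂ : Q₂ ⟶ X} {q₂ : Q₂ ⟶ T₂} {p₂' : Q₂' ⟶ X} {q₂' : Q₂' ⟶ T₂'}
  {j₂ : T₂' ⟶ T₂} {J₂ : Q₂' ⟶ Q₂} {d1 : J₂ ≫ p₂ = p₂'} {d2 : J₂ ≫ q₂ = q₂' ≫ j₂} {f₂ : Q₂ ⟶ S} {f₂' : Q₂' ⟶ S} {ef₂ : J₂ ≫ f₂ = f₂'}
  {O₂ : T₂.Opens} {O₂' : T₂'.Opens} {hO₂ : O₂' ≤ j₂ ⁻¹ᵁ O₂} {aff₂ : IsAffineOpen O₂}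
  {h : T₂ ⟶ T} {h' : T₂' ⟶ T'} {g : Q₂ ⟶ Q} {g' : Q₂' ⟶ Q'} (E1 : g ≫ p = p₂) (E2 : g ≫ q = q₂ ≫ h)
  (E1' : g' ≫ p' = p₂') (E2' : g' ≫ q' = q₂' ≫ h') (E3 : J₂ ≫ g = g' ≫ J) (E4 : g ≫ f = f₂) (E4' : g' ≫ f' = f₂')
  (hh : O₂ ≤ h ⁻¹ᵁ O) (hh' : O₂' ≤ h' ⁻¹ᵁ O')
include E1 E2 E1' E2' E3 E4 E4' hh hh'

lemma TD.map {e : ∀ a, Sec N f (Bx p q (U a) O)} {u : ∀ a b, Γ(Q, Bx p q (U a ⊓ U b) O)} (D : TD e1 e2 ef s hO U e u) :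
    TD d1 d2 ef₂ (s.pull g' E4' le_pre_top) hO₂ U (fun a => (e a).pull g E4 (Bx.le E1 E2 hh)) (fun a b => pl g (Bx.le E1 E2 hh) (u a b)) := by
  refine ⟨fun a => (D.gen a).pull _ _ _, fun a => ?_, fun a b => ?_⟩
  · have e3 : J₂ ≫ g ≫ f = f₂' := by rw [E4, ef₂]
    rw [Sec.pull_pull g E4 (Bx.le E1 E2 hh) J₂ ef₂ (Bx.le d1 d2 hO₂) (J₂ ≫ g) rfl (by rw [assoc, e3]) (le_pre_pre (Bx.le E1 E2 hh) (Bx.le d1 d2 hO₂)),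
      ← Sec.pull_pull J ef (Bx.le e1 e2 hO) g' E4' (Bx.le E1' E2' hh') (J₂ ≫ g) E3.symm (by rw [assoc, e3]), D.pb a,
      Sec.pull_res, Sec.res_pull]
  · have := congrArg (fun z => Sec.pull g E4 z (Bx.le E1 E2 hh : Bx p₂ q₂ (U a ⊓ U b) O₂ ≤ _)) (D.tr a b)
    rw [Sec.pull_smul, Sec.pull_res, Sec.pull_res] at this
    rw [Sec.res_pull, Sec.res_pull, this]

lemma OB.map (H₂ : IsPullback p₂ q₂ sX sT₂) (E5 : h ≫ sT = sT₂) {l : ∀ a b, Sct sX (U a ⊓ U b) →ₗ[k] k} {ω : Γ(T, O)} (h₁ : OB H e1 e2 hU ef s hO aff l ω) :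
    OB H₂ d1 d2 hU ef₂ (s.pull g' E4' le_pre_top) hO₂ aff₂ l (pl h hh ω) := by
  obtain ⟨e, u, D, rfl⟩ := h₁
  refine ⟨_, _, D.map E1 E2 E1' E2' E3 E4 E4' hh hh', ?_⟩
  simp only [map_sum]
  refine sum_congr rfl fun a _ => sum_congr rfl fun b _ => ?_
  rw [pl_slice H (hU a b) aff Bx.eq H₂ E5 E1 E2 aff₂ Bx.eq hh (Bx.le E1 E2 hh), map_sub, map_one]
end pull

lemma OB.res {O₂ : T.Opens} {O₂' : T'.Opens} {hO₂ : O₂' ≤ j ⁻¹ᵁ O₂} {aff₂ : IsAffineOpen O₂} (hh : O₂ ≤ O) (hh' : O₂' ≤ O')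
    {l : ∀ a b, Sct sX (U a ⊓ U b) →ₗ[k] k} {ω : Γ(T, O)} (h₁ : OB H e1 e2 hU ef s hO aff l ω) :
    OB H e1 e2 hU ef s hO₂ aff₂ l (rs hh ω) := by
  have key := h₁.map (hO₂ := hO₂) (aff₂ := aff₂) (d1 := e1) (d2 := e2) (ef₂ := ef) H hU (h := 𝟙 T) (h' := 𝟙 T') (g := 𝟙 Q) (g' := 𝟙 Q') (id_comp _) (by rw [id_comp, comp_id])
    (id_comp _) (by rw [id_comp, comp_id]) (by rw [id_comp, comp_id])
    (id_comp _) (id_comp _) (by rw [Scheme.Hom.id_preimage]; exact hh) (by rw [Scheme.Hom.id_preimage]; exact hh') H (id_comp _)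
  rw [pl_id, Sec.pull_id, Sec.res_self] at key
  exact key

end OB
end

section
section A1
variable {k : Type u} [Field k] {X T Q : Scheme.{u}}
  {sX : X ⟶ Spk k} {sT : T ⟶ Spk k}
  {p : Q ⟶ X} {q : Q ⟶ T} (H : IsPullback p q sX sT)
  {T' Q' : Scheme.{u}} {sT' : T' ⟶ Spk k} {p' : Q' ⟶ X} {q' : Q' ⟶ T'}
    (H' : IsPullback p' q' sX sT') {j : T' ⟶ T} {J : Q' ⟶ Q} (eh : j ≫ sT = sT') {e1 : J ≫ p = p'}
    {e2 : J ≫ q = q' ≫ j} {n : ℕ} {U : Fin n → X.Opens} (hV : ∀ a, IsAffineOpen (U a)) (hU : ∀ a b, QQ (U a ⊓ U b))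
    (hcU : ∀ x, ∃ a, x ∈ U a)
  {S : Scheme.{u}} {N : LB S} {f : Q ⟶ S} {f' : Q' ⟶ S} {ef : J ≫ f = f'} {s : Sec N f' ⊤} (hs : s.IsGen)

variable (sX U) in
/-- coboundary map -/
def cobd : (∀ a, Sct sX (U a)) →ₗ[k] (∀ i : Fin n × Fin n, Sct sX (U i.1 ⊓ U i.2)) :=
  LinearMap.pi fun i => (rsL sX inf_le_left).toLinearMap ∘ₗ LinearMap.proj i.1 - (rsL sX inf_le_right).toLinearMap ∘ₗ LinearMap.proj i.2

lemma cobd_apply (d : ∀ a, Sct sX (U a)) (i) : cobd sX U d i = rsL sX inf_le_left (d i.1) - rsL sX inf_le_right (d i.2) := rfl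

lemma cobd_kill {l : ∀ a b, Sct sX (U a ⊓ U b) →ₗ[k] k} (h : ∀ d, ∑ i : Fin n × Fin n, l i.1 i.2 (cobd sX U d i) = 0) (a : Fin n) (d : Sct sX (U a)) :
    ∑ b, l a b (rsL sX inf_le_left d) = ∑ b, l b a (rsL sX inf_le_right d) := by
  classical
  have h1 := h (Pi.single a d)
  simp only [cobd_apply, map_sub, Finset.sum_sub_distrib] at h1
  rw [Fintype.sum_prod_type, Fintype.sum_prod_type_right, sub_eq_zero] at h1
  dsimp only at h1
  have h2 : ∀ F : (c : Fin n) → Sct sX (U c) →ₗ[k] k, ∑ c, F c (Pi.single (M := fun c => Sct sX (U c)) a d c) = F a d := fun F => by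
    rw [Finset.sum_eq_single a, Pi.single_eq_same]
    · intro b _ hb
      rw [Pi.single_eq_of_ne hb, map_zero]
    · simp
  have h3 := h2 fun c => ∑ b, l c b ∘ₗ (rsL sX inf_le_left).toLinearMap
  have h4 := h2 fun c => ∑ b, l b c ∘ₗ (rsL sX inf_le_right).toLinearMap
  simp only [LinearMap.sum_apply, LinearMap.comp_apply] at h3 h4
  exact (h3.symm.trans h1).trans h4

lemma alg_glue {R : Type*} [CommRing R] {u a b : R} (h : u - 1 = a - b) (h1 : a * a = 0) (h2 : a * b = 0) :
    (1 - a) * u = 1 - b := by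
  linear_combination (1 - a) * h + h2 - h1

variable {O : T.Opens} {O' : T'.Opens} {hO : O' ≤ j ⁻¹ᵁ O}

include H H' eh hU hcU hs in
lemma TD.triv (Z : SqZ j O O' hO) {e : ∀ a, Sec N f (Bx p q (U a) O)} {u : ∀ a b, Γ(Q, Bx p q (U a ⊓ U b) O)} (D : TD e1 e2 ef s hO U e u)
    (h : ∀ l : ∀ a b, Sct sX (U a ⊓ U b) →ₗ[k] k,
      (∀ a d, ∑ b, l a b (rsL sX inf_le_left d) = ∑ b, l b a (rsL sX inf_le_right d)) →
      ∑ a, ∑ b, slice H (hU a b) Z.aff Bx.eq (l a b) (u a b - 1) = 0) : TrivOver N f q O := by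
  have hone : ∀ a b, pl J (Bx.le e1 e2 hO : Bx p' q' (U a ⊓ U b) O' ≤ _) (u a b - 1) = 0 := fun a b => by
    rw [map_sub, map_one, D.pl_one hs, sub_self]
  obtain ⟨m, d, c, hc, hd⟩ := slice_mem_J H (κ := Fin n × Fin n) (U := fun i => U i.1 ⊓ U i.2) (W := fun i => Bx p q (U i.1 ⊓ U i.2) O)
    (fun i => hU i.1 i.2) Z.aff (fun _ => Bx.eq) (LinearMap.range (cobd sX U)) (fun i => u i.1 i.2 - 1) (fun l hl => by
      rw [Fintype.sum_prod_type]
      exact h (fun a b => l (a, b)) (cobd_kill fun d => hl _ ⟨d, rfl⟩)) (Z.ker eh) (fun i l => Z.slice_ker H H' eh e1 e2 (hU i.1 i.2) _ (hone _ _) l)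
  choose g hg using fun i => (d i).2
  have hc' : ∀ i, pl j hO (c i) = 0 := hc
  let γ : ∀ (V : X.Opens) (hV : ∀ i, Γ(X, V)), Γ(Q, Bx p q V O) := fun V w => ∑ i, pl p Bx.l (w i) * pl q Bx.r (c i)
  have hγ : ∀ (V : X.Opens) (w w'), γ V w * γ V w' = 0 := fun V w w' => by
    simp only [γ]
    rw [Finset.sum_mul_sum]
    refine Finset.sum_eq_zero fun i _ => Finset.sum_eq_zero fun i' _ => ?_
    rw [mul_mul_mul_comm, ← map_mul, ← map_mul, Z.sq _ _ (hc' i) (hc' i'), map_zero, mul_zero]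
  have hrs : ∀ {V V' : X.Opens} (hVV : V' ≤ V) (w), rs (Bx.mono hVV le_rfl) (γ V w) = γ V' (fun i => rs hVV (w i)) := fun hVV w => by
    simp only [γ]
    rw [map_sum]
    refine sum_congr rfl fun i _ => ?_
    rw [map_mul, rs_pl, rs_pl, pl_rs]
  let G : ∀ a, Γ(Q, Bx p q (U a) O) := fun a => γ (U a) fun i => (toS sX _).symm (g i a)
  have hdu : ∀ a b, u a b - 1 = rs (Bx.mono inf_le_left le_rfl) (G a) - rs (Bx.mono inf_le_right le_rfl) (G b) := fun a b => by
    rw [hrs, hrs, hd (a, b)]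
    simp only [γ]
    rw [← Finset.sum_sub_distrib]
    refine sum_congr rfl fun i _ => ?_
    rw [← hg, cobd_apply, map_sub, map_sub, symm_rsL, symm_rsL, sub_mul]
  have hGu : ∀ a, IsUnit (1 - G a) := fun a => by
    refine IsUnit.of_mul_eq_one (1 + G a) ?_
    have : (1 - G a) * (1 + G a) = 1 - G a * G a := by ring
    rw [this, hγ, sub_zero]
  let e' := fun a => (1 - G a) • e a
  obtain ⟨t, ht⟩ := Sec.glue_res (V := q ⁻¹ᵁ O) (fun a => Bx p q (U a) O) (fun a => Bx.r) (fun x hx => by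
    obtain ⟨a, ha⟩ := hcU (p x)
    exact ⟨a, ha, hx⟩) e' (fun a b => by
      have key : ((1 - G a) • e a).res (Bx.mono inf_le_left le_rfl : Bx p q (U a ⊓ U b) O ≤ _) = ((1 - G b) • e b).res (Bx.mono inf_le_right le_rfl) := by
        rw [Sec.res_smul, Sec.res_smul, D.tr, smul_smul, map_sub, map_sub, map_one, map_one, alg_glue (hdu a b)]
        · rw [hrs inf_le_left, hγ]
        · rw [hrs inf_le_left, hrs inf_le_right, hγ]
      have key' := congrArg (Sec.res (Bx.inf.le : Bx p q (U a) O ⊓ Bx p q (U b) O ≤ Bx p q (U a ⊓ U b) O)) key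
      rw [Sec.res_res, Sec.res_res] at key'
      exact key')
  exact ⟨t, Sec.isGen_cover (fun a => Bx p q (U a) O) (fun a => Bx.r) (fun x hx => by
    obtain ⟨a, ha⟩ := hcU (p x)
    exact ⟨a, ha, hx⟩) (fun a => by rw [ht]; exact (D.gen a).smul (hGu a))⟩

section glob
variable {B QB B' QB' : Scheme.{u}} {sB : B ⟶ Spk k} {sB' : B' ⟶ Spk k}
  {pB : QB ⟶ X} {qB : QB ⟶ B} {pB' : QB' ⟶ X} {qB' : QB' ⟶ B'} (HB : IsPullback pB qB sX sB) (HB' : IsPullback pB' qB' sX sB')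
  {b : B' ⟶ B} {JB : QB' ⟶ QB} (d1 : JB ≫ pB = pB') (d2 : JB ≫ qB = qB' ≫ b) (d3 : b ≫ sB = sB') {fB : QB ⟶ S} {fB' : QB' ⟶ S} (efB : JB ≫ fB = fB')
  {τ : B ⟶ T} {τ' : B' ⟶ T'} {g : QB ⟶ Q} {g' : QB' ⟶ Q'} (E1 : g ≫ p = pB) (E2 : g ≫ q = qB ≫ τ)
  (E1' : g' ≫ p' = pB') (E2' : g' ≫ q' = qB' ≫ τ') (E3 : JB ≫ g = g' ≫ J) (E4 : g ≫ f = fB) (E4' : g' ≫ f' = fB')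
  (E5 : τ ≫ sT = sB)
include H H' eh hV hU hcU hs HB HB' d1 d2 d3 efB E1 E2 E1' E2' E3 E4 E4' E5

theorem A1core [Surjective J] (e1 : J ≫ p = p') (e2 : J ≫ q = q' ≫ j) (ef : J ≫ f = f') {σ : T ⟶ Q} (R : IsRig q σ) {r : Sec N (σ ≫ f) ⊤} (hr : r.IsGen)
    {κ : Type*} (O : κ → T.Opens) (hcO : ∀ t, ∃ c, t ∈ O c) (Z : ∀ c, SqZ j (O c) (j ⁻¹ᵁ O c) le_rfl)
    (Z2 : ∀ c d, SqZ j (O c ⊓ O d) (j ⁻¹ᵁ (O c ⊓ O d)) le_rfl) (ZB : SqZ b ⊤ ⊤ le_pre_top) (c0 : κ) (hτ : ⊤ ≤ τ ⁻¹ᵁ O c0)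
    (hτ' : ⊤ ≤ τ' ⁻¹ᵁ (j ⁻¹ᵁ O c0)) (t : Sec N fB ⊤) (ht : t.IsGen) (hts : t.pull JB efB (le_pre_top : ⊤ ≤ _) = s.pull g' E4' (le_pre_top : ⊤ ≤ _))
    (hinj : ∀ w : Γ(T, ⊤), pl τ (le_pre_top : ⊤ ≤ _) w = 0 → w = 0) : TrivOver N f q ⊤ := by
  choose e u D using fun c => TD.exists (e1 := e1) (e2 := e2) (ef := ef) H H' eh hV le_rfl (Z c) hs
  refine triv_local R hr O (fun _ => le_top) (fun t _ => hcO t) fun c => ?_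
  refine (D c).triv H H' eh hU hcU hs (Z c) fun l hl => ?_
  let ω : ∀ c, Γ(T, O c) := fun c => ∑ a, ∑ b, slice H (hU a b) (Z c).aff Bx.eq (l a b) (u c a b - 1)
  have hω : ∀ c, OB H e1 e2 hU ef s le_rfl (Z c).aff l (ω c) := fun c => ⟨_, _, D c, rfl⟩
  obtain ⟨Ω, hΩ⟩ := rs_glue O (fun _ => le_top) (fun t _ => hcO t) ω (fun c d => by
    exact OB.unique H H' eh hU hV (Z2 c d) hl hs ((hω d).res H hU inf_le_right (le_pre_mono le_rfl inf_le_right) (aff₂ := (Z2 c d).aff))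
     ((hω c).res H hU inf_le_left (le_pre_mono le_rfl inf_le_left)))
  have h0 : OB HB d1 d2 hU efB (s.pull g' E4' (le_pre_top : ⊤ ≤ _)) (le_pre_top : ⊤ ≤ b ⁻¹ᵁ ⊤) ZB.aff l 0 := by
    refine ⟨fun a => t.res le_top, fun a b => 1, ⟨fun a => ht.res _, fun a => ?_, fun a b => ?_⟩, ?_⟩
    · rw [Sec.pull_res, ← hts, Sec.res_pull]
    · rw [one_smul, Sec.res_res, Sec.res_res]
    · simp
  have h1 := (hω c0).map (hO₂ := le_pre_top) (aff₂ := ZB.aff) (d1 := d1) (d2 := d2) (ef₂ := efB) H hU E1 E2 E1' E2' E3 E4 E4' hτ hτ' HB E5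
  have h2 := OB.unique HB HB' d3 hU hV ZB hl (hs.pull _ _ _) h0 h1
  have h3 : Ω = 0 := hinj Ω (by
    rw [← hΩ, pl_rs] at h2
    exact h2)
  have h4 := hΩ c
  rw [h3, map_zero] at h4
  exact h4.symm
end glob
end A1
end

section
section bm
variable {T Q T₁ T₂ : Scheme.{u}} (q : Q ⟶ T) {a₁ : T₁ ⟶ T} {a₂ : T₂ ⟶ T} {β : T₂ ⟶ T₁} (e : β ≫ a₁ = a₂)

/-- base change of maps -/
def bm : pullback q a₂ ⟶ pullback q a₁ := pullback.lift (pullback.fst q a₂) (pullback.snd q a₂ ≫ β) (by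
  rw [pullback.condition, assoc, e])

lemma bm_fst : bm q e ≫ pullback.fst q a₁ = pullback.fst q a₂ := pullback.lift_fst _ _ _
lemma bm_snd : bm q e ≫ pullback.snd q a₁ = pullback.snd q a₂ ≫ β := pullback.lift_snd _ _ _

lemma bm_pb : IsPullback (bm q e) (pullback.snd q a₂) (pullback.snd q a₁) β := by
  have h := IsPullback.of_hasPullback q a₂
  subst e
  refine IsPullback.of_right (t := IsPullback.of_hasPullback q a₁) ?_ (bm_snd q rfl)
  rw [bm_fst]
  exact h

lemma bm_surj [Surjective β] : Surjective (bm q e) := MorphismProperty.of_isPullback (bm_pb q e).flip inferInstance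

lemma bm_bm {T₃ : Scheme.{u}} {a₃ : T₃ ⟶ T} {γ : T₃ ⟶ T₂} (e' : γ ≫ a₂ = a₃) {δ : T₃ ⟶ T₁} (e'' : δ ≫ a₁ = a₃) (h : γ ≫ β = δ) :
    bm q e' ≫ bm q e = bm q e'' := by
  apply pullback.hom_ext
  · rw [assoc, bm_fst, bm_fst, bm_fst]
  · rw [assoc, bm_snd, reassoc_of% bm_snd q e', bm_snd, h]
end bm

lemma pb_paste {X T Q B : Scheme.{u}} {p : Q ⟶ X} {q : Q ⟶ T} {sX : X ⟶ B} {sT : T ⟶ B} (H : IsPullback p q sX sT) {T' : Scheme.{u}} (a : T' ⟶ T)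
    {sT' : T' ⟶ B} (e : a ≫ sT = sT') : IsPullback (pullback.fst q a ≫ p) (pullback.snd q a) sX sT' := by
  subst e
  exact ((IsPullback.of_hasPullback q a).flip.paste_vert H.flip).flip

lemma SqZ.congr {T' T : Scheme.{u}} {j : T' ⟶ T} {O P : T.Opens} {O' P' : T'.Opens} {h : O' ≤ j ⁻¹ᵁ O} (Z : SqZ j O O' h) (e : P = O) (e' : P' = O') (h' : P' ≤ j ⁻¹ᵁ P) :
    SqZ j P P' h' := by
  subst e e'
  exact Z

lemma IsRig.inj_top {Q T : Scheme.{u}} {q : Q ⟶ T} {σ : T ⟶ Q} (R : IsRig q σ) (w : Γ(Q, ⊤)) (h : pl σ (le_pre_top : ⊤ ≤ _) w = 0) : w = 0 := by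
  have h1 := R.eq ⊤ (le_sec R.sec _) (rs le_top w)
  rw [pl_rs, h, map_zero] at h1
  have h2 := congrArg (rs (le_pre_top : ⊤ ≤ q ⁻¹ᵁ ⊤)) h1
  rwa [rs_rs, rs_self, map_zero] at h2

section A1
variable {k : Type u} [Field k] {X Y Z T Q : Scheme.{u}}
  {sX : X ⟶ Spk k} {sY : Y ⟶ Spk k} {sZ : Z ⟶ Spk k} {sT : T ⟶ Spk k}
  {p : Q ⟶ X} {q : Q ⟶ T} {pY : T ⟶ Y} {qT : T ⟶ Z} {S : Scheme.{u}} {N : LB S} {f : Q ⟶ S}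

/-- square-zero on boxes of `Y × B` -/
lemma SqZ.prod (HT : IsPullback pY qT sY sZ) {B B' : Scheme.{u}} {c : B ⟶ Z} {c' : B' ⟶ Z} {b : B' ⟶ B} (e : b ≫ c = c') (ZB : SqZ b ⊤ ⊤ le_pre_top) {V : Y.Opens} (hV : IsAffineOpen V)
    {P : (pullback qT c).Opens} (hP : P = Bx (pullback.fst qT c ≫ pY) (pullback.snd qT c) V ⊤) :
    SqZ (bm qT e) P (bm qT e ⁻¹ᵁ P) le_rfl := by
  have h := ZB.bx (pb_paste HT c rfl) (pb_paste HT c' rfl) (J := bm qT e) (by rw [← e, assoc])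
    (by rw [← assoc, bm_fst]) (bm_snd qT e) hV
  refine h.congr hP ?_ _
  subst hP
  ext t
  constructor
  · rintro ⟨h1, -⟩
    refine ⟨?_, trivial⟩
    change (bm qT e ≫ pullback.fst qT c ≫ pY) t ∈ V at h1
    rwa [← assoc, bm_fst] at h1
  · rintro ⟨h1, -⟩
    refine ⟨?_, trivial⟩
    change (bm qT e ≫ pullback.fst qT c ≫ pY) t ∈ V
    rwa [← assoc, bm_fst]

theorem A1 [IsIntegral X] [IsProper sX] (x : Spk k ⟶ X) (hx : x ≫ sX = 𝟙 _)
    [IsIntegral Y] [IsProper sY] (y : Spk k ⟶ Y) (hy : y ≫ sY = 𝟙 _)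
    (H : IsPullback p q sX sT) (HT : IsPullback pY qT sY sZ) {σ : T ⟶ Q} (hσ : σ ≫ q = 𝟙 T) {r : Sec N (σ ≫ f) ⊤} (hr : r.IsGen)
    {τ : Z ⟶ T} (hτ : τ ≫ qT = 𝟙 Z) (hτ' : τ ≫ pY = sZ ≫ y)
    {B B' : Scheme.{u}} (c : B ⟶ Z) {c' : B' ⟶ Z} (b : B' ⟶ B) [Surjective b] (e : b ≫ c = c') (ZB : SqZ b ⊤ ⊤ le_pre_top)
    (hB : TA q N f (c ≫ τ)) (hB' : TA q N f (pullback.fst qT c')) : TA q N f (pullback.fst qT c) := by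
  have : CompactSpace X := QuasiCompact.compactSpace_of_compactSpace sX
  obtain ⟨n, U, hU, -, hc⟩ := exists_affine_cover X
  have ebs : ∀ {T' : Scheme.{u}} (a : T' ⟶ T), a ≫ σ ≫ f = bsec σ hσ a ≫ pullback.fst q a ≫ f := fun a => by
    rw [← assoc (bsec σ hσ a), bsec_fst, assoc]
  obtain ⟨t, ht, htn⟩ := TA.norm x hx H hσ hr (ebs _) hB
  obtain ⟨s, hs, hsn⟩ := TA.norm x hx H hσ hr (ebs _) hB'
  have hB'' : TA q N f (c' ≫ τ) := hB.comp b (by rw [← e, assoc])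
  obtain ⟨t', ht', htn'⟩ := TA.norm x hx H hσ hr (ebs _) hB''
  let a := pullback.fst qT c
  let a' := pullback.fst qT c'
  let τB := bsec τ hτ c
  let τB' := bsec τ hτ c'
  have eb : b ≫ c ≫ τ = c' ≫ τ := by rw [← e, assoc]
  have ej : bm qT e ≫ a = a' := bm_fst qT e
  have eτ : τB ≫ a = c ≫ τ := bsec_fst τ hτ c
  have eτ' : τB' ≫ a' = c' ≫ τ := bsec_fst τ hτ c'
  have hj : Surjective (bm qT e) := bm_surj qT e
  have hJ : Surjective (bm q ej) := bm_surj q ej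
  have hd : b ≫ τB = τB' ≫ bm qT e := (bsec_map τ hτ e _).symm
  have hts : t.pull (bm q eb) (by rw [← assoc, bm_fst]) (le_pre_top : ⊤ ≤ _) = s.pull (bm q eτ') (by rw [← assoc, bm_fst]) (le_pre_top : ⊤ ≤ _) :=
    (norm_compat x hx H hσ r (ebs _) (ebs _) ht' htn htn' eb _ _).trans (norm_compat x hx H hσ r (ebs _) (ebs _) ht' hsn htn' eτ' _ _).symm
  have hR : IsRig (pullback.snd q a) (bsec σ hσ a) := isRig_of_proper x hx (pb_paste H a rfl) (bsec_snd σ hσ a)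
  have hRT : IsRig (pullback.snd qT c) τB := isRig_of_proper y hy (pb_paste HT c rfl) (bsec_snd τ hτ c)
  have hyV : ∃ V : Y.Opens, IsAffineOpen V ∧ ⊤ ≤ y ⁻¹ᵁ V := by
    obtain ⟨V, hV, hyV, -⟩ := exists_isAffineOpen_mem_and_subset (U := (⊤ : Y.Opens)) (x := y (IsLocalRing.closedPoint k)) trivial
    exact ⟨V, hV, fun w _ => by rw [Subsingleton.elim w (IsLocalRing.closedPoint k)]; exact hyV⟩
  obtain ⟨V₀, hV₀, hyV₀⟩ := hyV
  have hτ0 : ⊤ ≤ τB ⁻¹ᵁ (Bx (a ≫ pY) (pullback.snd qT c) V₀ ⊤) := fun w _ => by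
    refine ⟨?_, trivial⟩
    change (τB ≫ a ≫ pY) w ∈ V₀
    have : τB ≫ a ≫ pY = c ≫ sZ ≫ y := by rw [← hτ', reassoc_of% eτ]
    rw [this]
    exact hyV₀ (x := (c ≫ sZ) w) trivial
  have key := A1core (pb_paste H a rfl) (pb_paste H a' rfl) (j := bm qT e) (by rw [← ej, assoc]) hU
    (fun i i' => QQ.affine (inf_affine (sX := sX) (hU i) (hU i'))) hc hs (pb_paste H (c ≫ τ) rfl) (pb_paste H (c' ≫ τ) rfl)
    (b := b) (JB := bm q eb) (by rw [← assoc, bm_fst]) (bm_snd q eb) (by rw [← eb]; simp only [assoc])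
    (fB := pullback.fst q (c ≫ τ) ≫ f) (by rw [← assoc, bm_fst]) (τ := τB) (τ' := τB') (g := bm q eτ) (g' := bm q eτ')
    (by rw [← assoc, bm_fst]) (bm_snd q eτ) (by rw [← assoc, bm_fst]) (bm_snd q eτ') (J := bm q ej)
    (by
      have h1 : (τB' ≫ bm qT e) ≫ a = c' ≫ τ := by rw [assoc, ej, eτ']
      rw [bm_bm q eτ eb h1 hd, bm_bm q ej eτ' h1 rfl])
    (f := pullback.fst q a ≫ f) (by rw [← assoc, bm_fst]) (by rw [← assoc, bm_fst]) (by rw [← eτ, assoc])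
    (by rw [← assoc, bm_fst]) (bm_snd q ej) (by rw [← assoc, bm_fst]) hR (hr.pull a (ebs a) le_pre_top)
    (κ := {V : Y.Opens // IsAffineOpen V}) (fun V => Bx (a ≫ pY) (pullback.snd qT c) V.1 ⊤) (fun w => by
      obtain ⟨V, hV, hyV, -⟩ := exists_isAffineOpen_mem_and_subset (U := (⊤ : Y.Opens)) (x := (a ≫ pY) w) trivial
      exact ⟨⟨V, hV⟩, hyV, trivial⟩) (fun V => SqZ.prod HT e ZB V.2 rfl)
    (fun V V' => SqZ.prod HT e ZB (inf_affine (sX := sY) V.2 V'.2) Bx.inf) ZB ⟨V₀, hV₀⟩ hτ0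
    (by
      have h1 : ⊤ ≤ (b ≫ τB) ⁻¹ᵁ (Bx (a ≫ pY) (pullback.snd qT c) V₀ ⊤) := le_pre_of_comp rfl hτ0 le_pre_top
      rw [hd] at h1
      exact h1) t ht hts (hRT.inj_top)
  obtain ⟨h, hg⟩ := key
  exact ⟨h.res le_pre_top, hg.res _⟩
end A1
end

section
lemma mem_range_nb {T : Scheme.{u}} {O : T.Opens} (hO : IsAffineOpen O) (I : Ideal Γ(T, O)) (t : T) :
    t ∈ Set.range (nb hO I) ↔ t ∈ O ∧ ∀ c ∈ I, t ∉ T.basicOpen c := by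
  have h1 : Set.range (Spec.map (CommRingCat.ofHom (Ideal.Quotient.mk I))) = PrimeSpectrum.zeroLocus (I : Set Γ(T, O)) := by
    have := range_comap_of_surjective _ (Ideal.Quotient.mk I) Ideal.Quotient.mk_surjective
    rw [Ideal.mk_ker] at this
    exact this
  have h2 : Set.range (nb hO I) = T.zeroLocus (I : Set Γ(T, O)) ∩ O := by
    rw [← hO.fromSpec_image_zeroLocus, ← h1, ← Set.range_comp]
    congr 1
  rw [h2, and_comm]
  simp [Scheme.mem_zeroLocus_iff]

lemma Spec_surj_of_nilp {A B : Type u} [CommRing A] [CommRing B] (φ : A →+* B) (hφ : Function.Surjective φ)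
    (hn : ∀ a, φ a = 0 → a * a = 0) : Surjective (Spec.map (CommRingCat.ofHom φ)) := by
  have h1 := range_comap_of_surjective _ φ hφ
  have h2 : PrimeSpectrum.zeroLocus (RingHom.ker φ : Set A) = Set.univ := by
    rw [PrimeSpectrum.zeroLocus_eq_univ_iff]
    intro a ha
    exact ⟨2, by rw [pow_two]; exact hn a ha⟩
  rw [h2] at h1
  exact ⟨Set.range_eq_univ.mp h1⟩

lemma SqZ_Spec {A B : Type u} [CommRing A] [CommRing B] (φ : A →+* B) (hφ : Function.Surjective φ)
    (hn : ∀ a b, φ a = 0 → φ b = 0 → a * b = 0) : SqZ (Spec.map (CommRingCat.ofHom φ)) ⊤ ⊤ le_pre_top := by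
  refine ⟨isAffineOpen_top _, isAffineOpen_top _, fun b => ?_, fun a b ha hb => ?_⟩
  · obtain ⟨b, rfl⟩ := (sp (A := B)).surjective b
    obtain ⟨a, rfl⟩ := hφ b
    exact ⟨sp a, pl_sp _ _ _⟩
  · obtain ⟨a, rfl⟩ := (sp (A := A)).surjective a
    obtain ⟨b, rfl⟩ := (sp (A := A)).surjective b
    rw [pl_sp, EmbeddingLike.map_eq_zero_iff] at ha hb
    rw [← map_mul, hn a b ha hb, map_zero]

lemma factor_sq {A : Type u} [CommRing A] (I : Ideal A) (n : ℕ) (h : I ^ (n + 1 + 1) ≤ I ^ (n + 1)) (a b) (ha : Ideal.Quotient.factor h a = 0) (hb : Ideal.Quotient.factor h b = 0) :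
    a * b = 0 := by
  obtain ⟨a, rfl⟩ := Ideal.Quotient.mk_surjective a
  obtain ⟨b, rfl⟩ := Ideal.Quotient.mk_surjective b
  rw [Ideal.Quotient.factor_mk, Ideal.Quotient.eq_zero_iff_mem] at ha hb
  rw [← map_mul, Ideal.Quotient.eq_zero_iff_mem]
  have := Ideal.mul_mem_mul ha hb
  rw [← pow_add] at this
  exact Ideal.pow_le_pow_right (by omega) this

section Ap
variable {k : Type u} [Field k] {X Y Z T Q : Scheme.{u}}
  {sX : X ⟶ Spk k} {sY : Y ⟶ Spk k} {sZ : Z ⟶ Spk k} {sT : T ⟶ Spk k}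
  {p : Q ⟶ X} {q : Q ⟶ T} {pY : T ⟶ Y} {qT : T ⟶ Z} {S : Scheme.{u}} {N : LB S} {f : Q ⟶ S}

lemma nb_map {O : Z.Opens} (hO : IsAffineOpen O) {W : T.Opens} (hW : IsAffineOpen W) (h : W ≤ qT ⁻¹ᵁ O) (I : Ideal Γ(Z, O)) (J : Ideal Γ(T, W))
    (hJ : I ≤ J.comap (pl qT h)) : Spec.map (CommRingCat.ofHom (Ideal.quotientMap J (pl qT h) hJ)) ≫ nb hO I = nb hW J ≫ qT := by
  have h1 := hO.SpecMap_appLE_fromSpec qT hW h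
  rw [nb, nb, assoc, ← h1, ← Spec.map_comp_assoc, ← Spec.map_comp_assoc]
  congr 2

theorem A' [IsIntegral X] [IsProper sX] (x : Spk k ⟶ X) (hx : x ≫ sX = 𝟙 _)
    [IsIntegral Y] [IsProper sY] (y : Spk k ⟶ Y) (hy : y ≫ sY = 𝟙 _)
    (H : IsPullback p q sX sT) (HT : IsPullback pY qT sY sZ) {σ : T ⟶ Q} (hσ : σ ≫ q = 𝟙 T)
    {r : Sec N (σ ≫ f) ⊤} (hr : r.IsGen)
    {τ : Z ⟶ T} (hτ : τ ≫ qT = 𝟙 Z) (hτ' : τ ≫ pY = sZ ≫ y)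
    {O : Z.Opens} (hO : IsAffineOpen O) [IsNoetherianRing Γ(Z, O)] (I : Ideal Γ(Z, O)) (hB : TA q N f τ)
    (h : TA q N f (pullback.fst qT (nb hO I))) :
    ∃ D : Z.Opens, D ≤ O ∧ (∀ z ∈ O, (∀ c ∈ I, z ∉ Z.basicOpen c) → z ∈ D) ∧ TrivOver N f q (qT ⁻¹ᵁ D) := by
  have h1 : ∀ n, TA q N f (pullback.fst qT (nb hO (I ^ (n + 1)))) := fun n => by
    induction n with
    | zero => rwa [zero_add, pow_one]
    | succ n ih =>
      have hle : I ^ (n + 1 + 1) ≤ I ^ (n + 1) := Ideal.pow_le_pow_right (by omega)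
      have := Spec_surj_of_nilp (Ideal.Quotient.factor hle) (Ideal.Quotient.factor_surjective hle) (fun a ha => factor_sq I n hle a a ha ha)
      exact A1 x hx y hy H HT hσ hr hτ hτ' _ _ (nb_factor hO hle) (SqZ_Spec _ (Ideal.Quotient.factor_surjective hle) (factor_sq I n hle))
        (hB.comp _ rfl) ih
  have : IsProper qT := MorphismProperty.of_isPullback HT inferInstance
  have h2 : ∀ V : {V : Y.Opens // IsAffineOpen V}, ∃ O' : T.Opens, (∀ t, pY t ∈ V.1 → qT t ∈ O → (∀ c ∈ I, qT t ∉ Z.basicOpen c) → t ∈ O') ∧ TrivOver N f q O' := fun ⟨V, hV⟩ => by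
    have hW := box_affine HT hV hO (W := Bx pY qT V O) Bx.eq
    have : IsNoetherianRing Γ(T, Bx pY qT V O) := by
      have h3 := LocallyOfFiniteType.finiteType_appLE qT hO hW Bx.r
      letI := (qT.appLE O (Bx pY qT V O) Bx.r).hom.toAlgebra
      have : Algebra.FiniteType Γ(Z, O) Γ(T, Bx pY qT V O) := h3
      exact Algebra.FiniteType.isNoetherianRing Γ(Z, O) _
    obtain ⟨O', -, h4, h5⟩ := T4' x hx H hσ hr hW (I.map (pl qT Bx.r)) (fun n => by
      have hJ : I ^ (n + 1) ≤ ((I.map (pl qT (Bx.r (p := pY) (q := qT) (U := V) (O := O)))) ^ (n + 1)).comap (pl qT Bx.r) := by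
        rw [← Ideal.map_pow]
        exact Ideal.le_comap_map
      exact (h1 n).comp (pullback.lift _ _ (nb_map hO hW Bx.r _ _ hJ).symm) (pullback.lift_fst _ _ _))
    refine ⟨O', fun t ht ht' hc => h4 t ⟨ht, ht'⟩ ?_, h5⟩
    rw [mem_range_nb, zero_add, pow_one]
    refine ⟨⟨ht, ht'⟩, fun c hc' hm => ?_⟩
    have hmem : t ∈ Bx pY qT V O := ⟨ht, ht'⟩
    have h6 : I ≤ ((IsLocalRing.maximalIdeal (T.presheaf.stalk t)).comap (T.presheaf.germ (Bx pY qT V O) t hmem).hom).comap (pl qT Bx.r) := fun i hi => by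
      have h7 : ¬ t ∈ T.basicOpen (pl qT (Bx.r (p := pY) (q := qT) (U := V) (O := O)) i) := by
        rw [basicOpen_pl]
        exact fun hh => hc i hi hh.2
      rw [Scheme.mem_basicOpen _ _ _ hmem] at h7
      exact h7
    rw [Scheme.mem_basicOpen _ _ _ hmem] at hm
    exact Ideal.map_le_iff_le_comap.mpr h6 hc' hm
  choose O' hO' hT using h2
  have R := isRig_of_proper x hx H hσ
  let G : T.Opens := ⨆ V, O' V
  have hG : TrivOver N f q G := triv_local R hr O' (fun c => le_iSup O' c) (fun t ht => by simpa [G] using ht) hT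
  let F : Z.Opens := ⟨(qT '' (G : Set T)ᶜ)ᶜ, (qT.isClosedMap _ G.2.isClosed_compl).isOpen_compl⟩
  refine ⟨F ⊓ O, inf_le_right, fun z hz hc => ⟨?_, hz⟩, hG.mono fun t ht => ?_⟩
  · rintro ⟨t, ht, rfl⟩
    obtain ⟨V, hV, hm, -⟩ := exists_isAffineOpen_mem_and_subset (x := pY t) (U := ⊤) trivial
    exact ht (le_iSup O' ⟨V, hV⟩ (hO' ⟨V, hV⟩ t hm hz hc))
  · by_contra hn
    exact ht.1 ⟨t, hn, rfl⟩

end Ap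
end

section
section box
variable {S S' S'' : Scheme.{u}} (L : LB S) (L' : LB S') (L'' : LB S'')

def LB.box : LB (S ⨯ S') where
  ι := L.ι × L'.ι
  U i := (prod.fst : S ⨯ S' ⟶ S) ⁻¹ᵁ L.U i.1 ⊓ (prod.snd : S ⨯ S' ⟶ S') ⁻¹ᵁ L'.U i.2
  cov s := by
    obtain ⟨i, hi⟩ := L.cov ((prod.fst : S ⨯ S' ⟶ S) s)
    obtain ⟨j, hj⟩ := L'.cov ((prod.snd : S ⨯ S' ⟶ S') s)
    exact ⟨(i, j), hi, hj⟩
  g i j := L.tr prod.fst i.1 j.1 (inf_le_left.trans inf_le_left) (inf_le_right.trans inf_le_left) *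
    L'.tr prod.snd j.2 i.2 (inf_le_right.trans inf_le_right) (inf_le_left.trans inf_le_right)
  g_self i := by simp
  coc i j l := by
    simp only [map_mul, LB.rs_tr]
    rw [mul_mul_mul_comm, LB.tr_mul, mul_comm (L'.tr _ _ _ _ _), LB.tr_mul]

def LB.bi {L : LB S} {L' : LB S'} (i : L.ι) (j : L'.ι) : (L.box L').ι := (i, j)

variable {L L'} {Q Q' : Scheme.{u}} {f : Q ⟶ S} {g : Q ⟶ S'} {h : Q ⟶ S''} {V : Q.Opens}

lemma box_le {i j} {O : Q.Opens} (h1 : O ≤ f ⁻¹ᵁ L.U i) (h2 : O ≤ g ⁻¹ᵁ L'.U j) : O ≤ prod.lift f g ⁻¹ᵁ (L.box L').U (LB.bi i j) :=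
  le_pre_inf (le_pre_comp (prod.lift_fst f g) h1) (le_pre_comp (prod.lift_snd f g) h2)

lemma le_box1 {c} {O : Q.Opens} (h1 : O ≤ prod.lift f g ⁻¹ᵁ (L.box L').U c) : O ≤ f ⁻¹ᵁ L.U c.1 :=
  fun x hx => by
    have := (h1 hx).1
    have h2 := prod.lift_fst f g
    rw [← h2]
    exact this

lemma le_box2 {c} {O : Q.Opens} (h1 : O ≤ prod.lift f g ⁻¹ᵁ (L.box L').U c) : O ≤ g ⁻¹ᵁ L'.U c.2 :=
  fun x hx => by
    have := (h1 hx).2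
    have h2 := prod.lift_snd f g
    rw [← h2]
    exact this

lemma box_tr {i i' j j'} {O : Q.Opens} (h1 : O ≤ f ⁻¹ᵁ L.U i) (h1' : O ≤ f ⁻¹ᵁ L.U i') (h2 : O ≤ g ⁻¹ᵁ L'.U j) (h2' : O ≤ g ⁻¹ᵁ L'.U j') :
    (L.box L').tr (prod.lift f g) (LB.bi i j) (LB.bi i' j') (box_le h1 h2) (box_le h1' h2') = L.tr f i i' h1 h1' * L'.tr g j' j h2' h2 := by
  have e1 := LB.pl_tr L prod.fst (prod.lift f g) (prod.lift_fst f g) i i' (le_pre_inf (box_le h1 h2) (box_le h1' h2')) (inf_le_left.trans inf_le_left) (inf_le_right.trans inf_le_left) h1 h1'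
  have e2 := LB.pl_tr L' prod.snd (prod.lift f g) (prod.lift_snd f g) j' j (le_pre_inf (box_le h1 h2) (box_le h1' h2')) (inf_le_right.trans inf_le_right) (inf_le_left.trans inf_le_right) h2' h2
  exact (map_mul (pl (prod.lift f g) (le_pre_inf (box_le h1 h2) (box_le h1' h2'))) _ _).trans (congrArg₂ (· * ·) e1 e2)

def Sec.bat (σ : Sec (L.box L') (prod.lift f g) V) (i : L.ι) (j : L'.ι) {O : Q.Opens} (h1 : O ≤ f ⁻¹ᵁ L.U i) (h2 : O ≤ g ⁻¹ᵁ L'.U j) (hV : O ≤ V) : Γ(Q, O) :=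
  σ.at (LB.bi i j) (box_le h1 h2) hV

variable (σ : Sec (L.box L') (prod.lift f g) V)

lemma Sec.bat_at (c) {O : Q.Opens} (hc : O ≤ prod.lift f g ⁻¹ᵁ (L.box L').U c) (hV) : σ.at c hc hV = σ.bat c.1 c.2 (le_box1 hc) (le_box2 hc) hV := rfl

lemma Sec.rs_bat {i j} {O O' : Q.Opens} (hO : O' ≤ O) (h1 : O ≤ f ⁻¹ᵁ L.U i) (h2 : O ≤ g ⁻¹ᵁ L'.U j) (hV : O ≤ V) :
    rs hO (σ.bat i j h1 h2 hV) = σ.bat i j (hO.trans h1) (hO.trans h2) (hO.trans hV) := Sec.rs_at _ _ _ _ _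

lemma Sec.bat_tr {i i' j j'} {O : Q.Opens} (h1 : O ≤ f ⁻¹ᵁ L.U i) (h1' : O ≤ f ⁻¹ᵁ L.U i') (h2 : O ≤ g ⁻¹ᵁ L'.U j) (h2' : O ≤ g ⁻¹ᵁ L'.U j') (hV : O ≤ V) :
    σ.bat i j h1 h2 hV = L.tr f i i' h1 h1' * L'.tr g j' j h2' h2 * σ.bat i' j' h1' h2' hV := by
  rw [← box_tr h1 h1' h2 h2']
  exact Sec.at_tr _ _ _ _ _ _

lemma Sec.pull_bat {f' : Q' ⟶ S} {g' : Q' ⟶ S'} (t : Q' ⟶ Q) (e : t ≫ prod.lift f g = prod.lift f' g') {V' : Q'.Opens} (hV : V' ≤ t ⁻¹ᵁ V) {i j} {O : Q.Opens} {O' : Q'.Opens}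
    (hO : O' ≤ t ⁻¹ᵁ O) (h1 : O' ≤ f' ⁻¹ᵁ L.U i) (h2 : O' ≤ g' ⁻¹ᵁ L'.U j) (hV' : O' ≤ V') (k1 : O ≤ f ⁻¹ᵁ L.U i) (k2 : O ≤ g ⁻¹ᵁ L'.U j) (kV : O ≤ V) :
    (σ.pull t e hV).bat i j h1 h2 hV' = pl t hO (σ.bat i j k1 k2 kV) := Sec.pull_at _ _ _ _ _ _ _ _ _ _

lemma Sec.IsGen.bat {σ : Sec (L.box L') (prod.lift f g) V} (hσ : σ.IsGen) {i j} {O : Q.Opens} (h1 : O ≤ f ⁻¹ᵁ L.U i) (h2 : O ≤ g ⁻¹ᵁ L'.U j) (hV : O ≤ V) : IsUnit (σ.bat i j h1 h2 hV) := hσ _ _ _ _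

/-- builder -/
lemma Sec.bglue {κ : Type*} (O : κ → Q.Opens) (i : κ → L.ι) (j : κ → L'.ι) (h1 : ∀ c, O c ≤ f ⁻¹ᵁ L.U (i c)) (h2 : ∀ c, O c ≤ g ⁻¹ᵁ L'.U (j c))
    (hO : ∀ c, O c ≤ V) (hc : ∀ x ∈ V, ∃ c, x ∈ O c) (a : ∀ c, Γ(Q, O c))
    (hu : ∀ c d, rs (inf_le_left : O c ⊓ O d ≤ O c) (a c) =
      L.tr f (i c) (i d) (inf_le_left.trans (h1 c)) (inf_le_right.trans (h1 d)) * L'.tr g (j d) (j c) (inf_le_right.trans (h2 d)) (inf_le_left.trans (h2 c)) *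
        rs (inf_le_right : O c ⊓ O d ≤ O d) (a d)) :
    ∃ σ : Sec (L.box L') (prod.lift f g) V, ∀ c, σ.bat (i c) (j c) (h1 c) (h2 c) (hO c) = a c :=
  Sec.glue (N := L.box L') O (fun c => LB.bi (i c) (j c)) (fun c => box_le (h1 c) (h2 c)) hO hc a (fun c d => by
    rw [hu c d, box_tr])

variable (L L' f g V)
def IsoOn : Prop := ∃ σ : Sec (L.box L') (prod.lift f g) V, σ.IsGen
variable {L L' f g V}

lemma alg_quot {A : Type*} [CommRing A] {x x' y y' b b' t s s' : A} (hx : x = t * x') (hy : y = s * y') (hb : y * b = 1) (hb' : y' * b' = 1) (hs : s * s' = 1) :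
    x * b = t * s' * (x' * b') := by
  have : s' * b' = b := by
    calc s' * b' = s' * b' * (y * b) := by rw [hb, mul_one]
      _ = (s * s') * (y' * b') * b := by rw [hy]; ring
      _ = b := by rw [hs, hb']; ring
  rw [hx, ← this]; ring

lemma alg_div {A : Type*} [CommRing A] {x x' y y' b b' t s s' w : A} (hx : x = t * w * x') (hy : y = s * w * y') (hb : y * b = 1) (hb' : y' * b' = 1) (hs : s * s' = 1) :
    x * b = t * s' * (x' * b') := by
  have : s' * b' = w * b := by
    calc s' * b' = s' * b' * (y * b) := by rw [hb, mul_one]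
      _ = (s * s') * (y' * b') * (w * b) := by rw [hy]; ring
      _ = w * b := by rw [hs, hb']; ring
  calc x * b = t * x' * (w * b) := by rw [hx]; ring
    _ = t * s' * (x' * b') := by rw [← this]; ring

lemma IsoOn.refl : IsoOn L L f f V := by
  obtain ⟨σ, hσ⟩ := Sec.bglue (L := L) (L' := L) (f := f) (g := f) (V := V) (fun i : L.ι => f ⁻¹ᵁ L.U i ⊓ V) id id (fun _ => inf_le_left) (fun _ => inf_le_left) (fun _ => inf_le_right)
    (fun x hx => (L.cov' f x).imp fun i hi => ⟨hi, hx⟩) (fun _ => 1) (fun c d => by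
      rw [LB.tr_symm, map_one, map_one, mul_one])
  refine ⟨σ, Sec.isGen_loc fun x hx => ?_⟩
  obtain ⟨i, hi⟩ := L.cov' f x
  refine ⟨_, _, box_le inf_le_left inf_le_left, inf_le_right, (⟨hi, hx⟩ : x ∈ f ⁻¹ᵁ L.U i ⊓ V), ?_⟩
  exact (congrArg IsUnit (hσ i)).mpr isUnit_one

lemma Sec.quot {r : Sec L f V} {r' : Sec L' g V} (hr : r.IsGen) (hr' : r'.IsGen) : ∃ σ : Sec (L.box L') (prod.lift f g) V, σ.IsGen ∧
    ∀ i j (O : Q.Opens) (h1 : O ≤ f ⁻¹ᵁ L.U i) (h2 : O ≤ g ⁻¹ᵁ L'.U j) (hV : O ≤ V), σ.bat i j h1 h2 hV * r'.at j h2 hV = r.at i h1 hV := by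
  choose b hb using fun j => (hr' j (g ⁻¹ᵁ L'.U j ⊓ V) inf_le_left inf_le_right).exists_right_inv
  have hb' : ∀ (j) (O : Q.Opens) (hj : O ≤ g ⁻¹ᵁ L'.U j) (hV : O ≤ V), r'.at j hj hV * rs (le_inf hj hV) (b j) = 1 := fun j O hj hV => by
    have := congrArg (rs (le_inf hj hV)) (hb j)
    rwa [map_mul, map_one, Sec.rs_at] at this
  have hcv : ∀ x ∈ V, ∃ c : L.ι × L'.ι, x ∈ f ⁻¹ᵁ L.U c.1 ⊓ g ⁻¹ᵁ L'.U c.2 ⊓ V := fun x hx => by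
    obtain ⟨i, hi⟩ := L.cov' f x
    obtain ⟨j, hj⟩ := L'.cov' g x
    exact ⟨(i, j), ⟨hi, hj⟩, hx⟩
  obtain ⟨σ, hσ⟩ := Sec.bglue (L := L) (L' := L') (f := f) (g := g) (V := V) (fun c : L.ι × L'.ι => f ⁻¹ᵁ L.U c.1 ⊓ g ⁻¹ᵁ L'.U c.2 ⊓ V) Prod.fst Prod.snd
    (fun _ => inf_le_left.trans inf_le_left) (fun _ => inf_le_left.trans inf_le_right) (fun _ => inf_le_right) hcv
    (fun c => r.at c.1 (inf_le_left.trans inf_le_left) inf_le_right * rs (le_inf (inf_le_left.trans inf_le_right) inf_le_right) (b c.2)) (fun c d => by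
      rw [map_mul, map_mul, rs_rs, rs_rs, Sec.rs_at, Sec.rs_at]
      exact alg_quot (Sec.at_tr _ _ _ _ _ _) (Sec.at_tr r' _ _ _ _ (inf_le_left.trans inf_le_right)) (hb' _ _ _ _) (hb' _ _ _ _) (LB.tr_symm _ _ _ _ _ _))
  have key : ∀ i j (O : Q.Opens) (h1 : O ≤ f ⁻¹ᵁ L.U i) (h2 : O ≤ g ⁻¹ᵁ L'.U j) (hV : O ≤ V), σ.bat i j h1 h2 hV * r'.at j h2 hV = r.at i h1 hV := fun i j O h1 h2 hV => by
    have := congrArg (rs (le_inf (le_inf h1 h2) hV)) (hσ (i, j))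
    rw [Sec.rs_bat, map_mul, rs_rs, Sec.rs_at] at this
    rw [this, mul_assoc, mul_comm (rs _ _), hb', mul_one]
  refine ⟨σ, Sec.isGen_loc fun x hx => ?_, key⟩
  obtain ⟨c, hc⟩ := hcv x hx
  refine ⟨_, LB.bi c.1 c.2, box_le (inf_le_left.trans inf_le_left) (inf_le_left.trans inf_le_right), inf_le_right, hc, ?_⟩
  have := hr c.1 _ (inf_le_left.trans inf_le_left : f ⁻¹ᵁ L.U c.1 ⊓ g ⁻¹ᵁ L'.U c.2 ⊓ V ≤ _) inf_le_right
  rw [← key c.1 c.2 _ _ (inf_le_left.trans inf_le_right)] at this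
  exact isUnit_of_mul_isUnit_left this

variable {L''}

/-- composite of an isomorphism with an inverse -/
lemma IsoOn.div (hψ : IsoOn L L' f g V) (hφ : IsoOn L'' L' h g V) : IsoOn L L'' f h V := by
  obtain ⟨ψ, hψ⟩ := hψ
  obtain ⟨φ, hφ⟩ := hφ
  choose b hb using fun l j => (hφ.bat (i := l) (j := j) (O := h ⁻¹ᵁ L''.U l ⊓ g ⁻¹ᵁ L'.U j ⊓ V) (inf_le_left.trans inf_le_left) (inf_le_left.trans inf_le_right) inf_le_right).exists_right_inv
  have hb' : ∀ (l j) (O : Q.Opens) (hl : O ≤ h ⁻¹ᵁ L''.U l) (hj : O ≤ g ⁻¹ᵁ L'.U j) (hV : O ≤ V), φ.bat l j hl hj hV * rs (le_inf (le_inf hl hj) hV) (b l j) = 1 := fun l j O hl hj hV => by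
    have := congrArg (rs (le_inf (le_inf hl hj) hV)) (hb l j)
    rwa [map_mul, map_one, Sec.rs_bat] at this
  have hcv : ∀ x ∈ V, ∃ c : (L.ι × L''.ι) × L'.ι, x ∈ (f ⁻¹ᵁ L.U c.1.1 ⊓ h ⁻¹ᵁ L''.U c.1.2) ⊓ g ⁻¹ᵁ L'.U c.2 ⊓ V := fun x hx => by
    obtain ⟨i, hi⟩ := L.cov' f x
    obtain ⟨j, hj⟩ := L'.cov' g x
    obtain ⟨l, hl⟩ := L''.cov' h x
    exact ⟨((i, l), j), ⟨⟨hi, hl⟩, hj⟩, hx⟩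
  obtain ⟨σ, hσ⟩ := Sec.bglue (L := L) (L' := L'') (f := f) (g := h) (V := V) (fun c : (L.ι × L''.ι) × L'.ι => (f ⁻¹ᵁ L.U c.1.1 ⊓ h ⁻¹ᵁ L''.U c.1.2) ⊓ g ⁻¹ᵁ L'.U c.2 ⊓ V) (fun c => c.1.1) (fun c => c.1.2)
    (fun _ => inf_le_left.trans (inf_le_left.trans inf_le_left)) (fun _ => inf_le_left.trans (inf_le_left.trans inf_le_right)) (fun _ => inf_le_right) hcv
    (fun c => ψ.bat c.1.1 c.2 (inf_le_left.trans (inf_le_left.trans inf_le_left)) (inf_le_left.trans inf_le_right) inf_le_right *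
      rs (le_inf (le_inf (inf_le_left.trans (inf_le_left.trans inf_le_right)) (inf_le_left.trans inf_le_right)) inf_le_right) (b c.1.2 c.2)) (fun c d => by
      rw [map_mul, map_mul, rs_rs, rs_rs, Sec.rs_bat, Sec.rs_bat]
      exact alg_div (Sec.bat_tr _ _ _ _ _ _) (Sec.bat_tr φ _ _ _ _ (inf_le_left.trans inf_le_right)) (hb' _ _ _ _ _ _) (hb' _ _ _ _ _ _) (LB.tr_symm _ _ _ _ _ _))
  refine ⟨σ, Sec.isGen_loc fun x hx => ?_⟩
  obtain ⟨c, hc⟩ := hcv x hx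
  refine ⟨_, LB.bi c.1.1 c.1.2, box_le (inf_le_left.trans (inf_le_left.trans inf_le_left)) (inf_le_left.trans (inf_le_left.trans inf_le_right)), inf_le_right, hc, ?_⟩
  refine (congrArg IsUnit (hσ c)).mpr ((hψ.bat _ _ _).mul ?_)
  have := hb' c.1.2 c.2 _ (inf_le_left.trans (inf_le_left.trans inf_le_right) : (f ⁻¹ᵁ L.U c.1.1 ⊓ h ⁻¹ᵁ L''.U c.1.2) ⊓ g ⁻¹ᵁ L'.U c.2 ⊓ V ≤ _) (inf_le_left.trans inf_le_right) inf_le_right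
  exact IsUnit.of_mul_eq_one _ ((mul_comm _ _).trans this)

lemma IsoOn.symm (hψ : IsoOn L L' f g V) : IsoOn L' L g f V := IsoOn.refl.div hψ
lemma IsoOn.trans (hψ : IsoOn L L' f g V) (hφ : IsoOn L' L'' g h V) : IsoOn L L'' f h V := hψ.div hφ.symm

lemma IsoOn.quot {r : Sec L f V} {r' : Sec L' g V} (hr : r.IsGen) (hr' : r'.IsGen) : IsoOn L L' f g V := (Sec.quot hr hr').imp fun _ h => h.1

lemma IsoOn.pull (hψ : IsoOn L L' f g V) (t : Q' ⟶ Q) {f' : Q' ⟶ S} {g' : Q' ⟶ S'} (e1 : t ≫ f = f') (e2 : t ≫ g = g') {V' : Q'.Opens} (hV : V' ≤ t ⁻¹ᵁ V) :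
    IsoOn L L' f' g' V' := hψ.imp' (fun σ => σ.pull t (by rw [prod.comp_lift, e1, e2]) hV) (fun _ h => h.pull _ _ _)

end box
end

section
section m3
variable {k : Type u} [Field k] {X Y : Scheme.{u}} (sX : X ⟶ Spk k) (sY : Y ⟶ Spk k)
  {B B' B'' : Scheme.{u}} (sB : B ⟶ Spk k) {sB' : B' ⟶ Spk k} {sB'' : B'' ⟶ Spk k}

/-- `X × (Y × B)` -/
abbrev Q3 : Scheme.{u} := pullback sX (pullback.snd sY sB ≫ sB)

def b3 : Q3 sX sY sB ⟶ B := pullback.snd sX (pullback.snd sY sB ≫ sB) ≫ pullback.snd sY sB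

variable {sB}
lemma m2e {a : B' ⟶ B} (ea : a ≫ sB = sB') : bm sY ea ≫ pullback.snd sY sB ≫ sB = pullback.snd sY sB' ≫ sB' := by
  rw [reassoc_of% bm_snd sY ea, ea]

def m3 {a : B' ⟶ B} (ea : a ≫ sB = sB') : Q3 sX sY sB' ⟶ Q3 sX sY sB := bm sX (m2e sY ea)

lemma m3_b3 {a : B' ⟶ B} (ea : a ≫ sB = sB') : m3 sX sY ea ≫ b3 sX sY sB = b3 sX sY sB' ≫ a := by
  rw [m3, b3, b3, reassoc_of% bm_snd sX (m2e sY ea), bm_snd, assoc]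

lemma m3_pb {a : B' ⟶ B} (ea : a ≫ sB = sB') : IsPullback (m3 sX sY ea) (b3 sX sY sB') (b3 sX sY sB) a :=
  (bm_pb sX (m2e sY ea)).paste_vert (bm_pb sY ea)

lemma m3_m3 {a : B' ⟶ B} (ea : a ≫ sB = sB') {b : B'' ⟶ B'} (eb : b ≫ sB' = sB'') {c : B'' ⟶ B} (e : b ≫ a = c) (ec : c ≫ sB = sB'') :
    m3 sX sY eb ≫ m3 sX sY ea = m3 sX sY ec := bm_bm sX _ _ _ (bm_bm sY _ _ _ e)

lemma m3_ext {R : Scheme.{u}} (j : R ⟶ Q3 sX sY sB') {a a' : B' ⟶ B} (ea : a ≫ sB = sB') (ea' : a' ≫ sB = sB')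
    (h : j ≫ b3 sX sY sB' ≫ a = j ≫ b3 sX sY sB' ≫ a') : j ≫ m3 sX sY ea = j ≫ m3 sX sY ea' := by
  apply pullback.hom_ext
  · rw [assoc, assoc, m3, m3, bm_fst, bm_fst]
  · rw [assoc, assoc, m3, m3, bm_snd, bm_snd]
    apply pullback.hom_ext
    · simp only [assoc, bm_fst]
    · simp only [assoc, bm_snd]
      simpa only [b3, assoc] using h

end m3

section xs
variable {k : Type u} [Field k] {X T T' : Scheme.{u}} {sX : X ⟶ Spk k} {x : Spk k ⟶ X} (hx : x ≫ sX = 𝟙 _)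
  (s : T ⟶ Spk k)

/-- the constant section -/
def xs : T ⟶ pullback sX s := pullback.lift (s ≫ x) (𝟙 T) (by rw [assoc, hx, comp_id, id_comp])
lemma xs_fst : xs hx s ≫ pullback.fst sX s = s ≫ x := pullback.lift_fst _ _ _
lemma xs_snd : xs hx s ≫ pullback.snd sX s = 𝟙 _ := pullback.lift_snd _ _ _
variable {s}
lemma xs_bm {s' : T' ⟶ Spk k} {a : T' ⟶ T} (e : a ≫ s = s') : xs hx s' ≫ bm sX e = a ≫ xs hx s := by
  apply pullback.hom_ext
  · rw [assoc, assoc, bm_fst, xs_fst, xs_fst, reassoc_of% e]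
  · rw [assoc, assoc, bm_snd, xs_snd, reassoc_of% xs_snd hx s', comp_id]
end xs

section TAq
variable {S S' T Q T' : Scheme.{u}} {q : Q ⟶ T} {L : LB S} {L' : LB S'} {f : Q ⟶ S} {g : Q ⟶ S'} {a : T' ⟶ T}
lemma TA.quot (h : TA q L f a) (h' : TA q L' g a) : TA q (L.box L') (prod.lift f g) a := by
  obtain ⟨s, hs⟩ := h
  obtain ⟨s', hs'⟩ := h'
  rw [TA, prod.comp_lift]
  exact IsoOn.quot hs hs'

lemma TA.of_eq (L : LB S) {g : Q ⟶ S} (h : pullback.fst q a ≫ f = pullback.fst q a ≫ g) : TA q (L.box L) (prod.lift f g) a := by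
  rw [TA, prod.comp_lift, h]
  exact IsoOn.refl
end TAq
end

section
/-- the closed subscheme of a section is a point -/
lemma nb_point {B W : Scheme.{u}} [IsAffine W] {κ : B ⟶ W} {z : W ⟶ B} (hz : z ≫ κ = 𝟙 W) {O : B.Opens} (hO : IsAffineOpen O) (h : ⊤ ≤ z ⁻¹ᵁ O) :
    nb hO (RingHom.ker (pl z h)) ≫ κ ≫ z = nb hO (RingHom.ker (pl z h)) := by
  have hs : Function.Surjective (pl z h) := fun w => by
    refine ⟨rs le_top (pl κ (le_pre_top : ⊤ ≤ _) w), ?_⟩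
    rw [pl_rs, pl_comp hz _ _ (le_pre_top : ⊤ ≤ _), pl_id, rs_self]
  let φ := RingHom.quotientKerEquivOfSurjective hs
  let ν : Spec (CommRingCat.of Γ(W, ⊤)) ⟶ Spec (CommRingCat.of (Γ(B, O) ⧸ RingHom.ker (pl z h))) := Spec.map (CommRingCat.ofHom φ.toRingHom)
  have : IsIso ν := by
    have : IsIso (CommRingCat.ofHom φ.toRingHom) := (RingEquiv.toCommRingCatIso φ).isIso_hom
    exact inferInstanceAs (IsIso (Spec.map _))
  have e1 : ν ≫ nb hO (RingHom.ker (pl z h)) = (isAffineOpen_top W).fromSpec ≫ z := by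
    rw [← hO.SpecMap_appLE_fromSpec z (isAffineOpen_top W) h, nb, ← Spec.map_comp_assoc]
    rfl
  rw [← cancel_epi ν, reassoc_of% e1, reassoc_of% hz, e1]

section geo
variable {k : Type u} [Field k] {X Y Z : Scheme.{u}} {sX : X ⟶ Spk k} {sY : Y ⟶ Spk k} {sZ : Z ⟶ Spk k}
  {x : Spk k ⟶ X} (hx : x ≫ sX = 𝟙 _) {y : Spk k ⟶ Y} (hy : y ≫ sY = 𝟙 _)
  {L : LB (Q3 sX sY sZ)}

/-- trivializations along the two sections -/
structure Triv2 (L : LB (Q3 sX sY sZ)) : Prop where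
  hx : ∃ r : Sec L (xs hx (pullback.snd sY sZ ≫ sZ)) ⊤, r.IsGen
  hy : TA (pullback.snd sX (pullback.snd sY sZ ≫ sZ)) L (𝟙 _) (xs hy sZ)

variable {hx hy} (h : Triv2 hx hy L) {B : Scheme.{u}} {sB : B ⟶ Spk k} {a : B ⟶ Z} (ea : a ≫ sZ = sB)
  {a' : B ⟶ Z} (ea' : a' ≫ sZ = sB)
include h
lemma Triv2.bx : ∃ r : Sec L (xs hx (pullback.snd sY sB ≫ sB) ≫ m3 sX sY ea) ⊤, r.IsGen := by
  obtain ⟨r, hr⟩ := h.hx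
  exact ⟨r.pull (bm sY ea) (xs_bm hx (m2e sY ea)).symm (le_pre_top : ⊤ ≤ _), hr.pull _ _ _⟩

lemma Triv2.by : TA (pullback.snd sX (pullback.snd sY sB ≫ sB)) L (m3 sX sY ea) (xs hy sB) := by
  refine (h.hy.comp (c := a ≫ xs hy sZ) a rfl).use (j := pullback.fst _ _ ≫ m3 sX sY ea) (q' := pullback.snd _ _) ?_ ?_
  · rw [assoc, m3, bm_snd, pullback.condition_assoc, xs_bm hy ea]
  · rw [comp_id]

lemma Triv2.bbx : ∃ r : Sec (L.box L) (xs hx (pullback.snd sY sB ≫ sB) ≫ prod.lift (m3 sX sY ea) (m3 sX sY ea')) ⊤, r.IsGen := by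
  obtain ⟨r, hr⟩ := h.bx ea
  obtain ⟨r', hr'⟩ := h.bx ea'
  rw [prod.comp_lift]
  exact IsoOn.quot hr hr'

lemma Triv2.near [IsIntegral X] [IsProper sX] [IsIntegral Y] [IsProper sY] {W : Scheme.{u}} [IsAffine W] {κ : B ⟶ W} {z : W ⟶ B} (hz : z ≫ κ = 𝟙 W)
    (e : κ ≫ z ≫ a = a') {O : B.Opens} (hO : IsAffineOpen O) [IsNoetherianRing Γ(B, O)] (hzO : ⊤ ≤ z ⁻¹ᵁ O) (w : W) :
    ∃ D : B.Opens, z w ∈ D ∧ IsoOn L L (m3 sX sY ea) (m3 sX sY ea') (b3 sX sY sB ⁻¹ᵁ D) := by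
  obtain ⟨r, hr⟩ := h.bbx ea ea'
  obtain ⟨D, hD1, hD2, hD3⟩ := A' x hx y hy (IsPullback.of_hasPullback sX (pullback.snd sY sB ≫ sB)) (IsPullback.of_hasPullback sY sB) (xs_snd hx _) hr
    (xs_snd hy sB) (xs_fst hy sB) hO (RingHom.ker (pl z hzO)) ((h.by ea).quot (h.by ea')) (TA.of_eq L (by
      apply m3_ext
      rw [← e]
      have h1 := nb_point hz hO hzO
      simp only [b3, assoc]
      rw [pullback.condition_assoc, pullback.condition_assoc (f := pullback.snd sY sB), ← reassoc_of% h1, pullback.condition_assoc, pullback.condition_assoc (f := pullback.snd sY sB)]))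
  refine ⟨D, hD2 _ (hzO (Set.mem_univ w)) (fun c hc hm => ?_), hD3⟩
  have h2 := basicOpen_pl z hzO c
  rw [RingHom.mem_ker.mp hc, Scheme.basicOpen_zero, top_inf_eq] at h2
  have : w ∈ z ⁻¹ᵁ B.basicOpen c := hm
  rw [← h2] at this
  exact this

lemma Triv2.rig [IsIntegral X] [IsProper sX] [IsIntegral Y] [IsProper sY] : IsRig (b3 sX sY sB) (xs hy sB ≫ xs hx (pullback.snd sY sB ≫ sB)) :=
  (isRig_of_proper x hx (IsPullback.of_hasPullback _ _) (xs_snd hx _)).comp (isRig_of_proper y hy (IsPullback.of_hasPullback _ _) (xs_snd hy _))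

lemma Triv2.loc [IsIntegral X] [IsProper sX] [IsIntegral Y] [IsProper sY] {V : B.Opens} {κ : Type*} (O : κ → B.Opens) (hO : ∀ c, O c ≤ V)
    (hc : ∀ x ∈ V, ∃ c, x ∈ O c) (hh : ∀ c, IsoOn L L (m3 sX sY ea) (m3 sX sY ea') (b3 sX sY sB ⁻¹ᵁ O c)) : IsoOn L L (m3 sX sY ea) (m3 sX sY ea') (b3 sX sY sB ⁻¹ᵁ V) := by
  obtain ⟨r, hr⟩ := h.bbx ea ea'
  exact triv_local (N := L.box L) (f := prod.lift (m3 sX sY ea) (m3 sX sY ea')) h.rig (r := r.pull (xs hy sB) (assoc _ _ _).symm (le_pre_top : ⊤ ≤ _)) (hr.pull _ _ _) O hO hc hh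
end geo
end

section
section geo
variable {k : Type u} [Field k] {X Y Z W : Scheme.{u}} {sX : X ⟶ Spk k} {sY : Y ⟶ Spk k} {sZ : Z ⟶ Spk k}
  {x : Spk k ⟶ X} {hx : x ≫ sX = 𝟙 _} {y : Spk k ⟶ Y} {hy : y ≫ sY = 𝟙 _}
  {L : LB (Q3 sX sY sZ)} {sW : W ⟶ Spk k}

lemma pt_e {z : W ⟶ pullback sZ sW} (hz : z ≫ pullback.snd sZ sW = 𝟙 W) : (z ≫ pullback.fst sZ sW) ≫ sZ = sW := by
  rw [assoc, pullback.condition, reassoc_of% hz]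

lemma pt_e' {c : W ⟶ Z} (hc : c ≫ sZ = sW) : (pullback.snd sZ sW ≫ c) ≫ sZ = pullback.fst sZ sW ≫ sZ := by
  rw [assoc, hc, pullback.condition]

/-- comparison over `D` with the fibre at `z` -/
def GG (L : LB (Q3 sX sY sZ)) (z : {z : W ⟶ pullback sZ sW // z ≫ pullback.snd sZ sW = 𝟙 W}) (D : (pullback sZ sW).Opens) : Prop :=
  IsoOn L L (m3 sX sY (rfl : pullback.fst sZ sW ≫ sZ = pullback.fst sZ sW ≫ sZ)) (m3 sX sY (pt_e' (pt_e z.2))) (b3 sX sY (pullback.fst sZ sW ≫ sZ) ⁻¹ᵁ D)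

lemma GG.fib {z : {z : W ⟶ pullback sZ sW // z ≫ pullback.snd sZ sW = 𝟙 W}} {D : (pullback sZ sW).Opens} (h : GG L z D)
    (w : {z : W ⟶ pullback sZ sW // z ≫ pullback.snd sZ sW = 𝟙 W}) (hw : ⊤ ≤ w.1 ⁻¹ᵁ D) : IsoOn L L (m3 sX sY (pt_e w.2)) (m3 sX sY (pt_e z.2)) ⊤ := by
  have e : w.1 ≫ pullback.fst sZ sW ≫ sZ = sW := (assoc _ _ _).symm.trans (pt_e w.2)
  refine IsoOn.pull h (m3 sX sY e) (m3_m3 sX sY rfl e rfl _) (m3_m3 sX sY _ e ?_ _) ?_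
  · rw [reassoc_of% w.2]
  · intro t _
    change (m3 sX sY e ≫ b3 sX sY (pullback.fst sZ sW ≫ sZ)) t ∈ D
    rw [m3_b3]
    exact hw (Set.mem_univ (b3 sX sY sW t))

lemma GG.of {z t : {z : W ⟶ pullback sZ sW // z ≫ pullback.snd sZ sW = 𝟙 W}} (h : IsoOn L L (m3 sX sY (pt_e z.2)) (m3 sX sY (pt_e t.2)) ⊤) {D : (pullback sZ sW).Opens}
    (hz : GG L z D) : GG L t D := by
  have e : pullback.snd sZ sW ≫ sW = pullback.fst sZ sW ≫ sZ := pullback.condition.symm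
  refine IsoOn.trans hz (h.pull (m3 sX sY e) (m3_m3 sX sY _ e rfl _) (m3_m3 sX sY _ e rfl _) le_pre_top)

variable {K : Type u} [Field K] [IsAlgClosed K] {sK : Spk K ⟶ Spk k}

theorem geo (h : Triv2 hx hy L) [IsIntegral X] [IsProper sX] [IsIntegral Y] [IsProper sY] [LocallyOfFiniteType sZ] [ConnectedSpace (pullback sZ sK : Scheme.{u})] :
    ∃ (c : Spk K ⟶ Z) (hc : c ≫ sZ = sK),
      IsoOn L L (m3 sX sY (rfl : pullback.fst sZ sK ≫ sZ = pullback.fst sZ sK ≫ sZ)) (m3 sX sY (pt_e' hc)) ⊤ := by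
  have : LocallyOfFiniteType (pullback.snd sZ sK) := inferInstance
  have : JacobsonSpace (pullback sZ sK : Scheme.{u}) := LocallyOfFiniteType.jacobsonSpace (pullback.snd sZ sK)
  let pt := {z : Spk K ⟶ pullback sZ sK // z ≫ pullback.snd sZ sK = 𝟙 _}
  let S : pt → (pullback sZ sK).Opens := fun z => sSup {D | GG L z D}
  let o : Spec (CommRingCat.of K) := IsLocalRing.closedPoint K
  have hS : ∀ z, GG L z (S z) := fun z => h.loc _ _ (fun D : {D | GG L z D} => D.1) (fun D => le_sSup D.2) (fun x hx => by
    obtain ⟨D, hD, hx⟩ := TopologicalSpace.Opens.mem_sSup.mp hx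
    exact ⟨⟨D, hD⟩, hx⟩) (fun D => D.2)
  have hm : ∀ z : pt, z.1 o ∈ S z := fun z => by
    obtain ⟨O, hO, hzO, -⟩ := exists_isAffineOpen_mem_and_subset (U := ⊤) (x := z.1 o) trivial
    have : IsNoetherianRing Γ(pullback sZ sK, O) := by
      have := finiteType_Sct (pullback.snd sZ sK) hO
      have := Algebra.FiniteType.isNoetherianRing K (Sct (pullback.snd sZ sK) O)
      exact isNoetherianRing_of_ringEquiv _ (toS (pullback.snd sZ sK) O).symm
    obtain ⟨D, hD, hD'⟩ := h.near rfl (pt_e' (pt_e z.2)) z.2 rfl hO (pre_top_of_closedPoint z.1 hzO) o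
    exact TopologicalSpace.Opens.mem_sSup.mpr ⟨D, hD', hD⟩
  have hcl : ∀ F : Set (pullback sZ sK : Scheme.{u}), IsLocallyClosed F → F.Nonempty → ∃ z : pt, z.1 o ∈ F := fun F hF hne => by
    obtain ⟨t, ht, ht'⟩ := nonempty_inter_closedPoints hne hF
    have ht2 : IsClosed {t} := ht'
    exact ⟨⟨pointOfClosedPoint (pullback.snd sZ sK) t ht2, pointOfClosedPoint_comp _ _ _⟩, (congrArg (· ∈ F) (pointOfClosedPoint_apply _ _ ht2 _)).mpr ht⟩
  have hall : ∀ t, ∃ z, t ∈ S z := by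
    by_contra! hc
    obtain ⟨t, ht⟩ := hc
    have ho : IsOpen (⋃ z, (S z : Set (pullback sZ sK : Scheme.{u}))) := isOpen_iUnion fun z => (S z).2
    obtain ⟨z, hz⟩ := hcl (⋃ z, (S z : Set (pullback sZ sK : Scheme.{u})))ᶜ ho.isClosed_compl.isLocallyClosed ⟨t, by simpa using ht⟩
    exact hz (Set.mem_iUnion.mpr ⟨z, hm z⟩)
  have hdis : ∀ z t, ((S z : Set (pullback sZ sK : Scheme.{u})) ∩ S t).Nonempty → S z ≤ S t := fun z t hne => by
    obtain ⟨w, hw1, hw2⟩ := hcl _ ((S z).2.inter (S t).2).isLocallyClosed hne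
    have h1 := (hS z).fib w (pre_top_of_closedPoint w.1 hw1)
    have h2 := (hS t).fib w (pre_top_of_closedPoint w.1 hw2)
    exact le_sSup (GG.of (h1.symm.trans h2) (hS z))
  obtain ⟨z, -⟩ := hcl Set.univ isOpen_univ.isLocallyClosed Set.univ_nonempty
  have hc : IsClopen (S z : Set (pullback sZ sK : Scheme.{u})) := by
    refine ⟨⟨isOpen_iff_forall_mem_open.mpr fun t ht => ?_⟩, (S z).2⟩
    obtain ⟨z', hz'⟩ := hall t
    refine ⟨S z', fun s hs hs' => ht ?_, (S z').2, hz'⟩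
    exact hdis z' z ⟨s, hs, hs'⟩ hz'
  have ht : S z = ⊤ := by
    apply TopologicalSpace.Opens.ext
    exact hc.eq_univ ⟨_, hm z⟩
  have := hS z
  rw [ht] at this
  exact ⟨_, pt_e z.2, this⟩
end geo
end

section
section ws
variable {k : Type u} [Field k] {W T Q : Scheme.{u}} [CompactSpace W] [QuasiSeparatedSpace W]
  {sW : W ⟶ Spk k} {sT : T ⟶ Spk k}
  {p : Q ⟶ W} {q : Q ⟶ T} (H : IsPullback p q sW sT)

lemma hWt {O : T.Opens} : q ⁻¹ᵁ O = p ⁻¹ᵁ ⊤ ⊓ q ⁻¹ᵁ O := (top_inf_eq _).symm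

lemma pre_le {O O' : T.Opens} (h : O' ≤ O) : q ⁻¹ᵁ O' ≤ q ⁻¹ᵁ O := fun _ hx => h hx

lemma pre_rfl {O : T.Opens} : q ⁻¹ᵁ O ≤ q ⁻¹ᵁ O := le_rfl

lemma le_pre_comp' {S : Scheme.{u}} {f : T ⟶ S} {f' : Q ⟶ S} (e : q ≫ f = f') {U : S.Opens} {O : T.Opens} (h : O ≤ f ⁻¹ᵁ U) : q ⁻¹ᵁ O ≤ f' ⁻¹ᵁ U :=
  e ▸ fun _ hx => h hx

/-- slicing along an affine (or just qcqs) scheme -/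
def ws (l : Sct sW ⊤ →ₗ[k] k) {O : T.Opens} (hO : IsAffineOpen O) : Γ(Q, q ⁻¹ᵁ O) →+ Γ(T, O) :=
  slice H QQ.top hO hWt l

variable (l : Sct sW ⊤ →ₗ[k] k)

lemma ws_mul {O : T.Opens} (hO : IsAffineOpen O) (c : Γ(T, O)) (u : Γ(Q, q ⁻¹ᵁ O)) :
    ws H l hO (pl q pre_rfl c * u) = c * ws H l hO u := slice_mul H QQ.top hO hWt l c u

lemma ws_pl {O : T.Opens} (hO : IsAffineOpen O) (h1 : l (toS sW ⊤ 1) = 1) (c : Γ(T, O)) :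
    ws H l hO (pl q pre_rfl c) = c := by
  have := slice_mk H QQ.top hO hWt l 1 c
  rw [map_one, one_mul, h1, map_one, one_mul] at this
  exact this

lemma rs_ws {O O' : T.Opens} (hO : IsAffineOpen O) (hO' : IsAffineOpen O') (h : O' ≤ O) (u : Γ(Q, q ⁻¹ᵁ O)) :
    rs h (ws H l hO u) = ws H l hO' (rs (pre_le h) u) :=
  rs_slice' H QQ.top hO hO' hWt hWt h (pre_le h) l u

lemma pl_ws {T' Q' : Scheme.{u}} {sT' : T' ⟶ Spk k} {p' : Q' ⟶ W} {q' : Q' ⟶ T'}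
    (H' : IsPullback p' q' sW sT') {h : T' ⟶ T} {h' : Q' ⟶ Q} (eh : h ≫ sT = sT') (e1 : h' ≫ p = p')
    (e2 : h' ≫ q = q' ≫ h) {O : T.Opens} {O' : T'.Opens} (hO : IsAffineOpen O) (hO' : IsAffineOpen O')
    (hOO : O' ≤ h ⁻¹ᵁ O) (hWW : q' ⁻¹ᵁ O' ≤ h' ⁻¹ᵁ q ⁻¹ᵁ O) (u : Γ(Q, q ⁻¹ᵁ O)) :
    pl h hOO (ws H l hO u) = ws H' l hO' (pl h' hWW u) :=
  pl_slice H QQ.top hO hWt H' eh e1 e2 hO' hWt hOO hWW l u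

lemma ws_nz {O : T.Opens} (hO : IsAffineOpen O) (u : Γ(Q, q ⁻¹ᵁ O)) {x : Q} (hx : x ∈ Q.basicOpen u) :
    ∃ l : Sct sW ⊤ →ₗ[k] k, q x ∈ T.basicOpen (ws H l hO u) := by
  obtain ⟨n, a, c, e⟩ := bx_expand H QQ.top hO hWt u
  let D := Submodule.span k (Set.range fun i => toS sW ⊤ (a i))
  have : FiniteDimensional k D := FiniteDimensional.span_of_finite k (Set.finite_range _)
  obtain ⟨m, d, φ, hφ⟩ := fd_dual D
  have key : u = ∑ j, pl q pre_rfl (ws H (φ j) hO u) * pl p (le_pre_top : q ⁻¹ᵁ O ≤ p ⁻¹ᵁ ⊤) ((toS sW ⊤).symm (d j)) := by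
    have h1 : ∀ j, ws H (φ j) hO u = ∑ i, kal sT O (φ j (toS sW ⊤ (a i))) * c i := fun j => by
      rw [e, map_sum]
      exact sum_congr rfl fun i _ => slice_mk H QQ.top hO hWt (φ j) (a i) (c i)
    have h2 : ∀ i, a i = ∑ j, kal sW ⊤ (φ j (toS sW ⊤ (a i))) * (toS sW ⊤).symm (d j) := fun i => by
      have := congrArg (toS sW ⊤).symm (hφ (toS sW ⊤ (a i)) (Submodule.subset_span ⟨i, rfl⟩))
      rw [RingEquiv.symm_apply_apply, map_sum] at this
      rw [this]
      refine sum_congr rfl fun j _ => ?_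
      rw [symm_smul_toS, ← this]
    conv_lhs => rw [e]
    have h3 : ∀ i, pl p (hWl hWt) (a i) * pl q (hWr (hWt (p := p))) (c i) =
      ∑ j, pl q (pre_rfl (O := O)) (kal sT O (φ j (toS sW ⊤ (a i))) * c i) * pl p (le_pre_top : q ⁻¹ᵁ O ≤ p ⁻¹ᵁ ⊤) ((toS sW ⊤).symm (d j)) := fun i => by
      conv_lhs => rw [h2 i, map_sum, Finset.sum_mul]
      refine sum_congr rfl fun j _ => ?_
      rw [map_mul, map_mul, pl_kal rfl, pl_kal H.w.symm]
      rw [mul_right_comm]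
    rw [sum_congr rfl fun i _ => h3 i, Finset.sum_comm]
    refine sum_congr rfl fun j _ => ?_
    rw [h1, map_sum, Finset.sum_mul]
  have hxO : x ∈ q ⁻¹ᵁ O := Q.basicOpen_le u hx
  by_contra hcon
  push Not at hcon
  refine (IsLocalRing.mem_maximalIdeal _).mp ?_ ((Q.mem_basicOpen u x hxO).mp hx)
  rw [key, map_sum]
  refine Ideal.sum_mem _ fun j _ => ?_
  rw [map_mul]
  refine Ideal.mul_mem_right _ _ ((IsLocalRing.mem_maximalIdeal _).mpr fun hu => hcon (φ j) ?_)
  have h4 := (Q.mem_basicOpen _ x hxO).mpr hu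
  rw [basicOpen_pl] at h4
  exact h4.2

/-- slicing of sections -/
lemma Sec.ws {S : Scheme.{u}} {N : LB S} {f : T ⟶ S} {f' : Q ⟶ S} (e : q ≫ f = f') {V : T.Opens} (σ : Sec N f' (q ⁻¹ᵁ V)) :
    ∃ m : Sec N f V, ∀ (i) (O : T.Opens) (hO : IsAffineOpen O) (hi : O ≤ f ⁻¹ᵁ N.U i) (hV : O ≤ V),
      m.at i hi hV = Cub.ws H l hO (σ.at i (le_pre_comp' e hi) (pre_le hV)) := by
  let κ := { c : T.Opens × N.ι // IsAffineOpen c.1 ∧ c.1 ≤ f ⁻¹ᵁ N.U c.2 ∧ c.1 ≤ V }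
  have hc : ∀ (V' : T.Opens) (_ : V' ≤ V), ∀ x ∈ V', ∃ c : κ, c.1.1 ≤ V' ∧ x ∈ c.1.1 := fun V' hV' x hx => by
    obtain ⟨i, hi⟩ := N.cov' f x
    obtain ⟨O, hO, hxO, hle⟩ := exists_isAffineOpen_mem_and_subset (U := f ⁻¹ᵁ N.U i ⊓ V') (x := x) ⟨hi, hx⟩
    exact ⟨⟨(O, i), hO, hle.trans inf_le_left, (hle.trans inf_le_right).trans hV'⟩, hle.trans inf_le_right, hxO⟩
  have tr : ∀ (i j) (O : T.Opens) (hO : IsAffineOpen O) (hi : O ≤ f ⁻¹ᵁ N.U i) (hj : O ≤ f ⁻¹ᵁ N.U j) (hV : O ≤ V),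
      Cub.ws H l hO (σ.at i (le_pre_comp' e hi) (pre_le hV)) = N.tr f i j hi hj * Cub.ws H l hO (σ.at j (le_pre_comp' e hj) (pre_le hV)) := fun i j O hO hi hj hV => by
    rw [Sec.at_tr σ i j _ (le_pre_comp' e hj) _, ← LB.pl_tr N f q e i j pre_rfl hi hj, ws_mul]
  obtain ⟨m, hm⟩ := Sec.glue (N := N) (f := f) (V := V) (fun c : κ => c.1.1) (fun c => c.1.2) (fun c => c.2.2.1) (fun c => c.2.2.2) (fun x hx => (hc V le_rfl x hx).imp fun _ h => h.2)
    (fun c => Cub.ws H l c.2.1 (σ.at c.1.2 (le_pre_comp' e c.2.2.1) (pre_le c.2.2.2))) (fun c d => by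
      refine rs_ext (fun b : { b : κ // b.1.1 ≤ c.1.1 ⊓ d.1.1 } => b.1.1.1) (fun b => b.2) (fun x hx => ?_) fun b => ?_
      · obtain ⟨b, hb, hx⟩ := hc _ (inf_le_left.trans c.2.2.2) x hx
        exact ⟨⟨b, hb⟩, hx⟩
      · rw [map_mul, rs_rs, rs_rs, LB.rs_tr, rs_ws H l _ b.1.2.1, rs_ws H l _ b.1.2.1, Sec.rs_at, Sec.rs_at]
        exact tr _ _ _ _ _ _ b.1.2.2.2)
  refine ⟨m, fun i O hO hi hV => ?_⟩
  refine rs_ext (fun b : { b : κ // b.1.1 ≤ O } => b.1.1.1) (fun b => b.2) (fun x hx => ?_) fun b => ?_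
  · obtain ⟨b, hb, hx⟩ := hc _ hV x hx
    exact ⟨⟨b, hb⟩, hx⟩
  · rw [rs_ws H l _ b.1.2.1, Sec.rs_at, Sec.rs_at, tr i b.1.1.2 _ _ (b.2.trans hi) b.1.2.2.1 b.1.2.2.2]
    rw [Sec.at_tr m i b.1.1.2 _ b.1.2.2.1, hm b.1]
end ws
end

section
/-- geometric descent situation -/
structure DD (k : Type u) [Field k] where
  (S P G R R3 W : Scheme.{u})
  sW : W ⟶ Spk k
  sP : P ⟶ Spk k
  π : S ⟶ P
  ω : G ⟶ P
  γ : G ⟶ S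
  β : G ⟶ W
  p1 : R ⟶ S
  p2 : R ⟶ G
  d12 : R3 ⟶ R
  d13 : R3 ⟶ R
  d23 : R3 ⟶ R
  d3 : R3 ⟶ G
  hγ : γ ≫ π = ω
  HR : IsPullback p1 p2 π ω
  F0 : IsPullback β ω sW sP
  H3 : IsPullback d12 d3 (p1 ≫ π) ω
  e13 : d13 ≫ p1 = d12 ≫ p1
  e13' : d13 ≫ p2 = d3
  e23 : d23 ≫ p1 = d12 ≫ p2 ≫ γ
  e23' : d23 ≫ p2 = d3
  l0 : Sct sW ⊤ →ₗ[k] k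
  hl0 : l0 (toS sW ⊤ 1) = 1
  surj : Function.Surjective ω
  closed : IsClosedMap ω

namespace DD
variable {k : Type u} [Field k] (D : DD k)

lemma F1 : IsPullback (D.p2 ≫ D.β) D.p1 D.sW (D.π ≫ D.sP) :=
  IsPullback.paste_horiz D.HR.flip D.F0
lemma F2 : IsPullback (D.d3 ≫ D.β) D.d12 D.sW ((D.p1 ≫ D.π) ≫ D.sP) :=
  IsPullback.paste_horiz D.H3.flip D.F0

lemma l1 {V : D.P.Opens} : D.ω ⁻¹ᵁ V ≤ D.γ ⁻¹ᵁ D.π ⁻¹ᵁ V := le_pre_comp D.hγ le_rfl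
lemma l2 {V : D.P.Opens} : D.p1 ⁻¹ᵁ D.π ⁻¹ᵁ V ≤ D.p2 ⁻¹ᵁ D.ω ⁻¹ᵁ V := le_pre_comp D.HR.w.symm (by rfl)
lemma l3 {V : D.P.Opens} : D.p1 ⁻¹ᵁ D.π ⁻¹ᵁ V ≤ (D.p2 ≫ D.γ) ⁻¹ᵁ D.π ⁻¹ᵁ V := le_pre_comp (by rw [assoc, D.hγ, ← D.HR.w]) (by rfl)

lemma affs {T : Scheme.{u}} {V : T.Opens} : ∀ x ∈ V, ∃ c : { c : T.Opens // IsAffineOpen c ∧ c ≤ V }, x ∈ c.1 := fun x hx => by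
  obtain ⟨O, hO, hxO, hle⟩ := exists_isAffineOpen_mem_and_subset (U := V) (x := x) hx
  exact ⟨⟨O, hO, hle⟩, hxO⟩

variable [CompactSpace D.W] [QuasiSeparatedSpace D.W]

lemma inj_ω {V : D.P.Opens} {v v' : Γ(D.P, V)} (h : pl D.ω (pre_rfl (q := D.ω)) v = pl D.ω pre_rfl v') : v = v' := by
  refine rs_ext (fun c : { c : D.P.Opens // IsAffineOpen c ∧ c ≤ V } => c.1) (fun c => c.2.2) affs fun c => ?_
  rw [← ws_pl D.F0 D.l0 c.2.1 D.hl0 (rs c.2.2 v), ← ws_pl D.F0 D.l0 c.2.1 D.hl0 (rs c.2.2 v'), pl_rs, pl_rs]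
  have := congrArg (rs (pre_le (q := D.ω) c.2.2)) h
  rw [rs_pl, rs_pl] at this
  exact congrArg _ this

lemma inj_π {V : D.P.Opens} {v v' : Γ(D.P, V)} (h : pl D.π (pre_rfl (q := D.π)) v = pl D.π pre_rfl v') : v = v' := by
  apply D.inj_ω
  have := congrArg (pl D.γ D.l1) h
  rwa [pl_comp D.hγ _ _ pre_rfl, pl_comp D.hγ _ _ pre_rfl] at this

lemma desc_aff {V : D.P.Opens} (hV : IsAffineOpen V) (u : Γ(D.S, D.π ⁻¹ᵁ V))
    (h : pl D.p1 (pre_rfl (q := D.p1)) u = pl (D.p2 ≫ D.γ) D.l3 u) : ∃ v : Γ(D.P, V), pl D.π pre_rfl v = u := by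
  refine ⟨ws D.F0 D.l0 hV (pl D.γ D.l1 u), ?_⟩
  refine rs_ext (fun c : { c : D.S.Opens // IsAffineOpen c ∧ c ≤ _ } => c.1) (fun c => c.2.2) affs fun c => ?_
  have h1 : D.p1 ⁻¹ᵁ c.1 ≤ D.p2 ⁻¹ᵁ D.ω ⁻¹ᵁ V := (pre_le c.2.2).trans D.l2
  rw [rs_pl, pl_ws D.F0 D.l0 D.F1 rfl rfl D.HR.w.symm hV c.2.1 _ h1, pl_comp rfl _ _ ((pre_le c.2.2).trans D.l3)]
  have := congrArg (rs (pre_le (q := D.p1) c.2.2)) h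
  rw [rs_pl, rs_pl] at this
  rw [← this, ← ws_pl D.F1 D.l0 c.2.1 D.hl0 (rs c.2.2 u), pl_rs]

lemma desc_fun {V : D.P.Opens} (u : Γ(D.S, D.π ⁻¹ᵁ V))
    (h : pl D.p1 (pre_rfl (q := D.p1)) u = pl (D.p2 ≫ D.γ) D.l3 u) : ∃ v : Γ(D.P, V), pl D.π pre_rfl v = u := by
  have h1 : ∀ c : { c : D.P.Opens // IsAffineOpen c ∧ c ≤ V }, ∃ v : Γ(D.P, c.1), pl D.π pre_rfl v = rs (pre_le (q := D.π) c.2.2) u := fun c => by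
    refine D.desc_aff c.2.1 _ ?_
    have := congrArg (rs (pre_le (q := D.p1) (pre_le (q := D.π) c.2.2))) h
    rw [rs_pl, rs_pl] at this
    rw [pl_rs, pl_rs]
    exact this
  choose v hv using h1
  obtain ⟨w, hw⟩ := rs_glue (fun c : { c : D.P.Opens // IsAffineOpen c ∧ c ≤ V } => c.1) (fun c => c.2.2) affs v (fun c d => D.inj_π (by
    have e1 := congrArg (rs (pre_le (q := D.π) (inf_le_left : c.1 ⊓ d.1 ≤ c.1))) (hv c)
    have e2 := congrArg (rs (pre_le (q := D.π) (inf_le_right : c.1 ⊓ d.1 ≤ d.1))) (hv d)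
    rw [rs_pl, rs_rs] at e1 e2
    rw [pl_rs, pl_rs, e1, e2]))
  refine ⟨w, rs_ext (fun c : { c : D.P.Opens // IsAffineOpen c ∧ c ≤ V } => D.π ⁻¹ᵁ c.1) (fun c => pre_le c.2.2) (fun x hx => affs (D.π x) hx) fun c => ?_⟩
  rw [← hv, ← hw, rs_pl, pl_rs]

end DD
end

section
lemma alg_act {A : Type*} [CommRing A] {t s s' x y z y' : A} (hx : x = t * s * y) (hs : s * s' = 1) (hz : z = s' * y') : x * z = t * (y * y') := by
  calc x * z = t * (s * s') * (y * y') := by rw [hx, hz]; ring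
    _ = _ := by rw [hs, mul_one]

lemma Sec.act {S S' Q Q' : Scheme.{u}} {L : LB S} {L' : LB S'} {f : Q ⟶ S} {g : Q ⟶ S'} {V0 V : Q.Opens} (hV0 : V ≤ V0)
    (Φ : Sec (L.box L') (prod.lift f g) V0) {t : Q ⟶ Q'} {g' : Q' ⟶ S'} (e : t ≫ g' = g) {V' : Q'.Opens} (hV : V ≤ t ⁻¹ᵁ V') (s : Sec L' g' V') :
    ∃ σ : Sec L f V, ∀ (i j) (O : Q.Opens) (O' : Q'.Opens) (h1 : O ≤ f ⁻¹ᵁ L.U i) (h2 : O ≤ t ⁻¹ᵁ O') (k2 : O' ≤ g' ⁻¹ᵁ L'.U j) (v2 : O' ≤ V') (hO : O ≤ V),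
      σ.at i h1 hO = Φ.bat i j h1 (le_pre_of_comp e k2 h2) (hO.trans hV0) * pl t h2 (s.at j k2 v2) := by
  subst e
  have hk : ∀ j, t ⁻¹ᵁ (g' ⁻¹ᵁ L'.U j ⊓ V') ≤ (t ≫ g') ⁻¹ᵁ L'.U j := fun j => le_pre_pre inf_le_left le_rfl
  obtain ⟨σ, hσ⟩ := Sec.glue (N := L) (f := f) (V := V) (fun c : L.ι × L'.ι => f ⁻¹ᵁ L.U c.1 ⊓ t ⁻¹ᵁ (g' ⁻¹ᵁ L'.U c.2 ⊓ V') ⊓ V) (fun c => c.1)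
    (fun c => inf_le_left.trans inf_le_left) (fun c => inf_le_right) (fun x hx => by
      obtain ⟨i, hi⟩ := L.cov' f x
      obtain ⟨j, hj⟩ := L'.cov' g' (t x)
      exact ⟨(i, j), ⟨hi, hj, hV hx⟩, hx⟩)
    (fun c => Φ.bat c.1 c.2 (inf_le_left.trans inf_le_left) ((inf_le_left.trans inf_le_right).trans (hk _)) (inf_le_right.trans hV0) *
        pl t (inf_le_left.trans inf_le_right) (s.at c.2 inf_le_left inf_le_right)) (fun c d => by
      rw [map_mul, map_mul, rs_pl, rs_pl, Sec.rs_bat, Sec.rs_bat]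
      have h3 : f ⁻¹ᵁ L.U c.1 ⊓ t ⁻¹ᵁ (g' ⁻¹ᵁ L'.U c.2 ⊓ V') ⊓ V ⊓ (f ⁻¹ᵁ L.U d.1 ⊓ t ⁻¹ᵁ (g' ⁻¹ᵁ L'.U d.2 ⊓ V') ⊓ V) ≤ t ⁻¹ᵁ (g' ⁻¹ᵁ L'.U c.2 ⊓ V' ⊓ (g' ⁻¹ᵁ L'.U d.2 ⊓ V')) :=
        le_pre_inf (inf_le_left.trans (inf_le_left.trans inf_le_right)) (inf_le_right.trans (inf_le_left.trans inf_le_right))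
      have h4 := congrArg (pl t h3) (Sec.at_tr s c.2 d.2 (inf_le_left.trans inf_le_left) (inf_le_right.trans inf_le_left) (inf_le_left.trans inf_le_right))
      rw [map_mul, LB.pl_tr L' g' t rfl _ _ _ _ _ (le_pre_pre (inf_le_left.trans inf_le_left) h3) (le_pre_pre (inf_le_right.trans inf_le_left) h3)] at h4
      rw [← Sec.rs_at s c.2 inf_le_left inf_le_left inf_le_right, ← Sec.rs_at s d.2 inf_le_right inf_le_left inf_le_right, pl_rs, pl_rs] at h4
      exact alg_act (Sec.bat_tr Φ _ _ _ _ _) (LB.tr_symm _ _ _ _ _ _) h4)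
  refine ⟨σ, fun i j O O' h1 h2 k2 v2 hO => ?_⟩
  have h3 : O ≤ f ⁻¹ᵁ L.U i ⊓ t ⁻¹ᵁ (g' ⁻¹ᵁ L'.U j ⊓ V') ⊓ V := le_inf (le_inf h1 (le_pre_mono h2 (le_inf k2 v2))) hO
  have := congrArg (rs h3) (hσ (i, j))
  rw [map_mul, Sec.rs_at, Sec.rs_bat, rs_pl] at this
  rw [this, ← Sec.rs_at s j (le_inf k2 v2) inf_le_left inf_le_right, pl_rs]
end

section
namespace DD
variable {k : Type u} [Field k] (D : DD k) {L : LB D.S} (Φ : Sec (L.box L) (prod.lift D.p1 (D.p2 ≫ D.γ)) ⊤)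

def Inv {V : D.P.Opens} (m : Sec L (𝟙 D.S) (D.π ⁻¹ᵁ V)) : Prop :=
  ∀ (i j) (O : D.R.Opens) (O1 O2 : D.S.Opens) (h1 : O ≤ D.p1 ⁻¹ᵁ O1) (h2 : O ≤ (D.p2 ≫ D.γ) ⁻¹ᵁ O2) (k1 : O1 ≤ 𝟙 D.S ⁻¹ᵁ L.U i) (k2 : O2 ≤ 𝟙 D.S ⁻¹ᵁ L.U j)
    (v1 : O1 ≤ D.π ⁻¹ᵁ V) (v2 : O2 ≤ D.π ⁻¹ᵁ V),
    pl D.p1 h1 (m.at i k1 v1) = Φ.bat i j (le_pre_mono h1 (le_of_pre_id k1)) (le_pre_mono h2 (le_of_pre_id k2)) le_top * pl (D.p2 ≫ D.γ) h2 (m.at j k2 v2)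

def Coc : Prop := ∀ (i j l) (B : D.R3.Opens) (B12 B13 B23 : D.R.Opens) (h12 : B ≤ D.d12 ⁻¹ᵁ B12) (h13 : B ≤ D.d13 ⁻¹ᵁ B13) (h23 : B ≤ D.d23 ⁻¹ᵁ B23)
  (i12 : B12 ≤ D.p1 ⁻¹ᵁ L.U i) (j12 : B12 ≤ (D.p2 ≫ D.γ) ⁻¹ᵁ L.U j)
  (i13 : B13 ≤ D.p1 ⁻¹ᵁ L.U i) (l13 : B13 ≤ (D.p2 ≫ D.γ) ⁻¹ᵁ L.U l)
  (j23 : B23 ≤ D.p1 ⁻¹ᵁ L.U j) (l23 : B23 ≤ (D.p2 ≫ D.γ) ⁻¹ᵁ L.U l),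
  pl D.d13 h13 (Φ.bat i l i13 l13 le_top) = pl D.d12 h12 (Φ.bat i j i12 j12 le_top) * pl D.d23 h23 (Φ.bat j l j23 l23 le_top)

variable {D Φ}
lemma Inv.res {V V' : D.P.Opens} (h : V' ≤ V) {m : Sec L (𝟙 D.S) (D.π ⁻¹ᵁ V)} (hm : Inv D Φ m) : Inv D Φ (m.res (pre_le (q := D.π) h)) := fun i j O O1 O2 h1 h2 k1 k2 v1 v2 => by
  rw [Sec.res_at, Sec.res_at]
  exact hm _ _ _ _ _ _ _ _ _ _ _

variable [CompactSpace D.W] [QuasiSeparatedSpace D.W]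

lemma e13a (l) {A : D.S.Opens} {G1 : D.G.Opens} {B : D.R3.Opens} (hA : B ≤ D.d13 ⁻¹ᵁ D.p1 ⁻¹ᵁ A) (hG : B ≤ D.d3 ⁻¹ᵁ G1) (hl : G1 ≤ D.γ ⁻¹ᵁ L.U l) :
    B ≤ D.d13 ⁻¹ᵁ (D.p1 ⁻¹ᵁ A ⊓ D.p2 ⁻¹ᵁ G1) ∧ (D.p1 ⁻¹ᵁ A ⊓ D.p2 ⁻¹ᵁ G1 ≤ (D.p2 ≫ D.γ) ⁻¹ᵁ L.U l) :=
  ⟨le_pre_inf hA (le_pre_comp D.e13' hG), le_pre_pre hl inf_le_right⟩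

lemma e23a (l) {A : D.S.Opens} {G1 : D.G.Opens} {B : D.R3.Opens} (hA : B ≤ D.d23 ⁻¹ᵁ D.p1 ⁻¹ᵁ A) (hG : B ≤ D.d3 ⁻¹ᵁ G1) (hl : G1 ≤ D.γ ⁻¹ᵁ L.U l) :
    B ≤ D.d23 ⁻¹ᵁ (D.p1 ⁻¹ᵁ A ⊓ D.p2 ⁻¹ᵁ G1) ∧ (D.p1 ⁻¹ᵁ A ⊓ D.p2 ⁻¹ᵁ G1 ≤ (D.p2 ≫ D.γ) ⁻¹ᵁ L.U l) :=
  ⟨le_pre_inf hA (le_pre_comp D.e23' hG), le_pre_pre hl inf_le_right⟩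

variable (D Φ) in
/-- a section of `L` over `R` obtained from a section over `G` by the descent isomorphism -/
def IsAct {V : D.P.Opens} (e : Sec L D.γ (D.ω ⁻¹ᵁ V)) (σ : Sec L D.p1 (D.p1 ⁻¹ᵁ D.π ⁻¹ᵁ V)) : Prop :=
  ∀ (i j) (O : D.R.Opens) (O' : D.G.Opens) (h1 : O ≤ D.p1 ⁻¹ᵁ L.U i) (h2 : O ≤ D.p2 ⁻¹ᵁ O') (k2 : O' ≤ D.γ ⁻¹ᵁ L.U j) (v2 : O' ≤ D.ω ⁻¹ᵁ V) (hO : O ≤ D.p1 ⁻¹ᵁ D.π ⁻¹ᵁ V),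
      σ.at i h1 hO = Φ.bat i j h1 (le_pre_of_comp rfl k2 h2) le_top * pl D.p2 h2 (e.at j k2 v2)

lemma act_coc (hΦ : Coc D Φ) {V : D.P.Opens} {e : Sec L D.γ (D.ω ⁻¹ᵁ V)} {σ : Sec L D.p1 (D.p1 ⁻¹ᵁ D.π ⁻¹ᵁ V)} (hσ : IsAct D Φ e σ)
    {i j} {O : D.R.Opens} {O1 O2 : D.S.Opens} {B : D.R3.Opens} (h12 : B ≤ D.d12 ⁻¹ᵁ O) (h13 : B ≤ D.d13 ⁻¹ᵁ D.p1 ⁻¹ᵁ O1) (h23 : B ≤ D.d23 ⁻¹ᵁ D.p1 ⁻¹ᵁ O2)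
    (i12 : O ≤ D.p1 ⁻¹ᵁ L.U i) (j12 : O ≤ (D.p2 ≫ D.γ) ⁻¹ᵁ L.U j)
    (i13 : D.p1 ⁻¹ᵁ O1 ≤ D.p1 ⁻¹ᵁ L.U i) (v13 : D.p1 ⁻¹ᵁ O1 ≤ D.p1 ⁻¹ᵁ D.π ⁻¹ᵁ V) (j23 : D.p1 ⁻¹ᵁ O2 ≤ D.p1 ⁻¹ᵁ L.U j) (v23 : D.p1 ⁻¹ᵁ O2 ≤ D.p1 ⁻¹ᵁ D.π ⁻¹ᵁ V)
    (hv : B ≤ D.d3 ⁻¹ᵁ D.ω ⁻¹ᵁ V) :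
    pl D.d13 h13 (σ.at i i13 v13) = pl D.d12 h12 (Φ.bat i j i12 j12 le_top) * pl D.d23 h23 (σ.at j j23 v23) := by
  refine rs_ext (fun l : L.ι => B ⊓ D.d3 ⁻¹ᵁ D.γ ⁻¹ᵁ L.U l) (fun _ => inf_le_left) (fun x hx => (L.cov' D.γ (D.d3 x)).imp fun _ h => ⟨hx, h⟩) fun l => ?_
  have hG : B ⊓ D.d3 ⁻¹ᵁ D.γ ⁻¹ᵁ L.U l ≤ D.d3 ⁻¹ᵁ (D.γ ⁻¹ᵁ L.U l ⊓ D.ω ⁻¹ᵁ V) := le_pre_inf inf_le_right (inf_le_left.trans hv)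
  obtain ⟨a1, a2⟩ := e13a l (inf_le_left.trans h13) hG inf_le_left
  obtain ⟨b1, b2⟩ := e23a l (inf_le_left.trans h23) hG inf_le_left
  have ea := congrArg (pl D.d13 a1) (hσ i l _ _ (inf_le_left.trans i13) inf_le_right inf_le_left inf_le_right (inf_le_left.trans v13))
  have eb := congrArg (pl D.d23 b1) (hσ j l _ _ (inf_le_left.trans j23) inf_le_right inf_le_left inf_le_right (inf_le_left.trans v23))
  rw [map_mul, pl_comp D.e13' _ _ hG, ← Sec.rs_at σ i inf_le_left i13 v13, pl_rs] at ea
  rw [map_mul, pl_comp D.e23' _ _ hG, ← Sec.rs_at σ j inf_le_left j23 v23, pl_rs] at eb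
  rw [map_mul, rs_pl, rs_pl, rs_pl, ea, eb, hΦ i j l _ O _ _ (inf_le_left.trans h12) _ b1 i12 j12 _ _ (inf_le_left.trans j23) b2, mul_assoc]

lemma inv_ws (hΦ : Coc D Φ) {V : D.P.Opens} {e : Sec L D.γ (D.ω ⁻¹ᵁ V)} {σ : Sec L D.p1 (D.p1 ⁻¹ᵁ D.π ⁻¹ᵁ V)} (hσ : IsAct D Φ e σ) (l : Sct D.sW ⊤ →ₗ[k] k)
    {m : Sec L (𝟙 D.S) (D.π ⁻¹ᵁ V)} (hm : ∀ (i) (O : D.S.Opens) (hO : IsAffineOpen O) (hi : O ≤ 𝟙 D.S ⁻¹ᵁ L.U i) (hV : O ≤ D.π ⁻¹ᵁ V),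
      m.at i hi hV = ws D.F1 l hO (σ.at i (le_pre_comp' (comp_id _) hi) (pre_le hV))) : Inv D Φ m := by
  intro i j O O1 O2 h1 h2 k1 k2 v1 v2
  let κ := { c : D.R.Opens × D.S.Opens × D.S.Opens // IsAffineOpen c.1 ∧ IsAffineOpen c.2.1 ∧ IsAffineOpen c.2.2 ∧ c.1 ≤ O ∧ c.2.1 ≤ O1 ∧ c.2.2 ≤ O2 ∧ c.1 ≤ D.p1 ⁻¹ᵁ c.2.1 ∧ c.1 ≤ (D.p2 ≫ D.γ) ⁻¹ᵁ c.2.2 }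
  refine rs_ext (fun c : κ => c.1.1) (fun c => c.2.2.2.2.1) (fun x hx => ?_) fun c => ?_
  · obtain ⟨A1, hA1, hx1, hle1⟩ := exists_isAffineOpen_mem_and_subset (U := O1) (x := D.p1 x) (h1 hx)
    obtain ⟨A2, hA2, hx2, hle2⟩ := exists_isAffineOpen_mem_and_subset (U := O2) (x := (D.p2 ≫ D.γ) x) (h2 hx)
    obtain ⟨A, hA, hxA, hle⟩ := exists_isAffineOpen_mem_and_subset (U := O ⊓ D.p1 ⁻¹ᵁ A1 ⊓ (D.p2 ≫ D.γ) ⁻¹ᵁ A2) (x := x) ⟨⟨hx, hx1⟩, hx2⟩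
    exact ⟨⟨(A, A1, A2), hA, hA1, hA2, fun _ h => (hle h).1.1, hle1, hle2, fun _ h => (hle h).1.2, fun _ h => (hle h).2⟩, hxA⟩
  · obtain ⟨⟨A, A1, A2⟩, hA, hA1, hA2, hAO, hle1, hle2, g1, g2⟩ := c
    have f13 : D.d12 ⁻¹ᵁ A ≤ D.d13 ⁻¹ᵁ D.p1 ⁻¹ᵁ A1 := le_pre_comp D.e13 (le_pre_pre g1 le_rfl)
    have f23 : D.d12 ⁻¹ᵁ A ≤ D.d23 ⁻¹ᵁ D.p1 ⁻¹ᵁ A2 := le_pre_comp D.e23 (le_pre_pre g2 le_rfl)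
    have hv : D.d12 ⁻¹ᵁ A ≤ D.d3 ⁻¹ᵁ D.ω ⁻¹ᵁ V := le_pre_comp D.H3.w.symm (le_pre_pre (f := D.p1 ≫ D.π) (le_pre_pre (hle1.trans v1) g1) le_rfl)
    have s1 := pl_ws D.F1 l D.F2 (h := D.p1) (h' := D.d13) (assoc _ _ _).symm (by rw [← D.e13', assoc]) D.e13 hA1 hA g1 f13
      (σ.at i (le_pre_comp' (comp_id _) (hle1.trans k1)) (pre_le (hle1.trans v1)))
    have s2 := pl_ws D.F1 l D.F2 (h := D.p2 ≫ D.γ) (h' := D.d23) (by rw [assoc, reassoc_of% D.hγ, assoc, reassoc_of% D.HR.w]) (by rw [← D.e23', assoc]) D.e23 hA2 hA g2 f23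
      (σ.at j (le_pre_comp' (comp_id _) (hle2.trans k2)) (pre_le (hle2.trans v2)))
    rw [← hm i A1 hA1 (hle1.trans k1) (hle1.trans v1)] at s1
    rw [← hm j A2 hA2 (hle2.trans k2) (hle2.trans v2)] at s2
    rw [map_mul, rs_pl, rs_pl, Sec.rs_bat]
    rw [← Sec.rs_at m i hle1 k1 v1, pl_rs] at s1
    rw [← Sec.rs_at m j hle2 k2 v2, pl_rs] at s2
    rw [s1, s2, ← ws_mul]
    refine congrArg (ws D.F2 l hA) (act_coc hΦ hσ _ _ _ _ _ _ _ _ _ hv)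

end DD
end

section
lemma mem_pre_of {T T' : Scheme.{u}} {f : T ⟶ T'} {U : T'.Opens} {x : T} {y : T'} (e : f x = y) (h : y ∈ U) : x ∈ f ⁻¹ᵁ U := by
  subst e; exact h
lemma mem_of_pre {T T' : Scheme.{u}} {f : T ⟶ T'} {U : T'.Opens} {x : T} {y : T'} (e : f x = y) (h : x ∈ f ⁻¹ᵁ U) : y ∈ U := by
  subst e; exact h

lemma basicOpen_of_isUnit' {T : Scheme.{u}} {O : T.Opens} {a : Γ(T, O)} (h : IsUnit a) : T.basicOpen a = O := Scheme.basicOpen_of_isUnit T h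

lemma Sec.mem_nv_iff {T S : Scheme.{u}} {N : LB S} {f : T ⟶ S} {V : T.Opens} (σ : Sec N f V) {i} {O : T.Opens} (hi : O ≤ f ⁻¹ᵁ N.U i) (hV : O ≤ V) {x : T} (hx : x ∈ O) :
    x ∈ σ.nv ↔ x ∈ T.basicOpen (σ.at i hi hV) := by
  constructor
  · intro h
    have := (σ.isGen_of_le_nv le_rfl σ.nv_le) i (O ⊓ σ.nv) (inf_le_left.trans hi) inf_le_right
    rw [Sec.res_at, ← Sec.rs_at σ i inf_le_left hi hV] at this
    have h2 := basicOpen_of_isUnit' this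
    rw [basicOpen_rs] at h2
    have h3 : x ∈ O ⊓ σ.nv := ⟨hx, h⟩
    rw [← h2] at h3
    exact h3.2
  · intro h
    unfold Sec.at at h
    rw [basicOpen_rs] at h
    exact TopologicalSpace.Opens.mem_iSup.mpr ⟨i, h.2⟩

lemma exists_nv {T S : Scheme.{u}} (N : LB S) (f : T ⟶ S) {V : T.Opens} (hV : IsAffineOpen V) {x : T} (hx : x ∈ V) : ∃ σ : Sec N f V, x ∈ σ.nv := by
  obtain ⟨n, s, t, hst⟩ := exists_dual_basis N f hV
  obtain ⟨i, hi⟩ := N.cov' f x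
  by_contra hcon
  push Not at hcon
  have h1 : IsUnit (T.presheaf.germ V x hx (∑ a, pair (s a) (t a))) := by rw [hst, map_one]; exact isUnit_one
  refine (IsLocalRing.mem_maximalIdeal _).mp ?_ h1
  rw [map_sum]
  refine Ideal.sum_mem _ fun a _ => (IsLocalRing.mem_maximalIdeal _).mpr fun hu => hcon (s a) ?_
  have h4 := (T.mem_basicOpen _ x hx).mpr hu
  have hxO : x ∈ f ⁻¹ᵁ N.U i ⊓ V := ⟨hi, hx⟩
  rw [Sec.mem_nv_iff (s a) inf_le_left inf_le_right hxO]
  have h5 : x ∈ T.basicOpen (rs (inf_le_right : f ⁻¹ᵁ N.U i ⊓ V ≤ V) (pair (s a) (t a))) := by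
    rw [basicOpen_rs]; exact ⟨hxO, h4⟩
  rw [rs_pair (s a) (t a) i inf_le_left, Scheme.basicOpen_mul] at h5
  exact h5.1

namespace DD
variable {k : Type u} [Field k] {D : DD k} {L : LB D.S} {Φ : Sec (L.box L) (prod.lift D.p1 (D.p2 ≫ D.γ)) ⊤}

lemma exists_r {s : D.S} {g : D.G} (h : D.π s = D.ω g) : ∃ r : D.R, D.p1 r = s ∧ D.p2 r = g := by
  obtain ⟨r, h1, h2⟩ := Scheme.exists_preimage_of_isPullback D.HR s g h
  exact ⟨r, h1, h2⟩

lemma Inv.sat (hg : Φ.IsGen) {V : D.P.Opens} {m : Sec L (𝟙 D.S) (D.π ⁻¹ᵁ V)} (hm : Inv D Φ m) {s : D.S} {g : D.G} (h : D.π s = D.ω g) (hgm : D.γ g ∈ m.nv) : s ∈ m.nv := by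
  obtain ⟨r, h1, h2⟩ := exists_r h
  have hs : s ∈ D.π ⁻¹ᵁ V := by
    have h3 : D.γ g ∈ D.π ⁻¹ᵁ V := m.nv_le hgm
    have h4 : D.π (D.γ g) = D.ω g := by rw [← D.hγ]; rfl
    change D.π s ∈ V
    rw [h, ← h4]; exact h3
  obtain ⟨i, hi⟩ := L.cov' (𝟙 D.S) s
  obtain ⟨j, hj⟩ := L.cov' (𝟙 D.S) (D.γ g)
  have e := hm i j (D.p1 ⁻¹ᵁ (𝟙 D.S ⁻¹ᵁ L.U i ⊓ D.π ⁻¹ᵁ V) ⊓ (D.p2 ≫ D.γ) ⁻¹ᵁ (𝟙 D.S ⁻¹ᵁ L.U j ⊓ D.π ⁻¹ᵁ V)) _ _ inf_le_left inf_le_right inf_le_left inf_le_left inf_le_right inf_le_right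
  have hs' : s ∈ 𝟙 D.S ⁻¹ᵁ L.U i ⊓ D.π ⁻¹ᵁ V := ⟨hi, hs⟩
  have hg' : D.γ g ∈ 𝟙 D.S ⁻¹ᵁ L.U j ⊓ D.π ⁻¹ᵁ V := ⟨hj, m.nv_le hgm⟩
  have hr2 : (D.p2 ≫ D.γ) r = D.γ g := by rw [← h2]; rfl
  have hr : r ∈ D.p1 ⁻¹ᵁ (𝟙 D.S ⁻¹ᵁ L.U i ⊓ D.π ⁻¹ᵁ V) ⊓ (D.p2 ≫ D.γ) ⁻¹ᵁ (𝟙 D.S ⁻¹ᵁ L.U j ⊓ D.π ⁻¹ᵁ V) := by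
    refine ⟨?_, ?_⟩
    · exact mem_pre_of h1 hs'
    · exact mem_pre_of hr2 hg'
  have e2 := congrArg (fun a => D.R.basicOpen a) e
  simp only [Scheme.basicOpen_mul] at e2
  rw [basicOpen_pl, basicOpen_pl, basicOpen_of_isUnit' (hg.bat _ _ _)] at e2
  rw [Sec.mem_nv_iff m inf_le_left inf_le_right hg'] at hgm
  have h5 : r ∈ (D.p2 ≫ D.γ) ⁻¹ᵁ D.S.basicOpen (m.at j inf_le_left inf_le_right) := by
    exact mem_pre_of hr2 hgm
  have h6 := e2.ge ⟨hr, hr, h5⟩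
  rw [Sec.mem_nv_iff m inf_le_left inf_le_right hs']
  exact mem_of_pre h1 h6.2

lemma Inv.exists_open (hg : Φ.IsGen) {V : D.P.Opens} {m : Sec L (𝟙 D.S) (D.π ⁻¹ᵁ V)} (hm : Inv D Φ m) {g : D.G} (hgm : D.γ g ∈ m.nv) :
    ∃ A : D.P.Opens, D.ω g ∈ A ∧ ∃ m : Sec L (𝟙 D.S) (D.π ⁻¹ᵁ A), Inv D Φ m ∧ m.IsGen := by
  have hγ : ∀ g, D.π (D.γ g) = D.ω g := fun g => by rw [← D.hγ]; rfl
  let A : D.P.Opens := ⟨(D.ω '' (D.γ ⁻¹ᵁ m.nv : Set D.G)ᶜ)ᶜ, (D.closed _ (D.γ ⁻¹ᵁ m.nv).isOpen.isClosed_compl).isOpen_compl⟩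
  have hA : ∀ v, v ∈ A ↔ ∃ g, D.ω g = v ∧ D.γ g ∈ m.nv := fun v => by
    constructor
    · intro hv
      obtain ⟨g, rfl⟩ := D.surj v
      refine ⟨g, rfl, ?_⟩
      by_contra h
      exact hv ⟨g, h, rfl⟩
    · rintro ⟨g, rfl, h⟩ ⟨g', h', e⟩
      exact h' (hm.sat hg ((hγ g').trans e) h)
  have hAV : A ≤ V := fun v hv => by
    obtain ⟨g, rfl, h⟩ := (hA v).mp hv
    rw [← hγ]; exact m.nv_le h
  have hAm : D.π ⁻¹ᵁ A ≤ m.nv := fun s hs => by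
    obtain ⟨g, e, h⟩ := (hA _).mp hs
    exact hm.sat hg e.symm h
  exact ⟨A, (hA _).mpr ⟨g, rfl, hgm⟩, _, hm.res hAV, m.isGen_of_le_nv hAm _⟩

lemma exists_gen [IsAffine D.W] (hg : Φ.IsGen) (hΦ : Coc D Φ) (v : D.P) : ∃ A : D.P.Opens, v ∈ A ∧ ∃ m : Sec L (𝟙 D.S) (D.π ⁻¹ᵁ A), Inv D Φ m ∧ m.IsGen := by
  obtain ⟨g, rfl⟩ := D.surj v
  obtain ⟨V, hV, hvV, -⟩ := exists_isAffineOpen_mem_and_subset (U := ⊤) (x := D.ω g) trivial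
  obtain ⟨e, he⟩ := exists_nv L D.γ (box_affine D.F0 (isAffineOpen_top D.W) hV (W := D.ω ⁻¹ᵁ V) hWt) (x := g) hvV
  obtain ⟨σ, hσ⟩ := Sec.act (V := D.p1 ⁻¹ᵁ D.π ⁻¹ᵁ V) le_top Φ rfl D.l2 e
  have hσ' : IsAct D Φ e σ := hσ
  obtain ⟨i, hi⟩ := L.cov' (𝟙 D.S) (D.γ g)
  have hγ : D.π (D.γ g) ∈ V := by
    have : D.π (D.γ g) = D.ω g := by rw [← D.hγ]; rfl
    rw [this]; exact hvV
  obtain ⟨O, hO, hgO, hle⟩ := exists_isAffineOpen_mem_and_subset (U := 𝟙 D.S ⁻¹ᵁ L.U i ⊓ D.π ⁻¹ᵁ V) (x := D.γ g) ⟨hi, hγ⟩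
  obtain ⟨r, hr1, hr2⟩ := exists_r (D := D) (s := D.γ g) (g := g) (by rw [← D.hγ]; rfl)
  have hOi : O ≤ 𝟙 D.S ⁻¹ᵁ L.U i := hle.trans inf_le_left
  have hOV : O ≤ D.π ⁻¹ᵁ V := hle.trans inf_le_right
  have hrb : r ∈ D.R.basicOpen (σ.at i (le_pre_comp' (comp_id _) hOi) (pre_le hOV : D.p1 ⁻¹ᵁ O ≤ _)) := by
    have hgi : g ∈ D.γ ⁻¹ᵁ L.U i ⊓ D.ω ⁻¹ᵁ V := ⟨hi, hvV⟩
    have h1 := hσ' i i (D.p1 ⁻¹ᵁ O ⊓ D.p2 ⁻¹ᵁ (D.γ ⁻¹ᵁ L.U i ⊓ D.ω ⁻¹ᵁ V)) (D.γ ⁻¹ᵁ L.U i ⊓ D.ω ⁻¹ᵁ V) (inf_le_left.trans (le_pre_comp' (comp_id _) hOi)) inf_le_right inf_le_left inf_le_right (inf_le_left.trans (pre_le hOV))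
    have hr : r ∈ D.p1 ⁻¹ᵁ O ⊓ D.p2 ⁻¹ᵁ (D.γ ⁻¹ᵁ L.U i ⊓ D.ω ⁻¹ᵁ V) := by
      refine ⟨?_, ?_⟩
      · exact mem_pre_of hr1 hgO
      · exact mem_pre_of hr2 hgi
    rw [← Sec.rs_at σ i inf_le_left (le_pre_comp' (comp_id _) hOi) (pre_le hOV)] at h1
    have e2 := congrArg (fun a => D.R.basicOpen a) h1
    simp only [Scheme.basicOpen_mul] at e2
    rw [basicOpen_rs, basicOpen_pl, basicOpen_of_isUnit' (hg.bat _ _ _)] at e2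
    rw [Sec.mem_nv_iff e inf_le_left inf_le_right hgi] at he
    have h5 : r ∈ D.p2 ⁻¹ᵁ D.G.basicOpen (e.at i inf_le_left inf_le_right) := by
      exact mem_pre_of hr2 he
    exact (e2.ge ⟨hr, hr, h5⟩).2
  obtain ⟨l, hl⟩ := ws_nz D.F1 hO _ hrb
  obtain ⟨m, hm⟩ := Sec.ws D.F1 l (comp_id _) σ
  refine (inv_ws hΦ hσ' l hm).exists_open hg ?_
  rw [Sec.mem_nv_iff m hOi hOV hgO, hm i O hO]
  rwa [hr1] at hl
end DD
end

section
lemma alg_inv {A : Type*} [CommRing A] {x y φ a b a' b' : A} (hφ : IsUnit φ) (hb : IsUnit b) (h : a = φ * b) (ha' : a' = x * a) (hb' : b' = y * b) (h' : a' = φ * b') : x = y := by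
  refine (hφ.mul hb).mul_right_cancel ?_
  calc x * (φ * b) = a' := by rw [ha', h]
    _ = y * (φ * b) := by rw [h', hb']; ring

namespace DD
variable {k : Type u} [Field k] {D : DD k} {L : LB D.S} {Φ : Sec (L.box L) (prod.lift D.p1 (D.p2 ≫ D.γ)) ⊤}

lemma Inv.ratio [CompactSpace D.W] [QuasiSeparatedSpace D.W] (hg : Φ.IsGen) {V : D.P.Opens} {m m' : Sec L (𝟙 D.S) (D.π ⁻¹ᵁ V)} (hm : Inv D Φ m) (hm' : Inv D Φ m') (hmg : m.IsGen) :
    ∃ v : Γ(D.P, V), m' = pl D.π (pre_rfl (q := D.π)) v • m := by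
  obtain ⟨u, hu⟩ := hmg.exists_smul m'
  obtain ⟨v, hv⟩ := D.desc_fun u (by
    refine rs_ext (fun c : L.ι × L.ι => D.p1 ⁻¹ᵁ (𝟙 D.S ⁻¹ᵁ L.U c.1 ⊓ D.π ⁻¹ᵁ V) ⊓ (D.p2 ≫ D.γ) ⁻¹ᵁ (𝟙 D.S ⁻¹ᵁ L.U c.2 ⊓ D.π ⁻¹ᵁ V)) (fun c => inf_le_left.trans (pre_le inf_le_right)) (fun x hx => ?_) fun c => ?_
    · obtain ⟨i, hi⟩ := L.cov' (𝟙 D.S) (D.p1 x)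
      obtain ⟨j, hj⟩ := L.cov' (𝟙 D.S) ((D.p2 ≫ D.γ) x)
      exact ⟨(i, j), ⟨hi, hx⟩, ⟨hj, D.l3 hx⟩⟩
    · rw [rs_pl, rs_pl]
      have e1 := hm c.1 c.2 (D.p1 ⁻¹ᵁ (𝟙 D.S ⁻¹ᵁ L.U c.1 ⊓ D.π ⁻¹ᵁ V) ⊓ (D.p2 ≫ D.γ) ⁻¹ᵁ (𝟙 D.S ⁻¹ᵁ L.U c.2 ⊓ D.π ⁻¹ᵁ V)) _ _ inf_le_left inf_le_right inf_le_left inf_le_left inf_le_right inf_le_right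
      have e2 := hm' c.1 c.2 (D.p1 ⁻¹ᵁ (𝟙 D.S ⁻¹ᵁ L.U c.1 ⊓ D.π ⁻¹ᵁ V) ⊓ (D.p2 ≫ D.γ) ⁻¹ᵁ (𝟙 D.S ⁻¹ᵁ L.U c.2 ⊓ D.π ⁻¹ᵁ V)) _ _ inf_le_left inf_le_right inf_le_left inf_le_left inf_le_right inf_le_right
      refine alg_inv (hg.bat _ _ _) ((hmg c.2 _ inf_le_left inf_le_right).map (pl (D.p2 ≫ D.γ) inf_le_right)) e1 ?_ ?_ e2
      · rw [hu, Sec.at_smul, map_mul, pl_rs]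
      · rw [hu, Sec.at_smul, map_mul, pl_rs])
  exact ⟨v, by rw [hv, hu]⟩

lemma ratio_unique [CompactSpace D.W] [QuasiSeparatedSpace D.W] {V : D.P.Opens} {m : Sec L (𝟙 D.S) (D.π ⁻¹ᵁ V)} (hmg : m.IsGen) {v v' : Γ(D.P, V)}
    (h : pl D.π (pre_rfl (q := D.π)) v • m = pl D.π (pre_rfl (q := D.π)) v' • m) : v = v' := D.inj_π (hmg.smul_inj h)

variable (D Φ) in
structure MI where
  V : D.P.Opens
  m : Sec L (𝟙 D.S) (D.π ⁻¹ᵁ V)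
  inv : Inv D Φ m
  gen : m.IsGen

variable [IsAffine D.W]

lemma exists_g (hg : Φ.IsGen) (c d : MI D Φ) : ∃ v : Γ(D.P, c.V ⊓ d.V), d.m.res (pre_le (q := D.π) inf_le_right) = pl D.π (pre_rfl (q := D.π)) v • c.m.res (pre_le (q := D.π) inf_le_left) :=
  (c.inv.res inf_le_left).ratio hg (d.inv.res inf_le_right) (c.gen.res _)

def gg (hg : Φ.IsGen) (c d : MI D Φ) : Γ(D.P, c.V ⊓ d.V) := (exists_g hg c d).choose

lemma gg_spec (hg : Φ.IsGen) (c d : MI D Φ) {V : D.P.Opens} (h : V ≤ c.V ⊓ d.V) (hc : V ≤ c.V) (hd : V ≤ d.V) : d.m.res (pre_le (q := D.π) hd) = pl D.π (pre_rfl (q := D.π)) (rs h (gg hg c d)) • c.m.res (pre_le (q := D.π) hc) := by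
  have := congrArg (Sec.res (pre_le (q := D.π) h)) (exists_g hg c d).choose_spec
  rw [Sec.res_res, Sec.res_smul, Sec.res_res, rs_pl] at this
  rw [pl_rs]; exact this

def MM (hg : Φ.IsGen) (hΦ : Coc D Φ) : LB D.P where
  ι := MI D Φ
  U c := c.V
  cov v := by
    obtain ⟨A, hA, m, hm, hm'⟩ := exists_gen hg hΦ v
    exact ⟨⟨A, m, hm, hm'⟩, hA⟩
  g c d := gg hg c d
  g_self c := by
    refine ratio_unique (m := c.m.res (pre_le (q := D.π) inf_le_left)) (c.gen.res _) ?_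
    have := gg_spec hg c c le_rfl inf_le_left inf_le_left
    rw [rs_self] at this
    rw [← this, map_one, one_smul]
  coc c d e := by
    refine ratio_unique (m := c.m.res (pre_le (q := D.π) (inf_le_left.trans inf_le_left))) (c.gen.res _) ?_
    rw [← gg_spec hg c e _ (inf_le_left.trans inf_le_left) inf_le_right, map_mul, mul_comm, mul_smul, ← gg_spec hg c d _ (inf_le_left.trans inf_le_left) (inf_le_left.trans inf_le_right), ← gg_spec hg d e _ (inf_le_left.trans inf_le_right) inf_le_right]

lemma gg_at (hg : Φ.IsGen) (c d : L.ι × MI D Φ) {O Oc Od : D.S.Opens} (hc : O ≤ Oc) (hd : O ≤ Od) (h1 : Oc ≤ 𝟙 D.S ⁻¹ᵁ L.U c.1) (h2 : Oc ≤ D.π ⁻¹ᵁ c.2.V)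
    (k1 : Od ≤ 𝟙 D.S ⁻¹ᵁ L.U d.1) (k2 : Od ≤ D.π ⁻¹ᵁ d.2.V) (hO : O ≤ D.π ⁻¹ᵁ (d.2.V ⊓ c.2.V)) :
    rs hc (c.2.m.at c.1 h1 h2) = L.tr (𝟙 D.S) c.1 d.1 (hc.trans h1) (hd.trans k1) * pl D.π hO (gg hg d.2 c.2) * rs hd (d.2.m.at d.1 k1 k2) := by
  rw [Sec.rs_at, Sec.rs_at, Sec.at_tr _ c.1 d.1 _ (hd.trans k1), mul_assoc]
  refine congrArg _ ?_
  have := congrArg (fun s => Sec.at s d.1 (hd.trans k1) hO) (gg_spec hg d.2 c.2 le_rfl inf_le_left inf_le_right)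
  rw [Sec.res_at, Sec.at_smul, Sec.res_at, rs_self, rs_pl] at this
  exact this

theorem desc (hg : Φ.IsGen) (hΦ : Coc D Φ) : ∃ M : LB D.P, IsoOn L M (𝟙 D.S) D.π ⊤ := by
  refine ⟨MM hg hΦ, ?_⟩
  obtain ⟨σ, hσ⟩ := Sec.bglue (L := L) (L' := MM hg hΦ) (f := 𝟙 D.S) (g := D.π) (V := ⊤) (fun c : L.ι × MI D Φ => 𝟙 D.S ⁻¹ᵁ L.U c.1 ⊓ D.π ⁻¹ᵁ c.2.V) (fun c => c.1) (fun c => c.2)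
    (fun _ => inf_le_left) (fun _ => inf_le_right) (fun _ => le_top) (fun x _ => by
      obtain ⟨i, hi⟩ := L.cov' (𝟙 D.S) x
      obtain ⟨j, hj⟩ := (MM hg hΦ).cov' D.π x
      exact ⟨(i, j), hi, hj⟩) (fun c => c.2.m.at c.1 inf_le_left inf_le_right) (fun c d => gg_at hg c d inf_le_left inf_le_right _ _ _ _ _)
  refine ⟨σ, Sec.isGen_loc fun x _ => ?_⟩
  obtain ⟨i, hi⟩ := L.cov' (𝟙 D.S) x
  obtain ⟨j, hj⟩ := (MM hg hΦ).cov' D.π x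
  refine ⟨𝟙 D.S ⁻¹ᵁ L.U i ⊓ D.π ⁻¹ᵁ (MM hg hΦ).U j, LB.bi i j, box_le inf_le_left inf_le_right, le_top, ⟨hi, hj⟩, ?_⟩
  exact (congrArg IsUnit (hσ (i, j))).mpr ((MI.gen j) _ _ _ _)
end DD
end

section
section comp
variable {Q S S' S'' : Scheme.{u}} {L : LB S} {L' : LB S'} {L'' : LB S''} {f : Q ⟶ S} {g : Q ⟶ S'} {h : Q ⟶ S''} {V : Q.Opens}

lemma alg_comp {A : Type*} [CommRing A] {a a' b b' t1 t2 t3 t4 : A} (ha : a = t1 * t2 * a') (hb : b = t3 * t4 * b') (ht : t2 * t3 = 1) : a * b = t1 * t4 * (a' * b') := by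
  rw [ha, hb]
  calc t1 * t2 * a' * (t3 * t4 * b') = (t2 * t3) * (t1 * t4 * (a' * b')) := by ring
    _ = _ := by rw [ht, one_mul]

/-- composition of isomorphisms given by sections of boxes -/
lemma Sec.bcomp (ψ : Sec (L.box L') (prod.lift f g) V) (φ : Sec (L'.box L'') (prod.lift g h) V) : ∃ χ : Sec (L.box L'') (prod.lift f h) V,
    ∀ i j l (O : Q.Opens) (h1 : O ≤ f ⁻¹ᵁ L.U i) (h2 : O ≤ g ⁻¹ᵁ L'.U j) (h3 : O ≤ h ⁻¹ᵁ L''.U l) (hV : O ≤ V),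
      χ.bat i l h1 h3 hV = ψ.bat i j h1 h2 hV * φ.bat j l h2 h3 hV := by
  have hcv : ∀ x ∈ V, ∃ c : (L.ι × L''.ι) × L'.ι, x ∈ (f ⁻¹ᵁ L.U c.1.1 ⊓ h ⁻¹ᵁ L''.U c.1.2) ⊓ g ⁻¹ᵁ L'.U c.2 ⊓ V := fun x hx => by
    obtain ⟨i, hi⟩ := L.cov' f x
    obtain ⟨j, hj⟩ := L'.cov' g x
    obtain ⟨l, hl⟩ := L''.cov' h x
    exact ⟨((i, l), j), ⟨⟨hi, hl⟩, hj⟩, hx⟩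
  obtain ⟨χ, hχ⟩ := Sec.bglue (L := L) (L' := L'') (f := f) (g := h) (V := V) (fun c : (L.ι × L''.ι) × L'.ι => (f ⁻¹ᵁ L.U c.1.1 ⊓ h ⁻¹ᵁ L''.U c.1.2) ⊓ g ⁻¹ᵁ L'.U c.2 ⊓ V) (fun c => c.1.1) (fun c => c.1.2)
    (fun _ => inf_le_left.trans (inf_le_left.trans inf_le_left)) (fun _ => inf_le_left.trans (inf_le_left.trans inf_le_right)) (fun _ => inf_le_right) hcv
    (fun c => ψ.bat c.1.1 c.2 (inf_le_left.trans (inf_le_left.trans inf_le_left)) (inf_le_left.trans inf_le_right) inf_le_right *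
      φ.bat c.2 c.1.2 (inf_le_left.trans inf_le_right) (inf_le_left.trans (inf_le_left.trans inf_le_right)) inf_le_right) (fun c d => by
      rw [map_mul, map_mul, Sec.rs_bat, Sec.rs_bat, Sec.rs_bat, Sec.rs_bat]
      exact alg_comp (Sec.bat_tr _ _ _ _ (inf_le_right.trans (inf_le_left.trans inf_le_right)) _) (Sec.bat_tr φ _ (inf_le_right.trans (inf_le_left.trans inf_le_right)) _ _ _) (LB.tr_symm _ _ _ _ _ _))
  refine ⟨χ, fun i j l O h1 h2 h3 hV => ?_⟩
  have := congrArg (rs (le_inf (le_inf (le_inf h1 h3) h2) hV)) (hχ ((i, l), j))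
  rw [Sec.rs_bat, map_mul, Sec.rs_bat, Sec.rs_bat] at this
  exact this
end comp

section top'
variable {Q T S : Scheme.{u}} {q : Q ⟶ T} {σ : T ⟶ Q} {N : LB S} {f : Q ⟶ S} {f' : T ⟶ S} (ef : σ ≫ f = f') (R : IsRig q σ)
include R
lemma norm_unique_top' {h h' : Sec N f ⊤} (hg : h'.IsGen) (e : h.pull σ ef (le_pre_top : ⊤ ≤ _) = h'.pull σ ef (le_pre_top : ⊤ ≤ _)) : h = h' := by
  subst ef; exact norm_unique_top R hg e

lemma norm_exists_top' {r : Sec N f' ⊤} (hr : r.IsGen) {h : Sec N f ⊤} (hg : h.IsGen) : ∃ h : Sec N f ⊤, h.IsGen ∧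
    h.pull σ ef (le_pre_top : ⊤ ≤ _) = r := by
  subst ef; exact norm_exists_top R hr hg
end top'

section nm
variable {k : Type u} [Field k] {X Y Z : Scheme.{u}} {sX : X ⟶ Spk k} {sY : Y ⟶ Spk k} {sZ : Z ⟶ Spk k}
  {x : Spk k ⟶ X} {hx : x ≫ sX = 𝟙 _} {L : LB (Q3 sX sY sZ)} (r : Sec L (xs hx (pullback.snd sY sZ ≫ sZ)) ⊤)
  {B B' : Scheme.{u}} {sB : B ⟶ Spk k} {sB' : B' ⟶ Spk k}
  {a a' a'' : B ⟶ Z} (ea : a ≫ sZ = sB) (ea' : a' ≫ sZ = sB) (ea'' : a'' ≫ sZ = sB)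

lemma xs_m3 (hx : x ≫ sX = 𝟙 _) {b : B' ⟶ B} (eb : b ≫ sB = sB') : xs hx (pullback.snd sY sB' ≫ sB') ≫ m3 sX sY eb = bm sY eb ≫ xs hx (pullback.snd sY sB ≫ sB) := xs_bm hx (m2e sY eb)

def ra : Sec L (xs hx (pullback.snd sY sB ≫ sB) ≫ m3 sX sY ea) ⊤ := r.pull (bm sY ea) (xs_m3 hx ea).symm (le_pre_top : ⊤ ≤ _)

/-- pullback of a comparison to the section -/
def px (hx : x ≫ sX = 𝟙 _) (ψ : Sec (L.box L) (prod.lift (m3 sX sY ea) (m3 sX sY ea')) ⊤) : Sec (L.box L) (prod.lift (xs hx (pullback.snd sY sB ≫ sB) ≫ m3 sX sY ea) (xs hx (pullback.snd sY sB ≫ sB) ≫ m3 sX sY ea')) ⊤ :=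
  ψ.pull (xs hx (pullback.snd sY sB ≫ sB)) (prod.comp_lift _ _ _) (le_pre_top : ⊤ ≤ _)

/-- normalized comparisons -/
def Nm (ψ : Sec (L.box L) (prod.lift (m3 sX sY ea) (m3 sX sY ea')) ⊤) : Prop :=
  ∀ i j (O : (pullback sY sB).Opens) (h1 : O ≤ (xs hx (pullback.snd sY sB ≫ sB) ≫ m3 sX sY ea) ⁻¹ᵁ L.U i) (h2 : O ≤ (xs hx (pullback.snd sY sB ≫ sB) ≫ m3 sX sY ea') ⁻¹ᵁ L.U j),
    (px ea ea' hx ψ).bat i j h1 h2 le_top * (ra r ea').at j h2 le_top = (ra r ea).at i h1 le_top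

variable {r} (hr : r.IsGen)
include hr
lemma ra_gen : (ra r ea).IsGen := hr.pull _ _ _

lemma nm_exists [IsIntegral X] [IsProper sX] (h : IsoOn L L (m3 sX sY ea) (m3 sX sY ea') ⊤) : ∃ ψ : Sec (L.box L) (prod.lift (m3 sX sY ea) (m3 sX sY ea')) ⊤, ψ.IsGen ∧ Nm r ea ea' ψ := by
  obtain ⟨ψ, hψ⟩ := h
  obtain ⟨σ, hσ, hσ'⟩ := Sec.quot (ra_gen ea hr) (ra_gen ea' hr)
  obtain ⟨ψ', h1, h2⟩ := norm_exists_top' (prod.comp_lift (xs hx (pullback.snd sY sB ≫ sB)) (m3 sX sY ea) (m3 sX sY ea')) (isRig_of_proper x hx (IsPullback.of_hasPullback _ _) (xs_snd hx _)) hσ hψ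
  refine ⟨ψ', h1, fun i j O k1 k2 => ?_⟩
  rw [← hσ' i j O k1 k2 le_top, px, h2]

variable {ea ea' ea''}
lemma Nm.unique [IsIntegral X] [IsProper sX] {ψ ψ' : Sec (L.box L) (prod.lift (m3 sX sY ea) (m3 sX sY ea')) ⊤} (h : Nm r ea ea' ψ) (h' : Nm r ea ea' ψ') (hg : ψ'.IsGen) : ψ = ψ' := by
  refine norm_unique_top' (prod.comp_lift (xs hx (pullback.snd sY sB ≫ sB)) (m3 sX sY ea) (m3 sX sY ea')) (isRig_of_proper x hx (IsPullback.of_hasPullback _ _) (xs_snd hx _)) hg (Sec.ext fun c O hi hV => ?_)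
  rw [Sec.bat_at, Sec.bat_at]
  exact (ra_gen ea' hr _ _ (le_box2 hi) hV).mul_right_cancel ((h _ _ _ (le_box1 hi) (le_box2 hi)).trans (h' _ _ _ (le_box1 hi) (le_box2 hi)).symm)

omit hr
lemma Nm.comp {ψ : Sec (L.box L) (prod.lift (m3 sX sY ea) (m3 sX sY ea')) ⊤} {φ : Sec (L.box L) (prod.lift (m3 sX sY ea') (m3 sX sY ea'')) ⊤} {χ : Sec (L.box L) (prod.lift (m3 sX sY ea) (m3 sX sY ea'')) ⊤}
    (hψ : Nm r ea ea' ψ) (hφ : Nm r ea' ea'' φ) (h : ∀ i j l (O : (Q3 sX sY sB).Opens) (h1 : O ≤ m3 sX sY ea ⁻¹ᵁ L.U i) (h2 : O ≤ m3 sX sY ea' ⁻¹ᵁ L.U j) (h3 : O ≤ m3 sX sY ea'' ⁻¹ᵁ L.U l) (hV : O ≤ ⊤),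
      χ.bat i l h1 h3 hV = ψ.bat i j h1 h2 hV * φ.bat j l h2 h3 hV) : Nm r ea ea'' χ := by
  intro i l O h1 h3
  refine rs_ext (fun j => O ⊓ (xs hx (pullback.snd sY sB ≫ sB) ≫ m3 sX sY ea') ⁻¹ᵁ L.U j) (fun _ => inf_le_left) (fun t ht => (L.cov' (xs hx (pullback.snd sY sB ≫ sB) ≫ m3 sX sY ea') t).imp fun j hj => ⟨ht, hj⟩) fun j => ?_
  rw [map_mul, Sec.rs_bat, Sec.rs_at, Sec.rs_at, ← hψ i j _ _ inf_le_right, ← hφ j l _ inf_le_right _, ← mul_assoc]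
  refine congrArg (· * _) ?_
  rw [px, px, px, Sec.pull_bat (O := m3 sX sY ea ⁻¹ᵁ L.U i ⊓ m3 sX sY ea' ⁻¹ᵁ L.U j ⊓ m3 sX sY ea'' ⁻¹ᵁ L.U l) _ _ _ _ ?_ _ _ _ (inf_le_left.trans inf_le_left) inf_le_right le_top,
    Sec.pull_bat (O := m3 sX sY ea ⁻¹ᵁ L.U i ⊓ m3 sX sY ea' ⁻¹ᵁ L.U j ⊓ m3 sX sY ea'' ⁻¹ᵁ L.U l) _ _ _ _ ?_ _ _ _ (inf_le_left.trans inf_le_left) (inf_le_left.trans inf_le_right) le_top,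
    Sec.pull_bat (O := m3 sX sY ea ⁻¹ᵁ L.U i ⊓ m3 sX sY ea' ⁻¹ᵁ L.U j ⊓ m3 sX sY ea'' ⁻¹ᵁ L.U l) _ _ _ _ ?_ _ _ _ (inf_le_left.trans inf_le_right) inf_le_right le_top, h i j l _ _ (inf_le_left.trans inf_le_right) _ _, map_mul]
  exact le_pre_inf (le_pre_inf (inf_le_left.trans h1) inf_le_right) (inf_le_left.trans h3)

lemma ra_pull {b : B' ⟶ B} (eb : b ≫ sB = sB') {c : B' ⟶ Z} (ec : c ≫ sZ = sB') (e : b ≫ a = c) :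
    ∃ h, ra r ec = (ra r ea).pull (bm sY eb) h (le_pre_top : ⊤ ≤ _) := by
  have h1 := bm_bm sY ea eb ec e
  have h2 : bm sY eb ≫ xs hx (pullback.snd sY sB ≫ sB) ≫ m3 sX sY ea = xs hx (pullback.snd sY sB' ≫ sB') ≫ m3 sX sY ec := by
    rw [xs_m3 hx ea, xs_m3 hx ec, reassoc_of% h1]
  exact ⟨h2, by rw [ra, ra, Sec.pull_pull _ _ _ _ _ _ _ h1]⟩

lemma Nm.pull {ψ : Sec (L.box L) (prod.lift (m3 sX sY ea) (m3 sX sY ea')) ⊤} (hψ : Nm r ea ea' ψ) {b : B' ⟶ B} (eb : b ≫ sB = sB') {c c' : B' ⟶ Z} (ec : c ≫ sZ = sB') (ec' : c' ≫ sZ = sB')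
    (e : b ≫ a = c) (e' : b ≫ a' = c') (e'') : Nm r ec ec' (ψ.pull (m3 sX sY eb) e'' (le_pre_top : ⊤ ≤ _)) := by
  intro i j O h1 h2
  obtain ⟨k1, e1⟩ := ra_pull (r := r) (ea := ea) eb ec e
  obtain ⟨k2, e2⟩ := ra_pull (r := r) (ea := ea') eb ec' e'
  have h3 : xs hx (pullback.snd sY sB' ≫ sB') ≫ m3 sX sY eb = bm sY eb ≫ xs hx (pullback.snd sY sB ≫ sB) := xs_bm hx (m2e sY eb)
  have e3 : px ec ec' hx (ψ.pull (m3 sX sY eb) e'' (le_pre_top : ⊤ ≤ _)) = (px ea ea' hx ψ).pull (bm sY eb) (by rw [prod.comp_lift, k1, k2]) (le_pre_top : ⊤ ≤ _) := by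
    rw [px, px, Sec.pull_pull _ _ _ _ _ _ _ h3, Sec.pull_pull _ _ _ _ _ _ _ rfl]
    · rw [assoc, prod.comp_lift, prod.comp_lift, k1, k2]
    · exact le_pre_top
  have hO : O ≤ bm sY eb ⁻¹ᵁ ((xs hx (pullback.snd sY sB ≫ sB) ≫ m3 sX sY ea) ⁻¹ᵁ L.U i ⊓ (xs hx (pullback.snd sY sB ≫ sB) ≫ m3 sX sY ea') ⁻¹ᵁ L.U j) := le_pre_inf (le_pre_comp k1 h1) (le_pre_comp k2 h2)
  rw [e1, e2, e3, Sec.pull_bat _ _ _ _ hO _ _ _ inf_le_left inf_le_right le_top, Sec.pull_at (O := (xs hx (pullback.snd sY sB ≫ sB) ≫ m3 sX sY ea) ⁻¹ᵁ L.U i ⊓ (xs hx (pullback.snd sY sB ≫ sB) ≫ m3 sX sY ea') ⁻¹ᵁ L.U j) (hO := hO) (hi := inf_le_right) (hV0 := le_top),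
   Sec.pull_at (O := (xs hx (pullback.snd sY sB ≫ sB) ≫ m3 sX sY ea) ⁻¹ᵁ L.U i ⊓ (xs hx (pullback.snd sY sB ≫ sB) ≫ m3 sX sY ea') ⁻¹ᵁ L.U j) (hO := hO) (hi := inf_le_left) (hV0 := le_top), ← hψ i j _ inf_le_left inf_le_right, map_mul]
end nm
end

section
section p3
variable {k : Type u} [Field k] {X Y : Scheme.{u}} (sX : X ⟶ Spk k) (sY : Y ⟶ Spk k)
  {B B' B'' : Scheme.{u}} (sB : B ⟶ Spk k) {sB' : B' ⟶ Spk k} {sB'' : B'' ⟶ Spk k}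

/-- projection to `X × Y` -/
def p3 : Q3 sX sY sB ⟶ pullback sX sY := bm sX (pullback.condition : pullback.fst sY sB ≫ sY = pullback.snd sY sB ≫ sB)

lemma p3_pb : IsPullback (b3 sX sY sB) (p3 sX sY sB) sB (pullback.snd sX sY ≫ sY) :=
  (bm_pb sX (pullback.condition : pullback.fst sY sB ≫ sY = pullback.snd sY sB ≫ sB)).flip.paste_horiz (IsPullback.of_hasPullback sY sB).flip

variable {sB}
lemma m3_p3 {a : B' ⟶ B} (ea : a ≫ sB = sB') : m3 sX sY ea ≫ p3 sX sY sB = p3 sX sY sB' := bm_bm sX _ _ _ (bm_fst _ _)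

lemma m3_sq {a : B'' ⟶ B} {a' : B'' ⟶ B'} (H : IsPullback a a' sB sB') (ea : a ≫ sB = sB'') (ea' : a' ≫ sB' = sB'') : IsPullback (m3 sX sY ea) (m3 sX sY ea') (p3 sX sY sB) (p3 sX sY sB') := by
  refine IsPullback.of_right ?_ ((m3_p3 _ _ _).trans (m3_p3 _ _ _).symm) (p3_pb sX sY sB)
  rw [m3_b3, ← (p3_pb sX sY sB').w]
  exact (m3_pb sX sY ea').flip.paste_horiz H
end p3

theorem desc' {k : Type u} [Field k] {S P G R R3 W : Scheme.{u}} [IsAffine W]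
  {sW : W ⟶ Spk k}
  {sP : P ⟶ Spk k}
  {π : S ⟶ P}
  {ω : G ⟶ P}
  {γ : G ⟶ S}
  {β : G ⟶ W}
  {p1 : R ⟶ S}
  {p2 : R ⟶ G}
  {d12 : R3 ⟶ R}
  {d13 : R3 ⟶ R}
  {d23 : R3 ⟶ R}
  {d3 : R3 ⟶ G}
  (hγ : γ ≫ π = ω)
  (HR : IsPullback p1 p2 π ω)
  (F0 : IsPullback β ω sW sP)
  (H3 : IsPullback d12 d3 (p1 ≫ π) ω)
  (e13 : d13 ≫ p1 = d12 ≫ p1)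
  (e13' : d13 ≫ p2 = d3)
  (e23 : d23 ≫ p1 = d12 ≫ p2 ≫ γ)
  (e23' : d23 ≫ p2 = d3)
  (l0 : Sct sW ⊤ →ₗ[k] k)
  (hl0 : l0 (toS sW ⊤ 1) = 1)
  (surj : Function.Surjective ω)
  (closed : IsClosedMap ω) {L : LB S} {f2 : R ⟶ S} (ef : p2 ≫ γ = f2) {Φ : Sec (L.box L) (prod.lift p1 f2) ⊤} (hg : Φ.IsGen)
  (hc : ∀ (i j l) (B : R3.Opens) (B12 B13 B23 : R.Opens) (h12 : B ≤ d12 ⁻¹ᵁ B12) (h13 : B ≤ d13 ⁻¹ᵁ B13) (h23 : B ≤ d23 ⁻¹ᵁ B23)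
    (i12 : B12 ≤ p1 ⁻¹ᵁ L.U i) (j12 : B12 ≤ f2 ⁻¹ᵁ L.U j)
    (i13 : B13 ≤ p1 ⁻¹ᵁ L.U i) (l13 : B13 ≤ f2 ⁻¹ᵁ L.U l)
    (j23 : B23 ≤ p1 ⁻¹ᵁ L.U j) (l23 : B23 ≤ f2 ⁻¹ᵁ L.U l),
    pl d13 h13 (Φ.bat i l i13 l13 le_top) = pl d12 h12 (Φ.bat i j i12 j12 le_top) * pl d23 h23 (Φ.bat j l j23 l23 le_top)) :
  ∃ M : LB P, IsoOn L M (𝟙 S) π ⊤ := by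
  subst ef
  exact let D : DD k := ⟨S, P, G, R, R3, W, sW, sP, π, ω, γ, β, p1, p2, d12, d13, d23, d3, hγ, HR, F0, H3, e13, e13', e23, e23', l0, hl0, surj, closed⟩
    have : IsAffine D.W := inferInstanceAs (IsAffine W)
    DD.desc (D := D) (L := L) (Φ := Φ) hg hc

lemma exists_l0 {k : Type u} [Field k] {W : Scheme.{u}} [Nonempty W] (sW : W ⟶ Spk k) : ∃ l0 : Sct sW ⊤ →ₗ[k] k, l0 (toS sW ⊤ 1) = 1 := by
  have : Nonempty (⊤ : W.Opens) := ⟨⟨Classical.arbitrary W, trivial⟩⟩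
  have : Nontrivial Γ(W, ⊤) := W.component_nontrivial ⊤
  have : Nontrivial (Sct sW ⊤) := (toS sW ⊤).symm.toEquiv.nontrivial
  obtain ⟨f, hf⟩ := LinearMap.exists_leftInverse_of_injective (LinearMap.toSpanSingleton k (Sct sW ⊤) 1) (LinearMap.ker_eq_bot.mpr (fun a b h => by
    simp only [LinearMap.toSpanSingleton_apply] at h
    exact smul_left_injective k one_ne_zero h))
  refine ⟨f, ?_⟩
  have := LinearMap.congr_fun hf 1
  simpa using this

section
variable {k : Type u} [Field k] {X Y Z W : Scheme.{u}} {sX : X ⟶ Spk k} {sY : Y ⟶ Spk k} {sZ : Z ⟶ Spk k}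
  {x : Spk k ⟶ X} {hx : x ≫ sX = 𝟙 _} {y : Spk k ⟶ Y} {hy : y ≫ sY = 𝟙 _} {L : LB (Q3 sX sY sZ)} {r : Sec L (xs hx (pullback.snd sY sZ ≫ sZ)) ⊤}

/-- cocycle condition from normalization -/
lemma nm_coc [IsIntegral X] [IsProper sX] (hr : r.IsGen) {B B' : Scheme.{u}} {sB : B ⟶ Spk k} {sB' : B' ⟶ Spk k} {a a' : B ⟶ Z} {ea : a ≫ sZ = sB} {ea' : a' ≫ sZ = sB}
    {Φ : Sec (L.box L) (prod.lift (m3 sX sY ea) (m3 sX sY ea')) ⊤} (hg : Φ.IsGen) (hΦ : Nm r ea ea' Φ) {b12 b13 b23 : B' ⟶ B} (e12 : b12 ≫ sB = sB') (e13 : b13 ≫ sB = sB') (e23 : b23 ≫ sB = sB')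
    {c1 c2 c3 : B' ⟶ Z} (h1 : b12 ≫ a = c1) (h2 : b12 ≫ a' = c2) (h1' : b13 ≫ a = c1) (h3 : b13 ≫ a' = c3) (h2' : b23 ≫ a = c2) (h3' : b23 ≫ a' = c3)
    (i j l) (O : (Q3 sX sY sB').Opens) (B12 B13 B23 : (Q3 sX sY sB).Opens) (h12 : O ≤ m3 sX sY e12 ⁻¹ᵁ B12) (h13 : O ≤ m3 sX sY e13 ⁻¹ᵁ B13) (h23 : O ≤ m3 sX sY e23 ⁻¹ᵁ B23)
    (i12 : B12 ≤ m3 sX sY ea ⁻¹ᵁ L.U i) (j12 : B12 ≤ m3 sX sY ea' ⁻¹ᵁ L.U j)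
    (i13 : B13 ≤ m3 sX sY ea ⁻¹ᵁ L.U i) (l13 : B13 ≤ m3 sX sY ea' ⁻¹ᵁ L.U l)
    (j23 : B23 ≤ m3 sX sY ea ⁻¹ᵁ L.U j) (l23 : B23 ≤ m3 sX sY ea' ⁻¹ᵁ L.U l) :
    pl (m3 sX sY e13) h13 (Φ.bat i l i13 l13 le_top) = pl (m3 sX sY e12) h12 (Φ.bat i j i12 j12 le_top) * pl (m3 sX sY e23) h23 (Φ.bat j l j23 l23 le_top) := by
  have k1 : c1 ≫ sZ = sB' := by rw [← h1, assoc, ea, e12]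
  have k2 : c2 ≫ sZ = sB' := by rw [← h2, assoc, ea', e12]
  have k3 : c3 ≫ sZ = sB' := by rw [← h3, assoc, ea', e13]
  have t12 : m3 sX sY e12 ≫ prod.lift (m3 sX sY ea) (m3 sX sY ea') = prod.lift (m3 sX sY k1) (m3 sX sY k2) := by
    rw [prod.comp_lift, m3_m3 sX sY ea e12 h1 k1, m3_m3 sX sY ea' e12 h2 k2]
  have t13 : m3 sX sY e13 ≫ prod.lift (m3 sX sY ea) (m3 sX sY ea') = prod.lift (m3 sX sY k1) (m3 sX sY k3) := by
    rw [prod.comp_lift, m3_m3 sX sY ea e13 h1' k1, m3_m3 sX sY ea' e13 h3 k3]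
  have t23 : m3 sX sY e23 ≫ prod.lift (m3 sX sY ea) (m3 sX sY ea') = prod.lift (m3 sX sY k2) (m3 sX sY k3) := by
    rw [prod.comp_lift, m3_m3 sX sY ea e23 h2' k2, m3_m3 sX sY ea' e23 h3' k3]
  obtain ⟨χ, hχ⟩ := Sec.bcomp (Φ.pull (m3 sX sY e12) t12 (le_pre_top : ⊤ ≤ _)) (Φ.pull (m3 sX sY e23) t23 (le_pre_top : ⊤ ≤ _))
  have hn : Nm r k1 k3 χ := (hΦ.pull e12 k1 k2 h1 h2 t12).comp (hΦ.pull e23 k2 k3 h2' h3' t23) hχ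
  have he := Nm.unique hr hn (hΦ.pull e13 k1 k3 h1' h3 t13) (hg.pull _ _ _)
  have g1 : O ≤ m3 sX sY k1 ⁻¹ᵁ L.U i := le_pre_of_comp (m3_m3 sX sY ea e12 h1 k1) i12 h12
  have g2 : O ≤ m3 sX sY k2 ⁻¹ᵁ L.U j := le_pre_of_comp (m3_m3 sX sY ea' e12 h2 k2) j12 h12
  have g3 : O ≤ m3 sX sY k3 ⁻¹ᵁ L.U l := le_pre_of_comp (m3_m3 sX sY ea' e13 h3 k3) l13 h13
  have := hχ i j l O g1 g2 g3 le_top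
  rw [he, Sec.pull_bat _ _ _ _ h13 _ _ _ i13 l13 le_top, Sec.pull_bat _ _ _ _ h12 _ _ _ i12 j12 le_top, Sec.pull_bat _ _ _ _ h23 _ _ _ j23 l23 le_top] at this
  exact this

theorem abs_cube (h : Triv2 hx hy L) [IsIntegral X] [IsProper sX] [IsIntegral Y] [IsProper sY] [LocallyOfFiniteType sZ] {K : Type u} [Field K] [IsAlgClosed K] {φ : k →+* K} (hφ : φ.IsIntegral)
    [ConnectedSpace (pullback sZ (Spec.map (CommRingCat.ofHom φ)) : Scheme.{u})] : ∃ M : LB (pullback sX sY), IsoOn L M (𝟙 _) (p3 sX sY sZ) ⊤ := by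
  generalize hsK : Spec.map (CommRingCat.ofHom φ) = sK at *
  obtain ⟨c, hc, h1⟩ := geo h (sK := sK)
  obtain ⟨r, hr⟩ := h.hx
  obtain ⟨Φ, hg, hΦ⟩ := nm_exists _ _ hr h1
  obtain ⟨l0, hl0⟩ := exists_l0 sK
  have i1 : IsIntegralHom sK := by rw [← hsK, IsIntegralHom.SpecMap_iff]; exact hφ
  have i2 : UniversallyClosed sK := inferInstance
  have i3 : Surjective sK := ⟨fun t => ⟨Classical.arbitrary _, Subsingleton.elim _ _⟩⟩
  have j2 : UniversallyClosed (p3 sX sY sK) := MorphismProperty.of_isPullback (p3_pb sX sY sK) i2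
  have j3 : Surjective (p3 sX sY sK) := MorphismProperty.of_isPullback (p3_pb sX sY sK) i3
  have es : pullback.snd (pullback.fst sZ sK ≫ sZ) sK ≫ sK = pullback.fst (pullback.fst sZ sK ≫ sZ) sK ≫ pullback.fst sZ sK ≫ sZ := pullback.condition.symm
  let δ13 : pullback (pullback.fst sZ sK ≫ sZ) sK ⟶ pullback sZ sK := pullback.lift (pullback.fst _ _ ≫ pullback.fst _ _) (pullback.snd _ _) (by rw [assoc]; exact pullback.condition)
  let δ23 : pullback (pullback.fst sZ sK ≫ sZ) sK ⟶ pullback sZ sK := pullback.lift (pullback.fst _ _ ≫ pullback.snd _ _ ≫ c) (pullback.snd _ _) (by rw [assoc, assoc, hc, ← pullback.condition (f := sZ)]; exact pullback.condition)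
  have f13 : δ13 ≫ pullback.fst sZ sK = pullback.fst _ _ ≫ pullback.fst _ _ := pullback.lift_fst _ _ _
  have s13 : δ13 ≫ pullback.snd sZ sK = pullback.snd _ _ := pullback.lift_snd _ _ _
  have f23 : δ23 ≫ pullback.fst sZ sK = pullback.fst _ _ ≫ pullback.snd _ _ ≫ c := pullback.lift_fst _ _ _
  have s23 : δ23 ≫ pullback.snd sZ sK = pullback.snd _ _ := pullback.lift_snd _ _ _
  have e13 : δ13 ≫ pullback.fst sZ sK ≫ sZ = pullback.fst (pullback.fst sZ sK ≫ sZ) sK ≫ pullback.fst sZ sK ≫ sZ := by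
    rw [reassoc_of% f13]
  have e23 : δ23 ≫ pullback.fst sZ sK ≫ sZ = pullback.fst (pullback.fst sZ sK ≫ sZ) sK ≫ pullback.fst sZ sK ≫ sZ := by
    rw [reassoc_of% f23, hc, pullback.condition]
  refine desc' (π := p3 sX sY sZ) (ω := p3 sX sY sK) (γ := m3 sX sY hc) (β := b3 sX sY sK) (p1 := m3 sX sY rfl) (p2 := m3 sX sY pullback.condition.symm) (d12 := m3 sX sY rfl) (d13 := m3 sX sY e13) (d23 := m3 sX sY e23)
    (d3 := m3 sX sY es) (m3_p3 _ _ _) (m3_sq _ _ (IsPullback.of_hasPullback _ _) _ _) (p3_pb _ _ _) ?_ ?_ ?_ ?_ ?_ l0 hl0 j3.surj (p3 sX sY sK).isClosedMap (m3_m3 _ _ _ _ rfl _) hg ?_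
  · rw [m3_p3]; exact m3_sq _ _ (IsPullback.of_hasPullback _ _) _ _
  · rw [m3_m3 sX sY _ _ f13 (by rw [assoc]), m3_m3 sX sY _ _ rfl (by rw [assoc])]
  · rw [m3_m3 sX sY _ _ s13]
  · rw [m3_m3 sX sY _ _ f23 (by rw [← e23, reassoc_of% f23, assoc, assoc]), m3_m3 sX sY hc _ rfl (pt_e' hc), m3_m3 sX sY _ _ rfl]
  · rw [m3_m3 sX sY _ _ s23]
  · exact nm_coc hr hg hΦ _ _ _ rfl rfl f13 (by rw [reassoc_of% s13]) (by rw [f23]) (by rw [reassoc_of% s23])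
end
end

section
section
variable {T T' : Scheme.{u}}

lemma pl_bij (h : T' ⟶ T) [IsOpenImmersion h] {O : T.Opens} {O' : T'.Opens} (hO : O ≤ h.opensRange)
    (e : O' = h ⁻¹ᵁ O) (h' : O' ≤ h ⁻¹ᵁ O) : Function.Bijective (pl h h') := by
  subst e
  have : IsIso (h.app O) := Scheme.Hom.isIso_app h O hO
  have e2 : pl h h' = (h.app O).hom := by
    rw [pl, Scheme.Hom.app_eq_appLE]
  rw [e2]
  exact ConcreteCategory.bijective_of_isIso (h.app O)

lemma pl_inj (h : T' ⟶ T) [IsOpenImmersion h] {O : T.Opens} (hO : O ≤ h.opensRange)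
    {a b : Γ(T, O)} (e : pl h (pre_rfl : h ⁻¹ᵁ O ≤ _) a = pl h (pre_rfl : h ⁻¹ᵁ O ≤ _) b) : a = b :=
  (pl_bij h hO rfl _).1 e

/-- lift of a morphism to an open subscheme -/
def lf (f : T' ⟶ T) (U : T.Opens) (h : ⊤ ≤ f ⁻¹ᵁ U) : T' ⟶ U.toScheme :=
  IsOpenImmersion.lift U.ι f (by
    rintro _ ⟨x, rfl⟩
    simpa using h (show x ∈ (⊤ : T'.Opens) from trivial))

@[simp] lemma lf_ι (f : T' ⟶ T) (U : T.Opens) (h : ⊤ ≤ f ⁻¹ᵁ U) : lf f U h ≫ U.ι = f :=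
  IsOpenImmersion.lift_fac _ _ _

lemma lf_eq {f : T' ⟶ T} {U : T.Opens} (h : ⊤ ≤ f ⁻¹ᵁ U) {x : T' ⟶ U.toScheme} (e : x ≫ U.ι = f) :
    x = lf f U h := by
  rw [← cancel_mono U.ι, lf_ι, e]

lemma top_le_ι (U : T.Opens) : ⊤ ≤ U.ι ⁻¹ᵁ U := by simp

lemma top_le_of_ι {f : T' ⟶ T} {U : T.Opens} {x : T' ⟶ U.toScheme} (e : x ≫ U.ι = f) : ⊤ ≤ f ⁻¹ᵁ U := by
  subst e
  intro y _
  exact (x y).2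

lemma top_le_mono {T'' : Scheme.{u}} {g : T'' ⟶ T'} {f : T' ⟶ T} {f' : T'' ⟶ T} (e : g ≫ f = f') {U : T.Opens} (h : ⊤ ≤ f ⁻¹ᵁ U) :
    ⊤ ≤ f' ⁻¹ᵁ U := le_pre_of_comp e h le_pre_top

lemma pl_top (f : T' ⟶ T) (h : ⊤ ≤ f ⁻¹ᵁ ⊤) (a : Γ(T, ⊤)) : pl f h a = f.appTop a := by
  have e2 : f.appLE ⊤ ⊤ h = f.appTop := Scheme.Hom.appLE_eq_app f
  rw [pl, e2]

end

section
variable {S T : Scheme.{u}} {N : LB S} {f : T ⟶ S} {κ : Type*} {X : κ → Scheme.{u}} (h : ∀ c, X c ⟶ T)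
  [∀ c, IsOpenImmersion (h c)]

/-- sections agree if they agree on an open cover -/
lemma sec_ext_cover (hc : ∀ x : T, ∃ c y, h c y = x) {fc : ∀ c, X c ⟶ S} (e : ∀ c, h c ≫ f = fc c) {σ τ : Sec N f ⊤}
    (H : ∀ c, σ.pull (h c) (e c) (V' := ⊤) le_pre_top = τ.pull (h c) (e c) (V' := ⊤) le_pre_top) : σ = τ := by
  refine Sec.ext_loc fun x _ => ?_
  obtain ⟨c, y, hy⟩ := hc x
  obtain ⟨i, hi⟩ := N.cov' f x
  refine ⟨(h c).opensRange ⊓ f ⁻¹ᵁ N.U i, i, inf_le_right, le_top, ⟨⟨y, hy⟩, hi⟩, ?_⟩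
  apply pl_inj (h c) inf_le_left
  have hh : (h c) ⁻¹ᵁ ((h c).opensRange ⊓ f ⁻¹ᵁ N.U i) ≤ fc c ⁻¹ᵁ N.U i := le_pre_comp' (e c) inf_le_right
  have := congrArg (fun ρ : Sec N (fc c) ⊤ => ρ.at i hh le_top) (H c)
  rw [Sec.pull_at (h c) (e c) σ _ i pre_rfl hh le_top inf_le_right le_top,
    Sec.pull_at (h c) (e c) τ _ i pre_rfl hh le_top inf_le_right le_top] at this
  exact this

/-- gluing of sections on an open cover -/
lemma sec_glue_cover (hc : ∀ x : T, ∃ c y, h c y = x) {fc : ∀ c, X c ⟶ S} (e : ∀ c, h c ≫ f = fc c)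
    (σ : ∀ c, Sec N (fc c) ⊤)
    (H : ∀ (c d) (Z : Scheme.{u}) (p : Z ⟶ X c) (q : Z ⟶ X d) (g : Z ⟶ S) (_ : p ≫ h c = q ≫ h d)
      (ep : p ≫ fc c = g) (eq : q ≫ fc d = g),
      (σ c).pull p ep (V' := ⊤) le_pre_top = (σ d).pull q eq (V' := ⊤) le_pre_top) :
    ∃ τ : Sec N f ⊤, ∀ c, τ.pull (h c) (e c) (V' := ⊤) le_pre_top = σ c := by
  let O : κ × N.ι → T.Opens := fun p => (h p.1).opensRange ⊓ f ⁻¹ᵁ N.U p.2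
  have hO : ∀ p, (h p.1) ⁻¹ᵁ O p ≤ fc p.1 ⁻¹ᵁ N.U p.2 := fun p => le_pre_comp' (e p.1) inf_le_right
  choose a ha using fun p : κ × N.ι => (pl_bij (h p.1) (O := O p) inf_le_left rfl pre_rfl).2
    ((σ p.1).at p.2 (hO p) le_top)
  obtain ⟨τ, hτ⟩ := Sec.glue (N := N) (f := f) (V := ⊤) O (fun p => p.2) (fun p => inf_le_right) (fun p => le_top)
    (fun x _ => by
      obtain ⟨c, y, hy⟩ := hc x
      obtain ⟨i, hi⟩ := N.cov' f x
      exact ⟨(c, i), ⟨y, hy⟩, hi⟩) a (fun p q => by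
      have hr : O p ⊓ O q ≤ (pullback.fst (h p.1) (h q.1) ≫ h p.1).opensRange := by
        rintro x ⟨⟨⟨y, hy⟩, -⟩, ⟨⟨z, hz⟩, -⟩⟩
        obtain ⟨w, h1, h2⟩ := Scheme.Pullback.exists_preimage_pullback (f := h p.1) (g := h q.1) y z (hy.trans hz.symm)
        exact ⟨w, by rw [Scheme.Hom.comp_apply, h1, hy]⟩
      apply pl_inj (pullback.fst (h p.1) (h q.1) ≫ h p.1) hr
      have h1 : (pullback.fst (h p.1) (h q.1) ≫ h p.1) ⁻¹ᵁ (O p ⊓ O q) ≤ (pullback.fst (h p.1) (h q.1)) ⁻¹ᵁ ((h p.1) ⁻¹ᵁ O p) :=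
        le_pre_comp rfl (pre_le inf_le_left)
      have h2 : (pullback.fst (h p.1) (h q.1) ≫ h p.1) ⁻¹ᵁ (O p ⊓ O q) ≤ (pullback.snd (h p.1) (h q.1)) ⁻¹ᵁ ((h q.1) ⁻¹ᵁ O q) :=
        le_pre_comp pullback.condition.symm (pre_le inf_le_right)
      have e1 := congrArg (pl _ h1) (ha p)
      have e2 := congrArg (pl _ h2) (ha q)
      have ep : pullback.fst (h p.1) (h q.1) ≫ fc p.1 = (pullback.fst (h p.1) (h q.1) ≫ h p.1) ≫ f := by
        rw [assoc, e]
      have eq : pullback.snd (h p.1) (h q.1) ≫ fc q.1 = (pullback.fst (h p.1) (h q.1) ≫ h p.1) ≫ f := by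
        rw [pullback.condition, assoc, e]
      have hp : (pullback.fst (h p.1) (h q.1) ≫ h p.1) ⁻¹ᵁ (O p ⊓ O q) ≤ ((pullback.fst (h p.1) (h q.1) ≫ h p.1) ≫ f) ⁻¹ᵁ N.U p.2 :=
        le_pre_of_comp ep (hO p) h1
      have hq : (pullback.fst (h p.1) (h q.1) ≫ h p.1) ⁻¹ᵁ (O p ⊓ O q) ≤ ((pullback.fst (h p.1) (h q.1) ≫ h p.1) ≫ f) ⁻¹ᵁ N.U q.2 :=
        le_pre_of_comp eq (hO q) h2
      have key := H p.1 q.1 _ (pullback.fst _ _) (pullback.snd _ _) _ pullback.condition ep eq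
      have k1 := Sec.pull_at _ ep (σ p.1) (V' := ⊤) le_pre_top p.2 h1 hp le_top (hO p) le_top
      have k2 := Sec.pull_at _ eq (σ q.1) (V' := ⊤) le_pre_top q.2 h2 hq le_top (hO q) le_top
      have k3 := Sec.at_tr ((σ p.1).pull _ ep (V' := ⊤) le_pre_top) p.2 q.2 hp hq le_top
      rw [k1] at k3
      rw [key, k2] at k3
      rw [pl_comp rfl _ h1 (pre_le inf_le_left)] at e1
      rw [pl_comp pullback.condition.symm _ h2 (pre_le inf_le_right)] at e2
      rw [map_mul, pl_rs, pl_rs, e1, e2, k3]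
      congr 1
      exact (N.pl_tr f _ rfl p.2 q.2 _ _ _ _ _).symm)
  refine ⟨τ, fun c => Sec.ext_loc fun x _ => ?_⟩
  obtain ⟨i, hi⟩ := N.cov' (fc c) x
  have hi' : (h c) x ∈ f ⁻¹ᵁ N.U i := by
    rw [← e c] at hi; exact hi
  refine ⟨(h c) ⁻¹ᵁ O (c, i), i, hO (c, i), le_top, ⟨⟨x, rfl⟩, hi'⟩, ?_⟩
  rw [Sec.pull_at (h c) (e c) τ _ i pre_rfl (hO (c, i)) le_top inf_le_right le_top]
  exact (congrArg _ (hτ (c, i))).trans (ha (c, i))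

end
end

section
section
variable {S T T' T'' : Scheme.{u}}

/-- a section together with the morphism it lives over -/
structure Pt (N : LB S) (T : Scheme.{u}) : Type u where
  f : T ⟶ S
  σ : Sec N f ⊤

/-- pullback of points -/
def Pt.map {N : LB S} (p : Pt N T) (g : T' ⟶ T) : Pt N T' := ⟨g ≫ p.f, p.σ.pull g rfl le_pre_top⟩

variable {N : LB S}

lemma Pt.ext_id {p q : Pt N T} {f : T ⟶ S} (ep : 𝟙 T ≫ p.f = f) (eq : 𝟙 T ≫ q.f = f)
    (h : p.σ.pull (𝟙 T) ep (V' := ⊤) le_pre_top = q.σ.pull (𝟙 T) eq (V' := ⊤) le_pre_top) : p = q := by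
  obtain ⟨pf, ps⟩ := p
  obtain ⟨qf, qs⟩ := q
  obtain rfl : pf = f := by rw [← ep, id_comp]
  obtain rfl : qf = pf := by rw [← eq, id_comp]
  have h' : ps.pull (𝟙 T) ep (V' := ⊤) le_pre_top = qs.pull (𝟙 T) eq (V' := ⊤) le_pre_top := h
  rw [Sec.pull_id, Sec.pull_id, Sec.res_self, Sec.res_self] at h'
  rw [h']

lemma Pt.eq_pull {p q : Pt N T} (h : p = q) (g : T' ⟶ T) {f : T' ⟶ S} (ep : g ≫ p.f = f) (eq : g ≫ q.f = f) :
    p.σ.pull g ep (V' := ⊤) le_pre_top = q.σ.pull g eq (V' := ⊤) le_pre_top := by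
  subst h; rfl

lemma Pt.map_f (p : Pt N T) (g : T' ⟶ T) : (p.map g).f = g ≫ p.f := rfl

lemma Pt.map_pull (p : Pt N T) (g : T' ⟶ T) (h : T'' ⟶ T') {f : T'' ⟶ S} (e : h ≫ (p.map g).f = f) (e' : (h ≫ g) ≫ p.f = f) :
    (p.map g).σ.pull h e (V' := ⊤) le_pre_top = p.σ.pull (h ≫ g) e' (V' := ⊤) le_pre_top :=
  Sec.pull_pull g rfl (V' := ⊤) le_pre_top h e (V'' := ⊤) le_pre_top (h ≫ g) rfl e' le_pre_top p.σ

lemma Pt.map_id (p : Pt N T) : p.map (𝟙 T) = p := by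
  refine Pt.ext_id (f := p.f) (by rw [Pt.map_f]; simp) (by simp) ?_
  rw [Pt.map_pull p (𝟙 T) (𝟙 T) _ (by simp)]
  exact Sec.pull_congr (by simp) _ _ _ _ _

lemma Pt.map_map (p : Pt N T) (g : T' ⟶ T) (h : T'' ⟶ T') : (p.map g).map h = p.map (h ≫ g) := by
  refine Pt.ext_id (f := (h ≫ g) ≫ p.f) (by rw [Pt.map_f, Pt.map_f]; simp) (by rw [Pt.map_f]; simp) ?_
  rw [Pt.map_pull _ h (𝟙 _) _ (by rw [Pt.map_f]; simp), Pt.map_pull _ g _ _ (by simp),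
    Pt.map_pull _ (h ≫ g) _ _ (by simp)]
  exact Sec.pull_congr (by simp) _ _ _ _ _

lemma sec_ext_chart {f : T ⟶ S} (i : N.ι) (h : ⊤ ≤ f ⁻¹ᵁ N.U i) {σ τ : Sec N f ⊤} (e : σ.at i h le_rfl = τ.at i h le_rfl) :
    σ = τ :=
  Sec.ext_at (κ := Unit) (fun _ => ⊤) (fun _ => i) (fun _ => h) (fun _ => le_rfl) (fun x hx => ⟨(), hx⟩) (fun _ => e)

/-- chart schemes -/
abbrev AA (N : LB S) (i : N.ι) : Scheme.{u} := AffineSpace PUnit.{u + 1} (N.U i).toScheme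

/-- the projection of the chart -/
def aa (N : LB S) (i : N.ι) : AA N i ⟶ S := (AA N i ↘ (N.U i).toScheme) ≫ (N.U i).ι

lemma aa_le (N : LB S) (i : N.ι) : ⊤ ≤ aa N i ⁻¹ᵁ N.U i := top_le_of_ι (x := AA N i ↘ (N.U i).toScheme) rfl

/-- the universal section on a chart -/
def chσ (N : LB S) (i : N.ι) : Sec N (aa N i) ⊤ :=
  (AffineSpace.coord (N.U i).toScheme (PUnit.unit : PUnit.{u + 1}) : Γ(AA N i, ⊤)) • (N.chart (aa N i) i).res (aa_le N i)

/-- the universal point on a chart -/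
def ch (N : LB S) (i : N.ι) : Pt N (AA N i) := ⟨aa N i, chσ N i⟩

lemma chσ_at (i : N.ι) (x : T ⟶ AA N i) {f : T ⟶ S} (e : x ≫ aa N i = f) (h : ⊤ ≤ f ⁻¹ᵁ N.U i) :
    ((chσ N i).pull x e (V' := ⊤) le_pre_top).at i h le_rfl =
      x.appTop (AffineSpace.coord (N.U i).toScheme (PUnit.unit : PUnit.{u + 1})) := by
  rw [Sec.pull_at x e (chσ N i) (V' := ⊤) le_pre_top i (O := ⊤) le_pre_top h le_rfl (aa_le N i) le_rfl]
  rw [chσ, Sec.at_smul, Sec.res_at, LB.chart_at, LB.tr_self, mul_one, rs_self, pl_top]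

lemma ch_at (i : N.ι) (x : T ⟶ AA N i) {f : T ⟶ S} (e : x ≫ (ch N i).f = f) (h : ⊤ ≤ f ⁻¹ᵁ N.U i) :
    ((ch N i).σ.pull x e (V' := ⊤) le_pre_top).at i h le_rfl =
      x.appTop (AffineSpace.coord (N.U i).toScheme (PUnit.unit : PUnit.{u + 1})) := chσ_at i x e h

lemma ch_exists (i : N.ι) (p : Pt N T) (h : ⊤ ≤ p.f ⁻¹ᵁ N.U i) : ∃ x : T ⟶ AA N i, (ch N i).map x = p := by
  let x : T ⟶ AA N i := AffineSpace.homOfVector (lf p.f _ h) (fun _ => p.σ.at i h le_rfl)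
  have hx : x ≫ (ch N i).f = p.f := by
    change x ≫ (AA N i ↘ (N.U i).toScheme) ≫ (N.U i).ι = _
    rw [AffineSpace.homOfVector_over_assoc, lf_ι]
  refine ⟨x, Pt.ext_id (f := p.f) (by rw [Pt.map_f]; simpa using hx) (by simp) ?_⟩
  rw [Pt.map_pull _ x _ _ (by simpa using hx)]
  refine sec_ext_chart i h ?_
  rw [ch_at, Sec.pull_id, Sec.res_self, id_comp, AffineSpace.homOfVector_appTop_coord]

lemma ch_inj (i : N.ι) {x y : T ⟶ AA N i} (h : (ch N i).map x = (ch N i).map y) : x = y := by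
  have e : x ≫ aa N i = y ≫ aa N i := congrArg Pt.f h
  apply AffineSpace.hom_ext
  · rw [← cancel_mono (N.U i).ι, assoc, assoc]; exact e
  · rintro ⟨⟩
    have h1 : x ≫ (ch N i).f = x ≫ (ch N i).f := rfl
    have h2 : y ≫ (ch N i).f = x ≫ (ch N i).f := e.symm
    have hi : ⊤ ≤ (x ≫ (ch N i).f) ⁻¹ᵁ N.U i := top_le_mono (g := x) rfl (aa_le N i)
    rw [← ch_at i x h1 hi, ← ch_at i y h2 hi]
    have := Pt.eq_pull h (𝟙 _) (f := x ≫ (ch N i).f) (id_comp _) ((id_comp _).trans h2)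
    have k1 := Pt.map_pull (ch N i) x (𝟙 _) (f := x ≫ (ch N i).f) (id_comp _) (by simp)
    have k2 := Pt.map_pull (ch N i) y (𝟙 _) (f := x ≫ (ch N i).f) ((id_comp _).trans h2) (by simpa using h2)
    have k3 := k1.symm.trans (this.trans k2)
    have k4 := Sec.pull_congr (id_comp x) (by simp) h1 (V := ⊤) (V' := ⊤) le_pre_top le_pre_top (ch N i).σ
    have k5 := Sec.pull_congr (id_comp y) (by simpa using h2) h2 (V := ⊤) (V' := ⊤) le_pre_top le_pre_top (ch N i).σ
    rw [k4.symm.trans (k3.trans k5)]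

lemma ch_le (i : N.ι) {x : T ⟶ AA N i} {p : Pt N T} (h : (ch N i).map x = p) : ⊤ ≤ p.f ⁻¹ᵁ N.U i := by
  subst h
  exact top_le_mono (g := x) rfl (aa_le N i)

end
end

section
section
variable {S T T' T'' : Scheme.{u}} {N : LB S}

lemma pt_mk_eq {f : T ⟶ S} {p : Pt N T} {τ : Sec N f ⊤} (ef : 𝟙 T ≫ p.f = f)
    (e : p.σ.pull (𝟙 T) ef (V' := ⊤) le_pre_top = τ) : p = ⟨f, τ⟩ := by
  refine Pt.ext_id (f := f) ef (id_comp _) ?_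
  rw [e]
  exact ((Sec.pull_id _ τ _).trans (Sec.res_self _ _)).symm

lemma pt_ext_cover (𝓤 : T.OpenCover) {p q : Pt N T} (h : ∀ i, p.map (𝓤.f i) = q.map (𝓤.f i)) : p = q := by
  have e : p.f = q.f := 𝓤.hom_ext _ _ fun i => congrArg Pt.f (h i)
  refine Pt.ext_id (f := p.f) (id_comp _) ((id_comp _).trans e.symm) ?_
  refine sec_ext_cover 𝓤.f (fun x => ⟨_, 𝓤.covers x⟩) (fun i => rfl) fun i => ?_
  have := Pt.eq_pull (h i) (𝟙 _) (f := 𝓤.f i ≫ p.f) (id_comp _) (by rw [Pt.map_f, e]; simp)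
  have k1 := Pt.map_pull p (𝓤.f i) (𝟙 _) (f := 𝓤.f i ≫ p.f) (id_comp _) (by simp)
  have k2 := Pt.map_pull q (𝓤.f i) (𝟙 _) (f := 𝓤.f i ≫ p.f) (by rw [Pt.map_f, e]; simp) (by simp [e])
  have k3 := k1.symm.trans (this.trans k2)
  rw [Sec.pull_pull (𝟙 T) _ (V' := ⊤) le_pre_top (𝓤.f i) _ (V'' := ⊤) le_pre_top (𝟙 _ ≫ 𝓤.f i) (by simp) (by simp) le_pre_top,
    Sec.pull_pull (𝟙 T) _ (V' := ⊤) le_pre_top (𝓤.f i) _ (V'' := ⊤) le_pre_top (𝟙 _ ≫ 𝓤.f i) (by simp) (by simp [e]) le_pre_top]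
  exact k3

lemma pt_glue_cover (𝓤 : T.OpenCover) (p : ∀ i, Pt N (𝓤.X i))
    (h : ∀ i j {Z : Scheme.{u}} (a : Z ⟶ 𝓤.X i) (b : Z ⟶ 𝓤.X j), a ≫ 𝓤.f i = b ≫ 𝓤.f j → (p i).map a = (p j).map b) :
    ∃ q : Pt N T, ∀ i, q.map (𝓤.f i) = p i := by
  let f : T ⟶ S := 𝓤.glueMorphisms (fun i => (p i).f) fun i j => congrArg Pt.f (h i j _ _ pullback.condition)
  have ef : ∀ i, 𝓤.f i ≫ f = (p i).f := fun i => 𝓤.ι_glueMorphisms _ _ i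
  obtain ⟨τ, hτ⟩ := sec_glue_cover (N := N) (f := f) 𝓤.f (fun x => ⟨_, 𝓤.covers x⟩) ef (fun i => (p i).σ)
    (fun c d Z a b g e1 ea eb => by
      have := Pt.eq_pull (h c d a b e1) (𝟙 _) (f := g) ((id_comp _).trans ea) ((id_comp _).trans eb)
      have k1 := Pt.map_pull (p c) a (𝟙 _) (f := g) ((id_comp _).trans ea) (by simpa using ea)
      have k2 := Pt.map_pull (p d) b (𝟙 _) (f := g) ((id_comp _).trans eb) (by simpa using eb)
      have k3 := k1.symm.trans (this.trans k2)
      have k4 := Sec.pull_congr (id_comp a) (by simpa using ea) ea (V := ⊤) (V' := ⊤) le_pre_top le_pre_top (p c).σ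
      have k5 := Sec.pull_congr (id_comp b) (by simpa using eb) eb (V := ⊤) (V' := ⊤) le_pre_top le_pre_top (p d).σ
      exact k4.symm.trans (k3.trans k5))
  refine ⟨⟨f, τ⟩, fun i => ?_⟩
  refine pt_mk_eq (p := Pt.map ⟨f, τ⟩ (𝓤.f i)) (f := (p i).f) (τ := (p i).σ) ((id_comp _).trans (ef i)) ?_
  refine (Pt.map_pull (⟨f, τ⟩ : Pt N T) (𝓤.f i) (𝟙 _) _ (by simpa using ef i)).trans ?_
  exact (Sec.pull_congr (id_comp _) _ (ef i) _ _ τ).trans (hτ i)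

/-- the functor of points -/
def SecF (N : LB S) : Scheme.{u}ᵒᵖ ⥤ Type u where
  obj T := Pt N T.unop
  map g := ↾ (fun p => p.map g.unop)
  map_id T := by ext p; exact Pt.map_id p
  map_comp g h := by ext p; exact (Pt.map_map p _ _).symm

lemma secF_sheaf (N : LB S) : Presieve.IsSheaf Scheme.zariskiTopology.{u} (SecF N) := by
  rw [Precoverage.isSheaf_toGrothendieck_iff_of_isStableUnderBaseChange]
  rintro Y R hR x hx
  obtain ⟨(𝓤 : Y.OpenCover), rfl⟩ := Scheme.exists_cover_of_mem_pretopology hR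
  obtain ⟨q, hq⟩ := pt_glue_cover (N := N) 𝓤 (fun j => x (𝓤.f _) (.mk _)) (by
    intro i j Z a b e
    exact hx a b _ _ e)
  refine ⟨q, ?_, ?_⟩
  · rintro Z e ⟨j⟩
    exact hq j
  · intro q' h
    refine pt_ext_cover 𝓤 fun j => ?_
    exact (h (𝓤.f j) (.mk j)).trans (hq j).symm

/-- the sheaf of points -/
def SecS (N : LB S) : Sheaf Scheme.zariskiTopology.{u} (Type u) :=
  ⟨SecF N, (isSheaf_iff_isSheaf_of_type _ _).2 (secF_sheaf N)⟩

/-- the charts -/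
def chY (N : LB S) (i : N.ι) : yoneda.obj (AA N i) ⟶ (SecS N).1 where
  app T := ↾ (fun x : T.unop ⟶ AA N i => ((ch N i).map x : Pt N T.unop))
  naturality T T' g := by ext x; exact (Pt.map_map _ _ _).symm

lemma chY_rel (N : LB S) (i : N.ι) : IsOpenImmersion.presheaf (chY N i) := by
  apply MorphismProperty.relative.of_exists
  intro a g
  let p : Pt N a := yonedaEquiv g
  have hg : ∀ {T : Scheme.{u}} (x : T ⟶ a), (g.app (op T) x : Pt N T) = p.map x := fun x => by
    have := ConcreteCategory.congr_hom (g.naturality x.op) (𝟙 a)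
    refine Eq.trans ?_ this
    change g.app _ x = g.app _ (x ≫ 𝟙 a)
    rw [comp_id]
  let U := p.f ⁻¹ᵁ N.U i
  obtain ⟨y, hy⟩ := ch_exists (N := N) i (p.map U.ι) (top_le_of_ι (x := lf (U.ι ≫ p.f) (N.U i) (le_pre_comp rfl (top_le_ι U))) (lf_ι _ _ _))
  refine ⟨U.toScheme, yoneda.map y, U.ι, ?_, inferInstance⟩
  have hw : yoneda.map y ≫ chY N i = yoneda.map U.ι ≫ g := by
    ext ⟨T⟩ (t : T ⟶ U.toScheme)
    change (ch N i).map (t ≫ y) = g.app _ (t ≫ U.ι)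
    rw [hg, ← Pt.map_map, hy, Pt.map_map]
  refine IsPullback.of_forall_isPullback_app fun ⟨T⟩ => ?_
  rw [Types.isPullback_iff]
  refine ⟨by ext t; exact ConcreteCategory.congr_hom (NatTrans.congr_app hw (op T)) t, ?_, ?_⟩
  · rintro (t : T ⟶ U.toScheme) (t' : T ⟶ U.toScheme) ⟨-, h : t ≫ U.ι = t' ≫ U.ι⟩
    exact (cancel_mono U.ι).1 h
  · rintro (z : T ⟶ AA N i) (w : T ⟶ a) h
    have h' : (ch N i).map z = p.map w := (show (ch N i).map z = g.app _ w from h).trans (hg w)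
    have hle : ⊤ ≤ w ⁻¹ᵁ U := ch_le i h'
    refine ⟨lf w U hle, ?_, lf_ι _ _ _⟩
    apply ch_inj i
    change (ch N i).map (lf w U hle ≫ y) = _
    rw [← Pt.map_map, hy, Pt.map_map, lf_ι, h']

instance chY_surj (N : LB S) : Presheaf.IsLocallySurjective Scheme.zariskiTopology.{u} (Sigma.desc (chY N)) where
  imageSieve_mem {a} p' := by
    let p : Pt N a := p'
    let 𝓤 := a.openCoverOfIsOpenCover (fun i => p.f ⁻¹ᵁ N.U i) (by
      refine eq_top_iff.2 fun x _ => ?_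
      obtain ⟨i, hi⟩ := N.cov' p.f x
      exact TopologicalSpace.Opens.mem_iSup.2 ⟨i, hi⟩)
    refine GrothendieckTopology.superset_covering _ ?_ 𝓤.mem_grothendieckTopology
    rintro Z e ⟨W, b, _, ⟨i⟩, rfl⟩
    let U := p.f ⁻¹ᵁ N.U i
    obtain ⟨y, hy⟩ := ch_exists (N := N) i (p.map U.ι) (top_le_of_ι (x := lf (U.ι ≫ p.f) (N.U i) (le_pre_comp rfl (top_le_ι U))) (lf_ι _ _ _))
    let z : Z ⟶ AA N i := (show Z ⟶ U.toScheme from b) ≫ y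
    have := ConcreteCategory.congr_hom (NatTrans.congr_app (Sigma.ι_desc (chY N) i) (op Z)) z
    refine ⟨_, this.trans ?_⟩
    exact (Pt.map_map _ _ _).symm.trans ((congrArg (fun r => Pt.map r (show Z ⟶ U.toScheme from b)) hy).trans (Pt.map_map _ _ _))

/-- the sections of a line bundle are represented by a scheme -/
theorem exists_tot (N : LB S) : ∃ (E : Scheme.{u}) (π : E ⟶ S) (u : Sec N π ⊤), ∀ (T : Scheme.{u}) (f : T ⟶ S)
    (σ : Sec N f ⊤), ∃! a : T ⟶ E, ∃ e : a ≫ π = f, u.pull a e (V' := ⊤) le_pre_top = σ := by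
  have R := Scheme.LocalRepresentability.representableBy (F := SecS N) (f := chY N) (chY_rel N)
  generalize (Scheme.LocalRepresentability.glueData (F := SecS N) (f := chY N) (chY_rel N)).glued = E at R
  let p : Pt N E := R.homEquiv (𝟙 E)
  have hR : ∀ {T : Scheme.{u}} (a : T ⟶ E), (R.homEquiv a : Pt N T) = p.map a := fun a => by
    exact R.homEquiv_eq a
  refine ⟨E, p.f, p.σ, fun T f σ => ⟨R.homEquiv.symm (⟨f, σ⟩ : Pt N T), ?_, ?_⟩⟩
  · have h1 := hR (R.homEquiv.symm (⟨f, σ⟩ : Pt N T))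
    replace h1 : (⟨f, σ⟩ : Pt N T) = _ := (R.homEquiv.apply_symm_apply _).symm.trans h1
    generalize R.homEquiv.symm (⟨f, σ⟩ : Pt N T) = a at h1
    have e : a ≫ p.f = f := (congrArg Pt.f h1).symm
    refine ⟨e, ?_⟩
    have := Pt.eq_pull h1 (𝟙 _) (f := f) (id_comp _) ((id_comp _).trans e)
    have k2 := Pt.map_pull p a (𝟙 _) (f := f) ((id_comp _).trans e) (by simpa using e)
    have k3 := Sec.pull_congr (id_comp a) (by simpa using e) e (V := ⊤) (V' := ⊤) le_pre_top le_pre_top p.σ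
    refine k3.symm.trans (k2.symm.trans (this.symm.trans ?_))
    exact (Sec.pull_id _ σ _).trans (Sec.res_self _ _)
  · rintro a ⟨e, he⟩
    apply R.homEquiv.injective
    refine Eq.trans ((hR a).trans ?_) (R.homEquiv.apply_symm_apply _).symm
    refine pt_mk_eq (p := p.map a) ((id_comp _).trans e) ?_
    refine (Pt.map_pull p a (𝟙 _) _ (by simpa using e)).trans ?_
    exact (Sec.pull_congr (id_comp a) _ e _ _ p.σ).trans he

end
end

section
section
variable {S T T' : Scheme.{u}} {E : VecBundleData S}

lemma frame_out {U : S.Opens} {s : Fin 1 → (U.toScheme ⟶ E.tot)} (h : E.IsFrame U s) :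
    ∃ _ : s 0 ≫ E.π = U.ι, ∀ {T : Scheme.{u}} (x : T ⟶ U.toScheme) (a : T ⟶ E.tot), a ≫ E.π = x ≫ U.ι →
      ∃! c : Γ(T, ⊤), E.smul c (x ≫ s 0) = a := by
  obtain ⟨hs, H⟩ := h
  refine ⟨hs 0, fun {T} x a ha => ?_⟩
  obtain ⟨c, hc⟩ := (H x).2 ⟨a, ha⟩
  simp only [Fin.sum_univ_one] at hc
  refine ⟨c 0, congrArg Subtype.val hc, fun d hd => ?_⟩
  have := (H x).1 (a₁ := fun _ => d) (a₂ := c) (by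
    simp only [Fin.sum_univ_one]
    rw [hc]
    exact Subtype.ext hd)
  exact congrFun this 0

lemma frame_in {U : S.Opens} {s : U.toScheme ⟶ E.tot} (hs : s ≫ E.π = U.ι)
    (H : ∀ {T : Scheme.{u}} (x : T ⟶ U.toScheme) (a : T ⟶ E.tot), a ≫ E.π = x ≫ U.ι →
      ∃! c : Γ(T, ⊤), E.smul c (x ≫ s) = a) : E.IsFrame (n := 1) U (fun _ => s) := by
  refine ⟨fun _ => hs, fun {T} x => ⟨fun c d h => ?_, fun a => ?_⟩⟩
  · simp only [Fin.sum_univ_one] at h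
    have h' : E.smul (c 0) (x ≫ s) = E.smul (d 0) (x ≫ s) := congrArg Subtype.val h
    have := (H x (E.smul (d 0) (x ≫ s)) ((E.smul_π _ _).trans (by rw [assoc, hs]))).unique h' rfl
    funext i
    rw [Subsingleton.elim i 0, this]
  · obtain ⟨c, hc, -⟩ := H x a.1 a.2
    refine ⟨fun _ => c, ?_⟩
    simp only [Fin.sum_univ_one]
    exact Subtype.ext hc

lemma gframe_out {s : Fin 1 → (S ⟶ E.tot)} (h : E.IsGlobalFrame s) :
    ∃ _ : s 0 ≫ E.π = 𝟙 S, ∀ {T : Scheme.{u}} (x : T ⟶ S) (a : T ⟶ E.tot), a ≫ E.π = x →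
      ∃ c : Γ(T, ⊤), E.smul c (x ≫ s 0) = a := by
  obtain ⟨hs, H⟩ := h
  refine ⟨hs 0, fun {T} x a ha => ?_⟩
  obtain ⟨c, hc⟩ := (H x).2 ⟨a, ha⟩
  simp only [Fin.sum_univ_one] at hc
  exact ⟨c 0, congrArg Subtype.val hc⟩

end

section
variable {S T T' E : Scheme.{u}} {N : LB S} {π : E ⟶ S} (u : Sec N π ⊤)

/-- the section of a point -/
def ev (a : T ⟶ E) {f : T ⟶ S} (e : a ≫ π = f) : Sec N f ⊤ := u.pull a e (V' := ⊤) le_pre_top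

lemma ev_comp (g : T' ⟶ T) (a : T ⟶ E) {f : T ⟶ S} {f' : T' ⟶ S} (e : a ≫ π = f) (e' : g ≫ f = f') (e'' : (g ≫ a) ≫ π = f') :
    ev u (g ≫ a) e'' = (ev u a e).pull g e' (V' := ⊤) le_pre_top :=
  (Sec.pull_pull a e (V' := ⊤) le_pre_top g e' (V'' := ⊤) le_pre_top (g ≫ a) rfl e'' le_pre_top u).symm

lemma ev_congr {a b : T ⟶ E} (h : a = b) {f : T ⟶ S} (e : a ≫ π = f) (e' : b ≫ π = f) : ev u a e = ev u b e' := by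
  subst h; rfl

end

/-- a bundle represents a line bundle -/
structure Rep {S : Scheme.{u}} (E : VecBundleData S) (N : LB S) where
  u : Sec N E.π ⊤
  add : ∀ {T : Scheme.{u}} (a b : T ⟶ E.tot) (h) {f : T ⟶ S} (ea : a ≫ E.π = f) (eb : b ≫ E.π = f)
    (e : E.add a b h ≫ E.π = f), ev u (E.add a b h) e = ev u a ea + ev u b eb
  smul : ∀ {T : Scheme.{u}} (c : Γ(T, ⊤)) (a : T ⟶ E.tot) {f : T ⟶ S} (ea : a ≫ E.π = f)
    (e : E.smul c a ≫ E.π = f), ev u (E.smul c a) e = c • ev u a ea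
  bij : ∀ {T : Scheme.{u}} (f : T ⟶ S) (σ : Sec N f ⊤), ∃! a : T ⟶ E.tot, ∃ e : a ≫ E.π = f, ev u a e = σ

section
variable {S T T' : Scheme.{u}} {N : LB S} {f : T ⟶ S}

lemma Rep.inj {E : VecBundleData S} (r : Rep E N) {a b : T ⟶ E.tot} (ea : a ≫ E.π = f) (eb : b ≫ E.π = f) (h : ev r.u a ea = ev r.u b eb) :
    a = b := (r.bij f (ev r.u b eb)).unique ⟨ea, h⟩ ⟨eb, rfl⟩

lemma Rep.ex {E : VecBundleData S} (r : Rep E N) (σ : Sec N f ⊤) : ∃ (a : T ⟶ E.tot) (e : a ≫ E.π = f), ev r.u a e = σ :=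
  (r.bij f σ).exists

lemma pull_smul_top {f' : T' ⟶ S} (g : T' ⟶ T) (e : g ≫ f = f') (c : Γ(T, ⊤)) (σ : Sec N f ⊤) :
    (c • σ).pull g e (V' := ⊤) le_pre_top = (g.appTop c : Γ(T', ⊤)) • σ.pull g e (V' := ⊤) le_pre_top := by
  rw [Sec.pull_smul, pl_top]

/-- the total space data -/
structure TotData (N : LB S) where
  E : Scheme.{u}
  π : E ⟶ S
  u : Sec N π ⊤
  H : ∀ (T : Scheme.{u}) (f : T ⟶ S) (σ : Sec N f ⊤), ∃! a : T ⟶ E, ∃ e : a ≫ π = f, ev u a e = σ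

namespace TotData
variable (D : TotData N)

/-- the point of a section -/
def pt (σ : Sec N f ⊤) : T ⟶ D.E := (D.H T f σ).choose
lemma pt_π (σ : Sec N f ⊤) : D.pt σ ≫ D.π = f := (D.H T f σ).choose_spec.1.1
lemma ev_pt (σ : Sec N f ⊤) (e : D.pt σ ≫ D.π = f) : ev D.u (D.pt σ) e = σ := (D.H T f σ).choose_spec.1.2
lemma inj {a b : T ⟶ D.E} (ea : a ≫ D.π = f) (eb : b ≫ D.π = f) (h : ev D.u a ea = ev D.u b eb) :
    a = b := (D.H T f (ev D.u b eb)).unique ⟨ea, h⟩ ⟨eb, rfl⟩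

/-- addition -/
def add (a b : T ⟶ D.E) (h : a ≫ D.π = b ≫ D.π) : T ⟶ D.E := D.pt (ev D.u a rfl + ev D.u b h.symm)
lemma add_π (a b : T ⟶ D.E) (h : a ≫ D.π = b ≫ D.π) : D.add a b h ≫ D.π = a ≫ D.π := D.pt_π _
lemma ev_add (a b : T ⟶ D.E) (h : a ≫ D.π = b ≫ D.π) (ea : a ≫ D.π = f) (eb : b ≫ D.π = f) (e : D.add a b h ≫ D.π = f) :
    ev D.u (D.add a b h) e = ev D.u a ea + ev D.u b eb := by
  subst ea; exact D.ev_pt _ _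
/-- multiplication -/
def smul (c : Γ(T, ⊤)) (a : T ⟶ D.E) : T ⟶ D.E := D.pt (c • ev D.u a rfl)
lemma smul_π (c : Γ(T, ⊤)) (a : T ⟶ D.E) : D.smul c a ≫ D.π = a ≫ D.π := D.pt_π _
lemma ev_smul (c : Γ(T, ⊤)) (a : T ⟶ D.E) (ea : a ≫ D.π = f) (e : D.smul c a ≫ D.π = f) :
    ev D.u (D.smul c a) e = c • ev D.u a ea := by
  subst ea; exact D.ev_pt _ _
/-- zero -/
def zero : S ⟶ D.E := D.pt (0 : Sec N (𝟙 S) ⊤)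
lemma zero_π : D.zero ≫ D.π = 𝟙 S := D.pt_π _
lemma ev_zero (x : T ⟶ S) (e : (x ≫ D.zero) ≫ D.π = f) : ev D.u (x ≫ D.zero) e = 0 := by
  have e' : x ≫ 𝟙 S = f := by rw [← e, assoc, zero_π]
  have e0 : ev D.u D.zero D.zero_π = 0 := D.ev_pt _ _
  rw [ev_comp D.u x D.zero D.zero_π e' e, e0, Sec.pull_zero]
lemma zero_π' (x : T ⟶ S) : (x ≫ D.zero) ≫ D.π = x := by rw [assoc, zero_π, comp_id]

/-- the vector bundle -/
def bun : VecBundleData S where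
  tot := D.E
  π := D.π
  zero := D.zero
  zero_π := D.zero_π
  add := D.add
  smul := D.smul
  add_π := D.add_π
  smul_π := D.smul_π
  add_natural g a b h h' := by
    have e1 : (g ≫ D.add a b h) ≫ D.π = g ≫ a ≫ D.π := by rw [assoc, D.add_π]
    have e2 : (g ≫ b) ≫ D.π = g ≫ a ≫ D.π := by rw [assoc, h]
    refine D.inj (f := g ≫ a ≫ D.π) e1 ((D.add_π _ _ _).trans (assoc _ _ _)) ?_
    rw [ev_comp D.u g (D.add a b h) (D.add_π a b h) rfl e1, D.ev_add a b h rfl h.symm, Sec.pull_add,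
      D.ev_add _ _ h' (assoc _ _ _) e2, ev_comp D.u g a rfl rfl, ev_comp D.u g b h.symm rfl]
  smul_natural g c a := by
    have e1 : (g ≫ D.smul c a) ≫ D.π = g ≫ a ≫ D.π := by rw [assoc, D.smul_π]
    refine D.inj (f := g ≫ a ≫ D.π) e1 ((D.smul_π _ _).trans (assoc _ _ _)) ?_
    rw [ev_comp D.u g (D.smul c a) (D.smul_π c a) rfl e1, D.ev_smul c a rfl, pull_smul_top,
      D.ev_smul _ _ (assoc _ _ _), ev_comp D.u g a rfl rfl]
  add_comm a b h h' := by
    refine D.inj (f := a ≫ D.π) (D.add_π _ _ _) ((D.add_π _ _ _).trans h') ?_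
    rw [D.ev_add a b h rfl h', D.ev_add b a h' h' rfl, add_comm]
  add_assoc a b c h₁ h₂ h₃ h₄ := by
    have e1 : c ≫ D.π = a ≫ D.π := h₂.symm.trans (D.add_π _ _ _)
    refine D.inj (f := a ≫ D.π) ((D.add_π _ _ _).trans (D.add_π _ _ _)) (D.add_π _ _ _) ?_
    rw [D.ev_add _ _ h₂ (D.add_π _ _ _) e1, D.ev_add a b h₁ rfl h₁.symm, D.ev_add _ _ h₄ rfl h₄.symm,
      D.ev_add _ _ h₃ h₁.symm e1, add_assoc]
  zero_add a h := by
    refine D.inj (f := a ≫ D.π) ((D.add_π _ _ _).trans h) rfl ?_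
    rw [D.ev_add _ _ h h rfl, D.ev_zero, zero_add]
  one_smul a := by
    refine D.inj (f := a ≫ D.π) (D.smul_π _ _) rfl ?_
    rw [D.ev_smul _ _ rfl, one_smul]
  mul_smul c d a := by
    refine D.inj (f := a ≫ D.π) (D.smul_π _ _) ((D.smul_π _ _).trans (D.smul_π _ _)) ?_
    rw [D.ev_smul _ _ rfl, D.ev_smul _ _ (D.smul_π _ _), D.ev_smul _ _ rfl, mul_smul]
  smul_add c a b h h' := by
    refine D.inj (f := a ≫ D.π) ((D.smul_π _ _).trans (D.add_π _ _ _)) ((D.add_π _ _ _).trans (D.smul_π _ _)) ?_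
    rw [D.ev_smul _ _ (D.add_π _ _ _), D.ev_add _ _ h rfl h.symm, D.ev_add _ _ h' (D.smul_π _ _) ((D.smul_π _ _).trans h.symm),
      D.ev_smul _ a rfl, D.ev_smul _ b h.symm, smul_add]
  add_smul c d a h := by
    refine D.inj (f := a ≫ D.π) (D.smul_π _ _) ((D.add_π _ _ _).trans (D.smul_π _ _)) ?_
    rw [D.ev_smul _ _ rfl, D.ev_add _ _ h (D.smul_π _ _) (D.smul_π _ _), D.ev_smul _ _ rfl, D.ev_smul _ _ rfl, add_smul]
  zero_smul a := by
    refine D.inj (f := a ≫ D.π) (D.smul_π _ _) (D.zero_π' _) ?_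
    rw [D.ev_smul _ _ rfl, D.ev_zero, zero_smul]
  smul_zero c x := by
    refine D.inj (f := x) ((D.smul_π _ _).trans (D.zero_π' _)) (D.zero_π' _) ?_
    rw [D.ev_smul _ _ (D.zero_π' _), D.ev_zero, smul_zero]

/-- the bundle represents -/
def rep : Rep D.bun N where
  u := D.u
  add a b h _ ea eb e := D.ev_add a b h ea eb e
  smul c a _ ea e := D.ev_smul c a ea e
  bij f σ := D.H _ f σ

end TotData

/-- every cocycle gives a line bundle -/
theorem exists_bundle (N : LB S) : ∃ E : LineBundle S, Nonempty (Rep E.toVecBundleData N) := by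
  obtain ⟨E, π, u, H⟩ := exists_tot N
  let D : TotData N := ⟨E, π, u, H⟩
  refine ⟨⟨D.bun, fun x => ?_⟩, ⟨D.rep⟩⟩
  obtain ⟨i, hi⟩ := N.cov x
  let σ : Sec N (N.U i).ι ⊤ := (N.chart (N.U i).ι i).res (top_le_ι _)
  have hσ : σ.IsGen := (N.chart_isGen _ i).res _
  have r := D.rep
  obtain ⟨s, hs, hsσ⟩ := r.ex σ
  refine ⟨N.U i, fun _ => s, hi, frame_in hs fun {T} y a ha => ?_⟩
  have e1 : (y ≫ s) ≫ D.bun.π = y ≫ (N.U i).ι := by rw [assoc, hs]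
  have hg : (ev r.u (y ≫ s) e1).IsGen := by
    rw [ev_comp r.u y s hs rfl, hsσ]
    exact hσ.pull _ _ _
  obtain ⟨c, hc⟩ := hg.exists_smul (ev r.u a ha)
  have e2 : ∀ c, D.bun.smul c (y ≫ s) ≫ D.bun.π = y ≫ (N.U i).ι := fun c => (D.bun.smul_π _ _).trans e1
  refine ⟨c, r.inj (e2 c) ha ?_, fun d hd => ?_⟩
  · rw [r.smul c _ e1, hc]
  · apply hg.smul_inj
    rw [← r.smul d _ e1 (e2 d), ← hc]
    exact ev_congr _ hd _ _

end
end

section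
/-- local frames of a line bundle -/
structure Fr {S : Scheme.{u}} (E : VecBundleData S) : Type u where
  U : S.Opens
  s : U.toScheme ⟶ E.tot
  hs : s ≫ E.π = U.ι
  H : ∀ {T : Scheme.{u}} (x : T ⟶ U.toScheme) (a : T ⟶ E.tot), a ≫ E.π = x ≫ U.ι →
      ∃! c : Γ(T, ⊤), E.smul c (x ≫ s) = a

section
variable {S T T' T'' : Scheme.{u}} {E : VecBundleData S} {f : T ⟶ S}

/-- the frame along a morphism -/
def Fr.sp (i : Fr E) (f : T ⟶ S) (h : ⊤ ≤ f ⁻¹ᵁ i.U) : T ⟶ E.tot := lf f i.U h ≫ i.s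

lemma Fr.sp_π (i : Fr E) (h : ⊤ ≤ f ⁻¹ᵁ i.U) : i.sp f h ≫ E.π = f := by
  rw [Fr.sp, assoc, i.hs, lf_ι]

lemma Fr.comp_sp (i : Fr E) (h : ⊤ ≤ f ⁻¹ᵁ i.U) {f' : T' ⟶ S} (g : T' ⟶ T) (e : g ≫ f = f') (h' : ⊤ ≤ f' ⁻¹ᵁ i.U) :
    g ≫ i.sp f h = i.sp f' h' := by
  rw [Fr.sp, Fr.sp, ← assoc]
  congr 1
  exact lf_eq _ (by rw [assoc, lf_ι, e])

lemma Fr.uniq (i : Fr E) (h : ⊤ ≤ f ⁻¹ᵁ i.U) {c d : Γ(T, ⊤)} (e : E.smul c (i.sp f h) = E.smul d (i.sp f h)) : c = d :=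
  (i.H (lf f i.U h) (E.smul d (i.sp f h)) ((E.smul_π _ _).trans ((i.sp_π h).trans (lf_ι _ _ _).symm))).unique e rfl

lemma Fr.ex (i : Fr E) (h : ⊤ ≤ f ⁻¹ᵁ i.U) {a : T ⟶ E.tot} (e : a ≫ E.π = f) : ∃ c : Γ(T, ⊤), E.smul c (i.sp f h) = a :=
  (i.H (lf f i.U h) a (e.trans (lf_ι _ _ _).symm)).exists

lemma Fr.core_ex (i : Fr E) {O : T.Opens} (hO : O ≤ f ⁻¹ᵁ i.U) (A : O.toScheme ⟶ E.tot) (hA : A ≫ E.π = O.ι ≫ f) :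
    ∃ c : Γ(T, O), ∀ {T' : Scheme.{u}} (g : T' ⟶ T) (hg : ⊤ ≤ g ⁻¹ᵁ O) {f' : T' ⟶ S} (_ : g ≫ f = f') (hi : ⊤ ≤ f' ⁻¹ᵁ i.U),
      E.smul (pl g hg c) (i.sp f' hi) = lf g O hg ≫ A := by
  obtain ⟨d, hd⟩ := i.ex (f := O.ι ≫ f) (le_pre_of_comp rfl hO (top_le_ι O)) hA
  obtain ⟨c, hc⟩ := (pl_bij O.ι (O := O) (O' := ⊤) (by simp) (by simp) (top_le_ι O)).2 d
  refine ⟨c, fun {T'} g hg f' e hi => ?_⟩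
  rw [← hd, E.smul_natural, i.comp_sp _ _ (by rw [← assoc, lf_ι, e]) hi, ← hc, ← pl_top _ le_pre_top,
    pl_comp (lf_ι _ _ _) _ _ hg]

lemma Fr.core_uniq (i : Fr E) {O : T.Opens} (hO : O ≤ f ⁻¹ᵁ i.U) {c d : Γ(T, O)}
    (h : ∀ (hi : ⊤ ≤ (O.ι ≫ f) ⁻¹ᵁ i.U), E.smul (pl O.ι (top_le_ι O) c) (i.sp (O.ι ≫ f) hi) =
      E.smul (pl O.ι (top_le_ι O) d) (i.sp (O.ι ≫ f) hi)) : c = d := by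
  apply (pl_bij O.ι (O := O) (O' := ⊤) (by simp) (by simp) (top_le_ι O)).1
  exact i.uniq _ (h (le_pre_of_comp rfl hO (top_le_ι O)))

/-- being the transition function -/
def IsTr (i j : Fr E) (f : T ⟶ S) (O : T.Opens) (c : Γ(T, O)) : Prop :=
  ∀ ⦃T' : Scheme.{u}⦄ (g : T' ⟶ T) (hg : ⊤ ≤ g ⁻¹ᵁ O) ⦃f' : T' ⟶ S⦄ (_ : g ≫ f = f') (hi : ⊤ ≤ f' ⁻¹ᵁ i.U)
    (hj : ⊤ ≤ f' ⁻¹ᵁ j.U), E.smul (pl g hg c) (i.sp f' hi) = j.sp f' hj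

/-- being the coefficient -/
def IsCo (i : Fr E) (f : T ⟶ S) (a : T ⟶ E.tot) (O : T.Opens) (c : Γ(T, O)) : Prop :=
  ∀ ⦃T' : Scheme.{u}⦄ (g : T' ⟶ T) (hg : ⊤ ≤ g ⁻¹ᵁ O) ⦃f' : T' ⟶ S⦄ (_ : g ≫ f = f') (hi : ⊤ ≤ f' ⁻¹ᵁ i.U),
    E.smul (pl g hg c) (i.sp f' hi) = g ≫ a

lemma IsTr.ex {i j : Fr E} {O : T.Opens} (hi : O ≤ f ⁻¹ᵁ i.U) (hj : O ≤ f ⁻¹ᵁ j.U) : ∃ c, IsTr i j f O c := by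
  have hj' : ⊤ ≤ (O.ι ≫ f) ⁻¹ᵁ j.U := le_pre_of_comp rfl hj (top_le_ι O)
  obtain ⟨c, hc⟩ := i.core_ex hi (j.sp (O.ι ≫ f) hj') (j.sp_π _)
  refine ⟨c, fun T' g hg f' e hi hj => ?_⟩
  rw [hc g hg e hi]
  exact j.comp_sp _ _ (by rw [← assoc, lf_ι, e]) _

lemma IsTr.uniq {i j : Fr E} {O : T.Opens} (hi : O ≤ f ⁻¹ᵁ i.U) (hj : O ≤ f ⁻¹ᵁ j.U) {c d} (h : IsTr i j f O c)
    (h' : IsTr i j f O d) : c = d := by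
  have hj' : ⊤ ≤ (O.ι ≫ f) ⁻¹ᵁ j.U := le_pre_of_comp rfl hj (top_le_ι O)
  exact i.core_uniq hi fun hi' => (h O.ι (top_le_ι O) rfl hi' hj').trans (h' O.ι (top_le_ι O) rfl hi' hj').symm

lemma IsTr.pl {i j : Fr E} {O : T.Opens} {c} (h : IsTr i j f O c) {O' : T'.Opens} {f' : T' ⟶ S} (g : T' ⟶ T) (e : g ≫ f = f')
    (hO : O' ≤ g ⁻¹ᵁ O) : IsTr i j f' O' (pl g hO c) := fun T'' g' hg f'' e' hi hj => by
  rw [pl_comp rfl _ _ (le_pre_of_comp rfl hO hg)]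
  exact h _ _ (by rw [assoc, e, e']) hi hj

lemma IsTr.rs {i j : Fr E} {O : T.Opens} {c} (h : IsTr i j f O c) {O' : T.Opens}
    (hO : O' ≤ O) : IsTr i j f O' (rs hO c) := fun T'' g' hg f'' e' hi hj => by
  rw [pl_rs]
  exact h _ _ e' hi hj

lemma IsTr.mul {i j l : Fr E} {O : T.Opens} {c d} (h : IsTr i j f O c) (h' : IsTr j l f O d) (hj' : O ≤ f ⁻¹ᵁ j.U) : IsTr i l f O (c * d) :=
  fun T'' g' hg f'' e' hi hj => by
  have hh : ⊤ ≤ f'' ⁻¹ᵁ j.U := le_pre_of_comp e' hj' hg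
  rw [mul_comm, map_mul, E.mul_smul, h g' hg e' hi hh, h' g' hg e' hh hj]

lemma IsTr.one (i : Fr E) (O : T.Opens) : IsTr i i f O 1 := fun T'' g' hg f'' e' hi hj => by
  rw [map_one, E.one_smul]

lemma IsCo.ex {i : Fr E} {O : T.Opens} (hi : O ≤ f ⁻¹ᵁ i.U) {a : T ⟶ E.tot} (ha : a ≫ E.π = f) : ∃ c, IsCo i f a O c := by
  obtain ⟨c, hc⟩ := i.core_ex hi (O.ι ≫ a) (by rw [assoc, ha])
  refine ⟨c, fun T' g hg f' e hi => ?_⟩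
  rw [hc g hg e hi, ← assoc, lf_ι]

lemma IsCo.uniq {i : Fr E} {O : T.Opens} (hi : O ≤ f ⁻¹ᵁ i.U) {a : T ⟶ E.tot} {c d} (h : IsCo i f a O c)
    (h' : IsCo i f a O d) : c = d :=
  i.core_uniq hi fun hi' => (h O.ι (top_le_ι O) rfl hi').trans (h' O.ι (top_le_ι O) rfl hi').symm

lemma IsCo.pl {i : Fr E} {O : T.Opens} {a : T ⟶ E.tot} {c} (h : IsCo i f a O c) {O' : T'.Opens} {f' : T' ⟶ S} (g : T' ⟶ T) (e : g ≫ f = f')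
    {a' : T' ⟶ E.tot} (ea : g ≫ a = a') (hO : O' ≤ g ⁻¹ᵁ O) : IsCo i f' a' O' (pl g hO c) := fun T'' g' hg f'' e' hi => by
  rw [pl_comp rfl _ _ (le_pre_of_comp rfl hO hg), ← ea, ← assoc]
  exact h _ _ (by rw [assoc, e, e']) hi

lemma IsCo.rs {i : Fr E} {O : T.Opens} {a : T ⟶ E.tot} {c} (h : IsCo i f a O c) {O' : T.Opens}
    (hO : O' ≤ O) : IsCo i f a O' (rs hO c) := fun T'' g' hg f'' e' hi => by
  rw [pl_rs]
  exact h _ _ e' hi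

lemma IsCo.tr {i j : Fr E} {O : T.Opens} {a : T ⟶ E.tot} {c d} (h : IsTr i j f O c) (h' : IsCo j f a O d) (hj' : O ≤ f ⁻¹ᵁ j.U) : IsCo i f a O (c * d) :=
  fun T'' g' hg f'' e' hi => by
  have hh : ⊤ ≤ f'' ⁻¹ᵁ j.U := le_pre_of_comp e' hj' hg
  rw [mul_comm, map_mul, E.mul_smul, h g' hg e' hi hh, h' g' hg e' hh]

lemma IsCo.add {i : Fr E} {O : T.Opens} {a b : T ⟶ E.tot} {c d} (h : IsCo i f a O c) (h' : IsCo i f b O d) (hab) :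
    IsCo i f (E.add a b hab) O (c + d) := fun T'' g' hg f'' e' hi => by
  have e1 : (g' ≫ a) ≫ E.π = (g' ≫ b) ≫ E.π := by rw [assoc, hab, assoc]
  rw [map_add, E.add_smul _ _ _ (by rw [E.smul_π, E.smul_π]), E.add_natural _ _ _ _ e1]
  exact E.add_congr (h g' hg e' hi) (h' g' hg e' hi) _ _

lemma IsCo.smul {i : Fr E} {O : T.Opens} {a : T ⟶ E.tot} {c} (h : IsCo i f a O c) (d : Γ(T, ⊤)) :
    IsCo i f (E.smul d a) O (Cub.rs le_top d * c) := fun T'' g' hg f'' e' hi => by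
  rw [map_mul, E.mul_smul, h g' hg e' hi, E.smul_natural, pl_rs, pl_top]

lemma le_pre_id {U V : S.Opens} (h : V ≤ U) : V ≤ 𝟙 S ⁻¹ᵁ U := by simpa using h

/-- the transition functions -/
def Fr.g (i j : Fr E) : Γ(S, i.U ⊓ j.U) :=
  (IsTr.ex (f := 𝟙 S) (i := i) (j := j) (O := i.U ⊓ j.U) (le_pre_id inf_le_left) (le_pre_id inf_le_right)).choose

lemma Fr.g_spec (i j : Fr E) : IsTr i j (𝟙 S) (i.U ⊓ j.U) (i.g j) :=
  (IsTr.ex (f := 𝟙 S) (i := i) (j := j) (O := i.U ⊓ j.U) (le_pre_id inf_le_left) (le_pre_id inf_le_right)).choose_spec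

/-- the cocycle of a line bundle -/
abbrev lbOf (E : VecBundleData S) (hc : ∀ x : S, ∃ i : Fr E, x ∈ i.U) : LB S where
  ι := Fr E
  U i := i.U
  cov := hc
  g i j := i.g j
  g_self i := IsTr.uniq (le_pre_id inf_le_left) (le_pre_id inf_le_right) (Fr.g_spec i i) (IsTr.one i _)
  coc i j l := by
    refine IsTr.uniq (i := i) (j := l) (f := 𝟙 S) (le_pre_id (inf_le_left.trans inf_le_left)) (le_pre_id inf_le_right)
      (IsTr.mul (IsTr.rs (Fr.g_spec i j) _) (IsTr.rs (Fr.g_spec j l) _) (le_pre_id (inf_le_left.trans inf_le_right))) (IsTr.rs (Fr.g_spec i l) _)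

end
end

section
section
variable {S T T' : Scheme.{u}} {E : VecBundleData S} {hc : ∀ x : S, ∃ i : Fr E, x ∈ i.U} {f : T ⟶ S}

lemma lbOf_tr (i j : Fr E) {O : T.Opens} (hi : O ≤ f ⁻¹ᵁ i.U) (hj : O ≤ f ⁻¹ᵁ j.U) :
    IsTr i j f O ((lbOf E hc).tr f i j hi hj) :=
  IsTr.pl (Fr.g_spec i j) f (comp_id f) (le_pre_inf hi hj)

lemma lbOf_u (E : VecBundleData S) (hc : ∀ x : S, ∃ i : Fr E, x ∈ i.U) :
    ∃ u : Sec (lbOf E hc) E.π ⊤, ∀ {T : Scheme.{u}} (a : T ⟶ E.tot) {f : T ⟶ S} (e : a ≫ E.π = f) (i : Fr E) (O : T.Opens)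
      (hi : O ≤ f ⁻¹ᵁ i.U) (hV : O ≤ ⊤), IsCo i f a O ((ev u a e).at i hi hV) := by
  have H : ∀ i : Fr E, ∃ c, IsCo i E.π (𝟙 _) (E.π ⁻¹ᵁ i.U) c := fun i => IsCo.ex pre_rfl (id_comp _)
  choose c h_c using H
  obtain ⟨u, hu⟩ := Sec.glue (N := lbOf E hc) (f := E.π) (V := ⊤) (fun i : Fr E => E.π ⁻¹ᵁ i.U) (fun i => i) (fun i => pre_rfl)
    (fun i => le_top) (fun x _ => hc (E.π x)) c (fun i j =>
      IsCo.uniq (i := i) (f := E.π) (a := 𝟙 _) (inf_le_left.trans pre_rfl) (IsCo.rs (h_c i) inf_le_left)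
        (IsCo.tr (lbOf_tr i j _ _) (IsCo.rs (h_c j) inf_le_right) (inf_le_right.trans pre_rfl)))
  refine ⟨u, fun {T} a f e i O hi hV => ?_⟩
  rw [ev, Sec.pull_at a e u le_pre_top i (le_pre_comp e hi) hi hV pre_rfl le_top, hu i]
  exact IsCo.pl (h_c i) a e (comp_id a) _

lemma co_self {i : Fr E} {a : T ⟶ E.tot} {c : Γ(T, ⊤)} (hi : ⊤ ≤ f ⁻¹ᵁ i.U) (h : IsCo i f a ⊤ c) : E.smul c (i.sp f hi) = a := by
  have := h (𝟙 T) (by simp) (id_comp f) hi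
  rw [pl_id, rs_self, id_comp] at this
  exact this

lemma co_pull {u : Sec (lbOf E hc) E.π ⊤} (hu : ∀ {T : Scheme.{u}} (a : T ⟶ E.tot) {f : T ⟶ S} (e : a ≫ E.π = f) (i : Fr E) (O : T.Opens)
      (hi : O ≤ f ⁻¹ᵁ i.U) (hV : O ≤ ⊤), IsCo i f a O ((ev u a e).at i hi hV)) {a : T ⟶ E.tot} (e : a ≫ E.π = f)
      (i : Fr E) (hi : ⊤ ≤ f ⁻¹ᵁ i.U) : E.smul ((ev u a e).at i hi le_rfl) (i.sp f hi) = a :=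
  co_self hi (hu a e i ⊤ hi le_rfl)

lemma exists_rep (E : VecBundleData S) (hc : ∀ x : S, ∃ i : Fr E, x ∈ i.U) : Nonempty (Rep E (lbOf E hc)) := by
  obtain ⟨u, hu⟩ := lbOf_u E hc
  have cov : ∀ {T : Scheme.{u}} (f : T ⟶ S), (⨆ i : Fr E, f ⁻¹ᵁ i.U) = ⊤ := fun f => by
    refine eq_top_iff.2 fun x _ => ?_
    obtain ⟨i, hi⟩ := hc (f x)
    exact TopologicalSpace.Opens.mem_iSup.2 ⟨i, hi⟩
  refine ⟨⟨u, fun a b h f ea eb e => ?_, fun c a f ea e => ?_, fun {T} f σ => ?_⟩⟩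
  · refine Sec.ext fun i O hi hV => ?_
    rw [Sec.at_add]
    exact IsCo.uniq hi (hu _ e i O hi hV) (IsCo.add (hu a ea i O hi hV) (hu b eb i O hi hV) h)
  · refine Sec.ext fun i O hi hV => ?_
    rw [Sec.at_smul]
    exact IsCo.uniq hi (hu _ e i O hi hV) (IsCo.smul (hu a ea i O hi hV) c)
  · let 𝓤 := T.openCoverOfIsOpenCover (fun i : Fr E => f ⁻¹ᵁ i.U) (cov f)
    have hle : ∀ i : Fr E, ⊤ ≤ ((f ⁻¹ᵁ i.U).ι ≫ f) ⁻¹ᵁ i.U := fun i => le_pre_of_comp rfl pre_rfl (top_le_ι _)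
    let A : ∀ i : Fr E, (f ⁻¹ᵁ i.U).toScheme ⟶ E.tot := fun i =>
      E.smul ((σ.pull (f ⁻¹ᵁ i.U).ι rfl (V' := ⊤) le_pre_top).at i (hle i) le_rfl) (i.sp ((f ⁻¹ᵁ i.U).ι ≫ f) (hle i))
    have hA : ∀ i, A i ≫ E.π = (f ⁻¹ᵁ i.U).ι ≫ f := fun i => (E.smul_π _ _).trans (i.sp_π _)
    have key : ∀ (i : Fr E) {T' : Scheme.{u}} (x : T' ⟶ (f ⁻¹ᵁ i.U).toScheme) (g : T' ⟶ T) (eg : x ≫ (f ⁻¹ᵁ i.U).ι = g)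
        {f' : T' ⟶ S} (e' : g ≫ f = f') (e : (x ≫ A i) ≫ E.π = f'), ev u (x ≫ A i) e = σ.pull g e' (V' := ⊤) le_pre_top := by
      intro i T' x g eg f' e' e
      have ex : x ≫ (f ⁻¹ᵁ i.U).ι ≫ f = f' := by rw [← assoc, eg, e']
      rw [ev_comp u x (A i) (hA i) ex e, ← Sec.pull_pull (f ⁻¹ᵁ i.U).ι rfl (V' := ⊤) le_pre_top x ex (V'' := ⊤) le_pre_top g eg e' le_pre_top]
      congr 1
      exact sec_ext_chart (N := lbOf E hc) i (hle i) (i.uniq (hle i) (co_pull hu (hA i) i (hle i)))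
    have hinj : ∀ {T : Scheme.{u}} {f : T ⟶ S} {a b : T ⟶ E.tot} (ea : a ≫ E.π = f) (eb : b ≫ E.π = f), ev u a ea = ev u b eb → a = b := by
      intro T f a b ea eb h
      refine (T.openCoverOfIsOpenCover (fun i : Fr E => f ⁻¹ᵁ i.U) (cov f)).hom_ext _ _ fun (i : Fr E) => ?_
      change (f ⁻¹ᵁ i.U).ι ≫ a = (f ⁻¹ᵁ i.U).ι ≫ b
      have hi : ⊤ ≤ ((f ⁻¹ᵁ i.U).ι ≫ f) ⁻¹ᵁ i.U := le_pre_of_comp rfl pre_rfl (top_le_ι _)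
      have e1 : ((f ⁻¹ᵁ i.U).ι ≫ a) ≫ E.π = (f ⁻¹ᵁ i.U).ι ≫ f := by rw [assoc, ea]
      have e2 : ((f ⁻¹ᵁ i.U).ι ≫ b) ≫ E.π = (f ⁻¹ᵁ i.U).ι ≫ f := by rw [assoc, eb]
      rw [← co_pull hu e1 i hi, ← co_pull hu e2 i hi, ev_comp u _ a ea rfl e1, ev_comp u _ b eb rfl e2, h]
    have comp : ∀ (i j : Fr E) {W : Scheme.{u}} (p : W ⟶ (f ⁻¹ᵁ i.U).toScheme) (q : W ⟶ (f ⁻¹ᵁ j.U).toScheme),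
        p ≫ (f ⁻¹ᵁ i.U).ι = q ≫ (f ⁻¹ᵁ j.U).ι → p ≫ A i = q ≫ A j := by
      intro i j W p q e0
      have e1 : (p ≫ A i) ≫ E.π = (p ≫ (f ⁻¹ᵁ i.U).ι) ≫ f := by simp only [assoc, hA]
      have e2 : (q ≫ A j) ≫ E.π = (p ≫ (f ⁻¹ᵁ i.U).ι) ≫ f := by
        rw [e0]
        simp only [assoc, hA]
      exact hinj e1 e2 ((key i _ _ rfl rfl e1).trans (key j _ _ e0.symm rfl e2).symm)
    let a : T ⟶ E.tot := 𝓤.glueMorphisms (fun i => A i) fun i j => comp i j _ _ pullback.condition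
    have ha : ∀ i : Fr E, (f ⁻¹ᵁ i.U).ι ≫ a = A i := fun i => 𝓤.ι_glueMorphisms _ _ i
    have ea : a ≫ E.π = f := by
      refine 𝓤.hom_ext _ _ fun (i : Fr E) => ?_
      change (f ⁻¹ᵁ i.U).ι ≫ a ≫ E.π = (f ⁻¹ᵁ i.U).ι ≫ f
      rw [← assoc, ha, hA]
    have fin : ev u a ea = σ := by
      refine sec_ext_cover (fun i : Fr E => (f ⁻¹ᵁ i.U).ι) (fun x => ?_) (fun i => rfl) fun i => ?_
      · obtain ⟨i, hi⟩ := hc (f x)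
        exact ⟨i, ⟨x, hi⟩, rfl⟩
      · have e1 : ((f ⁻¹ᵁ i.U).ι ≫ a) ≫ E.π = (f ⁻¹ᵁ i.U).ι ≫ f := by rw [assoc, ea]
        have e2 : (𝟙 _ ≫ A i) ≫ E.π = (f ⁻¹ᵁ i.U).ι ≫ f := by rw [id_comp, hA]
        rw [← ev_comp u _ a ea rfl e1, ← key i (𝟙 _) _ (id_comp _) rfl e2]
        exact ev_congr u ((ha i).trans (id_comp _).symm) _ _
    exact ⟨a, ⟨ea, fin⟩, fun b ⟨eb, hb⟩ => hinj eb ea (hb.trans fin.symm)⟩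

theorem exists_lb (E : LineBundle S) : ∃ N : LB S, Nonempty (Rep E.toVecBundleData N) := by
  have hc : ∀ x : S, ∃ i : Fr E.toVecBundleData, x ∈ i.U := fun x => by
    obtain ⟨U, s, hx, hs⟩ := E.locTriv x
    obtain ⟨h, H⟩ := frame_out hs
    exact ⟨⟨U, s 0, h, H⟩, hx⟩
  exact ⟨_, exists_rep _ hc⟩

end
end

section
section
variable {S S' T T' : Scheme.{u}} {N : LB S} {N' : LB S'} {f : T ⟶ S} {f' : T ⟶ S'}

/-- correspondence of sections under an isomorphism -/
def Rl (Φ : Sec (N'.box N) (prod.lift f' f) ⊤) (σ : Sec N f ⊤) (ρ : Sec N' f' ⊤) : Prop :=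
  ∀ i j (O : T.Opens) (h1 : O ≤ f' ⁻¹ᵁ N'.U i) (h2 : O ≤ f ⁻¹ᵁ N.U j),
    ρ.at i h1 le_top = Φ.bat i j h1 h2 le_top * σ.at j h2 le_top

variable {Φ : Sec (N'.box N) (prod.lift f' f) ⊤} {σ σ' : Sec N f ⊤} {ρ ρ' : Sec N' f' ⊤}

lemma Rl.ex (Φ : Sec (N'.box N) (prod.lift f' f) ⊤) (σ : Sec N f ⊤) : ∃ ρ, Rl Φ σ ρ := by
  obtain ⟨ρ, h⟩ := Sec.act (V := ⊤) le_rfl Φ (t := 𝟙 T) (id_comp f) (V' := ⊤) le_pre_top σ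
  refine ⟨ρ, fun i j O h1 h2 => ?_⟩
  rw [h i j O O h1 (le_pre_id le_rfl) h2 le_top le_top, pl_id, rs_self]

lemma bcov (N : LB S) (N' : LB S') (f : T ⟶ S) (f' : T ⟶ S') (x : T) : ∃ c : N'.ι × N.ι, x ∈ f' ⁻¹ᵁ N'.U c.1 ⊓ f ⁻¹ᵁ N.U c.2 := by
  obtain ⟨i, hi⟩ := N'.cov' f' x
  obtain ⟨j, hj⟩ := N.cov' f x
  exact ⟨(i, j), hi, hj⟩

lemma Rl.uniq (h : Rl Φ σ ρ) (h' : Rl Φ σ ρ') : ρ = ρ' := by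
  refine Sec.ext_at (fun c : N'.ι × N.ι => f' ⁻¹ᵁ N'.U c.1 ⊓ f ⁻¹ᵁ N.U c.2) (fun c => c.1) (fun c => inf_le_left)
    (fun c => le_top) (fun x _ => bcov N N' f f' x) fun c => ?_
  rw [h c.1 c.2 _ inf_le_left inf_le_right, h' c.1 c.2 _ inf_le_left inf_le_right]

lemma Rl.inj (hΦ : Φ.IsGen) (h : Rl Φ σ ρ) (h' : Rl Φ σ' ρ) : σ = σ' := by
  refine Sec.ext_at (fun c : N'.ι × N.ι => f' ⁻¹ᵁ N'.U c.1 ⊓ f ⁻¹ᵁ N.U c.2) (fun c => c.2) (fun c => inf_le_right)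
    (fun c => le_top) (fun x _ => bcov N N' f f' x) fun c => ?_
  refine (hΦ.bat (i := c.1) (j := c.2) inf_le_left inf_le_right le_top).mul_left_cancel ?_
  rw [← h c.1 c.2 _ inf_le_left inf_le_right, ← h' c.1 c.2 _ inf_le_left inf_le_right]

lemma alg_rl {A : Type*} [CommRing A] {x y p q r s a b t : A} (hx : IsUnit x) (h : x = r * s * y) (ha : x * a = p) (hb : y * b = q)
    (hp : p = r * q) (ht : s * t = 1) : a = t * b := by
  apply hx.mul_left_cancel
  rw [ha, hp, ← hb, h]
  linear_combination (-(r * y * b)) * ht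

lemma Rl.surj (hΦ : Φ.IsGen) (ρ : Sec N' f' ⊤) : ∃ σ, Rl Φ σ ρ := by
  choose b hb using fun c : N'.ι × N.ι => (hΦ.bat (i := c.1) (j := c.2)
    (inf_le_left : f' ⁻¹ᵁ N'.U c.1 ⊓ f ⁻¹ᵁ N.U c.2 ≤ _) inf_le_right le_top).exists_right_inv
  have H : ∀ (c : N'.ι × N.ι) (O : T.Opens) (h1 : O ≤ f' ⁻¹ᵁ N'.U c.1) (h2 : O ≤ f ⁻¹ᵁ N.U c.2),
      Φ.bat c.1 c.2 h1 h2 le_top * rs (le_inf h1 h2) (b c * ρ.at c.1 inf_le_left le_top) = ρ.at c.1 h1 le_top := by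
    intro c O h1 h2
    have := congrArg (rs (le_inf h1 h2)) (hb c)
    rw [map_mul, map_one, Sec.rs_bat] at this
    rw [map_mul, Sec.rs_at, ← mul_assoc, this, one_mul]
  obtain ⟨σ, hσ⟩ := Sec.glue (N := N) (f := f) (V := ⊤) (fun c : N'.ι × N.ι => f' ⁻¹ᵁ N'.U c.1 ⊓ f ⁻¹ᵁ N.U c.2) (fun c => c.2)
    (fun c => inf_le_right) (fun c => le_top) (fun x _ => bcov N N' f f' x) (fun c => b c * ρ.at c.1 inf_le_left le_top)
    (fun c d => alg_rl (hΦ.bat (i := c.1) (j := c.2) (inf_le_left.trans inf_le_left) (inf_le_left.trans inf_le_right) le_top)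
      (Φ.bat_tr (i' := d.1) (j' := d.2) _ (inf_le_right.trans inf_le_left) _ (inf_le_right.trans inf_le_right) _) (H c _ _ _) (H d _ _ _)
      (ρ.at_tr c.1 d.1 _ _ _) (LB.tr_symm _ _ _ _ _ _))
  refine ⟨σ, fun i j O h1 h2 => ?_⟩
  have := congrArg (rs (le_inf h1 h2)) (hσ (i, j))
  rw [Sec.rs_at] at this
  rw [this]
  exact (H (i, j) O h1 h2).symm

lemma Rl.pull (h : Rl Φ σ ρ) (t : T' ⟶ T) {g : T' ⟶ S} {g' : T' ⟶ S'} (e : t ≫ f = g) (e' : t ≫ f' = g') (ee : t ≫ prod.lift f' f = prod.lift g' g) :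
    Rl (Φ.pull t ee (V' := ⊤) le_pre_top) (σ.pull t e (V' := ⊤) le_pre_top) (ρ.pull t e' (V' := ⊤) le_pre_top) := by
  intro i j O h1 h2
  have hO : O ≤ t ⁻¹ᵁ (f' ⁻¹ᵁ N'.U i ⊓ f ⁻¹ᵁ N.U j) := le_pre_inf (le_pre_comp e' h1) (le_pre_comp e h2)
  rw [Sec.pull_at t e' ρ _ i hO h1 _ inf_le_left le_top, Sec.pull_at t e σ _ j hO h2 _ inf_le_right le_top,
    Sec.pull_bat Φ t ee _ hO h1 h2 _ inf_le_left inf_le_right le_top, h i j _ inf_le_left inf_le_right, map_mul]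

lemma Rl.add (h : Rl Φ σ ρ) (h' : Rl Φ σ' ρ') : Rl Φ (σ + σ') (ρ + ρ') := by
  intro i j O h1 h2
  rw [Sec.at_add, Sec.at_add, h i j O h1 h2, h' i j O h1 h2, mul_add]

lemma Rl.smul (c : Γ(T, ⊤)) (h : Rl Φ σ ρ) : Rl Φ (c • σ) (c • ρ) := by
  intro i j O h1 h2
  rw [Sec.at_smul, Sec.at_smul, h i j O h1 h2, mul_left_comm]

end

section
variable {S S' T : Scheme.{u}}

lemma isPullback_of_iso {N : LB S} {N' : LB S'} {E : LineBundle S} {F : LineBundle S'} (r : Rep E.toVecBundleData N) (r' : Rep F.toVecBundleData N') {g : S ⟶ S'}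
    (h : IsoOn N' N g (𝟙 S) ⊤) : IsPullbackBundle g F E := by
  obtain ⟨Φ, hΦ⟩ := h
  have ef : ∀ {T : Scheme.{u}} {f : T ⟶ S} {f' : T ⟶ S'}, f ≫ g = f' → f ≫ prod.lift g (𝟙 S) = prod.lift f' f := by
    rintro T f _ rfl
    rw [prod.comp_lift, comp_id]
  obtain ⟨w, hw⟩ := Rl.ex (Φ.pull E.π (ef rfl) (V' := ⊤) le_pre_top) r.u
  obtain ⟨τ, eτ, hτ⟩ := r'.ex w
  have key : ∀ {T : Scheme.{u}} (a : T ⟶ E.tot) {f : T ⟶ S} {f' : T ⟶ S'} (ee : f ≫ g = f') (e : a ≫ E.π = f) (e' : (a ≫ τ) ≫ F.π = f'),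
      Rl (Φ.pull f (ef ee) (V' := ⊤) le_pre_top) (ev r.u a e) (ev r'.u (a ≫ τ) e') := by
    intro T a f f' ee e e'
    have e2 : a ≫ E.π ≫ g = f' := by rw [← assoc, e, ee]
    have e3 : a ≫ prod.lift (E.π ≫ g) E.π = prod.lift f' f := by rw [prod.comp_lift, e2, e]
    have := hw.pull a e e2 e3
    rw [Sec.pull_pull E.π (ef rfl) (V' := ⊤) le_pre_top a e3 (V'' := ⊤) le_pre_top f e (ef ee) le_pre_top Φ] at this
    rw [ev_comp r'.u a τ eτ e2 e', hτ]
    exact this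
  have eq : ∀ {T : Scheme.{u}} {a : T ⟶ E.tot} {f : T ⟶ S} (_ : a ≫ E.π = f), (a ≫ τ) ≫ F.π = f ≫ g := by
    rintro T a f rfl
    rw [assoc, eτ, assoc]
  refine ⟨τ, eτ, fun a b h h' => ?_, fun c a => ?_, fun {T} y a ha => ?_⟩
  · refine r'.inj (f := (a ≫ E.π) ≫ g) (eq (E.add_π _ _ _)) ((F.add_π _ _ _).trans (eq rfl)) ?_
    have k := key (E.add a b h) rfl (E.add_π a b h) (eq (E.add_π a b h))
    rw [r.add a b h rfl h.symm] at k
    rw [r'.add _ _ h' (eq rfl) (eq h.symm)]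
    exact Rl.uniq k ((key a rfl rfl (eq rfl)).add (key b rfl h.symm (eq h.symm)))
  · refine r'.inj (f := (a ≫ E.π) ≫ g) (eq (E.smul_π _ _)) ((F.smul_π _ _).trans (eq rfl)) ?_
    have k := key (E.smul c a) rfl (E.smul_π c a) (eq (E.smul_π c a))
    rw [r.smul c a rfl] at k
    rw [r'.smul c _ (eq rfl)]
    exact Rl.uniq k ((key a rfl rfl (eq rfl)).smul c)
  · have hg : (Φ.pull y (ef rfl) (V' := ⊤) le_pre_top).IsGen := hΦ.pull _ _ _
    obtain ⟨σ, hσ⟩ := Rl.surj hg (ev r'.u a ha)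
    obtain ⟨b, eb, hb⟩ := r.ex σ
    refine ⟨b, ⟨eb, ?_⟩, ?_⟩
    · refine r'.inj (eq eb) ha (Rl.uniq (key b rfl eb (eq eb)) ?_)
      rw [hb]
      exact hσ
    · rintro b' ⟨eb', hb'⟩
      refine r.inj eb' eb (Rl.inj hg (key b' rfl eb' (eq eb')) ?_)
      rw [hb, ev_congr r'.u hb' (eq eb') ha]
      exact hσ

lemma vbIso_refl (E : LineBundle S) : VBIso E E := by
  refine ⟨𝟙 _, ⟨id_comp _, fun a b h h' => ?_, fun c a => ?_⟩, inferInstance⟩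
  · rw [comp_id]
    exact E.add_congr (comp_id _).symm (comp_id _).symm _ _
  · rw [comp_id, comp_id]

end
end

section
section
variable {S T T' : Scheme.{u}} {N : LB S} {f : T ⟶ S}

lemma gen_of_span {σ : Sec N f ⊤} (H : ∀ {T' : Scheme.{u}} (h : T' ⟶ T) {f' : T' ⟶ S} (e : h ≫ f = f') (ρ : Sec N f' ⊤),
    ∃ c : Γ(T', ⊤), c • σ.pull h e (V' := ⊤) le_pre_top = ρ) : σ.IsGen := by
  refine Sec.isGen_loc fun x _ => ?_
  obtain ⟨i, hi⟩ := N.cov' f x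
  refine ⟨_, i, pre_rfl, le_top, hi, ?_⟩
  have hle : ⊤ ≤ ((f ⁻¹ᵁ N.U i).ι ≫ f) ⁻¹ᵁ N.U i := le_pre_of_comp rfl pre_rfl (top_le_ι _)
  obtain ⟨c, hc⟩ := H (f ⁻¹ᵁ N.U i).ι rfl ((N.chart ((f ⁻¹ᵁ N.U i).ι ≫ f) i).res hle)
  have h1 := ((N.chart_isGen ((f ⁻¹ᵁ N.U i).ι ≫ f) i).res hle) i ⊤ hle le_rfl
  rw [← hc, Sec.at_smul, Sec.pull_at _ rfl σ _ i (top_le_ι _) hle _ pre_rfl le_top] at h1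
  have h2 := isUnit_of_mul_isUnit_right h1
  let φ := RingEquiv.ofBijective (pl (f ⁻¹ᵁ N.U i).ι (top_le_ι _)) (pl_bij (f ⁻¹ᵁ N.U i).ι (by simp) (by simp) (top_le_ι _))
  exact (MulEquiv.isUnit_map φ).1 h2

lemma gen_of_triv {E : LineBundle S} (r : Rep E.toVecBundleData N) {F : LineBundle T} (h : IsPullbackBundle f E F) (h' : IsTrivialBundle F) :
    ∃ σ : Sec N f ⊤, σ.IsGen := by
  obtain ⟨τ, e1, -, e3, e4⟩ := h
  obtain ⟨s', h'⟩ := h'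
  obtain ⟨es, H⟩ := gframe_out h'
  generalize s' 0 = s at es H
  have e0 : (s ≫ τ) ≫ E.π = f := by rw [assoc, e1, ← assoc, es, id_comp]
  refine ⟨ev r.u (s ≫ τ) e0, gen_of_span fun {T'} h f' e ρ => ?_⟩
  obtain ⟨a, ea, ha⟩ := r.ex ρ
  obtain ⟨b, ⟨eb, hb⟩, -⟩ := e4 h a (ea.trans e.symm)
  obtain ⟨c, hc⟩ := H h b eb
  have k : E.smul c (h ≫ s ≫ τ) = a := by
    rw [← hb, ← hc, e3, assoc]
  have e5 : (h ≫ s ≫ τ) ≫ E.π = f' := by rw [assoc, e0, e]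
  refine ⟨c, ?_⟩
  rw [← ha, ← ev_comp r.u h (s ≫ τ) e0 e e5, ← r.smul c _ e5 ((E.smul_π _ _).trans e5)]
  exact ev_congr r.u k _ _

end

theorem cube_aux {k : Type u} [Field k] {X Y Z : Scheme.{u}} (sX : X ⟶ Spk k) (sY : Y ⟶ Spk k)
    (sZ : Z ⟶ Spk k) [IsIntegral X] [IsProper sX] [IsIntegral Y] [IsProper sY] [LocallyOfFiniteType sZ]
    {x : Spk k ⟶ X} (hx : x ≫ sX = 𝟙 _) {y : Spk k ⟶ Y} (hy : y ≫ sY = 𝟙 _)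
    (hZ : ConnectedSpace (pullback sZ (Spec.map (CommRingCat.ofHom (algebraMap k (AlgebraicClosure k)))) : Scheme.{u}))
    (L : LineBundle (Q3 sX sY sZ)) (ix : pullback sY sZ ⟶ Q3 sX sY sZ)
    (hix₁ : ix ≫ pullback.fst sX (pullback.snd sY sZ ≫ sZ) = (pullback.snd sY sZ ≫ sZ) ≫ x)
    (hix₂ : ix ≫ pullback.snd sX (pullback.snd sY sZ ≫ sZ) = 𝟙 _)
    (iy : pullback sX sZ ⟶ Q3 sX sY sZ)
    (hiy₁ : iy ≫ pullback.fst sX (pullback.snd sY sZ ≫ sZ) = pullback.fst sX sZ)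
    (hiy₂ : (iy ≫ pullback.snd sX (pullback.snd sY sZ ≫ sZ)) ≫ pullback.fst sY sZ = (pullback.snd sX sZ ≫ sZ) ≫ y)
    (hiy₃ : (iy ≫ pullback.snd sX (pullback.snd sY sZ ≫ sZ)) ≫ pullback.snd sY sZ = pullback.snd sX sZ)
    (prXY : Q3 sX sY sZ ⟶ pullback sX sY)
    (hpr₁ : prXY ≫ pullback.fst sX sY = pullback.fst sX (pullback.snd sY sZ ≫ sZ))
    (hpr₂ : prXY ≫ pullback.snd sX sY = pullback.snd sX (pullback.snd sY sZ ≫ sZ) ≫ pullback.fst sY sZ)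
    (hLx : ∃ Lx : LineBundle (pullback sY sZ), IsPullbackBundle ix L Lx ∧ IsTrivialBundle Lx)
    (hLy : ∃ Ly : LineBundle (pullback sX sZ), IsPullbackBundle iy L Ly ∧ IsTrivialBundle Ly) :
    ∃ (M : LineBundle (pullback sX sY)) (PM : LineBundle (Q3 sX sY sZ)), IsPullbackBundle prXY M PM ∧ VBIso L PM := by
  obtain ⟨N, ⟨r⟩⟩ := exists_lb L
  obtain ⟨Lx, hLx, hLx'⟩ := hLx
  obtain ⟨Ly, hLy, hLy'⟩ := hLy
  obtain rfl : ix = xs hx (pullback.snd sY sZ ≫ sZ) := by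
    apply pullback.hom_ext
    · rw [hix₁, xs_fst]
    · rw [hix₂, xs_snd]
  obtain rfl : prXY = p3 sX sY sZ := by
    apply pullback.hom_ext
    · rw [hpr₁, p3, bm_fst]
    · rw [hpr₂, p3, bm_snd]
  have e2 : xs hy sZ ≫ pullback.snd sY sZ ≫ sZ = sZ := by
    rw [← assoc, xs_snd, id_comp]
  have h2 : iy = bm sX e2 := by
    apply pullback.hom_ext
    · rw [hiy₁, bm_fst]
    · rw [bm_snd]
      apply pullback.hom_ext
      · rw [hiy₂, assoc, assoc, xs_fst]
      · rw [hiy₃, assoc, xs_snd, comp_id]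
  have hT : Triv2 hx hy N := by
    refine ⟨gen_of_triv r hLx hLx', ?_⟩
    obtain ⟨σ, hσ⟩ := gen_of_triv r hLy hLy'
    refine TA.of (j := iy) (q' := pullback.snd sX sZ) ?_ (comp_id _) hσ
    rw [h2]
    exact bm_pb sX e2
  obtain ⟨M, hM⟩ := abs_cube hT (K := AlgebraicClosure k) (φ := algebraMap k (AlgebraicClosure k))
    (algebraMap_isIntegral_iff.2 inferInstance)
  obtain ⟨F, ⟨r'⟩⟩ := exists_bundle M
  exact ⟨F, L, isPullback_of_iso r r' hM.symm, vbIso_refl L⟩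
end

end Cub

/-- **a theorem of the cube.** Let `X`, `Y` be proper varieties over `k` with
rational points `x`, `y`, let `Z` be a geometrically connected scheme of finite type over
`k`, and let `L` be a line bundle on `X ×ₖ Y ×ₖ Z`. If the pull-backs of `L` to
`{x} ×ₖ Y ×ₖ Z` and `X ×ₖ {y} ×ₖ Z` are trivial, then `L` is the pull-back of a line bundle
on `X ×ₖ Y` along the projection. Here `ix`, `iy` and `prXY` are the morphisms
`Y ×ₖ Z ⟶ X ×ₖ Y ×ₖ Z`, `X ×ₖ Z ⟶ X ×ₖ Y ×ₖ Z` and `X ×ₖ Y ×ₖ Z ⟶ X ×ₖ Y` characterized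
componentwise in the statement. -/
theorem theorem_of_the_cube
    (X Y Z : SchemeOver k)
    (hXvar : X.IsVariety) (hYvar : Y.IsVariety)
    (hXproper : IsProper X.str) (hYproper : IsProper Y.str)
    (x : Spk k ⟶ X.carrier) (hx : x ≫ X.str = 𝟙 (Spk k))
    (y : Spk k ⟶ Y.carrier) (hy : y ≫ Y.str = 𝟙 (Spk k))
    (hZft : Z.IsFiniteType) (hZgc : Z.IsGeomConnected)
    (L : LineBundle (prodXYZ X Y Z))
    -- the closed immersion `ix : Y ×ₖ Z ≅ {x} ×ₖ Y ×ₖ Z ⟶ X ×ₖ Y ×ₖ Z`: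
    (ix : prodYZ Y Z ⟶ prodXYZ X Y Z)
    (hix₁ : ix ≫ pullback.fst X.str (prodYZstr Y Z) = prodYZstr Y Z ≫ x)
    (hix₂ : ix ≫ pullback.snd X.str (prodYZstr Y Z) = 𝟙 (prodYZ Y Z))
    -- the closed immersion `iy : X ×ₖ Z ≅ X ×ₖ {y} ×ₖ Z ⟶ X ×ₖ Y ×ₖ Z`:
    (iy : pullback X.str Z.str ⟶ prodXYZ X Y Z)
    (hiy₁ : iy ≫ pullback.fst X.str (prodYZstr Y Z) = pullback.fst X.str Z.str)
    (hiy₂ : (iy ≫ pullback.snd X.str (prodYZstr Y Z)) ≫ pullback.fst Y.str Z.str =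
      (pullback.snd X.str Z.str ≫ Z.str) ≫ y)
    (hiy₃ : (iy ≫ pullback.snd X.str (prodYZstr Y Z)) ≫ pullback.snd Y.str Z.str =
      pullback.snd X.str Z.str)
    -- the projection `prXY : X ×ₖ Y ×ₖ Z ⟶ X ×ₖ Y`:
    (prXY : prodXYZ X Y Z ⟶ pullback X.str Y.str)
    (hpr₁ : prXY ≫ pullback.fst X.str Y.str = pullback.fst X.str (prodYZstr Y Z))
    (hpr₂ : prXY ≫ pullback.snd X.str Y.str =
      pullback.snd X.str (prodYZstr Y Z) ≫ pullback.fst Y.str Z.str)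
    -- triviality of the two restrictions of `L`:
    (hLx : ∃ Lx : LineBundle (prodYZ Y Z), IsPullbackBundle ix L Lx ∧ IsTrivialBundle Lx)
    (hLy : ∃ Ly : LineBundle (pullback X.str Z.str),
      IsPullbackBundle iy L Ly ∧ IsTrivialBundle Ly) :
    ∃ (M : LineBundle (pullback X.str Y.str)) (PM : LineBundle (prodXYZ X Y Z)),
      IsPullbackBundle prXY M PM ∧ VBIso L PM := by
  have := hXvar.1
  have := hYvar.1
  have := hZft.1
  exact Cub.cube_aux X.str Y.str Z.str hx hy hZgc L ix hix₁ hix₂ iy hiy₁ hiy₂ hiy₃ prXY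
    hpr₁ hpr₂ hLx hLy

end Cube
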